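/- Let N = 3 or N = 4, let −2 < a ≤ 0, −2 < b ≤ 0 and p, q > 0. Then there exists no positive solution (u, v) of the Hardy–Hénon system on ℝ^N if and only if (N+a)/(p+1) + (N+b)/(q+1) > N−2. -/

import Mathlib

open MeasureTheory Metric Set Filter

/-- The Euclidean Laplacian of `u : ℝ^N → ℝ`, as the sum of the second derivatives
along the standard coordinate directions. -/
noncomputable def lap {N : ℕ} (u : EuclideanSpace ℝ (Fin N) → ℝ)
    (x : EuclideanSpace ℝ (Fin N)) : ℝ :=
  ∑ i : Fin N, iteratedFDeriv ℝ 2 u x ![EuclideanSpace.single i 1, EuclideanSpace.single i 1]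

/-- `(u, v)` is a positive solution of the Hardy–Hénon system
`-Δu = |x|^a v^p`, `-Δv = |x|^b u^q` on the set `Ω`:
`u, v` are continuous on `Ω`, `C²` on `Ω \ {0}`, positive on `Ω`, and
the equations hold on `Ω \ {0}`. -/
def IsHHSol {N : ℕ} (a b p q : ℝ) (Ω : Set (EuclideanSpace ℝ (Fin N)))
    (u v : EuclideanSpace ℝ (Fin N) → ℝ) : Prop :=
  ContinuousOn u Ω ∧ ContinuousOn v Ω ∧
  ContDiffOn ℝ 2 u (Ω \ {0}) ∧ ContDiffOn ℝ 2 v (Ω \ {0}) ∧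
  (∀ x ∈ Ω, 0 < u x) ∧ (∀ x ∈ Ω, 0 < v x) ∧
  (∀ x ∈ Ω \ {0}, -lap u x = ‖x‖ ^ a * v x ^ p) ∧
  (∀ x ∈ Ω \ {0}, -lap v x = ‖x‖ ^ b * u x ^ q)

/-- Partial derivative in the `i`-th standard direction. -/
noncomputable def pd {N : ℕ} (i : Fin N) (u : EuclideanSpace ℝ (Fin N) → ℝ)
    (x : EuclideanSpace ℝ (Fin N)) : ℝ :=
  fderiv ℝ u x (EuclideanSpace.single i 1)

section PartialDerivatives

variable {N : ℕ} {u v w : EuclideanSpace ℝ (Fin N) → ℝ} {x : EuclideanSpace ℝ (Fin N)}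

theorem contDiff_pd {n : WithTop ℕ∞} (i : Fin N) (hu : ContDiff ℝ (n + 1) u) :
    ContDiff ℝ n (pd i u) :=
  (hu.fderiv_right le_rfl).clm_apply contDiff_const

theorem contDiff_pd_one (i : Fin N) (hu : ContDiff ℝ 2 u) : ContDiff ℝ 1 (pd i u) :=
  contDiff_pd i (by simpa [one_add_one_eq_two] using hu)

theorem continuous_pd (i : Fin N) (hu : ContDiff ℝ 1 u) : Continuous (pd i u) :=
  (contDiff_pd (n := 0) i (by simpa using hu)).continuous

theorem continuous_pd_pd (i j : Fin N) (hu : ContDiff ℝ 2 u) : Continuous (pd i (pd j u)) :=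
  continuous_pd i (contDiff_pd_one j hu)

theorem pd_congr (i : Fin N) (h : u =ᶠ[nhds x] v) : pd i u x = pd i v x := by
  simp only [pd, h.fderiv_eq]

theorem pd_add (i : Fin N) (hu : DifferentiableAt ℝ u x) (hv : DifferentiableAt ℝ v x) :
    pd i (fun y => u y + v y) x = pd i u x + pd i v x := by
  simp [pd, fderiv_fun_add hu hv]

theorem pd_mul (i : Fin N) (hu : DifferentiableAt ℝ u x) (hv : DifferentiableAt ℝ v x) :
    pd i (fun y => u y * v y) x = u x * pd i v x + pd i u x * v x := by
  simp [pd, fderiv_fun_mul hu hv, mul_comm]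

theorem pd_sum (i : Fin N) {ι : Type*} (s : Finset ι) {f : ι → EuclideanSpace ℝ (Fin N) → ℝ}
    (hf : ∀ j ∈ s, DifferentiableAt ℝ (f j) x) :
    pd i (fun y => ∑ j ∈ s, f j y) x = ∑ j ∈ s, pd i (f j) x := by
  simp [pd, fderiv_fun_sum hf]

theorem pd_comp (i : Fin N) {g : ℝ → ℝ} {g' : ℝ} (hg : HasDerivAt g g' (u x))
    (hu : DifferentiableAt ℝ u x) : pd i (fun y => g (u y)) x = g' * pd i u x := by
  have := (hg.comp_hasFDerivAt x hu.hasFDerivAt).fderiv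
  simp only [pd]
  rw [show (fun y => g (u y)) = g ∘ u from rfl, this]
  simp

theorem pd_coord (i j : Fin N) : pd i (fun y => y j) x = if j = i then 1 else 0 := by
  have : HasFDerivAt (fun y : EuclideanSpace ℝ (Fin N) => y j)
      (EuclideanSpace.proj j : EuclideanSpace ℝ (Fin N) →L[ℝ] ℝ) x :=
    (EuclideanSpace.proj j : EuclideanSpace ℝ (Fin N) →L[ℝ] ℝ).hasFDerivAt
  simp [pd, this.fderiv]

theorem pd_affine (i : Fin N) (c : ℝ) (y : EuclideanSpace ℝ (Fin N))
    (hu : DifferentiableAt ℝ u (y + c • x)) :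
    pd i (fun z => u (y + c • z)) x = c * pd i u (y + c • x) := by
  have h1 : HasFDerivAt (fun z : EuclideanSpace ℝ (Fin N) => y + c • z)
      (c • ContinuousLinearMap.id ℝ _) x := ((hasFDerivAt_id x).const_smul c).const_add y
  have := (hu.hasFDerivAt.comp x h1).fderiv
  simp only [pd]
  rw [show (fun z => u (y + c • z)) = u ∘ (fun z => y + c • z) from rfl, this]
  simp

theorem pd_comm (i j : Fin N) (hu : ContDiffAt ℝ 2 u x) :
    pd i (pd j u) x = pd j (pd i u) x := by
  have hd : DifferentiableAt ℝ (fderiv ℝ u) x :=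
    (hu.fderiv_right (m := 1) (by norm_num [one_add_one_eq_two])).differentiableAt (by norm_num)
  have key : ∀ i j : Fin N, pd i (pd j u) x =
      fderiv ℝ (fderiv ℝ u) x (EuclideanSpace.single i 1) (EuclideanSpace.single j 1) := by
    intro i j
    change fderiv ℝ (fun y => fderiv ℝ u y (EuclideanSpace.single j 1)) x _ = _
    rw [fderiv_clm_apply hd (by fun_prop)]
    simp
  rw [key, key]
  exact (hu.isSymmSndFDerivAt (by simp)) _ _

theorem lap_eq_sum_pd (hu : ContDiffAt ℝ 2 u x) : lap u x = ∑ i, pd i (pd i u) x := by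
  have hd : DifferentiableAt ℝ (fderiv ℝ u) x :=
    (hu.fderiv_right (m := 1) (by norm_num [one_add_one_eq_two])).differentiableAt (by norm_num)
  refine Finset.sum_congr rfl fun i _ => ?_
  rw [iteratedFDeriv_two_apply]
  change _ = fderiv ℝ (fun y => fderiv ℝ u y (EuclideanSpace.single i 1)) x _
  rw [fderiv_clm_apply hd (by fun_prop)]
  simp

theorem lap_congr (h : u =ᶠ[nhds x] v) : lap u x = lap v x := by
  simp only [lap, (h.iteratedFDeriv ℝ 2).eq_of_nhds]

theorem continuous_lap (hu : ContDiff ℝ 2 u) : Continuous (lap u) := by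
  have : lap u = fun x => ∑ i, pd i (pd i u) x := funext fun x => lap_eq_sum_pd hu.contDiffAt
  rw [this]
  exact continuous_finsetSum _ fun i _ => continuous_pd_pd i i hu

theorem hasCompactSupport_pd (i : Fin N) (hu : HasCompactSupport u) :
    HasCompactSupport (pd i u) :=
  hu.fderiv_apply (𝕜 := ℝ) _

theorem lap_affine (c : ℝ) (y : EuclideanSpace ℝ (Fin N)) (hu : ContDiffAt ℝ 2 u (y + c • x)) :
    lap (fun z => u (y + c • z)) x = c ^ 2 * lap u (y + c • x) := by
  have hA : ContDiff ℝ 2 (fun z : EuclideanSpace ℝ (Fin N) => y + c • z) := by fun_prop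
  have h1 : ContDiffAt ℝ 2 (fun z => u (y + c • z)) x := hu.comp x hA.contDiffAt
  rw [lap_eq_sum_pd h1, lap_eq_sum_pd hu, Finset.mul_sum]
  refine Finset.sum_congr rfl fun i _ => ?_
  have hev : ∀ᶠ z in nhds x, ContDiffAt ℝ 2 u (y + c • z) :=
    hA.continuous.continuousAt.eventually (hu.eventually (by simp))
  have : pd i (fun z => u (y + c • z)) =ᶠ[nhds x] fun z => c * pd i u (y + c • z) := by
    filter_upwards [hev] with z hz using pd_affine i c y (hz.differentiableAt (by norm_num))
  rw [pd_congr i this]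
  have hd : DifferentiableAt ℝ (pd i u) (y + c • x) := by
    have : DifferentiableAt ℝ (fderiv ℝ u) (y + c • x) :=
      (hu.fderiv_right (m := 1) (by norm_num [one_add_one_eq_two])).differentiableAt (by norm_num)
    exact this.clm_apply (by fun_prop)
  have hd2 : DifferentiableAt ℝ (fun z => pd i u (y + c • z)) x :=
    DifferentiableAt.comp (g := pd i u) x hd (hA.differentiable (by norm_num) x)
  rw [pd_mul i (by fun_prop) hd2, pd_affine i c y hd]
  simp [pd]; ring

theorem lap_const_mul (c : ℝ) (hu : ContDiffAt ℝ 2 u x) :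
    lap (fun z => c * u z) x = c * lap u x := by
  have h1 : ContDiffAt ℝ 2 (fun z => c * u z) x := contDiffAt_const.mul hu
  simp only [lap, Finset.mul_sum]
  refine Finset.sum_congr rfl fun i _ => ?_
  have := iteratedFDeriv_const_smul_apply (𝕜 := ℝ) (i := 2) (a := c) hu
  rw [show (fun z => c * u z) = c • u from rfl, this]
  simp

theorem lap_add (hu : ContDiffAt ℝ 2 u x) (hv : ContDiffAt ℝ 2 v x) :
    lap (fun z => u z + v z) x = lap u x + lap v x := by
  simp only [lap, ← Finset.sum_add_distrib]
  refine Finset.sum_congr rfl fun i _ => ?_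
  rw [show (fun z => u z + v z) = u + v from rfl, iteratedFDeriv_add_apply hu hv]
  simp

theorem integral_mul_pd {f g : EuclideanSpace ℝ (Fin N) → ℝ} (i : Fin N)
    (hf : ContDiff ℝ 1 f) (hc : HasCompactSupport f) (hg : ContDiff ℝ 1 g) :
    ∫ x, f x * pd i g x = - ∫ x, pd i f x * g x := by
  have hpf := hasCompactSupport_pd i hc
  exact integral_mul_fderiv_eq_neg_fderiv_mul_of_integrable
    (Continuous.integrable_of_hasCompactSupport ((continuous_pd i hf).mul hg.continuous)
      hpf.mul_right)
    (Continuous.integrable_of_hasCompactSupport (hf.continuous.mul (continuous_pd i hg))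
      hc.mul_right)
    (Continuous.integrable_of_hasCompactSupport (hf.continuous.mul hg.continuous) hc.mul_right)
    (fun x _ => hf.differentiable (by norm_num) x) (fun x _ => hg.differentiable (by norm_num) x)

/-- Green's identity for a compactly supported function. -/
theorem integral_mul_lap {f g : EuclideanSpace ℝ (Fin N) → ℝ}
    (hf : ContDiff ℝ 2 f) (hc : HasCompactSupport f) (hg : ContDiff ℝ 2 g) :
    ∫ x, f x * lap g x = ∫ x, lap f x * g x := by
  have h1 : ContDiff ℝ 1 f := hf.of_le (by norm_num)
  have h2 : ContDiff ℝ 1 g := hg.of_le (by norm_num)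
  simp_rw [fun x => lap_eq_sum_pd (hf.contDiffAt (x := x)),
    fun x => lap_eq_sum_pd (hg.contDiffAt (x := x)), Finset.mul_sum, Finset.sum_mul]
  rw [integral_finsetSum, integral_finsetSum]
  · refine Finset.sum_congr rfl fun i _ => ?_
    rw [integral_mul_pd i h1 hc (contDiff_pd_one i hg),
      ← neg_eq_iff_eq_neg.mpr (integral_mul_pd i (contDiff_pd_one i hf)
        (hasCompactSupport_pd i hc) h2)]
  · exact fun i _ => Continuous.integrable_of_hasCompactSupport
      ((continuous_pd_pd i i hf).mul hg.continuous)
      (hasCompactSupport_pd i (hasCompactSupport_pd i hc)).mul_right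
  · exact fun i _ => Continuous.integrable_of_hasCompactSupport
      (hf.continuous.mul (continuous_pd_pd i i hg)) hc.mul_right

/-- Green's identity with one derivative moved from one factor to the other. -/
theorem integral_pd_mul_lap {f g : EuclideanSpace ℝ (Fin N) → ℝ} (i : Fin N)
    (hf : ContDiff ℝ 2 f) (hc : HasCompactSupport f) (hg : ContDiff ℝ 2 g) :
    ∫ x, pd i f x * lap g x = - ∫ x, lap f x * pd i g x := by
  have h1 : ContDiff ℝ 1 f := hf.of_le (by norm_num)
  simp_rw [fun x => lap_eq_sum_pd (hf.contDiffAt (x := x)),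
    fun x => lap_eq_sum_pd (hg.contDiffAt (x := x)), Finset.mul_sum, Finset.sum_mul]
  rw [integral_finsetSum, integral_finsetSum, ← Finset.sum_neg_distrib]
  · refine Finset.sum_congr rfl fun j _ => ?_
    rw [integral_mul_pd j (contDiff_pd_one i hf) (hasCompactSupport_pd i hc)
      (contDiff_pd_one j hg), ← neg_eq_iff_eq_neg.mpr (integral_mul_pd j (contDiff_pd_one j hf)
        (hasCompactSupport_pd j hc) (contDiff_pd_one i hg))]
    simp_rw [fun x => pd_comm j i (hf.contDiffAt (x := x)),
      fun x => pd_comm j i (hg.contDiffAt (x := x))]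
    rw [← integral_mul_pd i (contDiff_pd_one j hf) (hasCompactSupport_pd j hc)
      (contDiff_pd_one j hg)]
    simp
  · exact fun j _ => Continuous.integrable_of_hasCompactSupport
      ((continuous_pd_pd j j hf).mul (continuous_pd i (hg.of_le (by norm_num))))
      (hasCompactSupport_pd j (hasCompactSupport_pd j hc)).mul_right
  · exact fun j _ => Continuous.integrable_of_hasCompactSupport
      ((continuous_pd i h1).mul (continuous_pd_pd j j hg)) (hasCompactSupport_pd i hc).mul_right

/-- A function that is `C^n` near a compact set agrees near it with a globally `C^n` function. -/
theorem exists_contDiff_eventuallyEq {n : ℕ} {Ω K : Set (EuclideanSpace ℝ (Fin N))}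
    (hΩ : IsOpen Ω) (hK : IsCompact K) (hKΩ : K ⊆ Ω) (hu : ContDiffOn ℝ n u Ω) :
    ∃ U : EuclideanSpace ℝ (Fin N) → ℝ, ContDiff ℝ n U ∧ ∀ x ∈ K, U =ᶠ[nhds x] u := by
  obtain ⟨K', hK', hKK', hK'Ω⟩ := exists_compact_between hK hΩ hKΩ
  obtain ⟨f, hf0, hf1, -⟩ := exists_contMDiffMap_zero_one_nhds_of_isClosed
    (modelWithCornersSelf ℝ (EuclideanSpace ℝ (Fin N))) (n := n) (s := (interior K')ᶜ) (t := K)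
    isOpen_interior.isClosed_compl hK.isClosed
    (disjoint_left.mpr fun x hx hxK => hx (hKK' hxK))
  have hfs : ContDiff ℝ n f := f.contMDiff.contDiff
  refine ⟨fun x => f x * u x, contDiff_iff_contDiffAt.mpr fun x => ?_, fun x hx => ?_⟩
  · by_cases hx : x ∈ Ω
    · exact hfs.contDiffAt.mul (hu.contDiffAt (hΩ.mem_nhds hx))
    · have hx' : x ∈ (interior K')ᶜ := fun h => hx (hK'Ω (interior_subset h))
      have : (fun x => f x * u x) =ᶠ[nhds x] fun _ => 0 := by
        filter_upwards [hf0.filter_mono (nhds_le_nhdsSet hx')] with y hy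
        simp [hy]
      exact contDiffAt_const.congr_of_eventuallyEq this
  · filter_upwards [hf1.filter_mono (nhds_le_nhdsSet hx)] with y hy
    simp [hy]

end PartialDerivatives

theorem hasDerivAt_ite_le {f g f' g' : ℝ → ℝ} {c : ℝ} (hf : ∀ t ≤ c, HasDerivAt f (f' t) t)
    (hg : ∀ t, c ≤ t → HasDerivAt g (g' t) t) (h0 : f c = g c) (h1 : f' c = g' c) (t : ℝ) :
    HasDerivAt (fun t => if t ≤ c then f t else g t) (if t ≤ c then f' t else g' t) t := by
  rcases lt_trichotomy t c with h | h | h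
  · rw [if_pos h.le]
    refine (hf t h.le).congr_of_eventuallyEq ?_
    filter_upwards [Iio_mem_nhds h] with y hy
    rw [if_pos (le_of_lt hy)]
  · subst h
    rw [if_pos le_rfl]
    have h2 : HasDerivWithinAt (fun s => if s ≤ t then f s else g s) (f' t) (Iic t) t :=
      (hf t le_rfl).hasDerivWithinAt.congr (fun y hy => if_pos hy) (if_pos le_rfl)
    have h3 : HasDerivWithinAt (fun s => if s ≤ t then f s else g s) (f' t) (Ici t) t := by
      rw [h1]
      refine (hg t le_rfl).hasDerivWithinAt.congr (fun y hy => ?_) (by simp [h0])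
      rcases eq_or_lt_of_le (mem_Ici.mp hy) with h4 | h4
      · subst h4; simp [h0]
      · rw [if_neg h4.not_ge]
    have := h2.union h3
    rwa [Iic_union_Ici, hasDerivWithinAt_univ] at this
  · rw [if_neg h.not_ge]
    refine (hg t h.le).congr_of_eventuallyEq ?_
    filter_upwards [Ioi_mem_nhds h] with y hy
    rw [if_neg (not_le.mpr hy)]

theorem continuous_ite_le {f g : ℝ → ℝ} {c : ℝ} (hf : Continuous f)
    (hg : ContinuousOn g (Ici c)) (h0 : f c = g c) :
    Continuous (fun t => if t ≤ c then f t else g t) := by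
  exact continuous_if_le continuous_id continuous_const hf.continuousOn hg
    (by rintro x rfl; exact h0)

theorem contDiff_two_of_hasDerivAt {f f' f'' : ℝ → ℝ} (h : ∀ t, HasDerivAt f (f' t) t)
    (h' : ∀ t, HasDerivAt f' (f'' t) t) (h'' : Continuous f'') : ContDiff ℝ 2 f := by
  have e : deriv f = f' := funext fun t => (h t).deriv
  have e' : deriv f' = f'' := funext fun t => (h' t).deriv
  have c1 : ContDiff ℝ 1 f' := contDiff_one_iff_deriv.mpr
    ⟨fun t => (h' t).differentiableAt, e' ▸ h''⟩
  rw [← one_add_one_eq_two, contDiff_succ_iff_deriv]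
  exact ⟨fun t => (h t).differentiableAt, by simp, e ▸ c1⟩

section Radial

variable {N : ℕ}

theorem pd_norm_sq (i : Fin N) (z : EuclideanSpace ℝ (Fin N)) :
    pd i (fun z => ‖z‖ ^ 2) z = 2 * z i := by
  have := (hasStrictFDerivAt_norm_sq z).hasFDerivAt.fderiv
  simp only [pd]
  rw [this]
  simp [EuclideanSpace.inner_single_right]

/-- The Laplacian of a radial function, written as a function of the squared norm. -/
theorem lap_comp_norm_sq {g g' g'' : ℝ → ℝ} {z : EuclideanSpace ℝ (Fin N)}
    (hc : ContDiffAt ℝ 2 g (‖z‖ ^ 2)) (h : ∀ᶠ t in nhds (‖z‖ ^ 2), HasDerivAt g (g' t) t)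
    (h' : HasDerivAt g' (g'' (‖z‖ ^ 2)) (‖z‖ ^ 2)) :
    lap (fun z => g (‖z‖ ^ 2)) z = 4 * ‖z‖ ^ 2 * g'' (‖z‖ ^ 2) + 2 * N * g' (‖z‖ ^ 2) := by
  have hn : ContDiff ℝ 2 (fun z : EuclideanSpace ℝ (Fin N) => ‖z‖ ^ 2) := contDiff_norm_sq ℝ
  have hnd : ∀ y, DifferentiableAt ℝ (fun z : EuclideanSpace ℝ (Fin N) => ‖z‖ ^ 2) y :=
    fun y => hn.differentiable (by norm_num) y
  have hg : ContDiffAt ℝ 2 (fun z : EuclideanSpace ℝ (Fin N) => g (‖z‖ ^ 2)) z :=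
    hc.comp z hn.contDiffAt
  rw [lap_eq_sum_pd hg]
  have hev : ∀ᶠ y in nhds z, HasDerivAt g (g' (‖y‖ ^ 2)) (‖y‖ ^ 2) :=
    hn.continuous.continuousAt.eventually h
  have key : ∀ i : Fin N, pd i (pd i (fun z => g (‖z‖ ^ 2))) z =
      4 * z i ^ 2 * g'' (‖z‖ ^ 2) + 2 * g' (‖z‖ ^ 2) := by
    intro i
    have e : pd i (fun z => g (‖z‖ ^ 2)) =ᶠ[nhds z] fun y => g' (‖y‖ ^ 2) * (2 * y i) := by
      filter_upwards [hev] with y hy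
      rw [pd_comp i (u := fun z => ‖z‖ ^ 2) hy (hnd y), pd_norm_sq]
    rw [pd_congr i e, pd_mul i, pd_comp i (u := fun z => ‖z‖ ^ 2) h' (hnd z), pd_norm_sq, pd_mul i,
      pd_coord]
    · simp [pd]; ring
    · fun_prop
    · fun_prop
    · exact h'.differentiableAt.comp (𝕜 := ℝ) z (hnd z)
    · fun_prop
  simp_rw [key]
  rw [Finset.sum_add_distrib, EuclideanSpace.norm_sq_eq z]
  simp only [Real.norm_eq_abs, sq_abs, Finset.sum_const, Finset.card_univ, Fintype.card_fin,
    nsmul_eq_mul, Finset.mul_sum, Finset.sum_mul]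
  congr 1
  ring

end Radial

section Kernel

/-- The function `t ^ (-m)`, replaced on `t ≤ 1` by its third Taylor polynomial at `1`. -/
noncomputable def capPow (m t : ℝ) : ℝ :=
  if t ≤ 1 then 1 + m * (1 - t) + m * (m + 1) / 2 * (1 - t) ^ 2 +
    m * (m + 1) * (m + 2) / 6 * (1 - t) ^ 3 else t ^ (-m)

noncomputable def capPowD (m t : ℝ) : ℝ :=
  if t ≤ 1 then -(m + m * (m + 1) * (1 - t) + m * (m + 1) * (m + 2) / 2 * (1 - t) ^ 2)
    else -m * t ^ (-m - 1)

noncomputable def capPowDD (m t : ℝ) : ℝ :=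
  if t ≤ 1 then m * (m + 1) + m * (m + 1) * (m + 2) * (1 - t) else m * (m + 1) * t ^ (-m - 2)

theorem hasDerivAt_capPow (m t : ℝ) : HasDerivAt (capPow m) (capPowD m t) t := by
  refine hasDerivAt_ite_le (f' := fun t => -(m + m * (m + 1) * (1 - t) +
    m * (m + 1) * (m + 2) / 2 * (1 - t) ^ 2)) (g' := fun t => -m * t ^ (-m - 1)) ?_ ?_ ?_ ?_ t
  · intro t _
    have h : HasDerivAt (fun t : ℝ => 1 - t) (-1) t := by
      simpa using (hasDerivAt_id t).const_sub 1
    have := (((h.const_mul m).const_add 1).add ((h.pow 2).const_mul (m * (m + 1) / 2))).add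
      ((h.pow 3).const_mul (m * (m + 1) * (m + 2) / 6))
    refine this.congr_deriv ?_
    push_cast; ring
  · intro t ht
    exact Real.hasDerivAt_rpow_const (Or.inl (by linarith))
  · simp
  · simp

theorem hasDerivAt_capPowD (m t : ℝ) : HasDerivAt (capPowD m) (capPowDD m t) t := by
  refine hasDerivAt_ite_le (f' := fun t => m * (m + 1) + m * (m + 1) * (m + 2) * (1 - t))
    (g' := fun t => m * (m + 1) * t ^ (-m - 2)) ?_ ?_ ?_ ?_ t
  · intro t _
    have h : HasDerivAt (fun t : ℝ => 1 - t) (-1) t := by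
      simpa using (hasDerivAt_id t).const_sub 1
    have := (((h.const_mul (m * (m + 1))).const_add m).add
      ((h.pow 2).const_mul (m * (m + 1) * (m + 2) / 2))).neg
    refine this.congr_deriv ?_
    push_cast; ring
  · intro t ht
    have := (Real.hasDerivAt_rpow_const (p := -m - 1) (x := t) (Or.inl (by linarith))).const_mul (-m)
    refine this.congr_deriv ?_
    rw [show -m - 1 - 1 = -m - 2 by ring]; ring
  · simp
  · simp

theorem continuous_capPowDD (m : ℝ) : Continuous (capPowDD m) := by
  refine continuous_ite_le (by fun_prop) ?_ (by simp)
  refine ContinuousOn.mul continuousOn_const ?_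
  exact continuousOn_id.rpow_const fun t ht => Or.inl (by have := mem_Ici.mp ht; simp; linarith)

theorem contDiff_capPow (m : ℝ) : ContDiff ℝ 2 (capPow m) :=
  contDiff_two_of_hasDerivAt (hasDerivAt_capPow m) (hasDerivAt_capPowD m) (continuous_capPowDD m)

theorem capPow_eq_of_one_le {m t : ℝ} (ht : 1 ≤ t) : capPow m t = t ^ (-m) := by
  rcases eq_or_lt_of_le ht with h | h
  · subst h; simp [capPow]
  · simp [capPow, h.not_ge]

theorem strictMonoOn_rpow_mul_capPow {m : ℝ} (hm : 0 < m) :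
    StrictMonoOn (fun t => t ^ m * capPow m t) (Ioc 0 1) := by
  have hd : ∀ t, 0 < t → HasDerivAt (fun t => t ^ m * capPow m t)
      (m * t ^ (m - 1) * capPow m t + t ^ m * capPowD m t) t := fun t ht =>
    (Real.hasDerivAt_rpow_const (Or.inl ht.ne')).mul (hasDerivAt_capPow m t)
  refine strictMonoOn_of_deriv_pos (convex_Ioc 0 1)
    (fun t ht => (hd t ht.1).continuousAt.continuousWithinAt) fun t ht => ?_
  rw [interior_Ioc] at ht
  rw [(hd t ht.1).deriv]
  have e : t ^ m = t ^ (m - 1) * t := by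
    rw [← Real.rpow_add_one ht.1.ne']; ring_nf
  have : m * t ^ (m - 1) * capPow m t + t ^ m * capPowD m t =
      t ^ (m - 1) * (m * (m + 1) * (m + 2) * (m + 3) / 6 * (1 - t) ^ 3) := by
    rw [e, capPow, capPowD, if_pos ht.2.le, if_pos ht.2.le]; ring
  rw [this]
  have := ht.1
  have : 0 < 1 - t := by linarith [ht.2]
  positivity

theorem capPow_four_mul_pos {m t : ℝ} (hm : 0 < m) (h0 : 0 ≤ t) (h1 : t ≤ 1 / 4) :
    0 < (4 : ℝ) ^ m * capPow m (4 * t) - capPow m t := by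
  rcases eq_or_lt_of_le h0 with h | h
  · subst h
    have h4 : 1 < (4 : ℝ) ^ m := Real.one_lt_rpow (by norm_num) hm
    have : 0 < capPow m 0 := by simp only [capPow, zero_le_one, if_true]; positivity
    rw [mul_zero]; nlinarith
  · have := strictMonoOn_rpow_mul_capPow hm (a := t) ⟨h, by linarith⟩ (b := 4 * t)
      ⟨by linarith, by linarith⟩ (by linarith)
    simp only at this
    rw [Real.mul_rpow (by norm_num) h.le] at this
    have ht : 0 < t ^ m := Real.rpow_pos_of_pos h m
    have h3 : t ^ m * capPow m t < t ^ m * ((4 : ℝ) ^ m * capPow m (4 * t)) := by linarith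
    linarith [lt_of_mul_lt_mul_left h3 ht.le]

theorem capPow_four_mul_eq {m t : ℝ} (h1 : 1 ≤ t) :
    (4 : ℝ) ^ m * capPow m (4 * t) - capPow m t = 0 := by
  rw [capPow_eq_of_one_le h1, capPow_eq_of_one_le (by linarith),
    Real.mul_rpow (by norm_num) (by linarith), Real.rpow_neg (by norm_num)]
  have : (4 : ℝ) ^ m ≠ 0 := (Real.rpow_pos_of_pos (by norm_num) m).ne'
  field_simp; ring

theorem capPow_four_mul_nonneg {m t : ℝ} (hm : 0 < m) (h0 : 0 ≤ t) :
    0 ≤ (4 : ℝ) ^ m * capPow m (4 * t) - capPow m t := by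
  rcases le_or_gt t (1 / 4) with h | h
  · exact (capPow_four_mul_pos hm h0 h).le
  rcases le_or_gt 1 t with h1 | h1
  · exact (capPow_four_mul_eq h1).ge
  have ht : 0 < t := by linarith
  have := (strictMonoOn_rpow_mul_capPow hm).monotoneOn (a := t) ⟨ht, h1.le⟩ (b := 1)
      ⟨by linarith, le_rfl⟩ h1.le
  have hc : capPow m 1 = 1 := by simp [capPow]
  simp only [Real.one_rpow, hc, one_mul] at this
  rw [capPow_eq_of_one_le (by linarith : 1 ≤ 4 * t), Real.mul_rpow (by norm_num) ht.le,
    Real.rpow_neg (by norm_num), Real.rpow_neg ht.le]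
  have h4 : (4 : ℝ) ^ m ≠ 0 := (Real.rpow_pos_of_pos (by norm_num) m).ne'
  have ht' : 0 < t ^ m := Real.rpow_pos_of_pos ht m
  rw [mul_inv_cancel_left₀ h4, sub_nonneg, ← one_div, le_div_iff₀ ht']
  linarith

variable (N : ℕ)

/-- A smoothed fundamental solution of the Laplacian. -/
noncomputable def smoothFund (z : EuclideanSpace ℝ (Fin N)) : ℝ :=
  capPow (((N : ℝ) - 2) / 2) (‖z‖ ^ 2)

/-- The mollifying kernel: minus the Laplacian of `smoothFund`. -/
noncomputable def molKer (z : EuclideanSpace ℝ (Fin N)) : ℝ :=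
  (N - 2) / 2 * ((N - 2) / 2 + 1) * ((N - 2) / 2 + 2) * ((N - 2) / 2 + 3) * 2 *
    (if ‖z‖ ^ 2 ≤ 1 then (1 - ‖z‖ ^ 2) ^ 2 else 0)

/-- The nonnegative compactly supported kernel relating two scales of mollification. -/
noncomputable def potKer (z : EuclideanSpace ℝ (Fin N)) : ℝ :=
  4 ^ (((N : ℝ) - 2) / 2) * smoothFund N ((2 : ℝ) • z) - smoothFund N z

variable {N}

theorem contDiff_smoothFund : ContDiff ℝ 2 (smoothFund N) :=
  (contDiff_capPow _).comp (contDiff_norm_sq ℝ)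

theorem contDiff_potKer : ContDiff ℝ 2 (potKer N) :=
  (contDiff_const.mul (contDiff_smoothFund.comp (contDiff_const_smul _))).sub contDiff_smoothFund

theorem contDiff_molKer : ContDiff ℝ 1 (molKer N) := by
  refine contDiff_const.mul ?_
  have h1 : ∀ t : ℝ, HasDerivAt (fun t : ℝ => if t ≤ 1 then (1 - t) ^ 2 else 0)
      (if t ≤ 1 then -2 * (1 - t) else 0) t := by
    refine hasDerivAt_ite_le (f' := fun t => -2 * (1 - t)) (g' := fun _ => 0) ?_ ?_ (by simp)
      (by simp)
    · intro t _
      have h : HasDerivAt (fun t : ℝ => 1 - t) (-1) t := by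
        simpa using (hasDerivAt_id t).const_sub 1
      refine (h.pow 2).congr_deriv ?_
      push_cast; ring
    · intro t _; exact hasDerivAt_const _ _
  have h2 : ContDiff ℝ 1 (fun t : ℝ => if t ≤ 1 then (1 - t) ^ 2 else 0) := by
    rw [contDiff_one_iff_deriv]
    refine ⟨fun t => (h1 t).differentiableAt, ?_⟩
    rw [show deriv _ = _ from funext fun t => (h1 t).deriv]
    exact continuous_ite_le (by fun_prop) continuousOn_const (by simp)
  exact h2.comp (contDiff_norm_sq ℝ)

theorem lap_smoothFund (z : EuclideanSpace ℝ (Fin N)) :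
    lap (smoothFund N) z = -molKer N z := by
  have := lap_comp_norm_sq (z := z) (g := capPow (((N : ℝ) - 2) / 2))
    (contDiff_capPow _).contDiffAt (Eventually.of_forall (hasDerivAt_capPow _))
    (hasDerivAt_capPowD _ _)
  unfold smoothFund molKer
  rw [this, capPowD, capPowDD]
  split_ifs with h
  · ring
  · push Not at h
    set t := ‖z‖ ^ 2
    have ht : 0 < t := by linarith
    have : t ^ (-(((N : ℝ) - 2) / 2) - 1) = t ^ (-(((N : ℝ) - 2) / 2) - 2) * t := by
      rw [← Real.rpow_add_one ht.ne']; ring_nf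
    rw [this]; ring

theorem lap_potKer (z : EuclideanSpace ℝ (Fin N)) :
    -lap (potKer N) z = 2 ^ N * molKer N ((2 : ℝ) • z) - molKer N z := by
  have h1 : ContDiff ℝ 2 (fun z => smoothFund N ((2 : ℝ) • z)) :=
    contDiff_smoothFund.comp (contDiff_const_smul _)
  have h2 : ContDiff ℝ 2 (fun z => 4 ^ (((N : ℝ) - 2) / 2) * smoothFund N ((2 : ℝ) • z)) :=
    contDiff_const.mul h1
  have e : potKer N = fun z => 4 ^ (((N : ℝ) - 2) / 2) * smoothFund N ((2 : ℝ) • z) +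
      (-1) * smoothFund N z := by
    funext z; simp [potKer, sub_eq_add_neg]
  have h3 : lap (fun z => smoothFund N ((2 : ℝ) • z)) z = 2 ^ 2 * lap (smoothFund N) ((2 : ℝ) • z) := by
    have := lap_affine (u := smoothFund N) (x := z) 2 0 contDiff_smoothFund.contDiffAt
    simpa using this
  rw [e, lap_add h2.contDiffAt (contDiff_const.mul contDiff_smoothFund).contDiffAt,
    lap_const_mul _ h1.contDiffAt, lap_const_mul _ contDiff_smoothFund.contDiffAt, h3,
    lap_smoothFund, lap_smoothFund]
  have : (4 : ℝ) ^ (((N : ℝ) - 2) / 2) * 2 ^ 2 = 2 ^ N := by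
    rw [show (2 : ℝ) ^ 2 = 4 by norm_num, ← Real.rpow_add_one (by norm_num),
      show (4 : ℝ) = 2 ^ (2 : ℝ) by norm_num, ← Real.rpow_mul (by norm_num), ← Real.rpow_natCast]
    ring_nf
  rw [← this]; ring

theorem potKer_eq (z : EuclideanSpace ℝ (Fin N)) : potKer N z =
    4 ^ (((N : ℝ) - 2) / 2) * capPow (((N : ℝ) - 2) / 2) (4 * ‖z‖ ^ 2) -
      capPow (((N : ℝ) - 2) / 2) (‖z‖ ^ 2) := by
  rw [potKer, smoothFund, smoothFund, norm_smul, mul_pow]; norm_num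

theorem potKer_eq_zero {z : EuclideanSpace ℝ (Fin N)} (hz : 1 ≤ ‖z‖) : potKer N z = 0 := by
  rw [potKer_eq]; exact capPow_four_mul_eq (one_le_pow₀ hz)

theorem molKer_eq_zero {z : EuclideanSpace ℝ (Fin N)} (hz : 1 ≤ ‖z‖) : molKer N z = 0 := by
  rw [molKer]
  split_ifs with h
  · rw [le_antisymm h (one_le_pow₀ hz)]; simp
  · simp

theorem hasCompactSupport_of_norm {F : Type*} [Zero F] {f : EuclideanSpace ℝ (Fin N) → F}
    (h : ∀ z, 1 ≤ ‖z‖ → f z = 0) : HasCompactSupport f :=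
  HasCompactSupport.intro (isCompact_closedBall 0 1) fun z hz => h z (by
    simp at hz; exact hz.le)

theorem pd_eq_zero_of_norm {f : EuclideanSpace ℝ (Fin N) → ℝ} (i : Fin N)
    (h : ∀ z, 1 ≤ ‖z‖ → f z = 0) (z : EuclideanSpace ℝ (Fin N)) (hz : 1 < ‖z‖) :
    pd i f z = 0 := by
  have : f =ᶠ[nhds z] fun _ => 0 := by
    filter_upwards [(isOpen_lt continuous_const continuous_norm).mem_nhds hz] with y hy
    exact h y (le_of_lt hy)
  rw [pd_congr i this]; simp [pd]

theorem potKer_nonneg (hN : 3 ≤ N) (z : EuclideanSpace ℝ (Fin N)) : 0 ≤ potKer N z := by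
  have : (3 : ℝ) ≤ N := by exact_mod_cast hN
  rw [potKer_eq]; exact capPow_four_mul_nonneg (by linarith) (by positivity)

theorem molKer_nonneg (hN : 3 ≤ N) (z : EuclideanSpace ℝ (Fin N)) : 0 ≤ molKer N z := by
  have : (3 : ℝ) ≤ N := by exact_mod_cast hN
  have : (0 : ℝ) ≤ N - 2 := by linarith
  rw [molKer]
  split_ifs <;> positivity

theorem exists_molKer_ge (hN : 3 ≤ N) : ∃ c > 0, ∀ z : EuclideanSpace ℝ (Fin N), ‖z‖ ≤ 1 / 2 →
    c ≤ molKer N z ∧ c ≤ potKer N z := by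
  have h3 : (3 : ℝ) ≤ N := by exact_mod_cast hN
  have h2 : (0 : ℝ) < N - 2 := by linarith
  have hK := isCompact_closedBall (0 : EuclideanSpace ℝ (Fin N)) (1 / 2)
  have hne : (closedBall (0 : EuclideanSpace ℝ (Fin N)) (1 / 2)).Nonempty :=
    ⟨0, by simp⟩
  have hsq : ∀ z : EuclideanSpace ℝ (Fin N), ‖z‖ ≤ 1 / 2 → ‖z‖ ^ 2 ≤ 1 / 4 := fun z hz => by
    have := norm_nonneg z; nlinarith
  obtain ⟨x, hx, hx'⟩ := hK.exists_isMinOn hne contDiff_molKer.continuous.continuousOn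
  obtain ⟨y, hy, hy'⟩ := hK.exists_isMinOn hne contDiff_potKer.continuous.continuousOn
  refine ⟨min (molKer N x) (potKer N y), lt_min ?_ ?_, fun z hz => ⟨?_, ?_⟩⟩
  · have := hsq x (by simpa using hx)
    rw [molKer, if_pos (by linarith)]
    have : 0 < 1 - ‖x‖ ^ 2 := by linarith
    positivity
  · rw [potKer_eq]
    exact capPow_four_mul_pos (by linarith) (by positivity) (hsq y (by simpa using hy))
  · exact (min_le_left _ _).trans (hx' (by simpa using hz))
  · exact (min_le_right _ _).trans (hy' (by simpa using hz))

theorem exists_kernel_le : ∃ C > 0, ∀ z : EuclideanSpace ℝ (Fin N), |molKer N z| ≤ C ∧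
    |potKer N z| ≤ C ∧ ∀ i, |pd i (molKer N) z| ≤ C ∧ |pd i (potKer N) z| ≤ C := by
  have hk := hasCompactSupport_of_norm fun z hz => molKer_eq_zero (N := N) hz
  have ht := hasCompactSupport_of_norm fun z hz => potKer_eq_zero (N := N) hz
  obtain ⟨C1, h1⟩ := hk.exists_bound_of_continuous contDiff_molKer.continuous
  obtain ⟨C2, h2⟩ := ht.exists_bound_of_continuous contDiff_potKer.continuous
  choose C3 h3 using fun i : Fin N => (hasCompactSupport_pd i hk).exists_bound_of_continuous
    (continuous_pd i contDiff_molKer)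
  choose C4 h4 using fun i : Fin N => (hasCompactSupport_pd i ht).exists_bound_of_continuous
    (continuous_pd i (contDiff_potKer.of_le (by norm_num)))
  have hs : ∀ (D : Fin N → ℝ) i, |D i| ≤ ∑ j, |D j| := fun D i =>
    Finset.single_le_sum (f := fun j => |D j|) (fun j _ => abs_nonneg _) (Finset.mem_univ i)
  refine ⟨1 + |C1| + |C2| + ∑ i, |C3 i| + ∑ i, |C4 i|, by positivity, fun z => ⟨?_, ?_,
    fun i => ⟨?_, ?_⟩⟩⟩
  all_goals
    have p3 : 0 ≤ ∑ i, |C3 i| := by positivity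
    have p4 : 0 ≤ ∑ i, |C4 i| := by positivity
    have := abs_nonneg C1
    have := abs_nonneg C2
  · have := (h1 z).trans (le_abs_self _); rw [Real.norm_eq_abs] at this; linarith
  · have := (h2 z).trans (le_abs_self _); rw [Real.norm_eq_abs] at this; linarith
  · have := ((h3 i z).trans (le_abs_self _)).trans (hs C3 i)
    rw [Real.norm_eq_abs] at this; linarith
  · have := ((h4 i z).trans (le_abs_self _)).trans (hs C4 i)
    rw [Real.norm_eq_abs] at this; linarith

end Kernel

section Averages

variable {N : ℕ}

/-- The integral of `F` against the kernel `g` centred at `x` at scale `s`. -/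
noncomputable def kerAvg (g F : EuclideanSpace ℝ (Fin N) → ℝ) (s : ℝ)
    (x : EuclideanSpace ℝ (Fin N)) : ℝ := ∫ z, g z * F (x + s • z)

theorem pow_mul_setIntegral_affine (F : EuclideanSpace ℝ (Fin N) → ℝ) {s : ℝ} (hs : 0 < s) (r : ℝ)
    (x : EuclideanSpace ℝ (Fin N)) :
    s ^ N * ∫ z in closedBall 0 r, F (x + s • z) = ∫ y in closedBall x (s * r), F y := by
  rw [← integral_indicator measurableSet_closedBall, ← integral_indicator measurableSet_closedBall]
  have e : (closedBall (0 : EuclideanSpace ℝ (Fin N)) r).indicator (fun z => F (x + s • z)) =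
      fun z => (closedBall x (s * r)).indicator F (x + s • z) := by
    funext z
    have : (z ∈ closedBall (0 : EuclideanSpace ℝ (Fin N)) r) ↔ x + s • z ∈ closedBall x (s * r) := by
      simp [mem_closedBall, dist_eq_norm, norm_smul, abs_of_pos hs, hs]
    by_cases h : z ∈ closedBall (0 : EuclideanSpace ℝ (Fin N)) r
    · rw [indicator_of_mem h, indicator_of_mem (this.mp h)]
    · rw [indicator_of_notMem h, indicator_of_notMem (fun h' => h (this.mpr h'))]
  rw [e, Measure.integral_comp_smul volume (fun z => (closedBall x (s * r)).indicator F (x + z)) s,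
    integral_add_left_eq_self]
  simp only [finrank_euclideanSpace, Fintype.card_fin, smul_eq_mul]
  rw [abs_of_pos (by positivity), mul_inv_cancel_left₀ (by positivity)]

theorem integrable_kernel_mul {g F : EuclideanSpace ℝ (Fin N) → ℝ} (hg : Continuous g)
    (hc : HasCompactSupport g) (hF : Continuous F) (s : ℝ) (x : EuclideanSpace ℝ (Fin N)) :
    Integrable fun z => g z * F (x + s • z) :=
  Continuous.integrable_of_hasCompactSupport (by fun_prop) hc.mul_right

theorem hasCompactSupport_molKer : HasCompactSupport (molKer N) :=
  hasCompactSupport_of_norm fun _ hz => molKer_eq_zero hz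

theorem hasCompactSupport_potKer : HasCompactSupport (potKer N) :=
  hasCompactSupport_of_norm fun _ hz => potKer_eq_zero hz

theorem contDiff_affine {n : WithTop ℕ∞} {w : EuclideanSpace ℝ (Fin N) → ℝ} (hw : ContDiff ℝ n w)
    (s : ℝ) (x : EuclideanSpace ℝ (Fin N)) : ContDiff ℝ n fun z => w (x + s • z) :=
  hw.comp (contDiff_const.add (contDiff_const_smul s))

theorem integral_molKer_two_smul (F : EuclideanSpace ℝ (Fin N) → ℝ) (s : ℝ)
    (x : EuclideanSpace ℝ (Fin N)) :
    ∫ z, 2 ^ N * molKer N ((2 : ℝ) • z) * F (x + s • z) = kerAvg (molKer N) F (s / 2) x := by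
  have := Measure.integral_comp_smul (E := EuclideanSpace ℝ (Fin N)) volume
    (fun z => molKer N z * F (x + (s / 2) • z)) 2
  simp only [smul_smul, div_mul_cancel₀ s two_ne_zero, finrank_euclideanSpace, Fintype.card_fin,
    smul_eq_mul] at this
  simp_rw [mul_assoc]
  rw [integral_const_mul, this, abs_of_pos (by positivity), mul_inv_cancel_left₀ (by positivity)]
  rfl

theorem integral_lap_potKer_mul {F : EuclideanSpace ℝ (Fin N) → ℝ} (hF : Continuous F) (s : ℝ)
    (x : EuclideanSpace ℝ (Fin N)) :
    ∫ z, lap (potKer N) z * F (x + s • z) =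
      kerAvg (molKer N) F s x - kerAvg (molKer N) F (s / 2) x := by
  have e : ∀ z, lap (potKer N) z * F (x + s • z) = molKer N z * F (x + s • z) -
      2 ^ N * molKer N ((2 : ℝ) • z) * F (x + s • z) := fun z => by
    rw [← neg_neg (lap _ z), lap_potKer]; ring
  have i1 := integrable_kernel_mul contDiff_molKer.continuous hasCompactSupport_molKer hF s x
  have hc : HasCompactSupport fun z : EuclideanSpace ℝ (Fin N) => molKer N ((2 : ℝ) • z) :=
    hasCompactSupport_of_norm fun z hz => molKer_eq_zero (by rw [norm_smul]; norm_num; linarith)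
  have i2 := integrable_kernel_mul (g := fun z => 2 ^ N * molKer N ((2 : ℝ) • z))
    (continuous_const.mul (contDiff_molKer.continuous.comp (continuous_const_smul _)))
    hc.mul_left hF s x
  simp_rw [e]
  rw [integral_sub i1 i2, integral_molKer_two_smul]
  rfl

theorem kerAvg_half_sub {w : EuclideanSpace ℝ (Fin N) → ℝ} (hw : ContDiff ℝ 2 w) (s : ℝ)
    (x : EuclideanSpace ℝ (Fin N)) :
    kerAvg (molKer N) w (s / 2) x - kerAvg (molKer N) w s x =
      s ^ 2 * kerAvg (potKer N) (fun y => -lap w y) s x := by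
  have h := integral_mul_lap contDiff_potKer hasCompactSupport_potKer (contDiff_affine hw s x)
  rw [integral_lap_potKer_mul hw.continuous] at h
  simp_rw [fun z => lap_affine (u := w) (x := z) s x hw.contDiffAt] at h
  have e : s ^ 2 * kerAvg (potKer N) (fun y => -lap w y) s x =
      -∫ z, potKer N z * (s ^ 2 * lap w (x + s • z)) := by
    rw [kerAvg, ← integral_const_mul, ← integral_neg]
    congr 1; funext z; ring
  rw [e, h, neg_sub]

theorem kerAvg_pd_half_sub {w : EuclideanSpace ℝ (Fin N) → ℝ} (hw : ContDiff ℝ 2 w) {s : ℝ}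
    (hs : s ≠ 0) (x : EuclideanSpace ℝ (Fin N)) (i : Fin N) :
    kerAvg (molKer N) (pd i w) (s / 2) x - kerAvg (molKer N) (pd i w) s x =
      -s * kerAvg (pd i (potKer N)) (fun y => -lap w y) s x := by
  have h := integral_pd_mul_lap i contDiff_potKer hasCompactSupport_potKer (contDiff_affine hw s x)
  have e : ∀ z, pd i (fun z => w (x + s • z)) z = s * pd i w (x + s • z) := fun z =>
    pd_affine i s x (hw.differentiable (by norm_num) _)
  simp_rw [e, mul_left_comm _ s, integral_const_mul,
    integral_lap_potKer_mul (continuous_pd i (hw.of_le (by norm_num)))] at h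
  simp_rw [fun z => lap_affine (u := w) (x := z) s x hw.contDiffAt, mul_left_comm _ (s ^ 2),
    integral_const_mul] at h
  have h2 : s * (kerAvg (molKer N) (pd i w) (s / 2) x - kerAvg (molKer N) (pd i w) s x) =
      s * (-s * kerAvg (pd i (potKer N)) (fun y => -lap w y) s x) := by
    simp only [kerAvg, mul_neg, integral_neg] at h ⊢
    linarith
  exact mul_left_cancel₀ hs h2

theorem mul_kerAvg_molKer_pd {w : EuclideanSpace ℝ (Fin N) → ℝ} (hw : ContDiff ℝ 1 w) (s : ℝ)
    (x : EuclideanSpace ℝ (Fin N)) (i : Fin N) :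
    s * kerAvg (molKer N) (pd i w) s x = -kerAvg (pd i (molKer N)) w s x := by
  have h := integral_mul_pd i contDiff_molKer hasCompactSupport_molKer (contDiff_affine hw s x)
  have e : ∀ z, pd i (fun z => w (x + s • z)) z = s * pd i w (x + s • z) := fun z =>
    pd_affine i s x (hw.differentiable (by norm_num) _)
  simp_rw [e, mul_left_comm _ s, integral_const_mul] at h
  exact h

theorem tendsto_kerAvg {F : EuclideanSpace ℝ (Fin N) → ℝ} (hF : Continuous F) (s : ℝ)
    (x : EuclideanSpace ℝ (Fin N)) :
    Tendsto (fun n : ℕ => kerAvg (molKer N) F (s / 2 ^ n) x) atTop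
      (nhds ((∫ z, molKer N z) * F x)) := by
  have hk := (contDiff_molKer (N := N)).continuous
  have hsupp : ∀ t, kerAvg (molKer N) F t x =
      ∫ z in closedBall 0 1, molKer N z * F (x + t • z) := fun t => by
    rw [kerAvg, setIntegral_eq_integral_of_forall_compl_eq_zero]
    intro z hz
    rw [molKer_eq_zero (by simp at hz; exact hz.le), zero_mul]
  have hcont : Continuous fun t => kerAvg (molKer N) F t x := by
    simp_rw [hsupp]
    exact continuous_parametric_integral_of_continuous (by fun_prop) (isCompact_closedBall 0 1)
  have h0 : Tendsto (fun n : ℕ => s / 2 ^ n) atTop (nhds 0) :=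
    tendsto_const_nhds.div_atTop (tendsto_pow_atTop_atTop_of_one_lt (by norm_num))
  have := (hcont.tendsto 0).comp h0
  simpa [kerAvg, integral_mul_const, Function.comp_def] using this

theorem integral_molKer_pos (hN : 3 ≤ N) : 0 < ∫ z, molKer N z := by
  obtain ⟨c, hc, h⟩ := exists_molKer_ge hN
  refine integral_pos_of_integrable_nonneg_nonzero (x := 0) contDiff_molKer.continuous
    (contDiff_molKer.continuous.integrable_of_hasCompactSupport hasCompactSupport_molKer)
    (molKer_nonneg hN) (hc.trans_le (h 0 (by simp)).1).ne'

theorem abs_kerAvg_le {g F : EuclideanSpace ℝ (Fin N) → ℝ} {C : ℝ} (hgC : ∀ z, |g z| ≤ C)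
    (hg0 : ∀ z, 1 < ‖z‖ → g z = 0) {s : ℝ} (hs : 0 < s) {x : EuclideanSpace ℝ (Fin N)}
    (hF : Continuous F) (hF0 : ∀ y ∈ closedBall x s, 0 ≤ F y) :
    s ^ N * |kerAvg g F s x| ≤ C * ∫ y in closedBall x s, F y := by
  have e : kerAvg g F s x = ∫ z in closedBall 0 1, g z * F (x + s • z) := by
    rw [kerAvg, setIntegral_eq_integral_of_forall_compl_eq_zero]
    intro z hz
    rw [hg0 z (by simpa using hz), zero_mul]
  have h := pow_mul_setIntegral_affine F hs 1 x
  rw [mul_one] at h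
  rw [e, ← h, mul_left_comm]
  refine mul_le_mul_of_nonneg_left ?_ (by positivity)
  rw [← integral_const_mul]
  have hi : IntegrableOn (fun z => C * F (x + s • z)) (closedBall 0 1) :=
    ContinuousOn.integrableOn_compact (isCompact_closedBall _ _)
      (Continuous.continuousOn (by fun_prop))
  rw [← Real.norm_eq_abs]
  refine norm_integral_le_of_norm_le hi ?_
  filter_upwards [ae_restrict_mem measurableSet_closedBall] with z hz
  have : 0 ≤ F (x + s • z) := hF0 _ (by
    simp only [mem_closedBall, dist_eq_norm, sub_zero, add_sub_cancel_left, norm_smul,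
      Real.norm_eq_abs, abs_of_pos hs] at hz ⊢
    nlinarith)
  rw [norm_mul, Real.norm_eq_abs, Real.norm_eq_abs, abs_of_nonneg this]
  exact mul_le_mul_of_nonneg_right (hgC z) this

theorem abs_kerAvg_le_of_le {g F : EuclideanSpace ℝ (Fin N) → ℝ} {C M : ℝ} (hgC : ∀ z, |g z| ≤ C)
    (hg0 : ∀ z, 1 < ‖z‖ → g z = 0) {s : ℝ} (hs : 0 < s) {x : EuclideanSpace ℝ (Fin N)}
    (hFM : ∀ y ∈ closedBall x s, |F y| ≤ M) :
    |kerAvg g F s x| ≤ C * M * (volume (closedBall (0 : EuclideanSpace ℝ (Fin N)) 1)).toReal := by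
  have e : kerAvg g F s x = ∫ z in closedBall 0 1, g z * F (x + s • z) := by
    rw [kerAvg, setIntegral_eq_integral_of_forall_compl_eq_zero]
    intro z hz
    rw [hg0 z (by simpa using hz), zero_mul]
  rw [e, ← Real.norm_eq_abs]
  refine norm_setIntegral_le_of_norm_le_const (measure_closedBall_lt_top) fun z hz => ?_
  have : |F (x + s • z)| ≤ M := hFM _ (by
    simp only [mem_closedBall, dist_eq_norm, sub_zero, add_sub_cancel_left, norm_smul,
      Real.norm_eq_abs, abs_of_pos hs] at hz ⊢
    nlinarith)
  rw [norm_mul, Real.norm_eq_abs, Real.norm_eq_abs]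
  exact mul_le_mul (hgC z) this (abs_nonneg _) ((abs_nonneg _).trans (hgC z))

theorem le_kerAvg {g F : EuclideanSpace ℝ (Fin N) → ℝ} {c : ℝ} (hg : Continuous g)
    (hgc : ∀ z, ‖z‖ ≤ 1 / 2 → c ≤ g z) (hgn : ∀ z, 0 ≤ g z)
    (hg0 : ∀ z, 1 < ‖z‖ → g z = 0) {s : ℝ} (hs : 0 < s) {x : EuclideanSpace ℝ (Fin N)}
    (hF : Continuous F) (hF0 : ∀ y ∈ closedBall x s, 0 ≤ F y) :
    c * ∫ y in closedBall x (s / 2), F y ≤ s ^ N * kerAvg g F s x := by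
  have hpos : ∀ z, ‖z‖ ≤ 1 → 0 ≤ F (x + s • z) := fun z hz => hF0 _ (by
    simp only [mem_closedBall, dist_eq_norm, add_sub_cancel_left, norm_smul,
      Real.norm_eq_abs, abs_of_pos hs]
    nlinarith)
  have hnn : ∀ z, 0 ≤ g z * F (x + s • z) := fun z => by
    rcases le_or_gt ‖z‖ 1 with h | h
    · exact mul_nonneg (hgn z) (hpos z h)
    · rw [hg0 z h, zero_mul]
  have hgint : Integrable fun z => g z * F (x + s • z) := by
    refine integrable_kernel_mul hg (HasCompactSupport.intro (isCompact_closedBall 0 1)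
      fun z hz => hg0 z (by simpa using hz)) hF s x
  have h := pow_mul_setIntegral_affine F hs (1 / 2) x
  rw [mul_one_div] at h
  rw [← h, mul_left_comm]
  refine mul_le_mul_of_nonneg_left ?_ (by positivity)
  rw [← integral_const_mul]
  refine le_trans ?_ (setIntegral_le_integral (s := closedBall 0 (1 / 2)) hgint
    (Eventually.of_forall hnn))
  refine setIntegral_mono_on (ContinuousOn.integrableOn_compact (isCompact_closedBall _ _)
      (Continuous.continuousOn (by fun_prop))) hgint.integrableOn
    measurableSet_closedBall fun z hz => ?_
  have hz' : ‖z‖ ≤ 1 / 2 := by simpa using hz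
  exact mul_le_mul_of_nonneg_right (hgc z hz') (hpos z (by linarith))

/-- Summing a geometric bound along dyadic scales. -/
theorem abs_sub_le_of_halving {A : ℝ → ℝ} {L B s : ℝ} (hs : 0 < s)
    (hL : Tendsto (fun n : ℕ => A (s / 2 ^ n)) atTop (nhds L))
    (h : ∀ t, 0 < t → t ≤ s → |A (t / 2) - A t| ≤ t * B) : |L - A s| ≤ 2 * s * B := by
  have hB : 0 ≤ B := by
    have := (abs_nonneg _).trans (h s hs le_rfl)
    exact nonneg_of_mul_nonneg_right this hs
  have key : ∀ n : ℕ, |A (s / 2 ^ n) - A s| ≤ (2 - 2 / 2 ^ n) * s * B := by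
    intro n
    induction n with
    | zero => simp
    | succ n ih =>
      have h1 : s / 2 ^ n ≤ s := div_le_self hs.le (one_le_pow₀ (by norm_num))
      have := h (s / 2 ^ n) (by positivity) h1
      rw [div_div, ← pow_succ] at this
      refine (abs_sub_le _ (A (s / 2 ^ n)) _).trans ((add_le_add this ih).trans (le_of_eq ?_))
      field_simp; ring
  refine le_of_tendsto ((hL.sub_const (A s)).abs) (Eventually.of_forall fun n => (key n).trans ?_)
  have : 0 ≤ 2 / (2 : ℝ) ^ n * s * B := by positivity
  nlinarith

end Averages

section Potential

variable {N : ℕ}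

theorem kerAvg_le_of_halving {w : EuclideanSpace ℝ (Fin N) → ℝ} (hN : 3 ≤ N)
    (hw : ContDiff ℝ 2 w) {s : ℝ} (hs : 0 < s) {x : EuclideanSpace ℝ (Fin N)}
    (hf : ∀ y ∈ closedBall x s, 0 ≤ -lap w y) :
    kerAvg (molKer N) w s x ≤ (∫ z, molKer N z) * w x ∧
    kerAvg (molKer N) w (s / 2) x ≤ (∫ z, molKer N z) * w x := by
  have hmono : Monotone fun n : ℕ => kerAvg (molKer N) w (s / 2 ^ n) x := by
    refine monotone_nat_of_le_succ fun n => ?_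
    have hn : 0 < s / 2 ^ n := by positivity
    have hle : s / 2 ^ n ≤ s := div_le_self hs.le (one_le_pow₀ (by norm_num))
    have h1 := kerAvg_half_sub hw (s / 2 ^ n) x
    rw [div_div, ← pow_succ] at h1
    have : 0 ≤ kerAvg (potKer N) (fun y => -lap w y) (s / 2 ^ n) x := by
      refine integral_nonneg fun z => ?_
      rcases le_or_gt ‖z‖ 1 with h | h
      · refine mul_nonneg (potKer_nonneg hN z) (hf _ ?_)
        simp only [mem_closedBall, dist_eq_norm, add_sub_cancel_left, norm_smul,
          Real.norm_eq_abs, abs_of_pos hn]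
        nlinarith
      · simp [potKer_eq_zero h.le]
    nlinarith [sq_nonneg (s / 2 ^ n)]
  have h := hmono.ge_of_tendsto (tendsto_kerAvg hw.continuous s x)
  exact ⟨by simpa using h 0, by simpa using h 1⟩

/-- Lower bounds for nonnegative superharmonic functions. -/
theorem exists_superharmonic_ge (hN : 3 ≤ N) : ∃ c > 0, ∀ (Ω : Set (EuclideanSpace ℝ (Fin N)))
    (w : EuclideanSpace ℝ (Fin N) → ℝ) (x : EuclideanSpace ℝ (Fin N)) (s : ℝ), IsOpen Ω →
    ContDiffOn ℝ 2 w Ω → 0 < s → closedBall x s ⊆ Ω → (∀ y ∈ closedBall x s, 0 ≤ w y) →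
    (∀ y ∈ closedBall x s, 0 ≤ -lap w y) →
    c * ∫ y in closedBall x (s / 2), w y ≤ s ^ N * w x ∧
    c * s ^ 2 * ∫ y in closedBall x (s / 2), -lap w y ≤ s ^ N * w x := by
  obtain ⟨c, hc, hck⟩ := exists_molKer_ge hN
  have hκ := integral_molKer_pos hN
  refine ⟨c / ∫ z, molKer N z, by positivity, fun Ω w' x s hΩ hw' hs hsub hw0' hf0' => ?_⟩
  obtain ⟨w, hw, hww⟩ := exists_contDiff_eventuallyEq (n := 2) hΩ (isCompact_closedBall x s) hsub hw'
  have e1 : ∀ y ∈ closedBall x s, w y = w' y := fun y hy => (hww y hy).self_of_nhds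
  have e2 : ∀ y ∈ closedBall x s, lap w y = lap w' y := fun y hy => lap_congr (hww y hy)
  have hx : x ∈ closedBall x s := mem_closedBall_self hs.le
  have hsub2 : closedBall x (s / 2) ⊆ closedBall x s := closedBall_subset_closedBall (by linarith)
  rw [← setIntegral_congr_fun measurableSet_closedBall fun y hy => e1 y (hsub2 hy),
    ← setIntegral_congr_fun measurableSet_closedBall fun y hy =>
      (congrArg (fun t => -t) (e2 y (hsub2 hy)) : -lap w y = -lap w' y), ← e1 x hx]
  have hw0 : ∀ y ∈ closedBall x s, 0 ≤ w y := fun y hy => by rw [e1 y hy]; exact hw0' y hy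
  have hf0 : ∀ y ∈ closedBall x s, 0 ≤ -lap w y := fun y hy => by rw [e2 y hy]; exact hf0' y hy
  obtain ⟨h1, h2⟩ := kerAvg_le_of_halving hN hw hs hf0
  have h3 := le_kerAvg contDiff_molKer.continuous (fun z hz => (hck z hz).1) (molKer_nonneg hN)
    (fun z hz => molKer_eq_zero hz.le) hs hw.continuous hw0
  have h4 := le_kerAvg contDiff_potKer.continuous (fun z hz => (hck z hz).2) (potKer_nonneg hN)
    (fun z hz => potKer_eq_zero hz.le) hs (continuous_lap hw).neg hf0
  have h5 := le_kerAvg contDiff_molKer.continuous (fun z _ => molKer_nonneg hN z) (molKer_nonneg hN)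
    (fun z hz => molKer_eq_zero hz.le) hs hw.continuous hw0
  rw [zero_mul] at h5
  have h6 := kerAvg_half_sub hw s x
  have hsN : 0 < s ^ N := by positivity
  constructor
  · rw [div_mul_eq_mul_div, div_le_iff₀ hκ]
    nlinarith
  · rw [div_mul_eq_mul_div, div_mul_eq_mul_div, div_le_iff₀ hκ]
    have h7 : s ^ 2 * (c * ∫ y in closedBall x (s / 2), -lap w y) ≤
        s ^ 2 * (s ^ N * kerAvg (potKer N) (fun y => -lap w y) s x) :=
      mul_le_mul_of_nonneg_left h4 (by positivity)
    have h8 : s ^ N * kerAvg (molKer N) w (s / 2) x ≤ s ^ N * ((∫ z, molKer N z) * w x) :=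
      mul_le_mul_of_nonneg_left h2 hsN.le
    have h9 : s ^ N * kerAvg (molKer N) w (s / 2) x = s ^ N * kerAvg (molKer N) w s x +
      s ^ 2 * (s ^ N * kerAvg (potKer N) (fun y => -lap w y) s x) := by
      rw [eq_add_of_sub_eq h6]; ring
    linarith

/-- The dyadic Riesz-type potential of order `κ` of `G`, cut off at scale `2 ^ (-J)`. -/
noncomputable def dyadicPot (κ : ℝ) (J : ℕ) (G : EuclideanSpace ℝ (Fin N) → ℝ)
    (x : EuclideanSpace ℝ (Fin N)) : ℝ :=
  ∑ j ∈ Finset.range J, ((1 / 2 : ℝ) ^ j) ^ (-κ) * ∫ y in closedBall x ((1 / 2) ^ j), G y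

theorem telescoping_le {A : ℝ → ℝ} {L R : ℝ} {D : ℕ → ℝ} {J : ℕ}
    (h : ∀ j < J, |A ((1 / 2) ^ j / 2) - A ((1 / 2) ^ j)| ≤ D j)
    (hJ : |L - A ((1 / 2) ^ J)| ≤ R) : |L| ≤ |A 1| + ∑ j ∈ Finset.range J, D j + R := by
  have h1 : |A ((1 / 2) ^ J) - A 1| ≤ ∑ j ∈ Finset.range J, D j := by
    have := Finset.sum_range_sub (fun j => A ((1 / 2) ^ j)) J
    simp only [pow_zero] at this
    rw [← this]
    refine (Finset.abs_sum_le_sum_abs _ _).trans (Finset.sum_le_sum fun j hj => ?_)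
    have := h j (Finset.mem_range.mp hj)
    rwa [show (1 / 2 : ℝ) ^ j / 2 = (1 / 2) ^ (j + 1) by ring] at this
  have e : L = A 1 + (A ((1 / 2) ^ J) - A 1) + (L - A ((1 / 2) ^ J)) := by ring
  rw [e]
  exact (abs_add_three _ _ _).trans (by gcongr)

theorem exists_dyadic_le (hN : 3 ≤ N) : ∃ C > 0, ∀ (Ω : Set (EuclideanSpace ℝ (Fin N)))
    (w : EuclideanSpace ℝ (Fin N) → ℝ) (x : EuclideanSpace ℝ (Fin N)) (M : ℝ), IsOpen Ω →
    ContDiffOn ℝ 2 w Ω → closedBall x 1 ⊆ Ω → (∀ y ∈ closedBall x 1, 0 ≤ w y) →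
    (∀ y ∈ closedBall x 1, 0 ≤ -lap w y) → (∀ y ∈ closedBall x 1, -lap w y ≤ M) → ∀ J : ℕ,
    w x ≤ C * ((∫ y in closedBall x 1, w y) + dyadicPot (N - 2) J (fun y => -lap w y) x +
      ((1 / 2) ^ J) ^ 2 * M) ∧
    ∀ i, |pd i w x| ≤ C * ((∫ y in closedBall x 1, w y) + dyadicPot (N - 1) J (fun y => -lap w y) x +
      (1 / 2) ^ J * M) := by
  obtain ⟨C, hC, hCk⟩ := exists_kernel_le (N := N)
  have hκ := integral_molKer_pos hN
  set κ := ∫ z, molKer N z with hκd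
  set vol := (volume (closedBall (0 : EuclideanSpace ℝ (Fin N)) 1)).toReal with hvol
  have hv0 : 0 ≤ vol := ENNReal.toReal_nonneg
  refine ⟨C * (1 + 2 * vol) / κ, by positivity, fun Ω w' x M hΩ hw' hsub hw0' hf0' hfM' J => ?_⟩
  obtain ⟨w, hw, hww⟩ := exists_contDiff_eventuallyEq (n := 2) hΩ (isCompact_closedBall x 1) hsub hw'
  have e1 : ∀ y ∈ closedBall x 1, w y = w' y := fun y hy => (hww y hy).self_of_nhds
  have e2 : ∀ y ∈ closedBall x 1, lap w y = lap w' y := fun y hy => lap_congr (hww y hy)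
  have hx : x ∈ closedBall x 1 := mem_closedBall_self zero_le_one
  have hs1 : ∀ j : ℕ, (1 / 2 : ℝ) ^ j ≤ 1 := fun j => pow_le_one₀ (by norm_num) (by norm_num)
  have hs0 : ∀ j : ℕ, 0 < (1 / 2 : ℝ) ^ j := fun j => by positivity
  have hsb : ∀ s : ℝ, s ≤ 1 → closedBall x s ⊆ closedBall x 1 := fun s hs =>
    closedBall_subset_closedBall hs
  have ed : ∀ k, dyadicPot k J (fun y => -lap w' y) x = dyadicPot k J (fun y => -lap w y) x :=
    fun k => Finset.sum_congr rfl fun j _ => by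
      rw [setIntegral_congr_fun measurableSet_closedBall fun y hy =>
        (congrArg (fun t => -t) (e2 y (hsb _ (hs1 j) hy)) : -lap w y = -lap w' y)]
  have ei : ∫ y in closedBall x 1, w' y = ∫ y in closedBall x 1, w y :=
    (setIntegral_congr_fun measurableSet_closedBall e1).symm
  have ep : ∀ i, pd i w' x = pd i w x := fun i => (pd_congr i (hww x hx)).symm
  rw [ed, ed, ei, ← e1 x hx]
  simp only [ep]
  have hw0 : ∀ y ∈ closedBall x 1, 0 ≤ w y := fun y hy => by rw [e1 y hy]; exact hw0' y hy
  have hf0 : ∀ y ∈ closedBall x 1, 0 ≤ -lap w y := fun y hy => by rw [e2 y hy]; exact hf0' y hy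
  have hfM : ∀ y ∈ closedBall x 1, |-lap w y| ≤ M := fun y hy => by
    rw [abs_of_nonneg (hf0 y hy), e2 y hy]; exact hfM' y hy
  have hM : 0 ≤ M := (abs_nonneg _).trans (hfM x hx)
  have hfc : Continuous fun y => -lap w y := (continuous_lap hw).neg
  have z1 : ∀ z : EuclideanSpace ℝ (Fin N), 1 < ‖z‖ → molKer N z = 0 := fun z hz =>
    molKer_eq_zero hz.le
  have z2 : ∀ z : EuclideanSpace ℝ (Fin N), 1 < ‖z‖ → potKer N z = 0 := fun z hz =>
    potKer_eq_zero hz.le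
  have z3 : ∀ i, ∀ z : EuclideanSpace ℝ (Fin N), 1 < ‖z‖ → pd i (molKer N) z = 0 := fun i =>
    pd_eq_zero_of_norm i fun z hz => molKer_eq_zero hz
  have z4 : ∀ i, ∀ z : EuclideanSpace ℝ (Fin N), 1 < ‖z‖ → pd i (potKer N) z = 0 := fun i =>
    pd_eq_zero_of_norm i fun z hz => potKer_eq_zero hz
  have hI : 0 ≤ ∫ y in closedBall x 1, w y := setIntegral_nonneg measurableSet_closedBall hw0
  have hD : ∀ k, 0 ≤ dyadicPot k J (fun y => -lap w y) x := fun k =>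
    Finset.sum_nonneg fun j _ => mul_nonneg (Real.rpow_nonneg (hs0 j).le _)
      (setIntegral_nonneg measurableSet_closedBall fun y hy => hf0 y (hsb _ (hs1 j) hy))
  have fin : ∀ {t I D R : ℝ}, 0 ≤ I → 0 ≤ D → 0 ≤ R → |κ * t| ≤ C * I + C * D + 2 * vol * C * R →
      |t| ≤ C * (1 + 2 * vol) / κ * (I + D + R) := by
    intro t I D R hI hD hR h
    rw [abs_mul, abs_of_pos hκ] at h
    rw [div_mul_eq_mul_div, le_div_iff₀ hκ]
    have a1 : 0 ≤ C * R := by positivity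
    have a2 : 0 ≤ C * (2 * vol) * (I + D) := by positivity
    nlinarith
  constructor
  · refine (le_abs_self _).trans (fin hI (hD _) (by positivity) ?_)
    have := telescoping_le (A := fun s => kerAvg (molKer N) w s x) (L := κ * w x)
      (R := 2 * vol * C * (((1 / 2) ^ J) ^ 2 * M))
      (D := fun j => C * (((1 / 2 : ℝ) ^ j) ^ (-((N : ℝ) - 2)) *
        ∫ y in closedBall x ((1 / 2) ^ j), -lap w y)) (J := J) ?_ ?_
    · rw [← Finset.mul_sum] at this
      refine this.trans ?_
      have h1 := abs_kerAvg_le (fun z => (hCk z).1) z1 one_pos hw.continuous hw0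
      rw [one_pow, one_mul] at h1
      unfold dyadicPot
      linarith
    · intro j _
      set s := (1 / 2 : ℝ) ^ j
      have hs : 0 < s := hs0 j
      rw [kerAvg_half_sub hw]
      have h2 := abs_kerAvg_le (fun z => (hCk z).2.1) z2 hs hfc fun y hy => hf0 y (hsb _ (hs1 j) hy)
      have e : s ^ (-((N : ℝ) - 2)) = s ^ 2 / s ^ N := by
        rw [neg_sub, Real.rpow_sub hs, Real.rpow_natCast, Real.rpow_two]
      rw [e, abs_mul, abs_of_nonneg (sq_nonneg s), div_mul_eq_mul_div, mul_div_assoc',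
        le_div_iff₀ (by positivity)]
      nlinarith [sq_nonneg s, mul_le_mul_of_nonneg_left h2 (sq_nonneg s)]
    · have h := abs_sub_le_of_halving (A := fun s => kerAvg (molKer N) w s x)
        (B := (1 / 2) ^ J * (C * M * vol)) (hs0 J) (tendsto_kerAvg hw.continuous _ x) ?_
      · refine h.trans (le_of_eq ?_); ring
      · intro t ht htJ
        rw [kerAvg_half_sub hw, abs_mul, abs_of_nonneg (sq_nonneg t)]
        have h2 := abs_kerAvg_le_of_le (fun z => (hCk z).2.1) z2 ht (x := x)
          fun y hy => hfM y (hsb _ (htJ.trans (hs1 J)) hy)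
        have : 0 ≤ C * M * vol := by positivity
        calc t ^ 2 * |kerAvg (potKer N) (fun y => -lap w y) t x| ≤ t ^ 2 * (C * M * vol) := by gcongr
          _ = t * (t * (C * M * vol)) := by ring
          _ ≤ _ := by gcongr
  · intro i
    have hpc : Continuous (pd i w) := continuous_pd i (hw.of_le (by norm_num))
    refine fin hI (hD _) (by positivity) ?_
    have := telescoping_le (A := fun s => kerAvg (molKer N) (pd i w) s x) (L := κ * pd i w x)
      (R := 2 * vol * C * ((1 / 2) ^ J * M))
      (D := fun j => C * (((1 / 2 : ℝ) ^ j) ^ (-((N : ℝ) - 1)) *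
        ∫ y in closedBall x ((1 / 2) ^ j), -lap w y)) (J := J) ?_ ?_
    · rw [← Finset.mul_sum] at this
      refine this.trans ?_
      have h1 := abs_kerAvg_le (fun z => ((hCk z).2.2 i).1) (z3 i) one_pos hw.continuous hw0
      have h2 := mul_kerAvg_molKer_pd (hw.of_le (by norm_num)) 1 x i
      rw [one_mul] at h2
      rw [one_pow, one_mul, ← abs_neg, ← h2] at h1
      unfold dyadicPot
      linarith
    · intro j _
      set s := (1 / 2 : ℝ) ^ j
      have hs : 0 < s := hs0 j
      rw [kerAvg_pd_half_sub hw hs.ne']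
      have h2 := abs_kerAvg_le (fun z => ((hCk z).2.2 i).2) (z4 i) hs hfc
        fun y hy => hf0 y (hsb _ (hs1 j) hy)
      have e : s ^ (-((N : ℝ) - 1)) = s / s ^ N := by
        rw [neg_sub, Real.rpow_sub hs, Real.rpow_natCast, Real.rpow_one]
      rw [e, abs_mul, abs_neg, abs_of_pos hs, div_mul_eq_mul_div, mul_div_assoc',
        le_div_iff₀ (by positivity)]
      nlinarith [mul_le_mul_of_nonneg_left h2 hs.le]
    · have h := abs_sub_le_of_halving (A := fun s => kerAvg (molKer N) (pd i w) s x)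
        (B := C * M * vol) (hs0 J) (tendsto_kerAvg hpc _ x) ?_
      · refine h.trans (le_of_eq ?_); ring
      · intro t ht htJ
        rw [kerAvg_pd_half_sub hw ht.ne', abs_mul, abs_neg, abs_of_pos ht]
        have h2 := abs_kerAvg_le_of_le (fun z => ((hCk z).2.2 i).2) (z4 i) ht (x := x)
          fun y hy => hfM y (hsb _ (htJ.trans (hs1 J)) hy)
        gcongr

/-- Interior gradient estimate. -/
theorem exists_abs_pd_le (hN : 3 ≤ N) : ∃ C > 0, ∀ (Ω : Set (EuclideanSpace ℝ (Fin N)))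
    (w : EuclideanSpace ℝ (Fin N) → ℝ) (x : EuclideanSpace ℝ (Fin N)) (s A M : ℝ), IsOpen Ω →
    ContDiffOn ℝ 2 w Ω → 0 < s → closedBall x s ⊆ Ω → (∀ y ∈ closedBall x s, |w y| ≤ A) →
    (∀ y ∈ closedBall x s, |lap w y| ≤ M) → ∀ i, |pd i w x| ≤ C * (A / s + s * M) := by
  obtain ⟨C, hC, hCk⟩ := exists_kernel_le (N := N)
  have hκ := integral_molKer_pos hN
  set κ := ∫ z, molKer N z with hκd
  set vol := (volume (closedBall (0 : EuclideanSpace ℝ (Fin N)) 1)).toReal with hvol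
  have hv0 : 0 ≤ vol := ENNReal.toReal_nonneg
  refine ⟨2 * C * (1 + vol) / κ, by positivity, fun Ω w' x s A M hΩ hw' hs hsub hA' hM' i => ?_⟩
  obtain ⟨w, hw, hww⟩ := exists_contDiff_eventuallyEq (n := 2) hΩ (isCompact_closedBall x s) hsub hw'
  have e1 : ∀ y ∈ closedBall x s, w y = w' y := fun y hy => (hww y hy).self_of_nhds
  have e2 : ∀ y ∈ closedBall x s, lap w y = lap w' y := fun y hy => lap_congr (hww y hy)
  have hx : x ∈ closedBall x s := mem_closedBall_self hs.le
  rw [← pd_congr i (hww x hx)]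
  have hA : ∀ y ∈ closedBall x s, |w y| ≤ A := fun y hy => by rw [e1 y hy]; exact hA' y hy
  have hM : ∀ y ∈ closedBall x s, |-lap w y| ≤ M := fun y hy => by
    rw [abs_neg, e2 y hy]; exact hM' y hy
  have hA0 : 0 ≤ A := (abs_nonneg _).trans (hA x hx)
  have hM0 : 0 ≤ M := (abs_nonneg _).trans (hM x hx)
  have hpc : Continuous (pd i w) := continuous_pd i (hw.of_le (by norm_num))
  have h := abs_sub_le_of_halving (A := fun s => kerAvg (molKer N) (pd i w) s x)
    (B := C * M * vol) hs (tendsto_kerAvg hpc _ x) ?_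
  · have h1 := abs_kerAvg_le_of_le (fun z => ((hCk z).2.2 i).1)
      (pd_eq_zero_of_norm i fun z hz => molKer_eq_zero hz) hs hA
    have h2 := mul_kerAvg_molKer_pd (hw.of_le (by norm_num)) s x i
    have h3 : |kerAvg (molKer N) (pd i w) s x| ≤ C * A * vol / s := by
      rw [le_div_iff₀ hs, mul_comm, ← abs_of_pos hs, ← abs_mul, abs_of_pos hs, h2, abs_neg]
      exact h1
    have h4 : |κ * pd i w x| ≤ C * A * vol / s + 2 * s * (C * M * vol) := by
      have := abs_sub_abs_le_abs_sub (κ * pd i w x) (kerAvg (molKer N) (pd i w) s x)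
      linarith
    rw [abs_mul, abs_of_pos hκ] at h4
    rw [div_mul_eq_mul_div, le_div_iff₀ hκ, mul_comm]
    refine h4.trans ?_
    have p1 : 0 ≤ C * A / s := by positivity
    have p2 : 0 ≤ C * s * M := by positivity
    have e : C * A * vol / s = C * A / s * vol := by ring
    rw [e, mul_add]
    have e' : 2 * C * (1 + vol) * (A / s) = 2 * (1 + vol) * (C * A / s) := by ring
    rw [e']
    nlinarith [mul_nonneg p1 hv0, mul_nonneg p2 hv0]
  · intro t ht htJ
    rw [kerAvg_pd_half_sub hw ht.ne', abs_mul, abs_neg, abs_of_pos ht]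
    have h2 := abs_kerAvg_le_of_le (fun z => ((hCk z).2.2 i).2)
      (pd_eq_zero_of_norm i fun z hz => potKer_eq_zero hz) ht (x := x)
      fun y hy => hM y (closedBall_subset_closedBall htJ hy)
    gcongr

end Potential

section Pohozaev

variable {N : ℕ}

/-- The `i`-th component of the Pohozaev vector field. -/
noncomputable def pohField (θ₁ θ₂ : ℝ) (u v Φ : EuclideanSpace ℝ (Fin N) → ℝ) (i : Fin N)
    (x : EuclideanSpace ℝ (Fin N)) : ℝ :=
  (∑ j, x j * pd j u x) * pd i v x + (∑ j, x j * pd j v x) * pd i u x -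
    x i * ∑ j, pd j u x * pd j v x + x i * Φ x + θ₁ * (v x * pd i u x) + θ₂ * (u x * pd i v x)

theorem contDiff_coord {n : WithTop ℕ∞} (j : Fin N) :
    ContDiff ℝ n fun x : EuclideanSpace ℝ (Fin N) => x j := by fun_prop

theorem contDiff_pohField {θ₁ θ₂ : ℝ} {u v Φ : EuclideanSpace ℝ (Fin N) → ℝ}
    (hu : ContDiff ℝ 2 u) (hv : ContDiff ℝ 2 v) (hΦ : ContDiff ℝ 1 Φ) (i : Fin N) :
    ContDiff ℝ 1 (pohField θ₁ θ₂ u v Φ i) := by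
  have h1 := fun j => contDiff_pd_one j hu
  have h2 := fun j => contDiff_pd_one j hv
  have h3 : ContDiff ℝ 1 u := hu.of_le (by norm_num)
  have h4 : ContDiff ℝ 1 v := hv.of_le (by norm_num)
  have h5 := h1 i
  have h6 := h2 i
  unfold pohField
  have h7 := contDiff_coord (N := N) (n := 1)
  exact (((((ContDiff.sum fun j _ => (h7 j).mul (h1 j)).mul h6).add
    ((ContDiff.sum fun j _ => (h7 j).mul (h2 j)).mul h5)).sub
    ((h7 i).mul (ContDiff.sum fun j _ => (h1 j).mul (h2 j)))).add ((h7 i).mul hΦ)).add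
    (contDiff_const.mul (h4.mul h5)) |>.add (contDiff_const.mul (h3.mul h6))

theorem pd_sub (i : Fin N) {u v : EuclideanSpace ℝ (Fin N) → ℝ} {x : EuclideanSpace ℝ (Fin N)}
    (hu : DifferentiableAt ℝ u x) (hv : DifferentiableAt ℝ v x) :
    pd i (fun y => u y - v y) x = pd i u x - pd i v x := by
  simp [pd, fderiv_fun_sub hu hv]

theorem pd_const_mul (i : Fin N) (c : ℝ) {u : EuclideanSpace ℝ (Fin N) → ℝ}
    {x : EuclideanSpace ℝ (Fin N)} (hu : DifferentiableAt ℝ u x) :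
    pd i (fun y => c * u y) x = c * pd i u x := by
  simp [pd, fderiv_const_mul hu]

theorem pd_pohField {θ₁ θ₂ : ℝ} {u v Φ : EuclideanSpace ℝ (Fin N) → ℝ}
    (hu : ContDiff ℝ 2 u) (hv : ContDiff ℝ 2 v) (hΦ : ContDiff ℝ 1 Φ) (i : Fin N)
    (x : EuclideanSpace ℝ (Fin N)) :
    pd i (pohField θ₁ θ₂ u v Φ i) x =
      (pd i u x * pd i v x + (∑ j, x j * pd i (pd j u) x) * pd i v x +
        (∑ j, x j * pd j u x) * pd i (pd i v) x) +
      (pd i v x * pd i u x + (∑ j, x j * pd i (pd j v) x) * pd i u x +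
        (∑ j, x j * pd j v x) * pd i (pd i u) x) -
      ((∑ j, pd j u x * pd j v x) +
        x i * ∑ j, (pd i (pd j u) x * pd j v x + pd j u x * pd i (pd j v) x)) +
      (Φ x + x i * pd i Φ x) + θ₁ * (pd i v x * pd i u x + v x * pd i (pd i u) x) +
      θ₂ * (pd i u x * pd i v x + u x * pd i (pd i v) x) := by
  have d1 := fun j => (contDiff_pd_one j hu).differentiable (by norm_num) x
  have d2 := fun j => (contDiff_pd_one j hv).differentiable (by norm_num) x
  have d3 := hu.differentiable (by norm_num) x
  have d4 := hv.differentiable (by norm_num) x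
  have d5 := hΦ.differentiable (by norm_num) x
  have d6 : ∀ j : Fin N, DifferentiableAt ℝ (fun x : EuclideanSpace ℝ (Fin N) => x j) x :=
    fun j => (contDiff_coord (n := 1) j).differentiable (by norm_num) x
  have s : ∀ w : EuclideanSpace ℝ (Fin N) → ℝ, (∀ j, DifferentiableAt ℝ (pd j w) x) →
      DifferentiableAt ℝ (fun x => ∑ j, x j * pd j w x) x ∧
      pd i (fun x => ∑ j, x j * pd j w x) x = pd i w x + ∑ j, x j * pd i (pd j w) x := by
    intro w hw
    refine ⟨DifferentiableAt.fun_sum fun j _ => (d6 j).fun_mul (hw j), ?_⟩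
    rw [pd_sum i _ fun j _ => (d6 j).fun_mul (hw j)]
    simp_rw [fun j => pd_mul i (d6 j) (hw j), pd_coord]
    rw [Finset.sum_add_distrib, add_comm]
    simp
  obtain ⟨su, su'⟩ := s u d1
  obtain ⟨sv, sv'⟩ := s v d2
  have sw : DifferentiableAt ℝ (fun x => ∑ j, pd j u x * pd j v x) x :=
    DifferentiableAt.fun_sum fun j _ => (d1 j).mul (d2 j)
  have sw' : pd i (fun x => ∑ j, pd j u x * pd j v x) x =
      ∑ j, (pd i (pd j u) x * pd j v x + pd j u x * pd i (pd j v) x) := by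
    rw [pd_sum i _ fun j _ => (d1 j).fun_mul (d2 j)]
    refine Finset.sum_congr rfl fun j _ => ?_
    rw [pd_mul i (d1 j) (d2 j)]; ring
  have a1 := su.fun_mul (d2 i)
  have a2 := sv.fun_mul (d1 i)
  have a3 := (d6 i).fun_mul sw
  have a4 := (d6 i).fun_mul d5
  have a5 := d4.fun_mul (d1 i)
  have a6 := d3.fun_mul (d2 i)
  have b1 := a1.fun_add a2
  have b2 := b1.fun_sub a3
  have b3 := b2.fun_add a4
  have a5' := a5.const_mul θ₁
  have a6' := a6.const_mul θ₂
  unfold pohField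
  rw [pd_add i (b3.fun_add a5') a6', pd_add i b3 a5', pd_add i b2 a4, pd_sub i b1 a3,
    pd_add i a1 a2, pd_const_mul i _ a5, pd_const_mul i _ a6, pd_mul i su (d2 i),
    pd_mul i sv (d1 i), pd_mul i (d6 i) sw,
    pd_mul i (d6 i) d5, pd_mul i d4 (d1 i), pd_mul i d3 (d2 i), su', sv', sw', pd_coord, if_pos rfl]
  ring

theorem sum_pd_pohField {θ₁ θ₂ : ℝ} {u v Φ : EuclideanSpace ℝ (Fin N) → ℝ}
    (hu : ContDiff ℝ 2 u) (hv : ContDiff ℝ 2 v) (hΦ : ContDiff ℝ 1 Φ)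
    (x : EuclideanSpace ℝ (Fin N)) :
    ∑ i, pd i (pohField θ₁ θ₂ u v Φ i) x =
      (∑ j, x j * pd j u x) * lap v x + (∑ j, x j * pd j v x) * lap u x +
      (2 - N + θ₁ + θ₂) * (∑ j, pd j u x * pd j v x) + N * Φ x + (∑ j, x j * pd j Φ x) +
      θ₁ * (v x * lap u x) + θ₂ * (u x * lap v x) := by
  have hsw : ∑ i, x i * ∑ j, (pd i (pd j u) x * pd j v x + pd j u x * pd i (pd j v) x) =
      ∑ i, (∑ j, x j * pd i (pd j u) x) * pd i v x + ∑ i, (∑ j, x j * pd i (pd j v) x) * pd i u x := by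
    simp_rw [Finset.mul_sum, Finset.sum_mul]
    rw [Finset.sum_comm, ← Finset.sum_add_distrib]
    refine Finset.sum_congr rfl fun i _ => ?_
    rw [← Finset.sum_add_distrib]
    refine Finset.sum_congr rfl fun j _ => ?_
    rw [pd_comm j i hu.contDiffAt, pd_comm j i hv.contDiffAt]; ring
  simp_rw [pd_pohField hu hv hΦ, lap_eq_sum_pd hu.contDiffAt, lap_eq_sum_pd hv.contDiffAt]
  simp only [Finset.sum_add_distrib, Finset.sum_sub_distrib, ← Finset.mul_sum, Finset.sum_const,
    Finset.card_univ, Fintype.card_fin, nsmul_eq_mul, mul_add] at hsw ⊢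
  have hc : ∑ i, pd i v x * pd i u x = ∑ i, pd i u x * pd i v x :=
    Finset.sum_congr rfl fun i _ => mul_comm _ _
  rw [hc]
  linear_combination -hsw

theorem pohField_congr {θ₁ θ₂ : ℝ} {u v Φ u' v' Φ' : EuclideanSpace ℝ (Fin N) → ℝ}
    {x : EuclideanSpace ℝ (Fin N)} (hu : u =ᶠ[nhds x] u') (hv : v =ᶠ[nhds x] v')
    (hΦ : Φ =ᶠ[nhds x] Φ') (i : Fin N) :
    pohField θ₁ θ₂ u v Φ i x = pohField θ₁ θ₂ u' v' Φ' i x := by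
  simp only [pohField, hu.eq_of_nhds, hv.eq_of_nhds, hΦ.eq_of_nhds, pd_congr _ hu, pd_congr _ hv]

theorem integral_mul_sum_pohField {Ω K : Set (EuclideanSpace ℝ (Fin N))} (hΩ : IsOpen Ω)
    (hK : IsCompact K) (hKΩ : K ⊆ Ω) {θ₁ θ₂ : ℝ} {u v Φ φ : EuclideanSpace ℝ (Fin N) → ℝ}
    (hu : ContDiffOn ℝ 2 u Ω) (hv : ContDiffOn ℝ 2 v Ω) (hΦ : ContDiffOn ℝ 1 Φ Ω)
    (hφ : ContDiff ℝ 1 φ) (hφK : ∀ x, x ∉ K → φ x = 0) {F : EuclideanSpace ℝ (Fin N) → ℝ}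
    (hF : ∀ x ∈ K, F x = (∑ j, x j * pd j u x) * lap v x + (∑ j, x j * pd j v x) * lap u x +
      (2 - N + θ₁ + θ₂) * (∑ j, pd j u x * pd j v x) + N * Φ x + (∑ j, x j * pd j Φ x) +
      θ₁ * (v x * lap u x) + θ₂ * (u x * lap v x)) :
    ∫ x, φ x * F x = -∫ x, ∑ i, pd i φ x * pohField θ₁ θ₂ u v Φ i x := by
  obtain ⟨u', hu', hue⟩ := exists_contDiff_eventuallyEq (n := 2) hΩ hK hKΩ hu
  obtain ⟨v', hv', hve⟩ := exists_contDiff_eventuallyEq (n := 2) hΩ hK hKΩ hv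
  obtain ⟨Φ', hΦ', hΦe⟩ := exists_contDiff_eventuallyEq (n := 1) hΩ hK hKΩ hΦ
  norm_cast at hu' hv' hΦ'
  have hcs : HasCompactSupport φ := HasCompactSupport.intro hK hφK
  have hcp : ∀ i x, x ∉ K → pd i φ x = 0 := by
    intro i x hx
    have : φ =ᶠ[nhds x] fun _ => 0 := by
      filter_upwards [hK.isClosed.isOpen_compl.mem_nhds hx] with y hy using hφK y hy
    rw [pd_congr i this]
    simp [pd]
  have hP := fun i => contDiff_pohField (θ₁ := θ₁) (θ₂ := θ₂) hu' hv' hΦ' i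
  have e1 : ∀ x, φ x * F x = ∑ i, φ x * pd i (pohField θ₁ θ₂ u' v' Φ' i) x := by
    intro x
    by_cases hx : x ∈ K
    · rw [← Finset.mul_sum, sum_pd_pohField hu' hv' hΦ', hF x hx]
      simp only [(hue x hx).eq_of_nhds, (hve x hx).eq_of_nhds, (hΦe x hx).eq_of_nhds,
        pd_congr _ (hue x hx), pd_congr _ (hve x hx), pd_congr _ (hΦe x hx),
        lap_congr (hue x hx), lap_congr (hve x hx)]
    · simp [hφK x hx]
  have e2 : ∀ x, ∑ i, pd i φ x * pohField θ₁ θ₂ u v Φ i x =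
      ∑ i, pd i φ x * pohField θ₁ θ₂ u' v' Φ' i x := by
    intro x
    refine Finset.sum_congr rfl fun i _ => ?_
    by_cases hx : x ∈ K
    · rw [pohField_congr (hue x hx) (hve x hx) (hΦe x hx)]
    · simp [hcp i x hx]
  have i1 : ∀ i, Integrable fun x => φ x * pd i (pohField θ₁ θ₂ u' v' Φ' i) x := fun i =>
    (hφ.continuous.mul (continuous_pd i (hP i))).integrable_of_hasCompactSupport hcs.mul_right
  have i2 : ∀ i, Integrable fun x => pd i φ x * pohField θ₁ θ₂ u' v' Φ' i x := fun i =>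
    ((continuous_pd i hφ).mul (hP i).continuous).integrable_of_hasCompactSupport
      (hasCompactSupport_pd i hcs).mul_right
  simp_rw [e1, e2]
  rw [integral_finsetSum _ fun i _ => i1 i, integral_finsetSum _ fun i _ => i2 i,
    ← Finset.sum_neg_distrib]
  exact Finset.sum_congr rfl fun i _ => integral_mul_pd i hφ hcs (hP i)

/-- The Pohozaev identity for the system `-Δu = c v^p`, `-Δv = d u^q`. -/
theorem integral_pohozaev {Ω K : Set (EuclideanSpace ℝ (Fin N))} (hΩ : IsOpen Ω)
    (hK : IsCompact K) (hKΩ : K ⊆ Ω) {θ₁ θ₂ p q : ℝ} (hp : 0 < p) (hq : 0 < q)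
    (hθ : θ₁ + θ₂ = N - 2) {u v c d φ : EuclideanSpace ℝ (Fin N) → ℝ}
    (hu : ContDiffOn ℝ 2 u Ω) (hv : ContDiffOn ℝ 2 v Ω) (hc : ContDiffOn ℝ 1 c Ω)
    (hd : ContDiffOn ℝ 1 d Ω) (hu0 : ∀ x ∈ Ω, 0 < u x) (hv0 : ∀ x ∈ Ω, 0 < v x)
    (hlu : ∀ x ∈ Ω, -lap u x = c x * v x ^ p) (hlv : ∀ x ∈ Ω, -lap v x = d x * u x ^ q)
    (hφ : ContDiff ℝ 1 φ) (hφK : ∀ x, x ∉ K → φ x = 0) :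
    ∫ x, φ x * (((N * c x + ∑ j, x j * pd j c x) / (p + 1) - θ₁ * c x) * v x ^ (p + 1) +
        ((N * d x + ∑ j, x j * pd j d x) / (q + 1) - θ₂ * d x) * u x ^ (q + 1)) =
      -∫ x, ∑ i, pd i φ x * pohField θ₁ θ₂ u v
        (fun y => c y * v y ^ (p + 1) / (p + 1) + d y * u y ^ (q + 1) / (q + 1)) i x := by
  have hpw : ∀ (r : ℝ) (w : EuclideanSpace ℝ (Fin N) → ℝ), ContDiffOn ℝ 2 w Ω →
      (∀ x ∈ Ω, 0 < w x) → ContDiffOn ℝ 1 (fun y => w y ^ r) Ω := fun r w hw h0 =>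
    (hw.of_le (by norm_num)).rpow_const_of_ne fun x hx => (h0 x hx).ne'
  refine integral_mul_sum_pohField hΩ hK hKΩ hu hv
    (((hc.mul (hpw (p + 1) v hv hv0)).div_const _).add
      ((hd.mul (hpw (q + 1) u hu hu0)).div_const _)) hφ hφK fun x hx => ?_
  have hxΩ := hKΩ hx
  have hn := hΩ.mem_nhds hxΩ
  have key : ∀ (r : ℝ) (c w : EuclideanSpace ℝ (Fin N) → ℝ), 0 < r → ContDiffOn ℝ 1 c Ω →
      ContDiffOn ℝ 2 w Ω → (∀ x ∈ Ω, 0 < w x) →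
      DifferentiableAt ℝ (fun y => c y * w y ^ (r + 1) / (r + 1)) x ∧
      ∑ j, x j * pd j (fun y => c y * w y ^ (r + 1) / (r + 1)) x =
        (∑ j, x j * pd j c x) * w x ^ (r + 1) / (r + 1) +
          (∑ j, x j * pd j w x) * (c x * w x ^ r) := by
    intro r c w hr hc hw h0
    have dc : DifferentiableAt ℝ c x := (hc.contDiffAt hn).differentiableAt (by norm_num)
    have dw : DifferentiableAt ℝ w x := (hw.contDiffAt hn).differentiableAt (by norm_num)
    have hD : HasFDerivAt (fun y => c y * w y ^ (r + 1) / (r + 1))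
        ((r + 1)⁻¹ • (c x • (((r + 1) * w x ^ (r + 1 - 1)) • fderiv ℝ w x) +
          w x ^ (r + 1) • fderiv ℝ c x)) x := by
      have := (dc.hasFDerivAt.mul (dw.hasFDerivAt.rpow_const (p := r + 1)
        (Or.inl (h0 x hxΩ).ne'))).mul_const (r + 1)⁻¹
      simpa only [div_eq_mul_inv, Pi.mul_apply] using this
    refine ⟨hD.differentiableAt, ?_⟩
    rw [Finset.sum_mul, Finset.sum_mul, Finset.sum_div, ← Finset.sum_add_distrib]
    refine Finset.sum_congr rfl fun j _ => ?_
    simp only [pd, hD.fderiv, add_apply, smul_apply,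
      smul_eq_mul, add_sub_cancel_right]
    field_simp
    ring
  obtain ⟨d1, s1⟩ := key p c v hp hc hv hv0
  obtain ⟨d2, s2⟩ := key q d u hq hd hu hu0
  simp_rw [pd_add _ d1 d2, mul_add, Finset.sum_add_distrib, s1, s2]
  have hu' : lap u x = -(c x * v x ^ p) := by linarith [hlu x hxΩ]
  have hv' : lap v x = -(d x * u x ^ q) := by linarith [hlv x hxΩ]
  rw [hu', hv', Real.rpow_add_one (hv0 x hxΩ).ne', Real.rpow_add_one (hu0 x hxΩ).ne']
  have : (2 - N + θ₁ + θ₂ : ℝ) = 0 := by linarith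
  rw [this]
  ring

end Pohozaev

section Slab

variable {N : ℕ}

/-- The points having some coordinate within `r` of `±t`. -/
def slab (t r : ℝ) : Set (EuclideanSpace ℝ (Fin N)) := {x | ∃ i, |(|x i| - t)| ≤ r}

theorem measurableSet_slab_prod (r : ℝ) :
    MeasurableSet {z : ℝ × EuclideanSpace ℝ (Fin N) | z.2 ∈ slab z.1 r} := by
  have : {z : ℝ × EuclideanSpace ℝ (Fin N) | z.2 ∈ slab z.1 r} =
      ⋃ i, {z | |(|z.2 i| - z.1)| ≤ r} := by ext; simp [slab]
  rw [this]
  refine MeasurableSet.iUnion fun i => IsClosed.measurableSet ?_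
  exact isClosed_le (by fun_prop) (by fun_prop)

theorem measurableSet_slab (t r : ℝ) :
    MeasurableSet (slab t r : Set (EuclideanSpace ℝ (Fin N))) :=
  (measurable_prodMk_left (x := t)) (measurableSet_slab_prod r)

theorem volume_setOf_mem_slab_le (x : EuclideanSpace ℝ (Fin N)) (r : ℝ) :
    volume {t : ℝ | x ∈ slab t r} ≤ ENNReal.ofReal (2 * N * r) := by
  have : {t : ℝ | x ∈ slab t r} ⊆ ⋃ i, Icc (|x i| - r) (|x i| + r) := by
    intro t ⟨i, hi⟩
    rw [abs_le] at hi
    exact mem_iUnion.2 ⟨i, by constructor <;> linarith⟩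
  refine (measure_mono this).trans ((measure_iUnion_fintype_le _ _).trans ?_)
  have h : ∀ i, volume (Icc (|x i| - r) (|x i| + r)) = ENNReal.ofReal (2 * r) := fun i => by
    rw [Real.volume_Icc]; congr 1; ring
  simp_rw [h]
  rw [Finset.sum_const, Finset.card_univ, Fintype.card_fin, nsmul_eq_mul]
  rw [← ENNReal.ofReal_natCast, ← ENNReal.ofReal_mul (by positivity)]
  exact ENNReal.ofReal_le_ofReal (by linarith)

theorem volume_slab_inter_closedBall_le (t : ℝ) {δ s : ℝ} (hδ : 0 ≤ δ) (hs : 0 ≤ s)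
    (y : EuclideanSpace ℝ (Fin N)) :
    volume (slab t δ ∩ closedBall y s) ≤ ENNReal.ofReal (N * 2 ^ (N + 1) * δ * s ^ (N - 1)) := by
  let P : ℝ → Fin N → Set (EuclideanSpace ℝ (Fin N)) := fun τ i =>
    (MeasurableEquiv.toLp 2 (Fin N → ℝ)).symm ⁻¹'
      (univ.pi fun j => if j = i then Icc (τ - δ) (τ + δ) else Icc (y j - s) (y j + s))
  have hP : ∀ τ i, volume (P τ i) ≤ ENNReal.ofReal (2 ^ N * δ * s ^ (N - 1)) := by
    intro τ i
    have hm : MeasurableSet (univ.pi fun j : Fin N =>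
        if j = i then Icc (τ - δ) (τ + δ) else Icc (y j - s) (y j + s)) :=
      MeasurableSet.univ_pi fun j => by split_ifs <;> exact measurableSet_Icc
    rw [(EuclideanSpace.volume_preserving_symm_measurableEquiv_toLp (Fin N)).measure_preimage
      hm.nullMeasurableSet, volume_pi_pi]
    have : ∀ j : Fin N, volume (if j = i then Icc (τ - δ) (τ + δ) else Icc (y j - s) (y j + s)) =
        ENNReal.ofReal (if j = i then 2 * δ else 2 * s) := by
      intro j
      split_ifs <;> rw [Real.volume_Icc] <;> congr 1 <;> ring
    simp_rw [this]
    rw [← ENNReal.ofReal_prod_of_nonneg fun j _ => by split_ifs <;> positivity]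
    refine ENNReal.ofReal_le_ofReal (le_of_eq ?_)
    rw [Finset.prod_ite]
    have h1 : (Finset.univ.filter fun j : Fin N => j = i).card = 1 := by
      simp [Finset.filter_eq']
    have h2 : (Finset.univ.filter fun j : Fin N => ¬ j = i).card = N - 1 := by
      rw [Finset.filter_not, Finset.card_sdiff_of_subset (Finset.filter_subset _ _), h1]; simp
    rw [Finset.prod_const, Finset.prod_const, h1, h2]
    have hN : N = N - 1 + 1 := by have := i.2; omega
    conv_rhs => rw [hN]
    simp only [Nat.add_sub_cancel]
    ring
  have hsub : slab t δ ∩ closedBall y s ⊆ ⋃ i, (P t i ∪ P (-t) i) := by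
    rintro x ⟨⟨i, hi⟩, hx⟩
    have hj : ∀ j, x j ∈ Icc (y j - s) (y j + s) := by
      intro j
      have h := (PiLp.norm_apply_le (x - y) j).trans (mem_closedBall_iff_norm.1 hx)
      rw [Real.norm_eq_abs, PiLp.sub_apply, abs_le] at h
      constructor <;> linarith
    refine mem_iUnion.2 ⟨i, ?_⟩
    rw [abs_le] at hi
    have key : ∀ τ, x i ∈ Icc (τ - δ) (τ + δ) → x ∈ P τ i := by
      intro τ hτ
      simp only [P, mem_preimage, mem_univ_pi]
      intro j
      split_ifs with h
      · subst h; exact hτ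
      · exact hj j
    rcases le_total 0 (x i) with h | h
    · rw [abs_of_nonneg h] at hi
      exact Or.inl (key _ (by constructor <;> linarith))
    · rw [abs_of_nonpos h] at hi
      exact Or.inr (key _ (by constructor <;> linarith))
  refine (measure_mono hsub).trans ((measure_iUnion_fintype_le _ _).trans ?_)
  refine (Finset.sum_le_sum fun i _ => (measure_union_le _ _).trans
    (add_le_add (hP t i) (hP (-t) i))).trans ?_
  rw [Finset.sum_const, Finset.card_univ, Fintype.card_fin, nsmul_eq_mul,
    ← ENNReal.ofReal_add (by positivity) (by positivity), ← ENNReal.ofReal_natCast,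
    ← ENNReal.ofReal_mul (by positivity)]
  exact ENNReal.ofReal_le_ofReal (by rw [pow_succ]; linarith)

theorem exists_good_slab (hN : 1 ≤ N) {G : EuclideanSpace ℝ (Fin N) → ENNReal} (hG : Measurable G)
    (h1 : ∫⁻ x, G x ≤ 1) (J : ℕ) : ∃ t ∈ Icc (1 : ℝ) 2, ∀ j ∈ Finset.range (J + 1),
      ∫⁻ x in slab t (2 * (1 / 2) ^ j), G x ≤ ENNReal.ofReal (8 * N * (J + 1) * (1 / 2) ^ j) := by
  by_contra! hcon
  have hpos : ∀ j : ℕ, (0 : ℝ) < 8 * N * (J + 1) * (1 / 2) ^ j := fun j => by positivity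
  let W : ℕ → ℝ → ENNReal := fun j t => ∫⁻ x in slab t (2 * (1 / 2) ^ j), G x
  have hWe : ∀ j t, W j t = ∫⁻ x, {z : ℝ × EuclideanSpace ℝ (Fin N) |
      z.2 ∈ slab z.1 (2 * (1 / 2) ^ j)}.indicator (fun z => G z.2) (t, x) := by
    intro j t
    exact (lintegral_indicator (measurableSet_slab _ _) _).symm
  have hmeas : ∀ j, Measurable ({z : ℝ × EuclideanSpace ℝ (Fin N) |
      z.2 ∈ slab z.1 (2 * (1 / 2) ^ j)}.indicator fun z => G z.2) := fun j =>
    (hG.comp measurable_snd).indicator (measurableSet_slab_prod _)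
  have hWm : ∀ j, Measurable (W j) := fun j => by
    simp_rw [funext (hWe j)]
    exact (hmeas j).lintegral_prod_right'
  have hWi : ∀ j, ∫⁻ t, W j t ≤ ENNReal.ofReal (4 * N * (1 / 2) ^ j) := by
    intro j
    simp_rw [hWe j]
    rw [lintegral_lintegral_swap (f := fun t x => {z : ℝ × EuclideanSpace ℝ (Fin N) |
      z.2 ∈ slab z.1 (2 * (1 / 2) ^ j)}.indicator (fun z => G z.2) (t, x)) (hmeas j).aemeasurable]
    calc _ ≤ ∫⁻ x, G x * ENNReal.ofReal (4 * N * (1 / 2) ^ j) := by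
          refine lintegral_mono fun x => ?_
          have : (fun t => {z : ℝ × EuclideanSpace ℝ (Fin N) |
              z.2 ∈ slab z.1 (2 * (1 / 2) ^ j)}.indicator (fun z => G z.2) (t, x)) =
              {t | x ∈ slab t (2 * (1 / 2) ^ j)}.indicator fun _ => G x := by
            ext t; simp [indicator]
          have hms : MeasurableSet {t | x ∈ slab t (2 * (1 / 2) ^ j)} :=
            (measurable_prodMk_right (y := x)) (measurableSet_slab_prod _)
          rw [this, lintegral_indicator_const hms]
          gcongr
          refine (volume_setOf_mem_slab_le x _).trans (ENNReal.ofReal_le_ofReal (by linarith))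
      _ ≤ _ := by
          rw [lintegral_mul_const _ hG]
          exact mul_le_of_le_one_left (by positivity) h1
  have key : (1 : ENNReal) ≤ ∑ j ∈ Finset.range (J + 1),
      (ENNReal.ofReal (8 * N * (J + 1) * (1 / 2) ^ j))⁻¹ *
        ENNReal.ofReal (4 * N * (1 / 2) ^ j) := by
    calc (1 : ENNReal) = ∫⁻ t in Icc (1 : ℝ) 2, 1 := by simp; norm_num
      _ ≤ ∫⁻ t in Icc (1 : ℝ) 2, ∑ j ∈ Finset.range (J + 1),
          (ENNReal.ofReal (8 * N * (J + 1) * (1 / 2) ^ j))⁻¹ * W j t := by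
        refine setLIntegral_mono (by fun_prop) fun t ht => ?_
        obtain ⟨j, hj, hlt⟩ := hcon t ht
        refine le_trans ?_ (Finset.single_le_sum (f := fun j =>
          (ENNReal.ofReal (8 * N * (J + 1) * (1 / 2) ^ j))⁻¹ * W j t) (fun _ _ => zero_le) hj)
        have h0 := ENNReal.ofReal_pos.2 (hpos j)
        rw [← ENNReal.inv_mul_cancel h0.ne' ENNReal.ofReal_ne_top]
        gcongr
      _ ≤ ∫⁻ t, ∑ j ∈ Finset.range (J + 1),
          (ENNReal.ofReal (8 * N * (J + 1) * (1 / 2) ^ j))⁻¹ * W j t := setLIntegral_le_lintegral _ _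
      _ = ∑ j ∈ Finset.range (J + 1),
          (ENNReal.ofReal (8 * N * (J + 1) * (1 / 2) ^ j))⁻¹ * ∫⁻ t, W j t := by
        rw [lintegral_finsetSum _ fun j _ => (hWm j).const_mul _]
        simp_rw [fun j => lintegral_const_mul (μ := volume)
          (ENNReal.ofReal (8 * N * (J + 1) * (1 / 2) ^ j))⁻¹ (hWm j)]
      _ ≤ _ := by gcongr with j hj; exact hWi j
  have e : ∀ j : ℕ, (ENNReal.ofReal (8 * N * (J + 1) * (1 / 2) ^ j))⁻¹ *
      ENNReal.ofReal (4 * N * (1 / 2) ^ j) = ENNReal.ofReal (1 / (2 * (J + 1))) := by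
    intro j
    rw [← ENNReal.ofReal_inv_of_pos (hpos j), ← ENNReal.ofReal_mul (inv_nonneg.2 (hpos j).le)]
    congr 1
    have : (N : ℝ) ≠ 0 := by positivity
    field_simp
    norm_num
  simp_rw [e] at key
  rw [Finset.sum_const, Finset.card_range, nsmul_eq_mul, ← ENNReal.ofReal_natCast,
    ← ENNReal.ofReal_mul (by positivity), ← ENNReal.ofReal_one] at key
  have := (ENNReal.ofReal_le_ofReal_iff (by positivity)).1 key
  push_cast at this
  field_simp at this
  norm_num at this

theorem setLIntegral_rpow_le {α : Type*} [MeasurableSpace α] {μ : Measure α} {G : α → ENNReal}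
    (hG : Measurable G) {k : ℝ} (hk : 1 ≤ k) (s : Set α) :
    (∫⁻ y in s, G y ∂μ) ^ k ≤ μ s ^ (k - 1) * ∫⁻ y in s, G y ^ k ∂μ := by
  have hk0 : 0 < k := by linarith
  have h := eLpNorm'_le_eLpNorm'_mul_rpow_measure_univ (μ := μ.restrict s) zero_lt_one hk
    hG.aestronglyMeasurable
  simp only [eLpNorm', enorm_eq_self, ENNReal.rpow_one, div_one, Measure.restrict_apply_univ] at h
  refine (ENNReal.rpow_le_rpow h hk0.le).trans (le_of_eq ?_)
  rw [ENNReal.mul_rpow_of_nonneg _ _ hk0.le, ← ENNReal.rpow_mul, ← ENNReal.rpow_mul, mul_comm]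
  congr 2
  · field_simp
  · rw [one_div, inv_mul_cancel₀ hk0.ne', ENNReal.rpow_one]

theorem measurable_setLIntegral_closedBall {G : EuclideanSpace ℝ (Fin N) → ENNReal}
    (hG : Measurable G) (s : ℝ) : Measurable fun x => ∫⁻ y in closedBall x s, G y := by
  have h : ∀ x, ∫⁻ y in closedBall x s, G y = ∫⁻ y, {z : EuclideanSpace ℝ (Fin N) ×
      EuclideanSpace ℝ (Fin N) | dist z.2 z.1 ≤ s}.indicator (fun z => G z.2) (x, y) := fun x =>
    (lintegral_indicator measurableSet_closedBall _).symm
  simp_rw [h]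
  refine Measurable.lintegral_prod_right' ((hG.comp measurable_snd).indicator ?_)
  exact (isClosed_le (by fun_prop) (by fun_prop)).measurableSet

theorem setLIntegral_slab_rpow_le {k z : ℝ} (hk : 1 ≤ k) (hkz : k ≤ z) :
    ∃ C > 0, ∀ G : EuclideanSpace ℝ (Fin N) → ENNReal, Measurable G → ∀ t δ s Y : ℝ, 0 ≤ δ →
      δ ≤ s → 0 < s → 0 ≤ Y → ∫⁻ y in slab t (2 * s), G y ^ k ≤ ENNReal.ofReal Y →
      ∫⁻ x in slab t δ, (∫⁻ y in closedBall x s, G y) ^ z ≤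
        ENNReal.ofReal (C * δ * s ^ (N - 1) * (s ^ N) ^ ((k - 1) * (z / k)) * Y ^ (z / k)) := by
  have hk0 : 0 < k := by linarith
  have hz0 : 0 < z := by linarith
  let c : ℝ := (volume (ball (0 : EuclideanSpace ℝ (Fin N)) 1)).toReal
  have hc : 0 < c := ENNReal.toReal_pos (measure_ball_pos _ _ one_pos).ne' measure_ball_lt_top.ne
  refine ⟨(N * 2 ^ (N + 1) + 1) * c ^ ((k - 1) * (z / k)), by positivity,
    fun G hG t δ s Y hδ hδs hs hY hGY => ?_⟩
  have hvol : ∀ x : EuclideanSpace ℝ (Fin N), volume (closedBall x s) = ENNReal.ofReal (c * s ^ N) := by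
    intro x
    rw [Measure.addHaar_closedBall _ _ hs.le, finrank_euclideanSpace_fin, mul_comm,
      ENNReal.ofReal_mul hc.le, ENNReal.ofReal_toReal measure_ball_lt_top.ne]
  have hsub : ∀ x ∈ slab t δ, ∀ y ∈ closedBall x s, y ∈ slab (N := N) t (2 * s) := by
    rintro x ⟨i, hi⟩ y hy
    refine ⟨i, ?_⟩
    have h := (PiLp.norm_apply_le (y - x) i).trans (mem_closedBall_iff_norm.1 hy)
    rw [Real.norm_eq_abs, PiLp.sub_apply] at h
    have h3 := (abs_abs_sub_abs_le_abs_sub (y i) (x i)).trans h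
    calc |(|y i| - t)| = |(|y i| - |x i|) + (|x i| - t)| := by congr 1; ring
      _ ≤ _ := (abs_add_le _ _).trans (by linarith)
  set A := (c * s ^ N) ^ (k - 1) with hA
  have hApos : 0 ≤ A := by positivity
  have hAk : ∀ x, (∫⁻ y in closedBall x s, G y) ^ k ≤
      ENNReal.ofReal A * ∫⁻ y in closedBall x s, G y ^ k := by
    intro x
    refine (setLIntegral_rpow_le hG hk _).trans (le_of_eq ?_)
    rw [hvol, ENNReal.ofReal_rpow_of_nonneg (by positivity) (by linarith)]
  have hpt : ∀ x ∈ slab t δ, (∫⁻ y in closedBall x s, G y) ^ z ≤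
      ENNReal.ofReal ((A * Y) ^ (z / k - 1) * A) * ∫⁻ y in closedBall x s, G y ^ k := by
    intro x hx
    have h1 : (∫⁻ y in closedBall x s, G y) ^ k ≤ ENNReal.ofReal (A * Y) := by
      refine (hAk x).trans ?_
      rw [ENNReal.ofReal_mul hApos]
      gcongr
      exact (lintegral_mono_set fun y hy => hsub x hx y hy).trans hGY
    have h2 : ((∫⁻ y in closedBall x s, G y) ^ k) ^ (z / k - 1) ≤
        ENNReal.ofReal ((A * Y) ^ (z / k - 1)) := by
      rw [← ENNReal.ofReal_rpow_of_nonneg (by positivity)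
        (by rw [sub_nonneg, le_div_iff₀ hk0]; linarith)]
      exact ENNReal.rpow_le_rpow h1 (by rw [sub_nonneg, le_div_iff₀ hk0]; linarith)
    calc (∫⁻ y in closedBall x s, G y) ^ z
        = ((∫⁻ y in closedBall x s, G y) ^ k) ^ (z / k - 1) * (∫⁻ y in closedBall x s, G y) ^ k := by
          rw [← ENNReal.rpow_mul, ← ENNReal.rpow_add_of_nonneg _ _
            (mul_nonneg hk0.le (by rw [sub_nonneg, le_div_iff₀ hk0]; linarith)) hk0.le]
          congr 1
          field_simp
          ring
      _ ≤ ENNReal.ofReal ((A * Y) ^ (z / k - 1)) *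
          (ENNReal.ofReal A * ∫⁻ y in closedBall x s, G y ^ k) := mul_le_mul' h2 (hAk x)
      _ = _ := by rw [ENNReal.ofReal_mul (by positivity), mul_assoc]
  have hGk : Measurable fun y => G y ^ k := hG.pow_const k
  have hfub : ∫⁻ x in slab t δ, ∫⁻ y in closedBall x s, G y ^ k ≤
      ENNReal.ofReal (N * 2 ^ (N + 1) * δ * s ^ (N - 1)) * ENNReal.ofReal Y := by
    let T : Set (EuclideanSpace ℝ (Fin N) × EuclideanSpace ℝ (Fin N)) :=
      {z | z.1 ∈ slab t δ ∧ dist z.2 z.1 ≤ s}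
    have hT : MeasurableSet T := (measurable_fst (measurableSet_slab t δ)).inter
      (isClosed_le (f := fun z : EuclideanSpace ℝ (Fin N) × EuclideanSpace ℝ (Fin N) =>
        dist z.2 z.1) (g := fun _ => s) (by fun_prop) (by fun_prop)).measurableSet
    have hmeas : Measurable (T.indicator fun z => G z.2 ^ k) :=
      (hGk.comp measurable_snd).indicator hT
    have e1 : ∫⁻ x in slab t δ, ∫⁻ y in closedBall x s, G y ^ k =
        ∫⁻ x, ∫⁻ y, T.indicator (fun z => G z.2 ^ k) (x, y) := by
      rw [← lintegral_indicator (measurableSet_slab t δ)]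
      refine lintegral_congr fun x => ?_
      by_cases hx : x ∈ slab t δ
      · rw [indicator_of_mem hx, ← lintegral_indicator measurableSet_closedBall]
        refine lintegral_congr fun y => ?_
        simp [indicator, T, hx]
      · rw [indicator_of_notMem hx]
        simp [indicator, T, hx]
    rw [e1, lintegral_lintegral_swap (f := fun x y => T.indicator (fun z => G z.2 ^ k) (x, y))
      hmeas.aemeasurable, mul_comm]
    calc _ ≤ ∫⁻ y in slab t (2 * s), G y ^ k * ENNReal.ofReal (N * 2 ^ (N + 1) * δ * s ^ (N - 1)) := by
          rw [← lintegral_indicator (measurableSet_slab _ _)]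
          refine lintegral_mono fun y => ?_
          by_cases hy : y ∈ slab t (2 * s)
          · rw [indicator_of_mem hy]
            have : (fun x => T.indicator (fun z => G z.2 ^ k) (x, y)) =
                (slab t δ ∩ closedBall y s).indicator fun _ => G y ^ k := by
              ext x
              have hiff : (x, y) ∈ T ↔ x ∈ slab t δ ∩ closedBall y s :=
                and_congr_right fun _ => by rw [mem_closedBall, dist_comm]
              by_cases h : x ∈ slab t δ ∩ closedBall y s
              · rw [indicator_of_mem h, indicator_of_mem (hiff.2 h)]
              · rw [indicator_of_notMem h, indicator_of_notMem (fun h' => h (hiff.1 h'))]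
            simp only [this]
            rw [lintegral_indicator_const ((measurableSet_slab _ _).inter measurableSet_closedBall)]
            gcongr
            exact volume_slab_inter_closedBall_le t hδ hs.le y
          · rw [indicator_of_notMem hy]
            refine le_of_eq ((lintegral_congr fun x => ?_).trans lintegral_zero)
            refine indicator_of_notMem (fun h => hy (hsub x h.1 y h.2)) _
      _ ≤ _ := by
          rw [lintegral_mul_const _ hGk]
          gcongr
  calc _ ≤ ∫⁻ x in slab t δ, ENNReal.ofReal ((A * Y) ^ (z / k - 1) * A) *
        ∫⁻ y in closedBall x s, G y ^ k := setLIntegral_mono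
          ((measurable_setLIntegral_closedBall hGk s).const_mul _) hpt
    _ = ENNReal.ofReal ((A * Y) ^ (z / k - 1) * A) *
        ∫⁻ x in slab t δ, ∫⁻ y in closedBall x s, G y ^ k :=
          lintegral_const_mul _ (measurable_setLIntegral_closedBall hGk s)
    _ ≤ ENNReal.ofReal ((A * Y) ^ (z / k - 1) * A) *
        (ENNReal.ofReal (N * 2 ^ (N + 1) * δ * s ^ (N - 1)) * ENNReal.ofReal Y) := by gcongr
    _ ≤ _ := by
      rw [← ENNReal.ofReal_mul (by positivity), ← ENNReal.ofReal_mul (by positivity)]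
      refine ENNReal.ofReal_le_ofReal ?_
      have e2 : (A * Y) ^ (z / k - 1) * (A * Y) = A ^ (z / k) * Y ^ (z / k) := by
        rcases (mul_nonneg hApos hY).eq_or_lt with h | h
        · rw [← h, mul_zero, ← Real.mul_rpow hApos hY, ← h, Real.zero_rpow (by positivity)]
        · rw [← Real.rpow_add_one h.ne', sub_add_cancel, Real.mul_rpow hApos hY]
      have e3 : A ^ (z / k) = c ^ ((k - 1) * (z / k)) * (s ^ N) ^ ((k - 1) * (z / k)) := by
        rw [hA, ← Real.rpow_mul (by positivity), Real.mul_rpow hc.le (by positivity)]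
      calc _ = ((A * Y) ^ (z / k - 1) * (A * Y)) * (N * 2 ^ (N + 1) * δ * s ^ (N - 1)) := by ring
        _ = (N * 2 ^ (N + 1)) * (c ^ ((k - 1) * (z / k)) * (s ^ N) ^ ((k - 1) * (z / k)) *
            Y ^ (z / k) * δ * s ^ (N - 1)) := by rw [e2, e3]; ring
        _ ≤ (N * 2 ^ (N + 1) + 1) * (c ^ ((k - 1) * (z / k)) * (s ^ N) ^ ((k - 1) * (z / k)) *
            Y ^ (z / k) * δ * s ^ (N - 1)) := by gcongr; linarith
        _ = _ := by ring

theorem setLIntegral_slab_dyadic_le (hN : 1 ≤ N) {k z κ : ℝ} (hk : 1 ≤ k) (hkz : k ≤ z)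
    (hκ : κ + (N - 1) * (1 / k - 1 / z) ≤ N) :
    ∃ C > 0, ∀ G : EuclideanSpace ℝ (Fin N) → ENNReal, Measurable G → ∀ (t X : ℝ) (J : ℕ), 0 ≤ X →
      (∀ j ∈ Finset.range J, ∫⁻ y in slab t (2 * (1 / 2) ^ j), G y ^ k ≤
        ENNReal.ofReal ((1 / 2) ^ j * X)) →
      ∫⁻ x in slab t ((1 / 2) ^ J), (∑ j ∈ Finset.range J,
        ENNReal.ofReal (((1 / 2 : ℝ) ^ j) ^ (-κ)) * ∫⁻ y in closedBall x ((1 / 2) ^ j), G y) ^ z ≤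
      ENNReal.ofReal (C * (1 / 2) ^ J * J ^ z * X ^ (z / k)) := by
  have hk0 : 0 < k := by linarith
  have hz0 : 0 < z := by linarith
  obtain ⟨C, hC, hCs⟩ := setLIntegral_slab_rpow_le (N := N) hk hkz
  refine ⟨C, hC, fun G hG t X J hX hGX => ?_⟩
  have hm := fun s => measurable_setLIntegral_closedBall hG s
  have hterm : ∀ j ∈ Finset.range J, ∫⁻ x in slab t ((1 / 2) ^ J),
      (ENNReal.ofReal (((1 / 2 : ℝ) ^ j) ^ (-κ)) * ∫⁻ y in closedBall x ((1 / 2) ^ j), G y) ^ z ≤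
        ENNReal.ofReal (C * (1 / 2) ^ J * X ^ (z / k)) := by
    intro j hj
    set s : ℝ := (1 / 2) ^ j with hs
    have hs0 : 0 < s := by positivity
    have hs1 : s ≤ 1 := pow_le_one₀ (by norm_num) (by norm_num)
    have h := hCs G hG t ((1 / 2) ^ J) s (s * X) (by positivity)
      (pow_le_pow_of_le_one (by norm_num) (by norm_num) (Finset.mem_range.1 hj).le) hs0
      (by positivity) (hGX j hj)
    simp_rw [ENNReal.mul_rpow_of_nonneg _ _ hz0.le]
    rw [lintegral_const_mul _ ((hm s).pow_const z),
      ENNReal.ofReal_rpow_of_nonneg (by positivity) hz0.le]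
    refine (mul_le_mul_right h _).trans ?_
    rw [← ENNReal.ofReal_mul (by positivity)]
    refine ENNReal.ofReal_le_ofReal ?_
    have e : (s ^ (-κ)) ^ z * (s ^ (N - 1) * (s ^ N) ^ ((k - 1) * (z / k)) * s ^ (z / k)) ≤ 1 := by
      rw [← Real.rpow_natCast s (N - 1), ← Real.rpow_natCast s N, ← Real.rpow_mul hs0.le,
        ← Real.rpow_mul hs0.le, ← Real.rpow_add hs0, ← Real.rpow_add hs0, ← Real.rpow_add hs0]
      refine Real.rpow_le_one hs0.le hs1 ?_
      rw [Nat.cast_sub hN]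
      have : -κ * z + (((N : ℝ) - (1 : ℕ)) + N * ((k - 1) * (z / k)) + z / k) =
          z * (N - (κ + (N - 1) * (1 / k - 1 / z))) := by
        push_cast
        field_simp
        ring
      rw [this]
      exact mul_nonneg hz0.le (by linarith)
    calc _ = (C * (1 / 2) ^ J * X ^ (z / k)) *
          ((s ^ (-κ)) ^ z * (s ^ (N - 1) * (s ^ N) ^ ((k - 1) * (z / k)) * s ^ (z / k))) := by
          rw [Real.mul_rpow hs0.le hX]; ring
      _ ≤ _ := mul_le_of_le_one_right (by positivity) e
  have hz1 : 1 ≤ z := hk.trans hkz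
  calc _ ≤ ∫⁻ x in slab t ((1 / 2) ^ J), (J : ENNReal) ^ (z - 1) * ∑ j ∈ Finset.range J,
        (ENNReal.ofReal (((1 / 2 : ℝ) ^ j) ^ (-κ)) * ∫⁻ y in closedBall x ((1 / 2) ^ j), G y) ^ z := by
        refine lintegral_mono fun x => ?_
        simpa using ENNReal.rpow_sum_le_const_mul_sum_rpow (Finset.range J) (fun j =>
          ENNReal.ofReal (((1 / 2 : ℝ) ^ j) ^ (-κ)) * ∫⁻ y in closedBall x ((1 / 2) ^ j), G y) hz1
    _ = (J : ENNReal) ^ (z - 1) * ∑ j ∈ Finset.range J, ∫⁻ x in slab t ((1 / 2) ^ J),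
        (ENNReal.ofReal (((1 / 2 : ℝ) ^ j) ^ (-κ)) * ∫⁻ y in closedBall x ((1 / 2) ^ j), G y) ^ z := by
        have hmj : ∀ j ∈ Finset.range J, Measurable fun x => (ENNReal.ofReal (((1 / 2 : ℝ) ^ j) ^ (-κ)) *
            ∫⁻ y in closedBall (x : EuclideanSpace ℝ (Fin N)) ((1 / 2) ^ j), G y) ^ z := fun j _ =>
          ((hm _).const_mul _).pow_const z
        rw [lintegral_const_mul _ (Finset.measurable_fun_sum _ hmj), lintegral_finsetSum _ hmj]
    _ ≤ (J : ENNReal) ^ (z - 1) * ∑ j ∈ Finset.range J,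
        ENNReal.ofReal (C * (1 / 2) ^ J * X ^ (z / k)) := by
        gcongr with j hj
        exact hterm j hj
    _ = ENNReal.ofReal (C * (1 / 2) ^ J * J ^ z * X ^ (z / k)) := by
      rw [Finset.sum_const, Finset.card_range, nsmul_eq_mul, ← mul_assoc, ← ENNReal.ofReal_natCast,
        ENNReal.ofReal_rpow_of_nonneg (by positivity) (by linarith),
        ← ENNReal.ofReal_mul (by positivity), ← ENNReal.ofReal_mul (by positivity)]
      congr 1
      have : (J : ℝ) ^ (z - 1) * J = J ^ z := by
        rcases Nat.eq_zero_or_pos J with rfl | h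
        · simp [Real.zero_rpow hz0.ne']
        · rw [← Real.rpow_add_one (by positivity), sub_add_cancel]
      rw [this]; ring

end Slab

section LocalSystem

variable {N : ℕ}

/-- A positive solution of `-Δu = c v^p`, `-Δv = d u^q` near the closed ball of radius `100`, with
coefficients close to constants. -/
structure LocSys (p q ε : ℝ) (Ω : Set (EuclideanSpace ℝ (Fin N)))
    (c d u v : EuclideanSpace ℝ (Fin N) → ℝ) : Prop where
  isOpen : IsOpen Ω
  ball : closedBall 0 100 ⊆ Ω
  cu : ContDiffOn ℝ 2 u Ω
  cv : ContDiffOn ℝ 2 v Ω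
  cc : ContDiffOn ℝ 1 c Ω
  cd : ContDiffOn ℝ 1 d Ω
  upos : ∀ x ∈ Ω, 0 < u x
  vpos : ∀ x ∈ Ω, 0 < v x
  cmem : ∀ x ∈ Ω, c x ∈ Icc (1 / 4) 4
  dmem : ∀ x ∈ Ω, d x ∈ Icc (1 / 4) 4
  cder : ∀ x ∈ closedBall 0 100, |∑ j, x j * pd j c x| ≤ ε
  dder : ∀ x ∈ closedBall 0 100, |∑ j, x j * pd j d x| ≤ ε
  equ : ∀ x ∈ Ω, -lap u x = c x * v x ^ p
  eqv : ∀ x ∈ Ω, -lap v x = d x * u x ^ q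

variable {p q ε : ℝ} {Ω : Set (EuclideanSpace ℝ (Fin N))} {c d u v : EuclideanSpace ℝ (Fin N) → ℝ}

theorem LocSys.symm (h : LocSys p q ε Ω c d u v) : LocSys q p ε Ω d c v u :=
  ⟨h.isOpen, h.ball, h.cv, h.cu, h.cd, h.cc, h.vpos, h.upos, h.dmem, h.cmem, h.dder, h.cder,
    h.eqv, h.equ⟩

theorem LocSys.ball_sub (h : LocSys p q ε Ω c d u v) {x : EuclideanSpace ℝ (Fin N)} {r s : ℝ}
    (hx : x ∈ closedBall 0 r) (hrs : s + r ≤ 100) : closedBall x s ⊆ Ω :=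
  (closedBall_subset_closedBall' (by rw [mem_closedBall] at hx; linarith)).trans h.ball

theorem LocSys.equ_lower (h : LocSys p q ε Ω c d u v) {x : EuclideanSpace ℝ (Fin N)}
    (hx : x ∈ Ω) : 1 / 4 * v x ^ p ≤ -lap u x := by
  rw [h.equ x hx]
  exact mul_le_mul_of_nonneg_right (h.cmem x hx).1 (Real.rpow_nonneg (h.vpos x hx).le _)

theorem LocSys.equ_upper (h : LocSys p q ε Ω c d u v) {x : EuclideanSpace ℝ (Fin N)}
    (hx : x ∈ Ω) : -lap u x ≤ 4 * v x ^ p := by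
  rw [h.equ x hx]
  exact mul_le_mul_of_nonneg_right (h.cmem x hx).2 (Real.rpow_nonneg (h.vpos x hx).le _)

theorem LocSys.equ_nonneg (h : LocSys p q ε Ω c d u v) {x : EuclideanSpace ℝ (Fin N)}
    (hx : x ∈ Ω) : 0 ≤ -lap u x :=
  (mul_nonneg (by norm_num) (Real.rpow_nonneg (h.vpos x hx).le _)).trans (h.equ_lower hx)

theorem LocSys.continuousOn_lap (h : LocSys p q ε Ω c d u v) :
    ContinuousOn (fun x => -lap u x) Ω :=
  (h.cc.continuousOn.mul (h.cv.continuousOn.rpow_const fun x hx => Or.inl (h.vpos x hx).ne')).congr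
    fun x hx => h.equ x hx

theorem LocSys.continuousOn_rpow (h : LocSys p q ε Ω c d u v) (r : ℝ) :
    ContinuousOn (fun x => u x ^ r) Ω :=
  h.cu.continuousOn.rpow_const fun x hx => Or.inl (h.upos x hx).ne'

theorem exists_integral_lap_le (hN : 3 ≤ N) {p q : ℝ} (hp : 0 < p) (hq : 0 < q)
    (hpq : 1 < p * q) : ∃ C > 0, ∀ (ε : ℝ) (Ω : Set (EuclideanSpace ℝ (Fin N)))
      (c d u v : EuclideanSpace ℝ (Fin N) → ℝ), LocSys p q ε Ω c d u v →
      (∫ x in closedBall 0 8, -lap u x) ≤ C ∧ (∫ x in closedBall 0 8, v x) ≤ C := by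
  obtain ⟨c₀, hc₀, hsup⟩ := exists_superharmonic_ge hN
  let κ : ℝ := c₀ / 40 ^ N
  have hκ : 0 < κ := by positivity
  let m : ℝ := (volume (closedBall (0 : EuclideanSpace ℝ (Fin N)) 8)).toReal
  have hm : 0 < m := ENNReal.toReal_pos (measure_closedBall_pos _ _ (by norm_num)).ne'
    measure_closedBall_lt_top.ne
  have low : ∀ (p q ε : ℝ) (Ω : Set (EuclideanSpace ℝ (Fin N)))
      (c d u v : EuclideanSpace ℝ (Fin N) → ℝ), LocSys p q ε Ω c d u v →
      ∀ x ∈ closedBall (0 : EuclideanSpace ℝ (Fin N)) 8,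
      κ * (∫ y in closedBall 0 8, u y) ≤ u x ∧ κ * (∫ y in closedBall 0 8, -lap u y) ≤ u x := by
    intro p q ε Ω c d u v h x hx
    have hb : closedBall x 40 ⊆ Ω := h.ball_sub hx (by norm_num)
    obtain ⟨h1, h2⟩ := hsup Ω u x 40 h.isOpen h.cu (by norm_num) hb
      (fun y hy => (h.upos y (hb hy)).le) (fun y hy => h.equ_nonneg (hb hy))
    have hsub : closedBall (0 : EuclideanSpace ℝ (Fin N)) 8 ⊆ closedBall x (40 / 2) :=
      closedBall_subset_closedBall' (by rw [mem_closedBall, dist_comm] at hx; linarith)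
    have hb' : closedBall x (40 / 2) ⊆ Ω := (closedBall_subset_closedBall (by norm_num)).trans hb
    have mono : ∀ f : EuclideanSpace ℝ (Fin N) → ℝ, ContinuousOn f Ω → (∀ y ∈ Ω, 0 ≤ f y) →
        0 ≤ ∫ y in closedBall x (40 / 2), f y ∧
        (∫ y in closedBall 0 8, f y) ≤ ∫ y in closedBall x (40 / 2), f y := fun f hf h0 =>
      ⟨setIntegral_nonneg measurableSet_closedBall fun y hy => h0 y (hb' hy),
        setIntegral_mono_set ((hf.mono hb').integrableOn_compact (isCompact_closedBall _ _))
        ((ae_restrict_iff' measurableSet_closedBall).2 (ae_of_all _ fun y hy => h0 y (hb' hy)))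
        hsub.eventuallyLE⟩
    have m1 := mono u h.cu.continuousOn fun y hy => (h.upos y hy).le
    have m2 := mono _ h.continuousOn_lap fun y hy => h.equ_nonneg hy
    have e : ∀ A B : ℝ, c₀ * B ≤ 40 ^ N * u x → A ≤ B → κ * A ≤ u x := by
      intro A B hB hAB
      simp only [κ]
      rw [div_mul_eq_mul_div, div_le_iff₀ (by positivity), mul_comm (u x)]
      exact (mul_le_mul_of_nonneg_left hAB hc₀.le).trans hB
    refine ⟨e _ _ h1 m1.2, e _ _ (le_trans ?_ h2) m2.2⟩
    exact mul_le_mul_of_nonneg_right (by nlinarith) m2.1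
  have step : ∀ (p q ε : ℝ) (Ω : Set (EuclideanSpace ℝ (Fin N)))
      (c d u v : EuclideanSpace ℝ (Fin N) → ℝ), 0 < p → LocSys p q ε Ω c d u v → ∀ A, 0 ≤ A →
      (∀ x ∈ closedBall (0 : EuclideanSpace ℝ (Fin N)) 8, κ * A ≤ v x) →
      m / 4 * (κ * A) ^ p ≤ ∫ y in closedBall 0 8, -lap u y := by
    intro p q ε Ω c d u v hp h A hA hv
    have hb : closedBall 0 8 ⊆ Ω := (closedBall_subset_closedBall (by norm_num)).trans h.ball
    have h1 : (∫ y in closedBall (0 : EuclideanSpace ℝ (Fin N)) 8, 1 / 4 * (κ * A) ^ p) ≤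
        ∫ y in closedBall 0 8, -lap u y := by
      refine setIntegral_mono_on (integrableOn_const measure_closedBall_lt_top.ne)
        ((h.continuousOn_lap.mono hb).integrableOn_compact (isCompact_closedBall _ _))
        measurableSet_closedBall fun x hx => ?_
      refine le_trans ?_ (h.equ_lower (hb hx))
      have := Real.rpow_le_rpow (by positivity) (hv x hx) hp.le
      linarith
    rw [setIntegral_const, smul_eq_mul] at h1
    calc _ = m * (1 / 4 * (κ * A) ^ p) := by ring
      _ ≤ _ := h1
  let B : ℝ := m / 4 * (κ * (m / 4 * κ ^ q)) ^ p
  have hB : 0 < B := by positivity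
  let C₁ : ℝ := (1 / B) ^ (1 / (p * q - 1))
  have hC₁ : 0 < C₁ := by positivity
  refine ⟨C₁ + (4 * C₁ / m) ^ (1 / p) / κ, by positivity, fun ε Ω c d u v h => ?_⟩
  have hb : closedBall 0 8 ⊆ Ω := (closedBall_subset_closedBall (by norm_num)).trans h.ball
  set Ig := ∫ y in closedBall 0 8, -lap u y with hIg
  set If := ∫ y in closedBall 0 8, -lap v y with hIf
  have hIg0 : 0 ≤ Ig := setIntegral_nonneg measurableSet_closedBall fun y hy => h.equ_nonneg (hb hy)
  have hIf0 : 0 ≤ If :=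
    setIntegral_nonneg measurableSet_closedBall fun y hy => h.symm.equ_nonneg (hb hy)
  have hg := step p q ε Ω c d u v hp h If hIf0 fun x hx => (low q p ε Ω d c v u h.symm x hx).2
  have hf := step q p ε Ω d c v u hq h.symm Ig hIg0 fun x hx => (low p q ε Ω c d u v h x hx).2
  have hIgC : Ig ≤ C₁ := by
    rcases hIg0.eq_or_lt with h0 | h0
    · rw [← h0]; exact hC₁.le
    have h1 : B * Ig ^ (p * q) ≤ Ig := by
      refine le_trans ?_ hg
      have : B * Ig ^ (p * q) = m / 4 * (κ * (m / 4 * (κ * Ig) ^ q)) ^ p := by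
        simp only [B]
        rw [Real.mul_rpow hκ.le hIg0, mul_comm p q, Real.rpow_mul hIg0, mul_assoc,
          ← Real.mul_rpow (by positivity) (by positivity)]
        congr 2; ring
      rw [this]
      gcongr
    have h2 : Ig ^ (p * q - 1) ≤ 1 / B := by
      rw [Real.rpow_sub_one h0.ne', div_le_div_iff₀ h0 hB]
      linarith
    calc Ig = (Ig ^ (p * q - 1)) ^ (1 / (p * q - 1)) := by
          rw [← Real.rpow_mul hIg0, mul_one_div_cancel (by linarith), Real.rpow_one]
      _ ≤ _ := Real.rpow_le_rpow (by positivity) h2 (by rw [one_div_nonneg]; linarith)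
  have hV0 : 0 ≤ ∫ y in closedBall 0 8, v y :=
    setIntegral_nonneg measurableSet_closedBall fun y hy => (h.vpos y (hb hy)).le
  refine ⟨hIgC.trans (le_add_of_nonneg_right (by positivity)),
    le_trans ?_ (le_add_of_nonneg_left hC₁.le)⟩
  have hv := step p q ε Ω c d u v hp h _ hV0 fun x hx => (low q p ε Ω d c v u h.symm x hx).1
  rw [le_div_iff₀ hκ, mul_comm]
  set A := κ * ∫ y in closedBall 0 8, v y
  have hA : 0 ≤ A := by positivity
  calc A = (A ^ p) ^ (1 / p) := by
        rw [← Real.rpow_mul hA, mul_one_div_cancel hp.ne', Real.rpow_one]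
    _ ≤ _ := Real.rpow_le_rpow (by positivity) (by rw [le_div_iff₀ hm]; linarith) (by positivity)

theorem exists_integral_le (hN : 3 ≤ N) {p q : ℝ} (hp : 0 < p) (hq : 0 < q) (hpq : 1 < p * q) :
    ∃ C > 0, ∀ (ε : ℝ) (Ω : Set (EuclideanSpace ℝ (Fin N)))
      (c d u v : EuclideanSpace ℝ (Fin N) → ℝ), LocSys p q ε Ω c d u v →
      (∫ x in closedBall 0 8, -lap u x) ≤ C ∧ (∫ x in closedBall 0 8, v x) ≤ C ∧
      (∫ x in closedBall 0 8, -lap v x) ≤ C ∧ (∫ x in closedBall 0 8, u x) ≤ C := by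
  obtain ⟨C, hC, h⟩ := exists_integral_lap_le hN hp hq hpq
  obtain ⟨C', hC', h'⟩ := exists_integral_lap_le hN hq hp (by linarith)
  refine ⟨C + C', by positivity, fun ε Ω c d u v hs => ?_⟩
  obtain ⟨h1, h2⟩ := h ε Ω c d u v hs
  obtain ⟨h3, h4⟩ := h' ε Ω d c v u hs.symm
  exact ⟨by linarith, by linarith, by linarith, by linarith⟩

theorem rpow_le_of_split {w K r t l : ℝ} (hw : 0 < w) (hK : 0 < K) (hrt : r ≤ t) (htl : t ≤ l) :
    w ^ t ≤ K ^ (t - r) * w ^ r + K ^ (t - l) * w ^ l := by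
  rcases le_total w K with h | h
  · have : w ^ t ≤ K ^ (t - r) * w ^ r := by
      rw [show t = (t - r) + r by ring, Real.rpow_add hw, add_sub_cancel_right]
      gcongr
    exact this.trans (le_add_of_nonneg_right (by positivity))
  · have : w ^ t ≤ K ^ (t - l) * w ^ l := by
      rw [show t = (t - l) + l by ring, Real.rpow_add hw, add_sub_cancel_right]
      gcongr ?_ * _
      exact Real.rpow_le_rpow_of_nonpos hK h (by linarith)
    exact this.trans (le_add_of_nonneg_left (by positivity))

end LocalSystem

section Cutoff

variable {N : ℕ}

theorem exists_abs_deriv_smoothTransition_le :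
    ∃ B > 0, ∀ y, |deriv Real.smoothTransition y| ≤ B ∧
      (deriv Real.smoothTransition y ≠ 0 → y ∈ Icc (0 : ℝ) 1) := by
  have hz : ∀ y, y ∉ Icc (0 : ℝ) 1 → deriv Real.smoothTransition y = 0 := by
    intro y hy
    rcases lt_or_ge y 0 with h | h
    · have : Real.smoothTransition =ᶠ[nhds y] fun _ => 0 := by
        filter_upwards [Iio_mem_nhds h] with z hz using Real.smoothTransition.zero_of_nonpos hz.le
      rw [this.deriv_eq, deriv_const]
    · have h1 : 1 < y := by
        by_contra h'
        exact hy ⟨h, not_lt.1 h'⟩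
      have : Real.smoothTransition =ᶠ[nhds y] fun _ => 1 := by
        filter_upwards [Ioi_mem_nhds h1] with z hz using Real.smoothTransition.one_of_one_le hz.le
      rw [this.deriv_eq, deriv_const]
  have hc : Continuous (deriv Real.smoothTransition) :=
    (Real.smoothTransition.contDiff (n := 1)).continuous_deriv le_rfl
  obtain ⟨B, hB⟩ := isCompact_Icc.exists_bound_of_continuousOn (hc.continuousOn (s := Icc (0 : ℝ) 1))
  refine ⟨|B| + 1, by positivity, fun y => ⟨?_, fun h => by_contra fun h' => h (hz y h')⟩⟩
  by_cases hy : y ∈ Icc (0 : ℝ) 1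
  · exact (hB y hy).trans ((le_abs_self B).trans (by linarith))
  · rw [hz y hy, abs_zero]; positivity

theorem exists_box_cutoff (hN : N ≤ 4) : ∃ C > 0, ∀ t ∈ Icc (1 : ℝ) 2, ∀ δ, 0 < δ → δ ≤ 1 →
    ∃ φ : EuclideanSpace ℝ (Fin N) → ℝ, ContDiff ℝ 1 φ ∧ (∀ x, 0 ≤ φ x) ∧
      (∀ x ∈ closedBall 0 1, φ x = 1) ∧ (∀ x, x ∉ closedBall 0 6 → φ x = 0) ∧
      (∀ i x, |pd i φ x| ≤ C / δ) ∧ ∀ i x, pd i φ x ≠ 0 → x ∈ slab t δ ∩ closedBall 0 6 := by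
  obtain ⟨B, hB, hS⟩ := exists_abs_deriv_smoothTransition_le
  refine ⟨3 * B, by positivity, fun t ht δ hδ hδ1 => ?_⟩
  set D := δ * (2 * t + δ) with hD
  have ht1 := ht.1
  have ht2 := ht.2
  have hDpos : 0 < D := by positivity
  let ψ : ℝ → ℝ := fun s => Real.smoothTransition (((t + δ) ^ 2 - s ^ 2) / D)
  have hψ : ContDiff ℝ 1 ψ := Real.smoothTransition.contDiff.comp (by fun_prop)
  have hψd : ∀ s, HasDerivAt ψ (deriv Real.smoothTransition (((t + δ) ^ 2 - s ^ 2) / D) *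
      (-(2 * s) / D)) s := by
    intro s
    have h1 : HasDerivAt (fun s => ((t + δ) ^ 2 - s ^ 2) / D) (-(2 * s) / D) s := by
      have := (((hasDerivAt_id s).pow 2).const_sub ((t + δ) ^ 2)).div_const D
      simpa using this
    exact ((Real.smoothTransition.contDiff (n := 1)).differentiable (by norm_num) _).hasDerivAt.comp
      s h1
  have hψ0 : ∀ s, 0 ≤ ψ s := fun s => Real.smoothTransition.nonneg _
  have hψ1 : ∀ s, ψ s ≤ 1 := fun s => Real.smoothTransition.le_one _
  have hψne : ∀ s, deriv ψ s ≠ 0 → t ≤ |s| ∧ |s| ≤ t + δ := by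
    intro s hs
    rw [(hψd s).deriv] at hs
    obtain ⟨h0, h1⟩ := (hS _).2 (left_ne_zero_of_mul hs)
    rw [le_div_iff₀ hDpos] at h0
    rw [div_le_iff₀ hDpos] at h1
    constructor
    · exact le_of_sq_le_sq (by rw [sq_abs]; linarith) (abs_nonneg _)
    · exact le_of_sq_le_sq (by rw [sq_abs]; linarith) (by positivity)
  have hψ' : ∀ s, |deriv ψ s| ≤ 3 * B / δ := by
    intro s
    by_cases hs : deriv ψ s = 0
    · rw [hs, abs_zero]; positivity
    obtain ⟨-, h2⟩ := hψne s hs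
    rw [(hψd s).deriv, abs_mul, abs_div, abs_neg, abs_mul, abs_of_pos hDpos, abs_two]
    have hδD : δ * 2 ≤ D := mul_le_mul_of_nonneg_left (by linarith) hδ.le
    calc _ ≤ B * (2 * 3 / D) := by gcongr; exacts [(hS _).1, by linarith]
      _ ≤ B * (2 * 3 / (δ * 2)) := by gcongr
      _ = _ := by field_simp
  let φ : EuclideanSpace ℝ (Fin N) → ℝ := fun x => ∏ i, ψ (x i)
  have hd : ∀ x, HasFDerivAt φ (∑ i, (∏ j ∈ Finset.univ.erase i, ψ (x j)) •
      (deriv ψ (x i) • (EuclideanSpace.proj i : EuclideanSpace ℝ (Fin N) →L[ℝ] ℝ))) x := by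
    intro x
    refine HasFDerivAt.finsetProd fun i _ => ?_
    exact (hψd (x i)).differentiableAt.hasDerivAt.comp_hasFDerivAt x
      (EuclideanSpace.proj i : EuclideanSpace ℝ (Fin N) →L[ℝ] ℝ).hasFDerivAt
  have hpd : ∀ i x, pd i φ x = (∏ j ∈ Finset.univ.erase i, ψ (x j)) * deriv ψ (x i) := by
    intro i x
    rw [pd, (hd x).fderiv, sum_apply]
    simp only [smul_apply, PiLp.proj_apply, smul_eq_mul]
    rw [Finset.sum_eq_single i]
    · simp
    · intro j _ hj; simp [hj]
    · simp
  have hout : ∀ x, x ∉ closedBall 0 6 → φ x = 0 := by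
    intro x hx
    by_contra h
    refine hx ?_
    rw [mem_closedBall_zero_iff, EuclideanSpace.norm_eq, Real.sqrt_le_left (by norm_num)]
    have hj : ∀ j, ‖x j‖ ^ 2 ≤ 9 := by
      intro j
      have h1 : ψ (x j) ≠ 0 := fun h0 => h (Finset.prod_eq_zero (Finset.mem_univ j) h0)
      have h2 : 0 < ((t + δ) ^ 2 - x j ^ 2) / D := by
        by_contra h3
        exact h1 (Real.smoothTransition.zero_of_nonpos (not_lt.1 h3))
      rw [lt_div_iff₀ hDpos] at h2
      rw [Real.norm_eq_abs, sq_abs]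
      nlinarith
    calc _ ≤ ∑ _j : Fin N, (9 : ℝ) := Finset.sum_le_sum fun j _ => hj j
      _ = 9 * N := by simp [mul_comm]
      _ ≤ 6 ^ 2 := by
        have : (N : ℝ) ≤ 4 := by exact_mod_cast hN
        linarith
  refine ⟨φ, contDiff_prod fun i _ => hψ.comp (contDiff_coord i), fun x => Finset.prod_nonneg fun i _ => hψ0 _,
    fun x hx => Finset.prod_eq_one fun i _ => Real.smoothTransition.one_of_one_le ?_, hout,
    fun i x => ?_, fun i x hx => ⟨⟨i, ?_⟩, ?_⟩⟩
  · rw [le_div_iff₀ hDpos]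
    have h := (PiLp.norm_apply_le x i).trans (mem_closedBall_zero_iff.1 hx)
    rw [Real.norm_eq_abs] at h
    have := sq_le_one_iff_abs_le_one (x i) |>.2 h
    nlinarith
  · rw [hpd, abs_mul]
    refine (mul_le_of_le_one_left (abs_nonneg _) ?_).trans (hψ' _)
    rw [abs_of_nonneg (Finset.prod_nonneg fun _ _ => hψ0 _)]
    exact Finset.prod_le_one (fun _ _ => hψ0 _) fun _ _ => hψ1 _
  · rw [hpd] at hx
    obtain ⟨h1, h2⟩ := hψne _ (right_ne_zero_of_mul hx)
    rw [abs_le]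
    constructor <;> linarith
  · by_contra h
    refine hx ?_
    have : φ =ᶠ[nhds x] fun _ => 0 := by
      filter_upwards [isClosed_closedBall.isOpen_compl.mem_nhds h] with y hy using hout y hy
    rw [pd_congr i this]
    simp [pd]

end Cutoff

section Pointwise

variable {N : ℕ}

/-- The extended-nonnegative version of `dyadicPot`. -/
noncomputable def dyadicLPot (κ : ℝ) (J : ℕ) (G : EuclideanSpace ℝ (Fin N) → ENNReal)
    (x : EuclideanSpace ℝ (Fin N)) : ENNReal :=
  ∑ j ∈ Finset.range J, ENNReal.ofReal (((1 / 2 : ℝ) ^ j) ^ (-κ)) *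
    ∫⁻ y in closedBall x ((1 / 2) ^ j), G y

theorem dyadicLPot_mono {κ κ' : ℝ} (h : κ ≤ κ') (J : ℕ) (G : EuclideanSpace ℝ (Fin N) → ENNReal)
    (x : EuclideanSpace ℝ (Fin N)) : dyadicLPot κ J G x ≤ dyadicLPot κ' J G x := by
  unfold dyadicLPot
  refine Finset.sum_le_sum fun j _ => ?_
  exact mul_le_mul_left (ENNReal.ofReal_le_ofReal (Real.rpow_le_rpow_of_exponent_ge (by positivity)
    (pow_le_one₀ (by norm_num) (by norm_num)) (by linarith))) _

theorem measurable_dyadicLPot (κ : ℝ) (J : ℕ) {G : EuclideanSpace ℝ (Fin N) → ENNReal}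
    (hG : Measurable G) : Measurable (dyadicLPot κ J G) :=
  Finset.measurable_fun_sum _ fun _ _ => (measurable_setLIntegral_closedBall hG _).const_mul _

theorem setLIntegral_slab_one_add_le (hN : 1 ≤ N) {k z κ : ℝ} (hk : 1 ≤ k) (hkz : k ≤ z)
    (hκ : κ + (N - 1) * (1 / k - 1 / z) ≤ N) :
    ∃ C > 0, ∀ G : EuclideanSpace ℝ (Fin N) → ENNReal, Measurable G → ∀ (t M : ℝ) (J : ℕ),
      1 ≤ J → 1 ≤ M →
      (∀ j ∈ Finset.range J, ∫⁻ y in slab t (2 * (1 / 2) ^ j), G y ^ k ≤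
        ENNReal.ofReal ((1 / 2) ^ j * (J * M))) →
      ∫⁻ x in slab t ((1 / 2) ^ J) ∩ closedBall 0 6, (1 + dyadicLPot κ J G x) ^ z ≤
      ENNReal.ofReal (C * (1 / 2) ^ J * J ^ (2 * z) * M ^ (z / k)) := by
  have hk0 : 0 < k := by linarith
  have hz0 : 0 < z := by linarith
  obtain ⟨C, hC, hCs⟩ := setLIntegral_slab_dyadic_le hN hk hkz hκ
  refine ⟨2 ^ (z - 1) * (N * 2 ^ (N + 1) * 6 ^ (N - 1) + C), by positivity,
    fun G hG t M J hJ hM hGX => ?_⟩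
  have hJ1 : (1 : ℝ) ≤ J := by exact_mod_cast hJ
  have h := hCs G hG t (J * M) J (by positivity) hGX
  set δ : ℝ := (1 / 2) ^ J
  have hδ : 0 < δ := by positivity
  have hvol := volume_slab_inter_closedBall_le t hδ.le (s := 6) (by norm_num)
    (0 : EuclideanSpace ℝ (Fin N))
  have hm := (measurable_dyadicLPot κ J hG).pow_const z
  have hM1 : 1 ≤ M ^ (z / k) := Real.one_le_rpow hM (by positivity)
  have hJz : (1 : ℝ) ≤ J ^ (2 * z) := Real.one_le_rpow hJ1 (by positivity)
  calc _ ≤ ∫⁻ x in slab t δ ∩ closedBall 0 6, 2 ^ (z - 1) * (1 + dyadicLPot κ J G x ^ z) := by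
        refine lintegral_mono fun x => ?_
        simpa using ENNReal.rpow_add_le_mul_rpow_add_rpow 1 (dyadicLPot κ J G x) (hk.trans hkz)
    _ = 2 ^ (z - 1) * (volume (slab t δ ∩ closedBall (0 : EuclideanSpace ℝ (Fin N)) 6) +
          ∫⁻ x in slab t δ ∩ closedBall 0 6, dyadicLPot κ J G x ^ z) := by
        rw [lintegral_const_mul _
          (show Measurable fun x => 1 + dyadicLPot κ J G x ^ z from measurable_const.add hm), lintegral_add_right _ hm,
          setLIntegral_one]
    _ ≤ 2 ^ (z - 1) * (ENNReal.ofReal (N * 2 ^ (N + 1) * δ * 6 ^ (N - 1)) +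
          ENNReal.ofReal (C * δ * J ^ z * (J * M) ^ (z / k))) := by
        gcongr
        exact (lintegral_mono_set inter_subset_left).trans h
    _ ≤ _ := by
        rw [← ENNReal.ofReal_add (by positivity) (by positivity),
          show (2 : ENNReal) = ENNReal.ofReal 2 by simp,
          ENNReal.ofReal_rpow_of_pos (by norm_num), ← ENNReal.ofReal_mul (by positivity)]
        refine ENNReal.ofReal_le_ofReal ?_
        have e1 : (J : ℝ) ^ z * (J * M) ^ (z / k) ≤ J ^ (2 * z) * M ^ (z / k) := by
          rw [Real.mul_rpow (by positivity) (by positivity), ← mul_assoc,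
            ← Real.rpow_add (by positivity)]
          gcongr
          have : z / k ≤ z := div_le_self hz0.le hk
          linarith
        have e2 : 1 ≤ (J : ℝ) ^ (2 * z) * M ^ (z / k) := one_le_mul_of_one_le_of_one_le hJz hM1
        have e3 : N * 2 ^ (N + 1) * δ * 6 ^ (N - 1) ≤
            N * 2 ^ (N + 1) * δ * 6 ^ (N - 1) * (J ^ (2 * z) * M ^ (z / k)) :=
          le_mul_of_one_le_right (by positivity) e2
        have e4 : C * δ * J ^ z * (J * M) ^ (z / k) ≤ C * δ * (J ^ (2 * z) * M ^ (z / k)) := by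
          rw [mul_assoc (C * δ)]
          exact mul_le_mul_of_nonneg_left e1 (by positivity)
        calc _ ≤ 2 ^ (z - 1) * (N * 2 ^ (N + 1) * δ * 6 ^ (N - 1) * (J ^ (2 * z) * M ^ (z / k)) +
              C * δ * (J ^ (2 * z) * M ^ (z / k))) := by gcongr
          _ = _ := by ring

end Pointwise

section LapDensity

variable {N : ℕ}

/-- The density `-Δu` on the closed ball of radius `8`. -/
noncomputable def lapDensity (u : EuclideanSpace ℝ (Fin N) → ℝ) :
    EuclideanSpace ℝ (Fin N) → ENNReal :=
  (closedBall 0 8).indicator fun x => ENNReal.ofReal (-lap u x)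

variable {p q ε : ℝ} {Ω : Set (EuclideanSpace ℝ (Fin N))} {c d u v : EuclideanSpace ℝ (Fin N) → ℝ}

theorem measurable_indicator_of_continuousOn {f : EuclideanSpace ℝ (Fin N) → ℝ}
    {s : Set (EuclideanSpace ℝ (Fin N))} (hs : MeasurableSet s) (hf : ContinuousOn f s) :
    Measurable (s.indicator fun x => ENNReal.ofReal (f x)) := by
  classical
  rw [← piecewise_eq_indicator]
  exact (ENNReal.continuous_ofReal.comp_continuousOn hf).measurable_piecewise
    continuousOn_const hs

theorem LocSys.measurable_lapDensity (h : LocSys p q ε Ω c d u v) : Measurable (lapDensity u) :=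
  measurable_indicator_of_continuousOn isClosed_closedBall.measurableSet
    (h.continuousOn_lap.mono ((closedBall_subset_closedBall (by norm_num)).trans h.ball))

theorem LocSys.integrableOn (h : LocSys p q ε Ω c d u v) {f : EuclideanSpace ℝ (Fin N) → ℝ}
    (hf : ContinuousOn f Ω) {r : ℝ} (hr : r ≤ 100) : IntegrableOn f (closedBall 0 r) :=
  (hf.mono ((closedBall_subset_closedBall hr).trans h.ball)).integrableOn_compact
    (isCompact_closedBall _ _)

theorem LocSys.lintegral_eq (h : LocSys p q ε Ω c d u v) {f : EuclideanSpace ℝ (Fin N) → ℝ}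
    (hf : ContinuousOn f Ω) (hf0 : ∀ x ∈ Ω, 0 ≤ f x) {r : ℝ} (hr : r ≤ 100) :
    ∫⁻ x in closedBall 0 r, ENNReal.ofReal (f x) = ENNReal.ofReal (∫ x in closedBall 0 r, f x) := by
  refine (ofReal_integral_eq_lintegral_ofReal (h.integrableOn hf hr) ?_).symm
  exact (ae_restrict_iff' isClosed_closedBall.measurableSet).2 (Eventually.of_forall fun x hx =>
    hf0 x (h.ball (closedBall_subset_closedBall hr hx)))

theorem exists_lintegral_lapDensity_rpow_le (hN : 3 ≤ N) (hp : 0 < p) (hq : 0 < q)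
    (hpq : 1 < p * q) {k : ℝ} (hk : 1 ≤ k) (hpk : p * k ≤ p + 1) :
    ∃ C ≥ 1, ∀ (ε : ℝ) (Ω : Set (EuclideanSpace ℝ (Fin N)))
      (c d u v : EuclideanSpace ℝ (Fin N) → ℝ), LocSys p q ε Ω c d u v →
      (∫⁻ x in closedBall 0 8, ENNReal.ofReal (v x ^ p)) ≤ ENNReal.ofReal C ∧
      ∀ E : ℝ, 1 ≤ E → (∫ x in closedBall 0 8, v x ^ (p + 1)) ≤ E →
        ∫⁻ x, lapDensity u x ^ k ≤ ENNReal.ofReal (C * E ^ (p * (k - 1))) := by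
  obtain ⟨C, hC, hCI⟩ := exists_integral_le hN hp hq hpq
  have h4 : (1 : ℝ) ≤ 4 ^ k := Real.one_le_rpow (by norm_num) (by linarith)
  refine ⟨4 ^ k * (4 * C + 1), by nlinarith, fun ε Ω c d u v h => ?_⟩
  have h8 : closedBall (0 : EuclideanSpace ℝ (Fin N)) 8 ⊆ Ω :=
    (closedBall_subset_closedBall (by norm_num)).trans h.ball
  have hI : (∫ x in closedBall 0 8, v x ^ p) ≤ 4 * C := by
    have h1 : (∫ x in closedBall 0 8, 1 / 4 * v x ^ p) ≤ ∫ x in closedBall 0 8, -lap u x :=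
      setIntegral_mono_on (h.integrableOn ((h.symm.continuousOn_rpow p).const_smul (1 / 4 : ℝ))
        (by norm_num)) (h.integrableOn h.continuousOn_lap (by norm_num))
        isClosed_closedBall.measurableSet fun x hx => h.equ_lower (h8 hx)
    rw [integral_const_mul] at h1
    linarith [(hCI ε Ω c d u v h).1]
  refine ⟨?_, fun E hE hEv => ?_⟩
  · rw [h.lintegral_eq (h.symm.continuousOn_rpow p)
      (fun x hx => Real.rpow_nonneg (h.vpos x hx).le _) (by norm_num)]
    exact ENNReal.ofReal_le_ofReal (by nlinarith)
  · have hE0 : 0 < E := by linarith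
    let g : EuclideanSpace ℝ (Fin N) → ℝ := fun x =>
      4 ^ k * (E ^ (p * k - p) * v x ^ p + E ^ (p * k - (p + 1)) * v x ^ (p + 1))
    have hg : ContinuousOn g Ω := ((continuousOn_const.mul (h.symm.continuousOn_rpow p)).add
      (continuousOn_const.mul (h.symm.continuousOn_rpow (p + 1)))).const_smul (4 ^ k : ℝ)
    have hg0 : ∀ x ∈ Ω, 0 ≤ g x := fun x hx => by
      have := h.vpos x hx
      positivity
    calc ∫⁻ x, lapDensity u x ^ k = ∫⁻ x in closedBall 0 8, ENNReal.ofReal (-lap u x) ^ k := by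
          rw [← lintegral_indicator isClosed_closedBall.measurableSet]
          refine lintegral_congr fun x => ?_
          by_cases hx : x ∈ closedBall (0 : EuclideanSpace ℝ (Fin N)) 8
          · simp only [lapDensity, indicator_of_mem hx]
          · simp only [lapDensity, indicator_of_notMem hx]
            exact ENNReal.zero_rpow_of_pos (by linarith)
      _ ≤ ∫⁻ x in closedBall 0 8, ENNReal.ofReal (g x) := by
          refine setLIntegral_mono' isClosed_closedBall.measurableSet fun x hx => ?_
          have hv := h.vpos x (h8 hx)
          rw [ENNReal.ofReal_rpow_of_nonneg (h.equ_nonneg (h8 hx)) (by linarith)]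
          refine ENNReal.ofReal_le_ofReal ?_
          calc (-lap u x) ^ k ≤ (4 * v x ^ p) ^ k :=
                Real.rpow_le_rpow (h.equ_nonneg (h8 hx)) (h.equ_upper (h8 hx)) (by linarith)
            _ = 4 ^ k * v x ^ (p * k) := by
                rw [Real.mul_rpow (by norm_num) (by positivity), ← Real.rpow_mul hv.le]
            _ ≤ g x := mul_le_mul_of_nonneg_left
                (rpow_le_of_split hv hE0 (by nlinarith) hpk) (by positivity)
      _ = ENNReal.ofReal (∫ x in closedBall 0 8, g x) := h.lintegral_eq hg hg0 (by norm_num)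
      _ ≤ _ := by
          refine ENNReal.ofReal_le_ofReal ?_
          have i1 := h.integrableOn (h.symm.continuousOn_rpow p) (r := 8) (by norm_num)
          have i2 := h.integrableOn (h.symm.continuousOn_rpow (p + 1)) (r := 8) (by norm_num)
          have e1 : E ^ (p * k - p) = E ^ (p * (k - 1)) := by ring_nf
          have e2 : E ^ (p * k - (p + 1)) * E = E ^ (p * (k - 1)) := by
            rw [← Real.rpow_add_one hE0.ne']; ring_nf
          simp only [g]
          rw [integral_const_mul, integral_add (i1.const_mul _) (i2.const_mul _),
            integral_const_mul, integral_const_mul, mul_assoc (4 ^ k : ℝ)]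
          refine mul_le_mul_of_nonneg_left ?_ (by positivity)
          calc _ ≤ E ^ (p * k - p) * (4 * C) + E ^ (p * k - (p + 1)) * E := by gcongr
            _ = _ := by rw [e1, e2]; ring

theorem exists_le_dyadicLPot (hN : 3 ≤ N) (hp : 0 < p) (hq : 0 < q) (hpq : 1 < p * q) :
    ∃ C ≥ 1, ∀ (ε : ℝ) (Ω : Set (EuclideanSpace ℝ (Fin N)))
      (c d u v : EuclideanSpace ℝ (Fin N) → ℝ), LocSys p q ε Ω c d u v → ∀ (Λ : ℝ) (J : ℕ),
      (∀ x ∈ closedBall 0 100, v x ≤ Λ) → (1 / 2 : ℝ) ^ J * Λ ^ p ≤ 1 → ∀ x ∈ closedBall 0 6,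
      ENNReal.ofReal (u x) ≤ ENNReal.ofReal C * (1 + dyadicLPot (N - 2) J (lapDensity u) x) ∧
      ∀ i, ENNReal.ofReal |pd i u x| ≤
        ENNReal.ofReal C * (1 + dyadicLPot (N - 1) J (lapDensity u) x) := by
  obtain ⟨C, hC, hCI⟩ := exists_integral_le hN hp hq hpq
  obtain ⟨D, hD, hDI⟩ := exists_dyadic_le hN
  refine ⟨D * (C + 4) + 1, by nlinarith, fun ε Ω c d u v h Λ J hΛ hJ x hx => ?_⟩
  have hb : closedBall x 1 ⊆ Ω := h.ball_sub hx (by norm_num)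
  have h8 : closedBall (0 : EuclideanSpace ℝ (Fin N)) 8 ⊆ Ω :=
    (closedBall_subset_closedBall (by norm_num)).trans h.ball
  have hb8 : closedBall x 1 ⊆ closedBall 0 8 :=
    closedBall_subset_closedBall' (by rw [mem_closedBall] at hx; linarith)
  have hI : (∫ y in closedBall x 1, u y) ≤ C :=
    (setIntegral_mono_set (h.integrableOn h.cu.continuousOn (by norm_num))
      ((ae_restrict_iff' isClosed_closedBall.measurableSet).2 (Eventually.of_forall fun y hy =>
        (h.upos y (h8 hy)).le)) hb8.eventuallyLE).trans (hCI ε Ω c d u v h).2.2.2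
  have hpot : ∀ κ, ENNReal.ofReal (dyadicPot κ J (fun y => -lap u y) x) =
      dyadicLPot κ J (lapDensity u) x := by
    intro κ
    rw [dyadicPot, dyadicLPot, ENNReal.ofReal_sum_of_nonneg]
    · refine Finset.sum_congr rfl fun j _ => ?_
      have hs : closedBall x ((1 / 2 : ℝ) ^ j) ⊆ closedBall x 1 :=
        closedBall_subset_closedBall (pow_le_one₀ (by norm_num) (by norm_num))
      rw [ENNReal.ofReal_mul (by positivity), ofReal_integral_eq_lintegral_ofReal]
      · congr 1
        refine setLIntegral_congr_fun isClosed_closedBall.measurableSet fun y hy => ?_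
        simp only [lapDensity, indicator_of_mem (hb8 (hs hy))]
      · exact (h.continuousOn_lap.mono (hs.trans hb)).integrableOn_compact (isCompact_closedBall _ _)
      · exact (ae_restrict_iff' isClosed_closedBall.measurableSet).2 (Eventually.of_forall
          fun y hy => h.equ_nonneg (hb (hs hy)))
    · intro j _
      refine mul_nonneg (by positivity) (setIntegral_nonneg isClosed_closedBall.measurableSet
        fun y hy => h.equ_nonneg (hb (closedBall_subset_closedBall
          (pow_le_one₀ (by norm_num) (by norm_num)) hy)))
  have hpot0 : ∀ κ, 0 ≤ dyadicPot κ J (fun y => -lap u y) x := fun κ =>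
    Finset.sum_nonneg fun j _ => mul_nonneg (by positivity)
      (setIntegral_nonneg isClosed_closedBall.measurableSet fun y hy => h.equ_nonneg
        (hb (closedBall_subset_closedBall (pow_le_one₀ (by norm_num) (by norm_num)) hy)))
  have hJ1 : (1 / 2 : ℝ) ^ J ≤ 1 := pow_le_one₀ (by norm_num) (by norm_num)
  have hΛ0 : 0 ≤ Λ := (h.vpos x (hb (mem_closedBall_self (by norm_num)))).le.trans
    (hΛ x (closedBall_subset_closedBall (by norm_num) hx))
  have hub : ∀ y ∈ closedBall x 1, -lap u y ≤ 4 * Λ ^ p := fun y hy =>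
    (h.equ_upper (hb hy)).trans (mul_le_mul_of_nonneg_left (Real.rpow_le_rpow
      (h.vpos y (hb hy)).le (hΛ y (closedBall_subset_closedBall (by norm_num) (hb8 hy))) hp.le)
      (by norm_num))
  obtain ⟨h1, h2⟩ := hDI Ω u x (4 * Λ ^ p) h.isOpen h.cu hb (fun y hy => (h.upos y (hb hy)).le)
    (fun y hy => h.equ_nonneg (hb hy)) hub J
  have conv : ∀ (κ a : ℝ), a ≤ D * (C + dyadicPot κ J (fun y => -lap u y) x + 4) →
      ENNReal.ofReal a ≤ ENNReal.ofReal (D * (C + 4) + 1) *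
        (1 + dyadicLPot κ J (lapDensity u) x) := by
    intro κ a ha
    rw [← hpot, ← ENNReal.ofReal_one, ← ENNReal.ofReal_add zero_le_one (hpot0 κ),
      ← ENNReal.ofReal_mul (by positivity)]
    refine ENNReal.ofReal_le_ofReal (ha.trans ?_)
    have := hpot0 κ
    have h3 : 0 ≤ D * C * dyadicPot κ J (fun y => -lap u y) x := by positivity
    have h4 : 0 ≤ D * dyadicPot κ J (fun y => -lap u y) x := by positivity
    nlinarith
  refine ⟨conv _ _ (h1.trans (mul_le_mul_of_nonneg_left ?_ hD.le)), fun i =>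
    conv _ _ ((h2 i).trans (mul_le_mul_of_nonneg_left ?_ hD.le))⟩
  · have : ((1 / 2 : ℝ) ^ J) ^ 2 * (4 * Λ ^ p) ≤ 4 := by
      have : 0 ≤ (1 / 2 : ℝ) ^ J := by positivity
      calc _ = 4 * ((1 / 2 : ℝ) ^ J * ((1 / 2 : ℝ) ^ J * Λ ^ p)) := by ring
        _ ≤ 4 * (1 * 1) := by gcongr
        _ = 4 := by norm_num
    linarith
  · linarith

theorem exists_common_good_slab (hN : 1 ≤ N) {F : Fin 3 → EuclideanSpace ℝ (Fin N) → ENNReal}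
    (hF : ∀ i, Measurable (F i)) {M : Fin 3 → ℝ} (hM : ∀ i, 0 < M i)
    (h1 : ∀ i, ∫⁻ x, F i x ≤ ENNReal.ofReal (M i)) {J : ℕ} (hJ : 1 ≤ J) :
    ∃ t ∈ Icc (1 : ℝ) 2, ∀ i, ∀ j ∈ Finset.range (J + 1),
      ∫⁻ x in slab t (2 * (1 / 2) ^ j), F i x ≤
        ENNReal.ofReal ((1 / 2) ^ j * (J * (48 * N * M i))) := by
  have hm : ∀ i, Measurable fun x => ENNReal.ofReal ((3 * M i)⁻¹) * F i x := fun i =>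
    (hF i).const_mul _
  obtain ⟨t, ht, h⟩ := exists_good_slab hN
    (G := fun x => ∑ i, ENNReal.ofReal ((3 * M i)⁻¹) * F i x)
    (Finset.measurable_fun_sum _ fun i _ => hm i) (by
      rw [lintegral_finsetSum _ fun i _ => hm i]
      calc _ ≤ ∑ _i : Fin 3, ENNReal.ofReal (1 / 3) := by
            refine Finset.sum_le_sum fun i _ => ?_
            rw [lintegral_const_mul _ (hF i)]
            refine (mul_le_mul_right (h1 i) _).trans ?_
            have := hM i
            rw [← ENNReal.ofReal_mul (by positivity)]
            refine ENNReal.ofReal_le_ofReal (le_of_eq ?_)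
            field_simp
        _ = 1 := by
            rw [← ENNReal.ofReal_sum_of_nonneg (by intros; norm_num)]
            norm_num) J
  refine ⟨t, ht, fun i j hj => ?_⟩
  have hMi := hM i
  have hJ1 : (1 : ℝ) ≤ J := by exact_mod_cast hJ
  calc ∫⁻ x in slab t (2 * (1 / 2) ^ j), F i x
      = ENNReal.ofReal (3 * M i) *
        ∫⁻ x in slab t (2 * (1 / 2) ^ j), ENNReal.ofReal ((3 * M i)⁻¹) * F i x := by
        rw [lintegral_const_mul _ (hF i), ← mul_assoc, ← ENNReal.ofReal_mul (by positivity),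
          mul_inv_cancel₀ (by positivity), ENNReal.ofReal_one, one_mul]
    _ ≤ ENNReal.ofReal (3 * M i) * ENNReal.ofReal (8 * N * (J + 1) * (1 / 2) ^ j) := by
        gcongr
        refine le_trans (lintegral_mono fun x => ?_) (h j hj)
        exact Finset.single_le_sum (f := fun i => ENNReal.ofReal ((3 * M i)⁻¹) * F i x)
          (fun _ _ => zero_le) (Finset.mem_univ i)
    _ ≤ _ := by
        rw [← ENNReal.ofReal_mul (by positivity)]
        refine ENNReal.ofReal_le_ofReal ?_
        have h0 : 0 ≤ M i * N * (1 / 2 : ℝ) ^ j := by positivity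
        nlinarith [mul_le_mul_of_nonneg_right hJ1 h0]

theorem exists_dyadic_scale (m : ℝ) (hm : 0 ≤ m) {η s : ℝ} (hη : 0 < η) (hs : 0 ≤ s) :
    ∃ C > 0, ∀ Λ : ℝ, 1 ≤ Λ → ∃ J : ℕ, 1 ≤ J ∧ (1 / 2 : ℝ) ^ J * Λ ^ m ≤ 1 ∧
      (J : ℝ) ^ s ≤ C * Λ ^ η := by
  have hl := Real.log_pos one_lt_two
  set θ := η / (s + 1) with hθ
  have hθ0 : 0 < θ := by positivity
  refine ⟨(m / Real.log 2 / θ + 2) ^ s, by positivity, fun Λ hΛ => ?_⟩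
  have hΛ0 : 0 < Λ := by linarith
  have hlog : 0 ≤ Real.log Λ := Real.log_nonneg hΛ
  set y := m * Real.log Λ / Real.log 2 with hy
  have hy0 : 0 ≤ y := by positivity
  refine ⟨⌈y⌉₊ + 1, by omega, ?_, ?_⟩
  · have h1 : y ≤ (⌈y⌉₊ + 1 : ℕ) := by push_cast; linarith [Nat.le_ceil y]
    rw [hy, div_le_iff₀ hl] at h1
    rw [one_div, inv_pow, inv_mul_le_iff₀ (by positivity), mul_one,
      ← Real.log_le_log_iff (by positivity) (by positivity), Real.log_rpow hΛ0, Real.log_pow]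
    exact h1
  · have h2 : ((⌈y⌉₊ + 1 : ℕ) : ℝ) ≤ (m / Real.log 2 / θ + 2) * Λ ^ θ := by
      have h3 := (Nat.ceil_lt_add_one hy0).le
      have h4 : Real.log Λ ≤ Λ ^ θ / θ := Real.log_le_rpow_div hΛ0.le hθ0
      have h5 : 1 ≤ Λ ^ θ := Real.one_le_rpow hΛ hθ0.le
      have h6 : y ≤ m / Real.log 2 / θ * Λ ^ θ := by
        calc y = m / Real.log 2 * Real.log Λ := by rw [hy]; ring
          _ ≤ m / Real.log 2 * (Λ ^ θ / θ) := by gcongr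
          _ = _ := by ring
      push_cast
      linarith
    calc _ ≤ ((m / Real.log 2 / θ + 2) * Λ ^ θ) ^ s := by gcongr
      _ = (m / Real.log 2 / θ + 2) ^ s * Λ ^ (θ * s) := by
        rw [Real.mul_rpow (by positivity) (by positivity), ← Real.rpow_mul hΛ0.le]
      _ ≤ _ := by
        refine mul_le_mul_of_nonneg_left (Real.rpow_le_rpow_of_exponent_le hΛ ?_) (by positivity)
        rw [hθ, div_mul_eq_mul_div, div_le_iff₀ (by positivity)]
        nlinarith

end LapDensity

section FieldBound

variable {N : ℕ} {p q ε : ℝ} {Ω : Set (EuclideanSpace ℝ (Fin N))}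
  {c d u v φ : EuclideanSpace ℝ (Fin N) → ℝ}

theorem abs_pohField_le {θ₁ θ₂ : ℝ} {u v Φ : EuclideanSpace ℝ (Fin N) → ℝ} {i : Fin N}
    {x : EuclideanSpace ℝ (Fin N)} {R : ℝ} (hx : x ∈ closedBall 0 R) :
    |pohField θ₁ θ₂ u v Φ i x| ≤ 3 * R * ((∑ j, |pd j u x|) * ∑ j, |pd j v x|) + R * |Φ x| +
      |θ₁| * (|v x| * ∑ j, |pd j u x|) + |θ₂| * (|u x| * ∑ j, |pd j v x|) := by
  have hxi : ∀ j, |x j| ≤ R := fun j =>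
    (PiLp.norm_apply_le x j).trans (mem_closedBall_zero_iff.1 hx)
  have hR : 0 ≤ R := (abs_nonneg _).trans (hxi i)
  have hS : ∀ w : EuclideanSpace ℝ (Fin N) → ℝ, |∑ j, x j * pd j w x| ≤ R * ∑ j, |pd j w x| := by
    intro w
    rw [Finset.mul_sum]
    refine (Finset.abs_sum_le_sum_abs _ _).trans (Finset.sum_le_sum fun j _ => ?_)
    rw [abs_mul]
    exact mul_le_mul_of_nonneg_right (hxi j) (abs_nonneg _)
  have hA : ∀ w : EuclideanSpace ℝ (Fin N) → ℝ, |pd i w x| ≤ ∑ j, |pd j w x| := fun w =>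
    Finset.single_le_sum (f := fun j => |pd j w x|) (fun _ _ => abs_nonneg _) (Finset.mem_univ i)
  have hD : |∑ j, pd j u x * pd j v x| ≤ (∑ j, |pd j u x|) * ∑ j, |pd j v x| := by
    rw [Finset.mul_sum]
    refine (Finset.abs_sum_le_sum_abs _ _).trans (Finset.sum_le_sum fun j _ => ?_)
    rw [abs_mul]
    refine mul_le_mul_of_nonneg_right ?_ (abs_nonneg _)
    exact Finset.single_le_sum (f := fun j => |pd j u x|) (fun _ _ => abs_nonneg _)
      (Finset.mem_univ j)
  set A := ∑ j, |pd j u x|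
  set B := ∑ j, |pd j v x|
  have hA0 : 0 ≤ A := Finset.sum_nonneg fun _ _ => abs_nonneg _
  have hB0 : 0 ≤ B := Finset.sum_nonneg fun _ _ => abs_nonneg _
  have t1 : |(∑ j, x j * pd j u x) * pd i v x| ≤ R * A * B := by
    rw [abs_mul]; exact mul_le_mul (hS u) (hA v) (abs_nonneg _) (by positivity)
  have t2 : |(∑ j, x j * pd j v x) * pd i u x| ≤ R * B * A := by
    rw [abs_mul]; exact mul_le_mul (hS v) (hA u) (abs_nonneg _) (by positivity)
  have t3 : |x i * ∑ j, pd j u x * pd j v x| ≤ R * (A * B) := by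
    rw [abs_mul]; exact mul_le_mul (hxi i) hD (abs_nonneg _) hR
  have t4 : |x i * Φ x| ≤ R * |Φ x| := by
    rw [abs_mul]; exact mul_le_mul_of_nonneg_right (hxi i) (abs_nonneg _)
  have t5 : |θ₁ * (v x * pd i u x)| ≤ |θ₁| * (|v x| * A) := by
    rw [abs_mul, abs_mul]; gcongr; exact hA u
  have t6 : |θ₂ * (u x * pd i v x)| ≤ |θ₂| * (|u x| * B) := by
    rw [abs_mul, abs_mul]; gcongr; exact hA v
  rw [pohField]
  rw [abs_le] at t1 t2 t3 t4 t5 t6 ⊢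
  constructor <;> linarith [t1.1, t1.2, t2.1, t2.2, t3.1, t3.2, t4.1, t4.2, t5.1, t5.2, t6.1, t6.2]

theorem LocSys.enorm_sum_pohField_le (h : LocSys p q ε Ω c d u v) (hp : 0 < p) (hq : 0 < q)
    {θ₁ θ₂ a : ℝ} {x : EuclideanSpace ℝ (Fin N)} (hx : x ∈ closedBall 0 6)
    (hφ : ∀ i, |pd i φ x| ≤ a) {C : ℝ} (hC : 1 ≤ C) {X Y : ENNReal}
    (hu : ENNReal.ofReal (u x) ≤ ENNReal.ofReal C * X)
    (hv : ENNReal.ofReal (v x) ≤ ENNReal.ofReal C * Y)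
    (hpu : ∀ i, ENNReal.ofReal |pd i u x| ≤ ENNReal.ofReal C * X)
    (hpv : ∀ i, ENNReal.ofReal |pd i v x| ≤ ENNReal.ofReal C * Y) :
    ‖∑ i, pd i φ x * pohField θ₁ θ₂ u v
      (fun y => c y * v y ^ (p + 1) / (p + 1) + d y * u y ^ (q + 1) / (q + 1)) i x‖ₑ ≤
    ENNReal.ofReal (N * a * (18 * N ^ 2 * C ^ 2 + 24 + (|θ₁| + |θ₂|) * N * C ^ 2)) *
      (X * Y + ENNReal.ofReal (u x ^ (q + 1)) + ENNReal.ofReal (v x ^ (p + 1))) := by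
  have hxΩ : x ∈ Ω := h.ball (closedBall_subset_closedBall (by norm_num) hx)
  have hu0 := h.upos x hxΩ
  have hv0 := h.vpos x hxΩ
  set Φ : EuclideanSpace ℝ (Fin N) → ℝ :=
    fun y => c y * v y ^ (p + 1) / (p + 1) + d y * u y ^ (q + 1) / (q + 1)
  set A := ∑ j, |pd j u x|
  set B := ∑ j, |pd j v x|
  have hA0 : 0 ≤ A := Finset.sum_nonneg fun _ _ => abs_nonneg _
  have hB0 : 0 ≤ B := Finset.sum_nonneg fun _ _ => abs_nonneg _
  have hΦ : |Φ x| ≤ 4 * (v x ^ (p + 1) + u x ^ (q + 1)) := by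
    have hc := h.cmem x hxΩ
    have hd := h.dmem x hxΩ
    have e1 : c x * v x ^ (p + 1) / (p + 1) ≤ 4 * v x ^ (p + 1) :=
      (div_le_self (mul_nonneg (by linarith [hc.1]) (by positivity)) (by linarith)).trans
        (mul_le_mul_of_nonneg_right hc.2 (by positivity))
    have e2 : d x * u x ^ (q + 1) / (q + 1) ≤ 4 * u x ^ (q + 1) :=
      (div_le_self (mul_nonneg (by linarith [hd.1]) (by positivity)) (by linarith)).trans
        (mul_le_mul_of_nonneg_right hd.2 (by positivity))
    have e3 : 0 ≤ c x * v x ^ (p + 1) / (p + 1) :=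
      div_nonneg (mul_nonneg (by linarith [hc.1]) (by positivity)) (by linarith)
    have e4 : 0 ≤ d x * u x ^ (q + 1) / (q + 1) :=
      div_nonneg (mul_nonneg (by linarith [hd.1]) (by positivity)) (by linarith)
    rw [abs_of_nonneg (add_nonneg e3 e4)]
    linarith
  have hA : ∀ (w : EuclideanSpace ℝ (Fin N) → ℝ) (Z : ENNReal),
      (∀ i, ENNReal.ofReal |pd i w x| ≤ ENNReal.ofReal C * Z) →
      ENNReal.ofReal (∑ j, |pd j w x|) ≤ ENNReal.ofReal (N * C) * Z := by
    intro w Z hw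
    rw [ENNReal.ofReal_sum_of_nonneg fun _ _ => abs_nonneg _]
    refine (Finset.sum_le_sum fun j _ => hw j).trans (le_of_eq ?_)
    simp [ENNReal.ofReal_mul, mul_assoc]
  have hAX := hA u X hpu
  have hBY := hA v Y hpv
  rcases N.eq_zero_or_pos with rfl | hN
  · simp
  have ha : 0 ≤ a := (abs_nonneg _).trans (hφ ⟨0, hN⟩)
  let T : ℝ := 18 * (A * B) + 24 * (v x ^ (p + 1) + u x ^ (q + 1)) + |θ₁| * (v x * A) +
    |θ₂| * (u x * B)
  have hT : ∀ i, |pohField θ₁ θ₂ u v Φ i x| ≤ T := by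
    intro i
    refine (abs_pohField_le hx).trans ?_
    rw [abs_of_pos hu0, abs_of_pos hv0]
    simp only [T]
    linarith
  have hsum : |∑ i, pd i φ x * pohField θ₁ θ₂ u v Φ i x| ≤ N * a * T := by
    refine (Finset.abs_sum_le_sum_abs _ _).trans ?_
    calc _ ≤ ∑ _i : Fin N, a * T := by
          refine Finset.sum_le_sum fun i _ => ?_
          rw [abs_mul]
          exact mul_le_mul (hφ i) (hT i) (abs_nonneg _) ha
      _ = _ := by simp [mul_assoc]
  rw [Real.enorm_eq_ofReal_abs]
  refine (ENNReal.ofReal_le_ofReal hsum).trans ?_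
  have m1 : ENNReal.ofReal (A * B) ≤ ENNReal.ofReal (N ^ 2 * C ^ 2) * (X * Y) := by
    rw [ENNReal.ofReal_mul hA0]
    refine (mul_le_mul' hAX hBY).trans (le_of_eq ?_)
    rw [show (N : ℝ) ^ 2 * C ^ 2 = (N * C) * (N * C) by ring,
      ENNReal.ofReal_mul (p := N * C) (by positivity)]
    ring
  have m2 : ENNReal.ofReal (v x * A) ≤ ENNReal.ofReal (N * C ^ 2) * (X * Y) := by
    rw [ENNReal.ofReal_mul hv0.le]
    refine (mul_le_mul' hv hAX).trans (le_of_eq ?_)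
    rw [show (N : ℝ) * C ^ 2 = C * (N * C) by ring, ENNReal.ofReal_mul (p := C) (by positivity)]
    ring
  have m3 : ENNReal.ofReal (u x * B) ≤ ENNReal.ofReal (N * C ^ 2) * (X * Y) := by
    rw [ENNReal.ofReal_mul hu0.le]
    refine (mul_le_mul' hu hBY).trans (le_of_eq ?_)
    rw [show (N : ℝ) * C ^ 2 = C * (N * C) by ring, ENNReal.ofReal_mul (p := C) (by positivity)]
    ring
  have hTle : ENNReal.ofReal T ≤
      ENNReal.ofReal (18 * N ^ 2 * C ^ 2 + 24 + (|θ₁| + |θ₂|) * N * C ^ 2) *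
      (X * Y + ENNReal.ofReal (u x ^ (q + 1)) + ENNReal.ofReal (v x ^ (p + 1))) := by
    have hκ : 0 ≤ 18 * (N : ℝ) ^ 2 * C ^ 2 + (|θ₁| + |θ₂|) * N * C ^ 2 := by positivity
    calc ENNReal.ofReal T = ENNReal.ofReal 18 * ENNReal.ofReal (A * B) + ENNReal.ofReal 24 *
          (ENNReal.ofReal (v x ^ (p + 1)) + ENNReal.ofReal (u x ^ (q + 1))) +
          ENNReal.ofReal |θ₁| * ENNReal.ofReal (v x * A) +
          ENNReal.ofReal |θ₂| * ENNReal.ofReal (u x * B) := by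
          simp only [T]
          rw [ENNReal.ofReal_add (by positivity) (by positivity),
            ENNReal.ofReal_add (by positivity) (by positivity),
            ENNReal.ofReal_add (by positivity) (by positivity), ENNReal.ofReal_mul (by norm_num),
            ENNReal.ofReal_mul (p := 24) (by norm_num),
            ENNReal.ofReal_add (p := v x ^ (p + 1)) (by positivity) (by positivity),
            ENNReal.ofReal_mul (p := |θ₁|) (by positivity),
            ENNReal.ofReal_mul (p := |θ₂|) (by positivity)]
      _ ≤ ENNReal.ofReal 18 * (ENNReal.ofReal (N ^ 2 * C ^ 2) * (X * Y)) + ENNReal.ofReal 24 *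
          (ENNReal.ofReal (v x ^ (p + 1)) + ENNReal.ofReal (u x ^ (q + 1))) +
          ENNReal.ofReal |θ₁| * (ENNReal.ofReal (N * C ^ 2) * (X * Y)) +
          ENNReal.ofReal |θ₂| * (ENNReal.ofReal (N * C ^ 2) * (X * Y)) := by gcongr
      _ = ENNReal.ofReal (18 * N ^ 2 * C ^ 2 + (|θ₁| + |θ₂|) * N * C ^ 2) * (X * Y) +
          ENNReal.ofReal 24 * (ENNReal.ofReal (v x ^ (p + 1)) + ENNReal.ofReal (u x ^ (q + 1))) := by
          rw [show 18 * (N : ℝ) ^ 2 * C ^ 2 + (|θ₁| + |θ₂|) * N * C ^ 2 =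
            18 * (N ^ 2 * C ^ 2) + |θ₁| * (N * C ^ 2) + |θ₂| * (N * C ^ 2) by ring,
            ENNReal.ofReal_add (by positivity) (by positivity),
            ENNReal.ofReal_add (by positivity) (by positivity),
            ENNReal.ofReal_mul (p := 18) (by norm_num), ENNReal.ofReal_mul (p := |θ₁|) (by positivity),
            ENNReal.ofReal_mul (p := |θ₂|) (by positivity)]
          ring
      _ ≤ ENNReal.ofReal (18 * N ^ 2 * C ^ 2 + 24 + (|θ₁| + |θ₂|) * N * C ^ 2) * (X * Y) +
          ENNReal.ofReal (18 * N ^ 2 * C ^ 2 + 24 + (|θ₁| + |θ₂|) * N * C ^ 2) *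
          (ENNReal.ofReal (v x ^ (p + 1)) + ENNReal.ofReal (u x ^ (q + 1))) := by
          gcongr ENNReal.ofReal ?_ * _ + ENNReal.ofReal ?_ * _ <;> linarith
      _ = _ := by ring
  calc _ = ENNReal.ofReal (N * a) * ENNReal.ofReal T := ENNReal.ofReal_mul (by positivity)
    _ ≤ _ := by
      rw [ENNReal.ofReal_mul (p := N * a) (by positivity), mul_assoc]
      gcongr

/-- The Pohozaev energy in a ball about the origin. -/
noncomputable def energy (p q : ℝ) (u v : EuclideanSpace ℝ (Fin N) → ℝ) (r : ℝ) : ℝ :=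
  ∫ x in closedBall 0 r, (v x ^ (p + 1) + u x ^ (q + 1))

theorem LocSys.continuousOn_energy (h : LocSys p q ε Ω c d u v) :
    ContinuousOn (fun x => v x ^ (p + 1) + u x ^ (q + 1)) Ω :=
  (h.symm.continuousOn_rpow _).add (h.continuousOn_rpow _)

theorem LocSys.le_integral_pohozaev (h : LocSys p q ε Ω c d u v) (hp : 0 < p) (hq : 0 < q)
    {θ₁ θ₂ γ : ℝ} (hγ₁ : γ + θ₁ ≤ N / (p + 1)) (hγ₂ : γ + θ₂ ≤ N / (q + 1)) (hγ : 0 < γ)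
    (hε : ε ≤ γ / 8) (hφ : ContDiff ℝ 1 φ) (hφ0 : ∀ x, 0 ≤ φ x)
    (hφ1 : ∀ x ∈ closedBall 0 1, φ x = 1) (hφK : ∀ x, x ∉ closedBall 0 6 → φ x = 0) :
    γ / 8 * energy p q u v 1 ≤
    ∫ x, φ x * (((N * c x + ∑ j, x j * pd j c x) / (p + 1) - θ₁ * c x) * v x ^ (p + 1) +
        ((N * d x + ∑ j, x j * pd j d x) / (q + 1) - θ₂ * d x) * u x ^ (q + 1)) := by
  set g : EuclideanSpace ℝ (Fin N) → ℝ := fun x =>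
    ((N * c x + ∑ j, x j * pd j c x) / (p + 1) - θ₁ * c x) * v x ^ (p + 1) +
        ((N * d x + ∑ j, x j * pd j d x) / (q + 1) - θ₂ * d x) * u x ^ (q + 1) with hg
  have h6 : closedBall (0 : EuclideanSpace ℝ (Fin N)) 6 ⊆ Ω :=
    (closedBall_subset_closedBall (by norm_num)).trans h.ball
  have hpd : ∀ (w : EuclideanSpace ℝ (Fin N) → ℝ) j, ContDiffOn ℝ 1 w Ω →
      ContinuousOn (fun x => pd j w x) Ω := fun w j hw =>
    (hw.continuousOn_fderiv_of_isOpen h.isOpen le_rfl).clm_apply continuousOn_const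
  have hS : ∀ w : EuclideanSpace ℝ (Fin N) → ℝ, ContDiffOn ℝ 1 w Ω →
      ContinuousOn (fun x => ∑ j, x j * pd j w x) Ω := fun w hw =>
    continuousOn_finsetSum _ fun j _ => ((contDiff_coord (n := 0) j).continuous.continuousOn).mul
      (hpd w j hw)
  have hgc : ContinuousOn g Ω :=
    (((((h.cc.continuousOn.const_smul (N : ℝ)).add (hS c h.cc)).div_const _).sub
      (h.cc.continuousOn.const_smul θ₁)).mul (h.symm.continuousOn_rpow _)).add
    (((((h.cd.continuousOn.const_smul (N : ℝ)).add (hS d h.cd)).div_const _).sub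
      (h.cd.continuousOn.const_smul θ₂)).mul (h.continuousOn_rpow _))
  have key : ∀ (e S P θ r : ℝ), γ + θ ≤ N / (r + 1) → 0 < r → e ∈ Icc (1 / 4 : ℝ) 4 →
      |S| ≤ ε → 0 ≤ P → γ / 8 * P ≤ ((N * e + S) / (r + 1) - θ * e) * P := by
    intro e S P θ r hθ hr he hS hP
    refine mul_le_mul_of_nonneg_right ?_ hP
    have h1 : (N * e + S) / (r + 1) - θ * e = (N / (r + 1) - θ) * e + S / (r + 1) := by ring
    have h2 : |S / (r + 1)| ≤ γ / 8 := by
      rw [abs_div, abs_of_pos (show 0 < r + 1 by linarith)]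
      exact (div_le_self (abs_nonneg _) (by linarith)).trans (hS.trans hε)
    have h3 : γ * (1 / 4) ≤ (N / (r + 1) - θ) * e :=
      mul_le_mul (by linarith) he.1 (by norm_num) (by linarith)
    rw [h1]
    linarith [(abs_le.1 h2).1]
  have hlow : ∀ x ∈ closedBall (0 : EuclideanSpace ℝ (Fin N)) 6,
      γ / 8 * (v x ^ (p + 1) + u x ^ (q + 1)) ≤ g x := by
    intro x hx
    have hx' := closedBall_subset_closedBall (show (6 : ℝ) ≤ 100 by norm_num) hx
    have := h.upos x (h6 hx)
    have := h.vpos x (h6 hx)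
    rw [mul_add]
    exact add_le_add
      (key _ _ _ θ₁ p hγ₁ hp (h.cmem x (h6 hx)) (h.cder x hx') (by positivity))
      (key _ _ _ θ₂ q hγ₂ hq (h.dmem x (h6 hx)) (h.dder x hx') (by positivity))
  have hen : ∀ x ∈ Ω, 0 ≤ v x ^ (p + 1) + u x ^ (q + 1) := fun x hx => by
    have := h.upos x hx
    have := h.vpos x hx
    positivity
  rw [← setIntegral_eq_integral_of_forall_compl_eq_zero (s := closedBall 0 6)
    fun x hx => by rw [hφK x hx, zero_mul]]
  have hce := h.continuousOn_energy
  calc γ / 8 * energy p q u v 1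
      = ∫ x in closedBall 0 1, φ x * (γ / 8 * (v x ^ (p + 1) + u x ^ (q + 1))) := by
        rw [energy, ← integral_const_mul]
        exact setIntegral_congr_fun isClosed_closedBall.measurableSet fun x hx => by
          simp only [hφ1 x hx, one_mul]
    _ ≤ ∫ x in closedBall 0 6, φ x * (γ / 8 * (v x ^ (p + 1) + u x ^ (q + 1))) := by
        refine setIntegral_mono_set (h.integrableOn
          (hφ.continuous.continuousOn.mul (hce.const_smul (γ / 8))) (by norm_num)) ?_
          (closedBall_subset_closedBall (by norm_num)).eventuallyLE
        exact (ae_restrict_iff' isClosed_closedBall.measurableSet).2 (Eventually.of_forall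
          fun x hx => mul_nonneg (hφ0 x) (mul_nonneg (by positivity) (hen x (h6 hx))))
    _ ≤ _ := setIntegral_mono_on (h.integrableOn
          (hφ.continuous.continuousOn.mul (hce.const_smul (γ / 8))) (by norm_num))
          (h.integrableOn (hφ.continuous.continuousOn.mul hgc) (by norm_num))
          isClosed_closedBall.measurableSet fun x hx =>
            mul_le_mul_of_nonneg_left (hlow x hx) (hφ0 x)

end FieldBound

section LocalEnergy

variable {N : ℕ}

theorem one_add_dyadicLPot_mono {κ κ' : ℝ} (h : κ ≤ κ') (J : ℕ)
    (G : EuclideanSpace ℝ (Fin N) → ENNReal) (x : EuclideanSpace ℝ (Fin N)) :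
    1 + dyadicLPot κ J G x ≤ 1 + dyadicLPot κ' J G x := by
  gcongr
  exact dyadicLPot_mono h J G x

theorem mul_rpow_scale_le {C δ J A E a e f s : ℝ} (hC : 0 ≤ C) (hδ : 0 ≤ δ) (hJ : 1 ≤ J)
    (hA : 0 ≤ A) (hE : 0 < E) (has : a ≤ s) :
    C * δ * J ^ a * (A * E ^ e) ^ f ≤ C * A ^ f * (δ * J ^ s * E ^ (e * f)) := by
  have h1 : J ^ a ≤ J ^ s := Real.rpow_le_rpow_of_exponent_le hJ has
  rw [Real.mul_rpow hA (by positivity), ← Real.rpow_mul hE.le]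
  calc _ ≤ C * δ * J ^ s * (A ^ f * E ^ (e * f)) := by gcongr
    _ = _ := by ring

/-- Hölder's inequality for two slab integrals. -/
theorem lintegral_mul_le_of_rpow {α : Type*} [MeasurableSpace α] {μ : Measure α} {z z' : ℝ}
    (hz : z.HolderConjugate z') {X Y : α → ENNReal} (hX : Measurable X) (hY : Measurable Y)
    {A B : ℝ} (hA : 0 ≤ A) (hB : 0 ≤ B) (h1 : ∫⁻ x, X x ^ z ∂μ ≤ ENNReal.ofReal A)
    (h2 : ∫⁻ x, Y x ^ z' ∂μ ≤ ENNReal.ofReal B) :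
    ∫⁻ x, X x * Y x ∂μ ≤ ENNReal.ofReal (A ^ (1 / z) * B ^ (1 / z')) := by
  refine (ENNReal.lintegral_mul_le_Lp_mul_Lq μ hz hX.aemeasurable hY.aemeasurable).trans ?_
  have hz0 := hz.pos
  have hz0' := hz.symm.pos
  rw [ENNReal.ofReal_mul (by positivity), ← ENNReal.ofReal_rpow_of_nonneg hA (by positivity),
    ← ENNReal.ofReal_rpow_of_nonneg hB (by positivity)]
  gcongr

/-- The exponents needed for the local energy estimate. -/
structure EnergyExponents (N : ℕ) (p q k l z z' lam μ b : ℝ) : Prop where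
  hk : 1 ≤ k
  hl : 1 ≤ l
  hkz : k ≤ z
  hlz : l ≤ z'
  hz : z.HolderConjugate z'
  hpk : p * k ≤ p + 1
  hql : q * l ≤ q + 1
  hkq : k ≤ q + 1
  hlm : l ≤ lam
  hpm : p + 1 ≤ lam
  h1 : (N - 1) * (1 / k - 1 / z) ≤ 1
  h2 : (N - 1) * (1 / l - 1 / z') ≤ 1
  h3 : (N - 1) * (1 / k - 1 / (q + 1)) ≤ 2
  h4 : (N - 1) * (1 / l - 1 / lam) ≤ 2
  hμ : μ ≤ b
  hb0 : 0 ≤ b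
  hb1 : b < 1
  e1 : p * (k - 1) * (1 / k) + q * (l - 1) * (1 / l) ≤ b
  e2 : p * (k - 1) * ((q + 1) / k) ≤ b
  e3 : q * (l - 1) * (lam / l) + μ * (p + 1 - lam) ≤ b

theorem exists_slab_bounds (hN : 3 ≤ N) {p q k l z z' lam μ b : ℝ} (hp : 0 < p) (hq : 0 < q)
    (hpq : 1 < p * q) (H : EnergyExponents N p q k l z z' lam μ b) :
    ∃ C ≥ 1, ∃ s : ℝ, 0 ≤ s ∧ ∀ (ε : ℝ) (Ω : Set (EuclideanSpace ℝ (Fin N)))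
      (c d u v : EuclideanSpace ℝ (Fin N) → ℝ), LocSys p q ε Ω c d u v → ∀ E : ℝ, 1 ≤ E →
      (∫ x in closedBall 0 8, v x ^ (p + 1)) ≤ E → (∫ x in closedBall 0 8, u x ^ (q + 1)) ≤ E →
      ∀ J : ℕ, 1 ≤ J → ∃ t ∈ Icc (1 : ℝ) 2,
        (∫⁻ x in slab t ((1 / 2) ^ J) ∩ closedBall 0 6,
          (1 + dyadicLPot (N - 1) J (lapDensity u) x) * (1 + dyadicLPot (N - 1) J (lapDensity v) x) ≤
          ENNReal.ofReal (C * ((1 / 2) ^ J * J ^ s * E ^ b))) ∧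
        (∫⁻ x in slab t ((1 / 2) ^ J) ∩ closedBall 0 6,
          (1 + dyadicLPot (N - 2) J (lapDensity u) x) ^ (q + 1) ≤
          ENNReal.ofReal (C * ((1 / 2) ^ J * J ^ s * E ^ b))) ∧
        (∫⁻ x in slab t ((1 / 2) ^ J) ∩ closedBall 0 6,
          (1 + dyadicLPot (N - 2) J (lapDensity v) x) ^ lam ≤
          ENNReal.ofReal (C * ((1 / 2) ^ J * J ^ s * E ^ (q * (l - 1) * (lam / l))))) ∧
        ∫⁻ x in slab t ((1 / 2) ^ J) ∩ closedBall 0 6, ENNReal.ofReal (v x ^ p) ≤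
          ENNReal.ofReal (C * ((1 / 2) ^ J * J ^ s)) := by
  have hN1 : 1 ≤ N := by omega
  have hNr : (3 : ℝ) ≤ N := by exact_mod_cast hN
  have hk0 : 0 < k := by linarith [H.hk]
  have hl0 : 0 < l := by linarith [H.hl]
  have hz0 := H.hz.pos
  have hz0' := H.hz.symm.pos
  have hlam0 : 0 < lam := by linarith [H.hpm]
  obtain ⟨C₁, hC₁, hG₁⟩ := exists_lintegral_lapDensity_rpow_le hN hp hq hpq H.hk H.hpk
  obtain ⟨C₂, hC₂, hG₂⟩ := exists_lintegral_lapDensity_rpow_le hN hq hp (by linarith) H.hl H.hql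
  obtain ⟨D₁, hD₁, hS₁⟩ := setLIntegral_slab_one_add_le (κ := N - 1) hN1 H.hk H.hkz
    (by linarith [H.h1])
  obtain ⟨D₂, hD₂, hS₂⟩ := setLIntegral_slab_one_add_le (κ := N - 1) hN1 H.hl H.hlz
    (by linarith [H.h2])
  obtain ⟨D₃, hD₃, hS₃⟩ := setLIntegral_slab_one_add_le (κ := N - 2) hN1 H.hk H.hkq
    (by linarith [H.h3])
  obtain ⟨D₄, hD₄, hS₄⟩ := setLIntegral_slab_one_add_le (κ := N - 2) hN1 H.hl H.hlm
    (by linarith [H.h4])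
  set A₁ := 48 * N * C₁ with hA₁
  set A₂ := 48 * N * C₂ with hA₂
  have hA₁1 : 1 ≤ A₁ := by nlinarith
  have hA₂1 : 1 ≤ A₂ := by nlinarith
  set B₁ := D₁ * A₁ ^ (z / k)
  set B₂ := D₂ * A₂ ^ (z' / l)
  have hB₁ : 0 < B₁ := by positivity
  have hB₂ : 0 < B₂ := by positivity
  refine ⟨1 + B₁ ^ (1 / z) * B₂ ^ (1 / z') + D₃ * A₁ ^ ((q + 1) / k) + D₄ * A₂ ^ (lam / l) + A₁,
    by linarith [show 0 < B₁ ^ (1 / z) * B₂ ^ (1 / z') by positivity,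
      show 0 < D₃ * A₁ ^ ((q + 1) / k) by positivity, show 0 < D₄ * A₂ ^ (lam / l) by positivity],
    4 + 2 * (q + 1) + 2 * lam, by positivity, fun ε Ω c d u v h E hE hEv hEu J hJ => ?_⟩
  obtain ⟨hV, hGu⟩ := hG₁ ε Ω c d u v h
  have hGv := (hG₂ ε Ω d c v u h.symm).2 E hE hEu
  replace hGu := hGu E hE hEv
  have hE0 : 0 < E := by linarith
  have hJ1 : (1 : ℝ) ≤ J := by exact_mod_cast hJ
  have hmu := h.measurable_lapDensity
  have hmv := h.symm.measurable_lapDensity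
  have hEp : 1 ≤ E ^ (p * (k - 1)) :=
    Real.one_le_rpow hE (mul_nonneg hp.le (by linarith [H.hk]))
  have hEq : 1 ≤ E ^ (q * (l - 1)) :=
    Real.one_le_rpow hE (mul_nonneg hq.le (by linarith [H.hl]))
  let F : Fin 3 → EuclideanSpace ℝ (Fin N) → ENNReal :=
    ![fun x => lapDensity u x ^ k, fun x => lapDensity v x ^ l,
      (closedBall 0 8).indicator fun x => ENNReal.ofReal (v x ^ p)]
  let M : Fin 3 → ℝ := ![C₁ * E ^ (p * (k - 1)), C₂ * E ^ (q * (l - 1)), C₁]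
  obtain ⟨t, ht, hgood⟩ := exists_common_good_slab (F := F) (M := M) hN1
    (by
      intro i
      fin_cases i
      · exact hmu.pow_const k
      · exact hmv.pow_const l
      · exact measurable_indicator_of_continuousOn isClosed_closedBall.measurableSet
          ((h.symm.continuousOn_rpow p).mono
            ((closedBall_subset_closedBall (by norm_num)).trans h.ball)))
    (by
      intro i
      fin_cases i
      · exact show 0 < C₁ * E ^ (p * (k - 1)) by positivity
      · exact show 0 < C₂ * E ^ (q * (l - 1)) by positivity
      · exact show 0 < C₁ by linarith)
    (by
      intro i
      fin_cases i
      · exact hGu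
      · exact hGv
      · exact (lintegral_indicator isClosed_closedBall.measurableSet _).trans_le hV) hJ
  have gu : ∀ j ∈ Finset.range J, ∫⁻ y in slab t (2 * (1 / 2) ^ j), lapDensity u y ^ k ≤
      ENNReal.ofReal ((1 / 2) ^ j * (J * (A₁ * E ^ (p * (k - 1))))) := by
    intro j hj
    have := hgood 0 j (Finset.range_mono (by omega) hj)
    simpa only [F, M, Matrix.cons_val_zero, hA₁, mul_assoc] using this
  have gv : ∀ j ∈ Finset.range J, ∫⁻ y in slab t (2 * (1 / 2) ^ j), lapDensity v y ^ l ≤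
      ENNReal.ofReal ((1 / 2) ^ j * (J * (A₂ * E ^ (q * (l - 1))))) := by
    intro j hj
    have := hgood 1 j (Finset.range_mono (by omega) hj)
    simpa only [F, M, Matrix.cons_val_one, Matrix.cons_val_zero, hA₂, mul_assoc] using this
  have gV := hgood 2 J (Finset.self_mem_range_succ J)
  set δ : ℝ := (1 / 2) ^ J with hδ
  have hδ0 : 0 < δ := by positivity
  set s := 4 + 2 * (q + 1) + 2 * lam with hs
  have hM₁ : 1 ≤ A₁ * E ^ (p * (k - 1)) := one_le_mul_of_one_le_of_one_le hA₁1 hEp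
  have hM₂ : 1 ≤ A₂ * E ^ (q * (l - 1)) := one_le_mul_of_one_le_of_one_le hA₂1 hEq
  have j1 := hS₁ _ hmu t _ J hJ hM₁ gu
  have j2 := hS₂ _ hmv t _ J hJ hM₂ gv
  have j3 := hS₃ _ hmu t _ J hJ hM₁ gu
  have j4 := hS₄ _ hmv t _ J hJ hM₂ gv
  have q1 : 0 ≤ B₁ ^ (1 / z) * B₂ ^ (1 / z') := by positivity
  have q3 : 0 ≤ D₃ * A₁ ^ ((q + 1) / k) := by positivity
  have q4 : 0 ≤ D₄ * A₂ ^ (lam / l) := by positivity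
  have fin : ∀ {a T : ℝ}, 0 ≤ a → a ≤ b → 0 ≤ T →
      T ≤ 1 + B₁ ^ (1 / z) * B₂ ^ (1 / z') + D₃ * A₁ ^ ((q + 1) / k) + D₄ * A₂ ^ (lam / l) + A₁ →
      T * (δ * J ^ s * E ^ a) ≤ (1 + B₁ ^ (1 / z) * B₂ ^ (1 / z') + D₃ * A₁ ^ ((q + 1) / k) +
        D₄ * A₂ ^ (lam / l) + A₁) * (δ * J ^ s * E ^ b) := by
    intro a T ha hab hT hTT
    have : E ^ a ≤ E ^ b := Real.rpow_le_rpow_of_exponent_le hE hab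
    gcongr
  refine ⟨t, ht, ?_, ?_, ?_, ?_⟩
  · refine (lintegral_mul_le_of_rpow H.hz (measurable_const.add (measurable_dyadicLPot _ _ hmu))
      (measurable_const.add (measurable_dyadicLPot _ _ hmv)) (by positivity) (by positivity)
      (j1.trans (ENNReal.ofReal_le_ofReal (mul_rpow_scale_le hD₁.le hδ0.le hJ1 (by positivity) hE0
        le_rfl)))
      (j2.trans (ENNReal.ofReal_le_ofReal (mul_rpow_scale_le hD₂.le hδ0.le hJ1 (by positivity) hE0
        le_rfl)))).trans (ENNReal.ofReal_le_ofReal ?_)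
    have hr : ∀ (B w g : ℝ), 0 < B → 0 < w → (B * (δ * (J : ℝ) ^ (2 * w) * E ^ g)) ^ (1 / w) =
        B ^ (1 / w) * (δ ^ (1 / w) * (J : ℝ) ^ (2 : ℝ) * E ^ (g * (1 / w))) := by
      intro B w g hB hw
      rw [Real.mul_rpow hB.le (by positivity), Real.mul_rpow (by positivity) (by positivity),
        Real.mul_rpow hδ0.le (by positivity), ← Real.rpow_mul (by positivity),
        ← Real.rpow_mul (by positivity), mul_assoc 2 w, mul_one_div_cancel hw.ne', mul_one]
    rw [hr B₁ z _ hB₁ hz0, hr B₂ z' _ hB₂ hz0']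
    have hδδ : δ ^ (1 / z) * δ ^ (1 / z') = δ := by
      rw [← Real.rpow_add hδ0, one_div, one_div, H.hz.inv_add_inv_eq_one, Real.rpow_one]
    have hJJ : (J : ℝ) ^ (2 : ℝ) * (J : ℝ) ^ (2 : ℝ) ≤ J ^ s := by
      rw [← Real.rpow_add (by linarith)]
      exact Real.rpow_le_rpow_of_exponent_le hJ1 (by rw [hs]; linarith)
    have x1 : p * (k - 1) * (z / k) * (1 / z) = p * (k - 1) * (1 / k) := by field_simp
    have x2 : q * (l - 1) * (z' / l) * (1 / z') = q * (l - 1) * (1 / l) := by field_simp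
    rw [x1, x2]
    calc _ = B₁ ^ (1 / z) * B₂ ^ (1 / z') * ((δ ^ (1 / z) * δ ^ (1 / z')) *
          ((J : ℝ) ^ (2 : ℝ) * (J : ℝ) ^ (2 : ℝ)) *
          (E ^ (p * (k - 1) * (1 / k)) * E ^ (q * (l - 1) * (1 / l)))) := by ring
      _ ≤ B₁ ^ (1 / z) * B₂ ^ (1 / z') * (δ * J ^ s *
          E ^ (p * (k - 1) * (1 / k) + q * (l - 1) * (1 / l))) := by
        rw [hδδ, Real.rpow_add hE0]
        gcongr
      _ ≤ _ := fin (add_nonneg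
          (mul_nonneg (mul_nonneg hp.le (by linarith [H.hk])) (by positivity))
          (mul_nonneg (mul_nonneg hq.le (by linarith [H.hl])) (by positivity))) H.e1 q1
          (by linarith)
  · refine j3.trans (ENNReal.ofReal_le_ofReal ((mul_rpow_scale_le (s := s) hD₃.le hδ0.le hJ1
      (by positivity) hE0 (by rw [hs]; linarith)).trans (fin ?_ H.e2 q3 (by linarith))))
    exact mul_nonneg (mul_nonneg hp.le (by linarith [H.hk])) (by positivity)
  · refine j4.trans (ENNReal.ofReal_le_ofReal ((mul_rpow_scale_le (s := s) hD₄.le hδ0.le hJ1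
      (by positivity) hE0 (by rw [hs]; linarith)).trans ?_))
    gcongr
    linarith
  · calc _ = ∫⁻ x in slab t δ ∩ closedBall 0 6, F 2 x := by
          refine setLIntegral_congr_fun ((measurableSet_slab _ _).inter
            isClosed_closedBall.measurableSet) fun x hx => ?_
          have h8 : x ∈ closedBall (0 : EuclideanSpace ℝ (Fin N)) 8 :=
            closedBall_subset_closedBall (by norm_num) hx.2
          exact (indicator_of_mem h8 fun x => ENNReal.ofReal (v x ^ p)).symm
      _ ≤ ∫⁻ x in slab t (2 * δ), F 2 x := by
          refine lintegral_mono_set (inter_subset_left.trans ?_)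
          rintro x ⟨i, hi⟩
          exact ⟨i, by linarith⟩
      _ ≤ _ := by
          refine gV.trans (ENNReal.ofReal_le_ofReal ?_)
          have hJs : (J : ℝ) ≤ J ^ s := by
            conv_lhs => rw [← Real.rpow_one (J : ℝ)]
            exact Real.rpow_le_rpow_of_exponent_le hJ1 (by rw [hs]; linarith)
          calc δ * (J * (48 * N * C₁)) = A₁ * (δ * J) := by rw [hA₁]; ring
            _ ≤ _ := by gcongr; linarith

end LocalEnergy

section LocalEnergy

variable {N : ℕ}

theorem exists_local_energy_le_of_exponents (hN : 3 ≤ N) (hN4 : N ≤ 4)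
    {p q k l z z' lam μ b : ℝ} (hp : 0 < p) (hq : 0 < q)
    (hpq : 1 < p * q) (hsub : (N : ℝ) - 2 < N / (p + 1) + N / (q + 1))
    (H : EnergyExponents N p q k l z z' lam μ b) {η : ℝ} (hη : 0 < η) :
    ∃ C > 0, ∀ (ε : ℝ) (Ω : Set (EuclideanSpace ℝ (Fin N)))
      (c d u v : EuclideanSpace ℝ (Fin N) → ℝ), LocSys p q ε Ω c d u v →
      ε ≤ (N / (p + 1) + N / (q + 1) - (N - 2)) / 16 → ∀ Λ : ℝ, 1 ≤ Λ →
      (∀ x ∈ closedBall 0 100, u x ≤ Λ ∧ v x ≤ Λ) →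
      energy p q u v 1 ≤ C * Λ ^ η * (1 + energy p q u v 8) ^ b := by
  set γ := (N / (p + 1) + N / (q + 1) - (N - 2)) / 2 with hγd
  have hγ : 0 < γ := by rw [hγd]; linarith
  set θ₁ := N / (p + 1) - γ with hθ₁
  set θ₂ := N / (q + 1) - γ with hθ₂
  have hθ : θ₁ + θ₂ = N - 2 := by rw [hθ₁, hθ₂, hγd]; ring
  obtain ⟨C₁, hC₁, s, hs, hS⟩ := exists_slab_bounds hN hp hq hpq H
  obtain ⟨C₂, hC₂, hP⟩ := exists_le_dyadicLPot hN hp hq hpq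
  obtain ⟨C₃, hC₃, hP'⟩ := exists_le_dyadicLPot hN hq hp (by linarith)
  obtain ⟨Cφ, hCφ, hcut⟩ := exists_box_cutoff (N := N) hN4
  obtain ⟨C₄, hC₄, hscale⟩ := exists_dyadic_scale (max p q) (hp.le.trans (le_max_left _ _)) hη hs
  set C₅ := max C₂ C₃
  have hC₅ : 1 ≤ C₅ := hC₂.trans (le_max_left _ _)
  have hlam0 : 0 < lam := by linarith [H.hpm]
  set D := 18 * (N : ℝ) ^ 2 * C₅ ^ 2 + 24 + (|θ₁| + |θ₂|) * N * C₅ ^ 2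
  have hD : 0 < D := by positivity
  set B := C₁ + C₅ ^ (q + 1) * C₁ + (C₁ + C₅ ^ lam * C₁)
  have hB : 0 < B := by positivity
  refine ⟨8 / γ * (N * Cφ * D * B * C₄), by positivity, fun ε Ω c d u v h hε Λ hΛ hb => ?_⟩
  obtain ⟨J, hJ, hJΛ, hJs⟩ := hscale Λ hΛ
  have h8 : closedBall (0 : EuclideanSpace ℝ (Fin N)) 8 ⊆ Ω :=
    (closedBall_subset_closedBall (by norm_num)).trans h.ball
  have iv := h.integrableOn (h.symm.continuousOn_rpow (p + 1)) (r := 8) (by norm_num)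
  have iu := h.integrableOn (h.continuousOn_rpow (q + 1)) (r := 8) (by norm_num)
  set E := 1 + energy p q u v 8 with hE
  have hv0 : 0 ≤ ∫ x in closedBall 0 8, v x ^ (p + 1) := setIntegral_nonneg
    isClosed_closedBall.measurableSet fun x hx => Real.rpow_nonneg (h.vpos x (h8 hx)).le _
  have hu0 : 0 ≤ ∫ x in closedBall 0 8, u x ^ (q + 1) := setIntegral_nonneg
    isClosed_closedBall.measurableSet fun x hx => Real.rpow_nonneg (h.upos x (h8 hx)).le _
  have hEe : E = 1 + ((∫ x in closedBall 0 8, v x ^ (p + 1)) +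
      ∫ x in closedBall 0 8, u x ^ (q + 1)) := by
    rw [hE, energy, integral_add iv iu]
  have hE1 : 1 ≤ E := by linarith
  have hE0 : 0 < E := by linarith
  obtain ⟨t, ht, s1, s2, s3, s4⟩ := hS ε Ω c d u v h E hE1 (by linarith) (by linarith) J hJ
  have hmu := h.measurable_lapDensity
  have hmv := h.symm.measurable_lapDensity
  set δ : ℝ := (1 / 2) ^ J with hδ
  have hδ0 : 0 < δ := by positivity
  obtain ⟨φ, hφ, hφ0, hφ1, hφK, hφa, hφs⟩ := hcut t ht δ hδ0
    (pow_le_one₀ (by norm_num) (by norm_num))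
  have low := h.le_integral_pohozaev hp hq (γ := γ) (θ₁ := θ₁) (θ₂ := θ₂)
    (by rw [hθ₁]; linarith) (by rw [hθ₂]; linarith) hγ (by rw [hγd]; linarith) hφ hφ0 hφ1 hφK
  rw [integral_pohozaev h.isOpen (isCompact_closedBall 0 6)
    ((closedBall_subset_closedBall (by norm_num)).trans h.ball) hp hq hθ h.cu h.cv h.cc h.cd
    h.upos h.vpos h.equ h.eqv hφ hφK] at low
  set f : EuclideanSpace ℝ (Fin N) → ℝ := fun x => ∑ i, pd i φ x * pohField θ₁ θ₂ u v
    (fun y => c y * v y ^ (p + 1) / (p + 1) + d y * u y ^ (q + 1) / (q + 1)) i x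
  set S := slab t δ ∩ closedBall (0 : EuclideanSpace ℝ (Fin N)) 6
  have hSm : MeasurableSet S := (measurableSet_slab _ _).inter isClosed_closedBall.measurableSet
  have hf0 : ∀ x, x ∉ S → f x = 0 := fun x hx => Finset.sum_eq_zero fun i _ => by
    rw [not_imp_comm.1 (hφs i x) hx, zero_mul]
  have hδΛ : ∀ r, 0 < r → r ≤ max p q → δ * Λ ^ r ≤ 1 := fun r _ hr =>
    (mul_le_mul_of_nonneg_left (Real.rpow_le_rpow_of_exponent_le hΛ hr) hδ0.le).trans hJΛ
  set X := fun x => 1 + dyadicLPot (N - 1) J (lapDensity u) x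
  set Y := fun x => 1 + dyadicLPot (N - 1) J (lapDensity v) x
  set X' := fun x => 1 + dyadicLPot (N - 2) J (lapDensity u) x
  set Y' := fun x => 1 + dyadicLPot (N - 2) J (lapDensity v) x
  have pu : ∀ x ∈ S, ENNReal.ofReal (u x) ≤ ENNReal.ofReal C₅ * X' x ∧
      ∀ i, ENNReal.ofReal |pd i u x| ≤ ENNReal.ofReal C₅ * X x := by
    intro x hx
    obtain ⟨a1, a2⟩ := hP ε Ω c d u v h Λ J (fun x hx => (hb x hx).2)
      (hδΛ p hp (le_max_left _ _)) x hx.2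
    have : ENNReal.ofReal C₂ ≤ ENNReal.ofReal C₅ := ENNReal.ofReal_le_ofReal (le_max_left _ _)
    exact ⟨a1.trans (mul_le_mul_left this _), fun i => (a2 i).trans (mul_le_mul_left this _)⟩
  have pv : ∀ x ∈ S, ENNReal.ofReal (v x) ≤ ENNReal.ofReal C₅ * Y' x ∧
      ∀ i, ENNReal.ofReal |pd i v x| ≤ ENNReal.ofReal C₅ * Y x := by
    intro x hx
    obtain ⟨a1, a2⟩ := hP' ε Ω d c v u h.symm Λ J (fun x hx => (hb x hx).1)
      (hδΛ q hq (le_max_right _ _)) x hx.2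
    have : ENNReal.ofReal C₃ ≤ ENNReal.ofReal C₅ := ENNReal.ofReal_le_ofReal (le_max_right _ _)
    exact ⟨a1.trans (mul_le_mul_left this _), fun i => (a2 i).trans (mul_le_mul_left this _)⟩
  have hSΩ : S ⊆ Ω := inter_subset_right.trans
    ((closedBall_subset_closedBall (by norm_num)).trans h.ball)
  have hXX : ∀ x, X' x ≤ X x := fun x => one_add_dyadicLPot_mono (by linarith) _ _ _
  have hYY : ∀ x, Y' x ≤ Y x := fun x => one_add_dyadicLPot_mono (by linarith) _ _ _
  set W := δ * (J : ℝ) ^ s * E ^ b with hW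
  have hJ1 : (1 : ℝ) ≤ J := by exact_mod_cast hJ
  have hW0 : 0 ≤ W := by positivity
  have bu : ∫⁻ x in S, ENNReal.ofReal (u x ^ (q + 1)) ≤ ENNReal.ofReal (C₅ ^ (q + 1) * C₁ * W) := by
    calc _ ≤ ∫⁻ x in S, ENNReal.ofReal (C₅ ^ (q + 1)) * X' x ^ (q + 1) := by
          refine setLIntegral_mono' hSm fun x hx => ?_
          rw [← ENNReal.ofReal_rpow_of_nonneg (h.upos x (hSΩ hx)).le (by linarith),
            ← ENNReal.ofReal_rpow_of_nonneg (by linarith) (by linarith),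
            ← ENNReal.mul_rpow_of_nonneg _ _ (by linarith)]
          exact ENNReal.rpow_le_rpow (pu x hx).1 (by linarith)
      _ = ENNReal.ofReal (C₅ ^ (q + 1)) * ∫⁻ x in S, X' x ^ (q + 1) :=
          lintegral_const_mul _ ((measurable_const.add (measurable_dyadicLPot _ _ hmu)).pow_const _)
      _ ≤ ENNReal.ofReal (C₅ ^ (q + 1)) * ENNReal.ofReal (C₁ * W) := by gcongr
      _ = _ := by rw [← ENNReal.ofReal_mul (by positivity), mul_assoc]
  have bv : ∫⁻ x in S, ENNReal.ofReal (v x ^ (p + 1)) ≤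
      ENNReal.ofReal ((C₁ + C₅ ^ lam * C₁) * W) := by
    set K := E ^ μ with hK
    have hK0 : 0 < K := by positivity
    have hvm : Measurable (S.indicator fun x => ENNReal.ofReal (v x ^ p)) :=
      measurable_indicator_of_continuousOn hSm ((h.symm.continuousOn_rpow p).mono hSΩ)
    calc _ ≤ ∫⁻ x in S, (ENNReal.ofReal K * S.indicator (fun x => ENNReal.ofReal (v x ^ p)) x +
          ENNReal.ofReal (K ^ (p + 1 - lam) * C₅ ^ lam) * Y' x ^ lam) := by
          refine setLIntegral_mono' hSm fun x hx => ?_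
          have hvx := h.vpos x (hSΩ hx)
          rw [indicator_of_mem hx]
          have e := rpow_le_of_split hvx hK0 (show p ≤ p + 1 by linarith) H.hpm
          rw [add_sub_cancel_left, Real.rpow_one] at e
          refine (ENNReal.ofReal_le_ofReal e).trans ?_
          rw [ENNReal.ofReal_add (by positivity) (by positivity), ENNReal.ofReal_mul hK0.le,
            ENNReal.ofReal_mul (by positivity), ENNReal.ofReal_mul (by positivity), mul_assoc]
          gcongr
          rw [← ENNReal.ofReal_rpow_of_nonneg hvx.le hlam0.le,
            ← ENNReal.ofReal_rpow_of_nonneg (by linarith) hlam0.le,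
            ← ENNReal.mul_rpow_of_nonneg _ _ hlam0.le]
          exact ENNReal.rpow_le_rpow (pv x hx).1 hlam0.le
      _ = ENNReal.ofReal K * (∫⁻ x in S, ENNReal.ofReal (v x ^ p)) +
          ENNReal.ofReal (K ^ (p + 1 - lam) * C₅ ^ lam) * ∫⁻ x in S, Y' x ^ lam := by
          rw [lintegral_add_left (hvm.const_mul _), lintegral_const_mul _ hvm, lintegral_const_mul _
            (show Measurable fun x => Y' x ^ lam from
              (measurable_const.add (measurable_dyadicLPot _ _ hmv)).pow_const _)]
          congr 2
          exact setLIntegral_congr_fun hSm fun x hx => indicator_of_mem hx _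
      _ ≤ ENNReal.ofReal K * ENNReal.ofReal (C₁ * (δ * J ^ s)) +
          ENNReal.ofReal (K ^ (p + 1 - lam) * C₅ ^ lam) *
          ENNReal.ofReal (C₁ * (δ * J ^ s * E ^ (q * (l - 1) * (lam / l)))) := by gcongr
      _ ≤ _ := by
          rw [← ENNReal.ofReal_mul hK0.le, ← ENNReal.ofReal_mul (by positivity),
            ← ENNReal.ofReal_add (by positivity) (by positivity)]
          refine ENNReal.ofReal_le_ofReal ?_
          have k1 : K ≤ E ^ b := Real.rpow_le_rpow_of_exponent_le hE1 H.hμ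
          have k2 : K ^ (p + 1 - lam) * E ^ (q * (l - 1) * (lam / l)) ≤ E ^ b := by
            rw [hK, ← Real.rpow_mul hE0.le, ← Real.rpow_add hE0]
            exact Real.rpow_le_rpow_of_exponent_le hE1 (by linarith [H.e3])
          calc _ = C₁ * (δ * J ^ s) * K + C₅ ^ lam * C₁ * (δ * J ^ s) *
                (K ^ (p + 1 - lam) * E ^ (q * (l - 1) * (lam / l))) := by ring
            _ ≤ C₁ * (δ * J ^ s) * E ^ b + C₅ ^ lam * C₁ * (δ * J ^ s) * E ^ b := by gcongr
            _ = _ := by rw [hW]; ring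
  have main : ENNReal.ofReal (γ / 8 * energy p q u v 1) ≤
      ENNReal.ofReal (N * (Cφ / δ) * D * (B * W)) := by
    calc _ ≤ ENNReal.ofReal |∫ x, f x| := ENNReal.ofReal_le_ofReal (low.trans (neg_le_abs _))
      _ = ‖∫ x, f x‖ₑ := (Real.enorm_eq_ofReal_abs _).symm
      _ ≤ ∫⁻ x, ‖f x‖ₑ := enorm_integral_le_lintegral_enorm _
      _ = ∫⁻ x in S, ‖f x‖ₑ := by
          rw [← lintegral_indicator hSm]
          refine lintegral_congr fun x => ?_
          by_cases hx : x ∈ S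
          · rw [indicator_of_mem hx]
          · rw [indicator_of_notMem hx, hf0 x hx, enorm_zero]
      _ ≤ ∫⁻ x in S, ENNReal.ofReal (N * (Cφ / δ) * D) * (X x * Y x +
          S.indicator (fun x => ENNReal.ofReal (u x ^ (q + 1))) x +
          ENNReal.ofReal (v x ^ (p + 1))) := by
          refine setLIntegral_mono' hSm fun x hx => ?_
          rw [indicator_of_mem hx]
          exact h.enorm_sum_pohField_le hp hq hx.2 (fun i => hφa i x) hC₅
            ((pu x hx).1.trans (mul_le_mul_right (hXX x) _))
            ((pv x hx).1.trans (mul_le_mul_right (hYY x) _)) (pu x hx).2 (pv x hx).2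
      _ = ENNReal.ofReal (N * (Cφ / δ) * D) * ((∫⁻ x in S, X x * Y x) +
          (∫⁻ x in S, ENNReal.ofReal (u x ^ (q + 1))) +
          ∫⁻ x in S, ENNReal.ofReal (v x ^ (p + 1))) := by
          have hum : Measurable (S.indicator fun x => ENNReal.ofReal (u x ^ (q + 1))) :=
            measurable_indicator_of_continuousOn hSm ((h.continuousOn_rpow _).mono hSΩ)
          have hXY : Measurable fun x => X x * Y x :=
            (measurable_const.add (measurable_dyadicLPot _ _ hmu)).mul
              (measurable_const.add (measurable_dyadicLPot _ _ hmv))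
          rw [lintegral_const_mul' _ _ ENNReal.ofReal_ne_top, lintegral_add_left
            (show Measurable fun x => X x * Y x +
              S.indicator (fun x => ENNReal.ofReal (u x ^ (q + 1))) x from hXY.add hum),
            lintegral_add_left hXY]
          congr 3
          exact setLIntegral_congr_fun hSm fun x hx => indicator_of_mem hx _
      _ ≤ ENNReal.ofReal (N * (Cφ / δ) * D) * (ENNReal.ofReal (C₁ * W) +
          ENNReal.ofReal (C₅ ^ (q + 1) * C₁ * W) +
          ENNReal.ofReal ((C₁ + C₅ ^ lam * C₁) * W)) := by gcongr
      _ = _ := by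
          rw [← ENNReal.ofReal_add (by positivity) (by positivity),
            ← ENNReal.ofReal_add (by positivity) (by positivity),
            ← ENNReal.ofReal_mul (by positivity)]
          congr 2
          ring
  rw [ENNReal.ofReal_le_ofReal_iff (by positivity)] at main
  calc energy p q u v 1 = 8 / γ * (γ / 8 * energy p q u v 1) := by field_simp
    _ ≤ 8 / γ * (N * (Cφ / δ) * D * (B * W)) := by gcongr
    _ = 8 / γ * (N * Cφ * D * B) * (J : ℝ) ^ s * E ^ b := by rw [hW]; field_simp
    _ ≤ 8 / γ * (N * Cφ * D * B) * (C₄ * Λ ^ η) * E ^ b := by gcongr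
    _ = _ := by ring

end LocalEnergy

section LocalEnergy

theorem energyExponents_three {p q : ℝ} (hp : 0 < p) (hq : 0 < q) :
    EnergyExponents 3 p q 1 1 2 2 (p + 1) 0 0 := by
  have h1 : 0 < 1 / (q + 1) := by positivity
  have h2 : 0 < 1 / (p + 1) := by positivity
  refine ⟨le_rfl, le_rfl, by norm_num, by norm_num, ⟨by norm_num, by norm_num, by norm_num⟩,
    by linarith, by linarith, by linarith, by linarith, le_rfl, ?_, ?_, ?_, ?_, le_rfl, le_rfl,
    by norm_num, ?_, ?_, ?_⟩ <;> push_cast <;> linarith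

theorem energyExponents_four_of_le_two {p q : ℝ} (hp : 1 ≤ p) (hq : 0 < q) (hq2 : q ≤ 2) :
    EnergyExponents 4 p q 1 (3 / 2) (3 / 2) 3 (4 * p) (8 / 9) (8 / 9) := by
  have h1 : 1 / 3 ≤ 1 / (q + 1) := one_div_le_one_div_of_le (by linarith) (by linarith)
  have h2 : 0 < 1 / (4 * p) := by positivity
  refine ⟨le_rfl, by norm_num, by norm_num, by norm_num, ⟨by norm_num, by norm_num, by norm_num⟩,
    by linarith, by linarith, by linarith, by linarith, by linarith, ?_, ?_, ?_, ?_, le_rfl,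
    by norm_num, by norm_num, ?_, ?_, ?_⟩ <;> push_cast
  · norm_num
  · norm_num
  · linarith
  · linarith
  · linarith
  · linarith
  · nlinarith

theorem exists_energyExponents_four {p q : ℝ} (hp : 0 < p) (hq : 2 < q) (hqp : q ≤ p)
    (h : (p - 1) * (q - 1) < 4) :
    ∃ k l z z' lam μ b : ℝ, EnergyExponents 4 p q k l z z' lam μ b := by
  have hq3 : q < 3 := by nlinarith
  have hτ : p * (q - 2) < 3 := by nlinarith
  have hq1 : 0 < q + 1 := by linarith
  have hq2 : 0 < q - 2 := by linarith
  have hτ0 : 0 < p * (q - 2) := by positivity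
  have h25 : 0 < 2 * q + 5 := by linarith
  have h21 : 0 < 2 * q - 1 := by linarith
  have h4 : 0 < q + 4 := by linarith
  set b := max (3 * q / (3 * q + 3 - p * (q - 2)))
    (max (p * (q - 2) / 3) ((p * (q - 2) + 3 * q) / (3 * (q + 1)))) with hb
  have hden : 0 < 3 * q + 3 - p * (q - 2) := by linarith
  have hb1 : b < 1 := by
    rw [hb, max_lt_iff, max_lt_iff, div_lt_one hden, div_lt_one (by norm_num),
      div_lt_one (by linarith)]
    exact ⟨by linarith, by linarith, by linarith⟩
  have b1 : 3 * q / (3 * q + 3 - p * (q - 2)) ≤ b := le_max_left _ _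
  have b2 : p * (q - 2) / 3 ≤ b := (le_max_left _ _).trans (le_max_right _ _)
  have b3 : (p * (q - 2) + 3 * q) / (3 * (q + 1)) ≤ b := (le_max_right _ _).trans (le_max_right _ _)
  have hb0 : 0 < b := lt_of_lt_of_le (by positivity) b2
  refine ⟨3 * (q + 1) / (2 * q + 5), (q + 1) / q, 3 * (q + 1) / (q + 4), 3 * (q + 1) / (2 * q - 1),
    3 * (q + 1) / (q - 2), b, b, ⟨?_, ?_, ?_, ?_, ⟨?_, ?_, ?_⟩, ?_, ?_, ?_, ?_, ?_, ?_, ?_, ?_, ?_,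
    le_rfl, hb0.le, hb1, ?_, ?_, ?_⟩⟩
  · rw [le_div_iff₀ h25]; linarith
  · rw [le_div_iff₀ (by linarith)]; linarith
  · exact div_le_div_of_nonneg_left (by linarith) h4 (by linarith)
  · rw [div_le_div_iff₀ (by linarith) h21]; nlinarith
  · field_simp; ring
  · positivity
  · positivity
  · rw [← mul_div_assoc, div_le_iff₀ h25]; nlinarith
  · rw [mul_div_cancel₀ _ (by linarith)]
  · rw [div_le_iff₀ h25]; nlinarith
  · rw [div_le_div_iff₀ (by linarith) hq2]; nlinarith
  · rw [le_div_iff₀ hq2]; nlinarith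
  · refine le_of_eq ?_; push_cast; field_simp; ring
  · refine le_of_eq ?_; push_cast; field_simp; ring
  · refine le_of_eq ?_; push_cast; field_simp; ring
  · refine le_of_eq ?_; push_cast; field_simp; ring
  · refine le_trans (le_of_eq ?_) b3; field_simp; ring
  · refine le_trans (le_of_eq ?_) b2; field_simp; ring
  · have hq0 : q ≠ 0 := by linarith
    rw [div_le_iff₀ hden] at b1
    have e : q * ((q + 1) / q - 1) * (3 * (q + 1) / (q - 2) / ((q + 1) / q)) +
        b * (p + 1 - 3 * (q + 1) / (q - 2)) =
        (3 * q - b * (3 * q + 3 - p * (q - 2))) / (q - 2) + b := by field_simp; ring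
    rw [e]
    have : (3 * q - b * (3 * q + 3 - p * (q - 2))) / (q - 2) ≤ 0 :=
      div_nonpos_of_nonpos_of_nonneg (by linarith) hq2.le
    linarith

variable {N : ℕ}

theorem exists_energyExponents (hN : N = 3 ∨ N = 4) {p q : ℝ} (hp : 0 < p) (hq : 0 < q)
    (hpq : 1 < p * q) (hqp : q ≤ p) (hsub : (N : ℝ) - 2 < N / (p + 1) + N / (q + 1)) :
    ∃ k l z z' lam μ b : ℝ, EnergyExponents N p q k l z z' lam μ b := by
  rcases hN with rfl | rfl
  · exact ⟨_, _, _, _, _, _, _, energyExponents_three hp hq⟩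
  · rcases le_or_gt q 2 with h | h
    · exact ⟨_, _, _, _, _, _, _, energyExponents_four_of_le_two (by nlinarith) hq h⟩
    · refine exists_energyExponents_four hp h hqp ?_
      push_cast at hsub
      rw [div_add_div _ _ (by positivity) (by positivity), lt_div_iff₀ (by positivity)] at hsub
      nlinarith

theorem energy_symm (p q : ℝ) (u v : EuclideanSpace ℝ (Fin N) → ℝ) (r : ℝ) :
    energy p q u v r = energy q p v u r := by
  simp only [energy, add_comm]

theorem exists_local_energy_le (hN : N = 3 ∨ N = 4) {p q : ℝ} (hp : 0 < p) (hq : 0 < q)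
    (hpq : 1 < p * q) (hsub : (N : ℝ) - 2 < N / (p + 1) + N / (q + 1)) :
    ∃ b : ℝ, 0 ≤ b ∧ b < 1 ∧ ∀ η : ℝ, 0 < η → ∃ C > 0, ∀ (ε : ℝ) (Ω : Set (EuclideanSpace ℝ (Fin N)))
      (c d u v : EuclideanSpace ℝ (Fin N) → ℝ), LocSys p q ε Ω c d u v →
      ε ≤ (N / (p + 1) + N / (q + 1) - (N - 2)) / 16 → ∀ Λ : ℝ, 1 ≤ Λ →
      (∀ x ∈ closedBall 0 100, u x ≤ Λ ∧ v x ≤ Λ) →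
      energy p q u v 1 ≤ C * Λ ^ η * (1 + energy p q u v 8) ^ b := by
  have hN3 : 3 ≤ N := by omega
  have hN4 : N ≤ 4 := by omega
  rcases le_total q p with h | h
  · obtain ⟨k, l, z, z', lam, μ, b, H⟩ := exists_energyExponents hN hp hq hpq h hsub
    exact ⟨b, H.hb0, H.hb1, fun η hη =>
      exists_local_energy_le_of_exponents hN3 hN4 hp hq hpq hsub H hη⟩
  · obtain ⟨k, l, z, z', lam, μ, b, H⟩ := exists_energyExponents hN hq hp (by linarith) h
      (by linarith)
    refine ⟨b, H.hb0, H.hb1, fun η hη => ?_⟩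
    obtain ⟨C, hC, hCs⟩ := exists_local_energy_le_of_exponents hN3 hN4 hq hp (by linarith)
      (by linarith) H hη
    refine ⟨C, hC, fun ε Ω c d u v hs hε Λ hΛ hb => ?_⟩
    rw [energy_symm, energy_symm p q u v 8]
    exact hCs ε Ω d c v u hs.symm (by linarith) Λ hΛ fun x hx => (hb x hx).symm

end LocalEnergy

section LocalLiouville

variable {N : ℕ} {p q ε α β R : ℝ} {Ω : Set (EuclideanSpace ℝ (Fin N))}
  {c d u v : EuclideanSpace ℝ (Fin N) → ℝ}

theorem norm_fderiv_le_of_abs_pd_le {w : EuclideanSpace ℝ (Fin N) → ℝ}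
    {x : EuclideanSpace ℝ (Fin N)} {G : ℝ} (hG : 0 ≤ G) (h : ∀ i, |pd i w x| ≤ G) :
    ‖fderiv ℝ w x‖ ≤ N * G := by
  refine ContinuousLinearMap.opNorm_le_bound _ (by positivity) fun z => ?_
  have hz : z = ∑ i, z i • EuclideanSpace.single i (1 : ℝ) := by
    ext j
    simp [Finset.sum_apply, Pi.single_apply]
  calc ‖fderiv ℝ w x z‖ = |∑ i, z i * pd i w x| := by
        conv_lhs => rw [hz]
        simp [pd, map_sum]
    _ ≤ ∑ i, |z i * pd i w x| := Finset.abs_sum_le_sum_abs _ _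
    _ ≤ ∑ _i : Fin N, ‖z‖ * G := by
        refine Finset.sum_le_sum fun i _ => ?_
        rw [abs_mul]
        exact mul_le_mul (PiLp.norm_apply_le z i) (h i) (abs_nonneg _) (norm_nonneg _)
    _ = N * G * ‖z‖ := by simp; ring

theorem abs_sub_le_of_abs_pd_le {w : EuclideanSpace ℝ (Fin N) → ℝ}
    {x y : EuclideanSpace ℝ (Fin N)} {r G : ℝ} (hG : 0 ≤ G)
    (hw : ∀ z ∈ closedBall x r, DifferentiableAt ℝ w z)
    (h : ∀ z ∈ closedBall x r, ∀ i, |pd i w z| ≤ G) (hy : y ∈ closedBall x r) :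
    |w y - w x| ≤ N * G * ‖y - x‖ := by
  have hr : 0 ≤ r := dist_nonneg.trans hy
  exact (convex_closedBall x r).norm_image_sub_le_of_norm_fderiv_le hw
    (fun z hz => norm_fderiv_le_of_abs_pd_le hG (h z hz)) (mem_closedBall_self hr) hy

theorem LocSys.scale (h : LocSys p q ε Ω c d u v) (hR : 0 < R) (hR1 : R ≤ 1)
    (hα : α + 2 = β * p) (hβ : β + 2 = α * q) :
    LocSys p q ε {x | R • x ∈ Ω} (fun x => c (0 + R • x)) (fun x => d (0 + R • x))
      (fun x => R ^ α * u (0 + R • x)) (fun x => R ^ β * v (0 + R • x)) := by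
  have hm : MapsTo (fun x : EuclideanSpace ℝ (Fin N) => 0 + R • x) {x | R • x ∈ Ω} Ω :=
    fun x hx => by simpa using hx
  have hm' : ∀ x : EuclideanSpace ℝ (Fin N), R • x ∈ Ω → 0 + R • x ∈ Ω := fun x hx => by
    simpa using hx
  have hcd : ∀ n : WithTop ℕ∞, ContDiffOn ℝ n
      (fun x : EuclideanSpace ℝ (Fin N) => 0 + R • x) {x | R • x ∈ Ω} := fun n =>
    ContDiff.contDiffOn (by fun_prop)
  have hb : ∀ x ∈ closedBall (0 : EuclideanSpace ℝ (Fin N)) 100, 0 + R • x ∈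
      closedBall (0 : EuclideanSpace ℝ (Fin N)) 100 := fun x hx => by
    rw [mem_closedBall_zero_iff] at hx ⊢
    rw [zero_add, norm_smul, Real.norm_of_nonneg hR.le]
    nlinarith [norm_nonneg x]
  have key : ∀ f : EuclideanSpace ℝ (Fin N) → ℝ, ContDiffOn ℝ 1 f Ω →
      (∀ x ∈ closedBall 0 100, |∑ j, x j * pd j f x| ≤ ε) →
      ∀ x ∈ closedBall 0 100, |∑ j, x j * pd j (fun x => f (0 + R • x)) x| ≤ ε := by
    intro f hf hfe x hx
    have : ∑ j, x j * pd j (fun x => f (0 + R • x)) x =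
        ∑ j, (0 + R • x) j * pd j f (0 + R • x) := by
      refine Finset.sum_congr rfl fun j _ => ?_
      rw [pd_affine j R 0 ((hf.contDiffAt (h.isOpen.mem_nhds
        (h.ball (hb x hx)))).differentiableAt (by norm_num))]
      simp; ring
    rw [this]
    exact hfe _ (hb x hx)
  refine ⟨h.isOpen.preimage (continuous_const_smul R), fun x hx => ?_,
    contDiffOn_const.mul (h.cu.comp (hcd 2) hm), contDiffOn_const.mul (h.cv.comp (hcd 2) hm),
    h.cc.comp (hcd 1) hm, h.cd.comp (hcd 1) hm,
    fun x hx => mul_pos (by positivity) (h.upos _ (hm' x hx)),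
    fun x hx => mul_pos (by positivity) (h.vpos _ (hm' x hx)), fun x hx => h.cmem _ (hm' x hx),
    fun x hx => h.dmem _ (hm' x hx), key c h.cc h.cder, key d h.cd h.dder, fun x hx => ?_,
    fun x hx => ?_⟩
  · simpa using h.ball (hb x hx)
  · have hx' := hm' x hx
    have hu := h.cu.contDiffAt (h.isOpen.mem_nhds hx')
    have hu' : ContDiffAt ℝ 2 (fun z => u (0 + R • z)) x :=
      ContDiffAt.comp (g := u) x hu (by fun_prop)
    rw [lap_const_mul _ hu', lap_affine R 0 hu,
      Real.mul_rpow (by positivity) (h.vpos _ hx').le, ← Real.rpow_mul hR.le, ← hα,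
      Real.rpow_add hR, Real.rpow_two]
    linear_combination R ^ α * R ^ 2 * h.equ _ hx'
  · have hx' := hm' x hx
    have hv := h.cv.contDiffAt (h.isOpen.mem_nhds hx')
    have hv' : ContDiffAt ℝ 2 (fun z => v (0 + R • z)) x :=
      ContDiffAt.comp (g := v) x hv (by fun_prop)
    rw [lap_const_mul _ hv', lap_affine R 0 hv,
      Real.mul_rpow (by positivity) (h.upos _ hx').le, ← Real.rpow_mul hR.le, ← hβ,
      Real.rpow_add hR, Real.rpow_two]
    linear_combination R ^ β * R ^ 2 * h.eqv _ hx'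

theorem LocSys.energy_scale (h : LocSys p q ε Ω c d u v) (hR : 0 < R) {r : ℝ}
    (hRr : R * r ≤ 100) (hα : α + 2 = β * p) (hβ : β + 2 = α * q) :
    energy p q (fun x => R ^ α * u (0 + R • x)) (fun x => R ^ β * v (0 + R • x)) r =
      R ^ (α + β + 2 - N) * energy p q u v (R * r) := by
  set G := fun x => v x ^ (p + 1) + u x ^ (q + 1) with hG
  have e1 : energy p q (fun x => R ^ α * u (0 + R • x)) (fun x => R ^ β * v (0 + R • x)) r =
      ∫ x in closedBall 0 r, R ^ (α + β + 2) * G (R • x) := by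
    refine setIntegral_congr_fun measurableSet_closedBall fun x hx => ?_
    have hx' : R • x ∈ Ω := h.ball (by
      rw [mem_closedBall_zero_iff] at hx ⊢
      rw [norm_smul, Real.norm_of_nonneg hR.le]
      exact (mul_le_mul_of_nonneg_left hx hR.le).trans hRr)
    simp only [zero_add, hG]
    rw [Real.mul_rpow (by positivity) (h.upos _ hx').le,
      Real.mul_rpow (by positivity) (h.vpos _ hx').le, ← Real.rpow_mul hR.le,
      ← Real.rpow_mul hR.le, show β * (p + 1) = α + β + 2 by linarith,
      show α * (q + 1) = α + β + 2 by linarith]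
    ring
  rw [e1, integral_const_mul, ← integral_indicator measurableSet_closedBall]
  have e2 : (closedBall 0 r).indicator (fun x => G (R • x)) =
      fun x => (closedBall 0 (R * r)).indicator G (R • x) := by
    funext x
    have : x ∈ closedBall (0 : EuclideanSpace ℝ (Fin N)) r ↔ R • x ∈ closedBall 0 (R * r) := by
      rw [mem_closedBall_zero_iff, mem_closedBall_zero_iff, norm_smul, Real.norm_of_nonneg hR.le,
        mul_le_mul_iff_right₀ hR]
    by_cases hx : x ∈ closedBall (0 : EuclideanSpace ℝ (Fin N)) r
    · rw [indicator_of_mem hx, indicator_of_mem (this.1 hx)]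
    · rw [indicator_of_notMem hx, indicator_of_notMem (fun h => hx (this.2 h))]
  rw [e2, Measure.integral_comp_smul volume _ R, integral_indicator measurableSet_closedBall,
    finrank_euclideanSpace_fin, abs_of_pos (by positivity), smul_eq_mul, ← mul_assoc,
    Real.rpow_sub hR, Real.rpow_natCast]
  rfl

theorem LocSys.energy_mono (h : LocSys p q ε Ω c d u v) {r s : ℝ} (hrs : r ≤ s) (hs : s ≤ 100) :
    energy p q u v r ≤ energy p q u v s := by
  refine setIntegral_mono_set (h.integrableOn h.continuousOn_energy hs) ?_
    (closedBall_subset_closedBall hrs).eventuallyLE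
  filter_upwards [ae_restrict_mem measurableSet_closedBall] with x hx
  have hx' := h.ball (closedBall_subset_closedBall hs hx)
  exact add_nonneg (Real.rpow_nonneg (h.vpos x hx').le _) (Real.rpow_nonneg (h.upos x hx').le _)

theorem LocSys.energy_nonneg (h : LocSys p q ε Ω c d u v) {r : ℝ} (hr : r ≤ 100) :
    0 ≤ energy p q u v r := by
  refine setIntegral_nonneg measurableSet_closedBall fun x hx => ?_
  have hx' := h.ball (closedBall_subset_closedBall hr hx)
  exact add_nonneg (Real.rpow_nonneg (h.vpos x hx').le _) (Real.rpow_nonneg (h.upos x hx').le _)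

theorem exists_le_energy (hN : 3 ≤ N) (hp : 0 < p) (hq : 0 < q) {K m : ℝ} (hK : 0 < K)
    (hm : 0 < m) : ∃ c₀ > 0, ∀ (ε : ℝ) (Ω : Set (EuclideanSpace ℝ (Fin N)))
      (c d u v : EuclideanSpace ℝ (Fin N) → ℝ), LocSys p q ε Ω c d u v →
      (∀ x ∈ closedBall 0 2, u x ≤ K ∧ v x ≤ K) → m ≤ u 0 → c₀ ≤ energy p q u v 1 := by
  obtain ⟨C, hC, hCs⟩ := exists_abs_pd_le hN
  set G := C * (K / 1 + 1 * (4 * K ^ p)) with hG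
  have hG0 : 0 < G := by positivity
  set r := min 1 (m / (2 * (N * G))) with hr
  have hN0 : (0 : ℝ) < N := by exact_mod_cast (show 0 < N by omega)
  have hr0 : 0 < r := lt_min one_pos (by positivity)
  have hvol : 0 < (volume (closedBall (0 : EuclideanSpace ℝ (Fin N)) r)).toReal :=
    ENNReal.toReal_pos (measure_closedBall_pos _ _ hr0).ne' measure_closedBall_lt_top.ne
  refine ⟨(volume (closedBall (0 : EuclideanSpace ℝ (Fin N)) r)).toReal * (m / 2) ^ (q + 1),
    by positivity, fun ε Ω c d u v h hb hu0 => ?_⟩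
  have hpd : ∀ z ∈ closedBall (0 : EuclideanSpace ℝ (Fin N)) 1, ∀ i, |pd i u z| ≤ G := by
    intro z hz
    have hsub : closedBall z 1 ⊆ closedBall 0 2 :=
      closedBall_subset_closedBall' (by rw [mem_closedBall] at hz; linarith)
    have hΩ : closedBall z 1 ⊆ Ω := h.ball_sub hz (by norm_num)
    refine hCs Ω u z 1 K (4 * K ^ p) h.isOpen h.cu one_pos hΩ (fun y hy => ?_) fun y hy => ?_
    · rw [abs_of_pos (h.upos y (hΩ hy))]; exact (hb y (hsub hy)).1
    · rw [← abs_neg, abs_of_nonneg (h.equ_nonneg (hΩ hy))]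
      refine (h.equ_upper (hΩ hy)).trans ?_
      have := Real.rpow_le_rpow (h.vpos y (hΩ hy)).le (hb y (hsub hy)).2 hp.le
      linarith
  have hlow : ∀ x ∈ closedBall (0 : EuclideanSpace ℝ (Fin N)) r, m / 2 ≤ u x := by
    intro x hx
    have hx1 : x ∈ closedBall (0 : EuclideanSpace ℝ (Fin N)) 1 :=
      closedBall_subset_closedBall (min_le_left _ _) hx
    have := abs_sub_le_of_abs_pd_le hG0.le (fun z hz => (h.cu.contDiffAt (h.isOpen.mem_nhds
      (h.ball (closedBall_subset_closedBall (by norm_num) hz)))).differentiableAt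
      (by norm_num)) hpd hx1
    rw [sub_zero] at this
    rw [mem_closedBall_zero_iff] at hx
    have h2 : N * G * ‖x‖ ≤ m / 2 := by
      calc N * G * ‖x‖ ≤ N * G * (m / (2 * (N * G))) :=
            mul_le_mul_of_nonneg_left (hx.trans (min_le_right _ _)) (by positivity)
        _ = m / 2 := by field_simp
    linarith [neg_abs_le (u x - u 0)]
  calc _ = ∫ _x in closedBall (0 : EuclideanSpace ℝ (Fin N)) r, (m / 2) ^ (q + 1) := by
        rw [setIntegral_const, smul_eq_mul]; rfl
    _ ≤ energy p q u v r := by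
        refine setIntegral_mono_on (integrableOn_const (by
          exact measure_closedBall_lt_top.ne)) (h.integrableOn h.continuousOn_energy
          ((min_le_left _ _).trans (by norm_num))) measurableSet_closedBall fun x hx => ?_
        have hx' := h.ball (closedBall_subset_closedBall
          ((min_le_left _ _).trans (by norm_num)) hx)
        exact (Real.rpow_le_rpow (by positivity) (hlow x hx) (by positivity)).trans
          (le_add_of_nonneg_left (Real.rpow_nonneg (h.vpos x hx').le _))
    _ ≤ energy p q u v 1 := h.energy_mono (min_le_left _ _) (by norm_num)

theorem le_of_recursion {x : ℕ → ℝ} {b S D : ℝ} {n : ℕ} (hb0 : 0 ≤ b) (hb1 : b < 1)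
    (hS : 0 ≤ S) (hD : ∀ j ≤ n, x j ≤ D) (h : ∀ j < n, x j ≤ S + b * x (j + 1)) (m : ℕ) :
    ∀ j, j + m ≤ n → x j ≤ S / (1 - b) + b ^ m * D := by
  have h1b : 0 < 1 - b := by linarith
  induction m with
  | zero =>
    intro j hj
    have : 0 ≤ S / (1 - b) := by positivity
    simpa using (hD j (by omega)).trans (by linarith)
  | succ m ih =>
    intro j hj
    calc x j ≤ S + b * x (j + 1) := h j (by omega)
      _ ≤ S + b * (S / (1 - b) + b ^ m * D) := by
          have := mul_le_mul_of_nonneg_left (ih (j + 1) (by omega)) hb0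
          linarith
      _ = S / (1 - b) + b ^ (m + 1) * D := by field_simp; ring

theorem exists_scale_of_recursion {b κ D l : ℝ} (hb0 : 0 ≤ b) (hb1 : b < 1) (hκ : 0 < κ) :
    ∃ δ > 0, ∀ L : ℝ, ∃ n m : ℕ, m ≤ n ∧
      (L + n * δ) / (1 - b) + b ^ m * (L + n * D) < ((n - m : ℕ) : ℝ) * κ + l := by
  have h1b : 0 < 1 - b := by linarith
  obtain ⟨m, hm⟩ := exists_pow_lt_of_lt_one (show 0 < κ / (4 * (|D| + 1)) by positivity) hb1
  refine ⟨(1 - b) * (κ / 4), by positivity, fun L => ?_⟩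
  obtain ⟨n, hn⟩ := exists_nat_gt (max (m : ℝ)
    ((L / (1 - b) + b ^ m * L + m * κ - l) / (κ / 2)))
  have hmn : m ≤ n := by exact_mod_cast (le_max_left _ _).trans hn.le
  refine ⟨n, m, hmn, ?_⟩
  have h2 := (le_max_right _ _).trans_lt hn
  rw [div_lt_iff₀ (by positivity)] at h2
  have h3 : b ^ m * D ≤ κ / 4 := by
    calc b ^ m * D ≤ b ^ m * (|D| + 1) :=
          mul_le_mul_of_nonneg_left (by linarith [le_abs_self D]) (by positivity)
      _ ≤ κ / (4 * (|D| + 1)) * (|D| + 1) := mul_le_mul_of_nonneg_right hm.le (by positivity)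
      _ = κ / 4 := by field_simp
  have h4 : (L + n * ((1 - b) * (κ / 4))) / (1 - b) = L / (1 - b) + n * (κ / 4) := by field_simp
  rw [h4, Nat.cast_sub hmn]
  have h5 := mul_le_mul_of_nonneg_left h3 (Nat.cast_nonneg (α := ℝ) n)
  nlinarith

theorem LocSys.energy_one_le (h : LocSys p q ε Ω c d u v) (hp : 0 < p) (hq : 0 < q) {Λ P : ℝ}
    (hΛ : 1 ≤ Λ) (hpP : p + 1 ≤ P) (hqP : q + 1 ≤ P)
    (hb : ∀ x ∈ closedBall 0 1, u x ≤ Λ ∧ v x ≤ Λ) :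
    energy p q u v 1 ≤ 2 * (volume (closedBall (0 : EuclideanSpace ℝ (Fin N)) 1)).toReal * Λ ^ P := by
  calc energy p q u v 1 ≤ ∫ _x in closedBall (0 : EuclideanSpace ℝ (Fin N)) 1, 2 * Λ ^ P := by
        refine setIntegral_mono_on (h.integrableOn h.continuousOn_energy (by norm_num))
          (integrableOn_const (by exact measure_closedBall_lt_top.ne)) measurableSet_closedBall
          fun x hx => ?_
        have hx' := h.ball (closedBall_subset_closedBall (by norm_num) hx)
        have h1 := (Real.rpow_le_rpow (h.vpos x hx').le (hb x hx).2 (by positivity)).trans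
          (Real.rpow_le_rpow_of_exponent_le hΛ hpP)
        have h2 := (Real.rpow_le_rpow (h.upos x hx').le (hb x hx).1 (by positivity)).trans
          (Real.rpow_le_rpow_of_exponent_le hΛ hqP)
        linarith
    _ = _ := by
        rw [setIntegral_const, smul_eq_mul, measureReal_def]; ring

set_option maxHeartbeats 1000000 in
theorem exists_no_local_solution_of_exponents (hN : N = 3 ∨ N = 4) (hp : 0 < p) (hq : 0 < q)
    (hpq : 1 < p * q) (hsub : (N : ℝ) - 2 < N / (p + 1) + N / (q + 1))
    (hα : α + 2 = β * p) (hβ : β + 2 = α * q) (hα0 : 0 < α) (hβ0 : 0 < β)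
    (hκ : 0 < α + β + 2 - N) {K c₀ : ℝ} (hK : 1 ≤ K) (hc₀ : 0 < c₀) :
    ∃ S : ℝ, 1 ≤ S ∧ ∀ (ε : ℝ) (Ω : Set (EuclideanSpace ℝ (Fin N)))
      (c d u v : EuclideanSpace ℝ (Fin N) → ℝ), LocSys p q ε Ω c d u v →
      ε ≤ (N / (p + 1) + N / (q + 1) - (N - 2)) / 16 →
      (∀ x ∈ closedBall 0 100, u x ≤ K * S ^ α ∧ v x ≤ K * S ^ β) →
      c₀ ≤ S⁻¹ ^ (α + β + 2 - N) * energy p q u v S⁻¹ → False := by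
  obtain ⟨b, hb0, hb1, H⟩ := exists_local_energy_le hN hp hq hpq hsub
  set κ := α + β + 2 - N with hκd
  set A := max α β with hA
  have hA0 : 0 < A := lt_max_of_lt_left hα0
  set P := max p q + 1 with hP
  have hP0 : 0 < P := by
    have : 0 < max p q := lt_max_of_lt_left hp
    positivity
  have hl8 : 0 < Real.log 8 := Real.log_pos (by norm_num)
  obtain ⟨δ, hδ, hs⟩ := exists_scale_of_recursion (b := b) (κ := κ * Real.log 8)
    (D := P * (A * Real.log 8)) (l := Real.log c₀) hb0 hb1 (by positivity)
  set η := δ / (A * Real.log 8) with hη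
  have hη0 : 0 < η := by positivity
  obtain ⟨C, hC, HC⟩ := H η hη0
  set vol := (volume (closedBall (0 : EuclideanSpace ℝ (Fin N)) 1)).toReal with hvol
  have hv0 : 0 ≤ vol := ENNReal.toReal_nonneg
  have hlK : 0 ≤ Real.log K := Real.log_nonneg hK
  have hlC : 0 ≤ Real.log (1 + C) := Real.log_nonneg (by linarith)
  have hlv : 0 ≤ Real.log (1 + 2 * vol) := Real.log_nonneg (by linarith)
  set L := Real.log (1 + 2 * vol) + P * Real.log K + Real.log (1 + C) + η * Real.log K with hL
  have hPK : 0 ≤ P * Real.log K := by positivity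
  have hηK : 0 ≤ η * Real.log K := by positivity
  obtain ⟨n, m, hmn, hcon⟩ := hs L
  have hS1 : (1 : ℝ) ≤ 8 ^ n := one_le_pow₀ (by norm_num)
  have hS0 : (0 : ℝ) < 8 ^ n := by positivity
  refine ⟨8 ^ n, hS1, fun ε Ω c d u v h hε hb hlow => ?_⟩
  set S : ℝ := 8 ^ n with hS
  set Λ := K * S ^ A with hΛ
  have hΛ1 : 1 ≤ Λ := one_le_mul_of_one_le_of_one_le hK (Real.one_le_rpow hS1 hA0.le)
  have hlΛ : Real.log Λ = Real.log K + n * (A * Real.log 8) := by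
    rw [hΛ, Real.log_mul (by positivity) (by positivity), Real.log_rpow hS0, hS, Real.log_pow]
    ring
  have hbΛ : ∀ x ∈ closedBall (0 : EuclideanSpace ℝ (Fin N)) 100, u x ≤ Λ ∧ v x ≤ Λ := fun x hx =>
    ⟨(hb x hx).1.trans (mul_le_mul_of_nonneg_left
      (Real.rpow_le_rpow_of_exponent_le hS1 (le_max_left _ _)) (by positivity)),
    (hb x hx).2.trans (mul_le_mul_of_nonneg_left
      (Real.rpow_le_rpow_of_exponent_le hS1 (le_max_right _ _)) (by positivity))⟩
  set R : ℕ → ℝ := fun j => 8 ^ j / S with hRd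
  have hR0 : ∀ j, 0 < R j := fun j => by positivity
  have hR1 : ∀ j ≤ n, R j ≤ 1 := fun j hj => by
    rw [hRd, div_le_one hS0]; exact pow_le_pow_right₀ (by norm_num) hj
  have hRs : ∀ j, R (j + 1) = R j * 8 := fun j => by simp only [hRd, pow_succ]; ring
  set e : ℕ → ℝ := fun j => R j ^ κ * energy p q u v (R j) with he
  have he0 : ∀ j ≤ n, 0 ≤ e j := fun j hj =>
    mul_nonneg (Real.rpow_nonneg (hR0 j).le _) (h.energy_nonneg ((hR1 j hj).trans (by norm_num)))
  set X : ℕ → ℝ := fun j => Real.log (1 + e j) with hX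
  have hpP : p + 1 ≤ P := by linarith [le_max_left p q]
  have hqP : q + 1 ≤ P := by linarith [le_max_right p q]
  have hD : ∀ j ≤ n, X j ≤ L + n * (P * (A * Real.log 8)) := by
    intro j hj
    have h1 := h.energy_one_le hp hq hΛ1 hpP hqP fun x hx =>
      hbΛ x (closedBall_subset_closedBall (by norm_num) hx)
    have h2 : e j ≤ energy p q u v 1 := by
      calc e j ≤ 1 * energy p q u v (R j) := mul_le_mul_of_nonneg_right
            (Real.rpow_le_one (hR0 j).le (hR1 j hj) hκ.le)
            (h.energy_nonneg ((hR1 j hj).trans (by norm_num)))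
        _ ≤ _ := by rw [one_mul]; exact h.energy_mono (hR1 j hj) (by norm_num)
    have h3 : 1 + e j ≤ (1 + 2 * vol) * Λ ^ P := by
      rw [add_mul, one_mul]
      exact add_le_add (Real.one_le_rpow hΛ1 hP0.le) (h2.trans h1)
    have h4 := Real.log_le_log (by linarith [he0 j hj]) h3
    rw [Real.log_mul (by positivity) (by positivity), Real.log_rpow (by positivity), hlΛ] at h4
    have h5 : P * (Real.log K + n * (A * Real.log 8)) =
      P * Real.log K + n * (P * (A * Real.log 8)) := by ring
    change Real.log (1 + e j) ≤ _
    linarith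
  have hstep : ∀ j < n, X j ≤ (L + n * δ) + b * X (j + 1) := by
    intro j hj
    have h1 := HC ε _ _ _ _ _ (h.scale (hR0 j) (hR1 j hj.le) hα hβ) hε Λ hΛ1 (fun x hx => by
      have hx' : 0 + R j • x ∈ closedBall (0 : EuclideanSpace ℝ (Fin N)) 100 := by
        rw [mem_closedBall_zero_iff] at hx ⊢
        rw [zero_add, norm_smul, Real.norm_of_nonneg (hR0 j).le]
        exact (mul_le_of_le_one_left (norm_nonneg x) (hR1 j hj.le)).trans hx
      have hx2 := h.ball hx'
      exact ⟨(mul_le_of_le_one_left (h.upos _ hx2).le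
        (Real.rpow_le_one (hR0 j).le (hR1 j hj.le) hα0.le)).trans (hbΛ _ hx').1,
        (mul_le_of_le_one_left (h.vpos _ hx2).le
        (Real.rpow_le_one (hR0 j).le (hR1 j hj.le) hβ0.le)).trans (hbΛ _ hx').2⟩)
    have hR1' := hR1 j hj.le
    rw [h.energy_scale (hR0 j) (by linarith) hα hβ,
      h.energy_scale (hR0 j) (by linarith) hα hβ, mul_one, ← hRs] at h1
    have hj1 : j + 1 ≤ n := hj
    have h2 : R j ^ κ * energy p q u v (R (j + 1)) ≤ e (j + 1) :=
      mul_le_mul_of_nonneg_right (Real.rpow_le_rpow (hR0 j).le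
        (by rw [hRs]; linarith [hR0 j]) hκ.le)
        (h.energy_nonneg ((hR1 _ hj1).trans (by norm_num)))
    have h20 : 0 ≤ R j ^ κ * energy p q u v (R (j + 1)) :=
      mul_nonneg (Real.rpow_nonneg (hR0 j).le _)
        (h.energy_nonneg ((hR1 _ hj1).trans (by norm_num)))
    have h3 : 1 + e j ≤ (1 + C) * Λ ^ η * (1 + e (j + 1)) ^ b := by
      have a1 : e j ≤ C * Λ ^ η * (1 + e (j + 1)) ^ b := by
        refine h1.trans (mul_le_mul_of_nonneg_left
          (Real.rpow_le_rpow (by linarith) (by linarith) hb0) (by positivity))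
      have a2 : 1 ≤ Λ ^ η * (1 + e (j + 1)) ^ b :=
        one_le_mul_of_one_le_of_one_le (Real.one_le_rpow hΛ1 hη0.le)
          (Real.one_le_rpow (by linarith [he0 _ hj1]) hb0)
      exact (add_le_add a2 a1).trans (le_of_eq (by ring))
    have he1 : 0 < 1 + e (j + 1) := by linarith [he0 _ hj1]
    have h4 := Real.log_le_log (by linarith [he0 j hj.le]) h3
    rw [Real.log_mul (by positivity) (by positivity), Real.log_mul (by positivity) (by positivity),
      Real.log_rpow (by positivity), Real.log_rpow he1, hlΛ] at h4
    have h5 : η * (n * (A * Real.log 8)) = n * δ := by rw [hη]; field_simp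
    change Real.log (1 + e j) ≤ _ + b * Real.log (1 + e (j + 1))
    linarith [mul_add η (Real.log K) (n * (A * Real.log 8))]
  have hfin := le_of_recursion hb0 hb1 (by positivity) hD hstep m (n - m) (by omega)
  have hnm : n - m ≤ n := Nat.sub_le _ _
  have hlow' : Real.log c₀ + ((n - m : ℕ) : ℝ) * (κ * Real.log 8) ≤ X (n - m) := by
    have hk : R (n - m) ^ κ = S⁻¹ ^ κ * ((8 : ℝ) ^ (n - m)) ^ κ := by
      rw [← Real.mul_rpow (by positivity) (by positivity)]; congr 1; simp only [hRd]; ring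
    have h1 : c₀ * ((8 : ℝ) ^ (n - m)) ^ κ ≤ e (n - m) := by
      calc c₀ * ((8 : ℝ) ^ (n - m)) ^ κ
          ≤ S⁻¹ ^ κ * energy p q u v S⁻¹ * ((8 : ℝ) ^ (n - m)) ^ κ :=
            mul_le_mul_of_nonneg_right hlow (by positivity)
        _ = R (n - m) ^ κ * energy p q u v S⁻¹ := by rw [hk]; ring
        _ ≤ e (n - m) := by
            refine mul_le_mul_of_nonneg_left (h.energy_mono ?_ ((hR1 _ hnm).trans (by norm_num)))
              (Real.rpow_nonneg (hR0 _).le _)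
            rw [inv_eq_one_div]
            exact div_le_div_of_nonneg_right (one_le_pow₀ (by norm_num)) hS0.le
    have h2 := Real.log_le_log (by positivity) (h1.trans (by linarith : e (n - m) ≤ 1 + e (n - m)))
    rw [Real.log_mul (by positivity) (by positivity), Real.log_rpow (by positivity),
      Real.log_pow] at h2
    change _ ≤ Real.log (1 + e (n - m))
    linarith
  linarith

/-- Local Liouville theorem: no solution near the ball of radius `100` is almost maximal, at the
scaling of the system, at the origin. -/
theorem exists_no_local_solution (hN : N = 3 ∨ N = 4) (hp : 0 < p) (hq : 0 < q)
    (hpq : 1 < p * q) (hsub : (N : ℝ) - 2 < N / (p + 1) + N / (q + 1))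
    (hα : α + 2 = β * p) (hβ : β + 2 = α * q) (hα0 : 0 < α) (hβ0 : 0 < β)
    (hκ : 0 < α + β + 2 - N) {K m : ℝ} (hK : 1 ≤ K) (hm : 0 < m) :
    ∃ S : ℝ, 1 ≤ S ∧ ∀ (ε : ℝ) (Ω : Set (EuclideanSpace ℝ (Fin N)))
      (c d u v : EuclideanSpace ℝ (Fin N) → ℝ), LocSys p q ε Ω c d u v →
      ε ≤ (N / (p + 1) + N / (q + 1) - (N - 2)) / 16 →
      (∀ x ∈ closedBall 0 100, u x ≤ K * S ^ α ∧ v x ≤ K * S ^ β) →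
      (m * S ^ α ≤ u 0 ∨ m * S ^ β ≤ v 0) → False := by
  have hN3 : 3 ≤ N := by omega
  have hK0 : 0 < K := by linarith
  obtain ⟨c₁, hc₁, H₁⟩ := exists_le_energy hN3 hp hq hK0 hm
  obtain ⟨c₂, hc₂, H₂⟩ := exists_le_energy hN3 hq hp hK0 hm
  obtain ⟨S, hS1, HS⟩ := exists_no_local_solution_of_exponents hN hp hq hpq hsub hα hβ hα0 hβ0 hκ hK
    (lt_min hc₁ hc₂)
  have hS0 : 0 < S := by linarith
  refine ⟨S, hS1, fun ε Ω c d u v h hε hb hlow => HS ε Ω c d u v h hε hb ?_⟩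
  have hi0 : 0 < S⁻¹ := by positivity
  have hi1 : S⁻¹ ≤ 1 := inv_le_one_of_one_le₀ hS1
  have hsc := h.scale hi0 hi1 hα hβ
  have hcancel : ∀ t : ℝ, S⁻¹ ^ t * S ^ t = 1 := fun t => by
    rw [← Real.mul_rpow hi0.le hS0.le, inv_mul_cancel₀ hS0.ne', Real.one_rpow]
  have hbd : ∀ x ∈ closedBall (0 : EuclideanSpace ℝ (Fin N)) 2,
      S⁻¹ ^ α * u (0 + S⁻¹ • x) ≤ K ∧ S⁻¹ ^ β * v (0 + S⁻¹ • x) ≤ K := by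
    intro x hx
    have hx' : 0 + S⁻¹ • x ∈ closedBall (0 : EuclideanSpace ℝ (Fin N)) 100 := by
      rw [mem_closedBall_zero_iff] at hx ⊢
      rw [zero_add, norm_smul, Real.norm_of_nonneg hi0.le]
      nlinarith [norm_nonneg x]
    constructor
    · refine (mul_le_mul_of_nonneg_left (hb _ hx').1 (by positivity)).trans (le_of_eq ?_)
      linear_combination K * hcancel α
    · refine (mul_le_mul_of_nonneg_left (hb _ hx').2 (by positivity)).trans (le_of_eq ?_)
      linear_combination K * hcancel β
  have hen := h.energy_scale hi0 (r := 1) (by linarith) hα hβ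
  rw [mul_one] at hen
  rw [← hen]
  rcases hlow with hl | hl
  · refine (min_le_left _ _).trans (H₁ ε _ _ _ _ _ hsc hbd ?_)
    calc m = S⁻¹ ^ α * (m * S ^ α) := by linear_combination -m * hcancel α
      _ ≤ _ := mul_le_mul_of_nonneg_left (by simpa using hl) (by positivity)
  · rw [energy_symm]
    refine (min_le_right _ _).trans (H₂ ε _ _ _ _ _ hsc.symm (fun x hx => (hbd x hx).symm) ?_)
    calc m = S⁻¹ ^ β * (m * S ^ β) := by linear_combination -m * hcancel β
      _ ≤ _ := mul_le_mul_of_nonneg_left (by simpa using hl) (by positivity)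

end LocalLiouville

section Decay

variable {N : ℕ} {p q a b α β R : ℝ} {u v : EuclideanSpace ℝ (Fin N) → ℝ}

theorem contDiffAt_norm_rpow {n : WithTop ℕ∞} {x : EuclideanSpace ℝ (Fin N)} (hx : x ≠ 0) (a : ℝ) :
    ContDiffAt ℝ n (fun y : EuclideanSpace ℝ (Fin N) => ‖y‖ ^ a) x :=
  (contDiffAt_norm ℝ hx).rpow_const_of_ne (norm_ne_zero_iff.2 hx)

theorem pd_norm_rpow {x : EuclideanSpace ℝ (Fin N)} (hx : x ≠ 0) (a : ℝ) (j : Fin N) :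
    pd j (fun y => ‖y‖ ^ a) x = a * ‖x‖ ^ (a - 2) * x j := by
  have hx0 : 0 < ‖x‖ := norm_pos_iff.2 hx
  have e : (fun y : EuclideanSpace ℝ (Fin N) => ‖y‖ ^ a) = fun y => (‖y‖ ^ 2) ^ (a / 2) := by
    funext y
    rw [← Real.rpow_natCast, ← Real.rpow_mul (norm_nonneg y)]
    congr 1; push_cast; ring
  have hg : HasDerivAt (fun t : ℝ => t ^ (a / 2)) (a / 2 * (‖x‖ ^ 2) ^ (a / 2 - 1)) (‖x‖ ^ 2) :=
    Real.hasDerivAt_rpow_const (Or.inl (by positivity))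
  rw [e, pd_comp (u := fun y => ‖y‖ ^ 2) j hg
    (((contDiff_norm_sq ℝ).differentiable (n := 1) (by norm_num)) x), pd_norm_sq]
  rw [← Real.rpow_natCast, ← Real.rpow_mul (norm_nonneg x),
    show ((2 : ℕ) : ℝ) * (a / 2 - 1) = a - 2 by push_cast; ring]
  ring

theorem sum_mul_pd_norm_rpow {x : EuclideanSpace ℝ (Fin N)} (hx : x ≠ 0) (a : ℝ) :
    ∑ j, x j * pd j (fun y => ‖y‖ ^ a) x = a * ‖x‖ ^ a := by
  have hx0 : 0 < ‖x‖ := norm_pos_iff.2 hx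
  have : ∑ j, x j * x j = ‖x‖ ^ 2 := by
    rw [EuclideanSpace.real_norm_sq_eq]
    exact Finset.sum_congr rfl fun j _ => by ring
  simp only [pd_norm_rpow hx]
  calc ∑ j, x j * (a * ‖x‖ ^ (a - 2) * x j) = a * (‖x‖ ^ (a - 2) * ∑ j, x j * x j) := by
        rw [Finset.mul_sum, Finset.mul_sum]
        exact Finset.sum_congr rfl fun j _ => by ring
    _ = a * ‖x‖ ^ a := by
        rw [this, ← Real.rpow_natCast, ← Real.rpow_add hx0]
        congr 2; push_cast; ring

theorem norm_rpow_mem_Icc {x : EuclideanSpace ℝ (Fin N)} (h1 : 1 / 2 ≤ ‖x‖) (h2 : ‖x‖ ≤ 3 / 2)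
    (ha : -2 < a) (ha0 : a ≤ 0) : ‖x‖ ^ a ∈ Icc (1 / 4) 4 := by
  constructor
  · calc (1 / 4 : ℝ) ≤ (3 / 2) ^ (-2 : ℝ) := by
          rw [Real.rpow_neg (by norm_num), Real.rpow_two]; norm_num
      _ ≤ (3 / 2) ^ a := Real.rpow_le_rpow_of_exponent_le (by norm_num) ha.le
      _ ≤ ‖x‖ ^ a := Real.rpow_le_rpow_of_nonpos (by linarith) h2 ha0
  · calc ‖x‖ ^ a ≤ (1 / 2) ^ a := Real.rpow_le_rpow_of_nonpos (by norm_num) h1 ha0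
      _ ≤ (1 / 2) ^ (-2 : ℝ) :=
          Real.rpow_le_rpow_of_exponent_ge (by norm_num) (by norm_num) ha.le
      _ = 4 := by rw [Real.rpow_neg (by norm_num), Real.rpow_two]; norm_num

theorem IsHHSol.scale (h : IsHHSol a b p q univ u v) (hR : 0 < R) (hα : α + 2 + a = β * p)
    (hβ : β + 2 + b = α * q) :
    IsHHSol a b p q univ (fun x => R ^ α * u (0 + R • x)) (fun x => R ^ β * v (0 + R • x)) := by
  obtain ⟨cu, cv, du, dv, pu, pv, eu, ev⟩ := h
  have hne : ∀ x : EuclideanSpace ℝ (Fin N), x ∈ univ \ {0} → 0 + R • x ∈ univ \ {0} := fun x hx => by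
    simpa [hR.ne'] using hx
  have hcd : ∀ n : WithTop ℕ∞, ContDiff ℝ n (fun x : EuclideanSpace ℝ (Fin N) => 0 + R • x) :=
    fun n => by fun_prop
  have hop : IsOpen (univ \ {0} : Set (EuclideanSpace ℝ (Fin N))) := by
    rw [← compl_eq_univ_sdiff]; exact isOpen_compl_singleton
  have key : ∀ (w f : EuclideanSpace ℝ (Fin N) → ℝ) (s t e k : ℝ), ContDiffOn ℝ 2 w (univ \ {0}) →
      (∀ x ∈ univ, 0 < f x) → s + 2 + e = t * k →
      (∀ x ∈ univ \ {0}, -lap w x = ‖x‖ ^ e * f x ^ k) → ∀ x ∈ univ \ {0},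
      -lap (fun x => R ^ s * w (0 + R • x)) x = ‖x‖ ^ e * (R ^ t * f (0 + R • x)) ^ k := by
    intro w f s t e k hw hf hs hwf x hx
    have hw' := hw.contDiffAt (hop.mem_nhds (hne x hx))
    have hw2 : ContDiffAt ℝ 2 (fun z => w (0 + R • z)) x :=
      ContDiffAt.comp (g := w) x hw' (hcd 2).contDiffAt
    have h1 := hwf _ (hne x hx)
    have hn : ‖0 + R • x‖ ^ e = R ^ e * ‖x‖ ^ e := by
      rw [zero_add, norm_smul, Real.norm_of_nonneg hR.le, Real.mul_rpow hR.le (norm_nonneg x)]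
    rw [hn] at h1
    rw [lap_const_mul _ hw2, lap_affine R 0 hw', Real.mul_rpow (by positivity) (hf _ trivial).le,
      ← Real.rpow_mul hR.le, ← hs, Real.rpow_add hR, Real.rpow_add hR, Real.rpow_two]
    linear_combination R ^ s * R ^ 2 * h1
  refine ⟨?_, ?_, ?_, ?_, fun x _ => mul_pos (by positivity) (pu _ trivial),
    fun x _ => mul_pos (by positivity) (pv _ trivial), key u v α β a p du pv hα eu,
    key v u β α b q dv pu hβ ev⟩
  · exact continuousOn_const.mul (cu.comp (hcd 0).continuous.continuousOn fun _ _ => trivial)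
  · exact continuousOn_const.mul (cv.comp (hcd 0).continuous.continuousOn fun _ _ => trivial)
  · exact contDiffOn_const.mul (du.comp (hcd 2).contDiffOn fun x hx => hne x hx)
  · exact contDiffOn_const.mul (dv.comp (hcd 2).contDiffOn fun x hx => hne x hx)

theorem abs_sum_pd_affine_norm_rpow_le {x y : EuclideanSpace ℝ (Fin N)} {lam : ℝ} (hlam : 0 < lam)
    (ha : -2 < a) (ha0 : a ≤ 0) (hx : x ∈ closedBall 0 100) (h1 : 1 / 2 ≤ ‖y + lam • x‖)
    (h2 : ‖y + lam • x‖ ≤ 3 / 2) :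
    |∑ j, x j * pd j (fun x => ‖y + lam • x‖ ^ a) x| ≤ 1600 * lam := by
  set z := y + lam • x with hz
  have hz0 : 0 < ‖z‖ := by linarith
  have hzne : z ≠ 0 := norm_pos_iff.1 hz0
  have e : ∑ j, x j * pd j (fun x => ‖y + lam • x‖ ^ a) x =
      lam * (a * (‖z‖ ^ a * (‖z‖ ^ 2)⁻¹ * inner ℝ z x)) := by
    rw [PiLp.inner_apply, Finset.mul_sum, Finset.mul_sum, Finset.mul_sum]
    refine Finset.sum_congr rfl fun j _ => ?_
    rw [pd_affine (u := fun z => ‖z‖ ^ a) j lam y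
      ((contDiffAt_norm_rpow (n := 1) hzne a).differentiableAt (by norm_num)), ← hz,
      pd_norm_rpow hzne, Real.rpow_sub hz0, Real.rpow_two]
    simp; ring
  have h3 : |inner ℝ z x| ≤ ‖z‖ * 100 :=
    (abs_real_inner_le_norm z x).trans
      (mul_le_mul_of_nonneg_left (mem_closedBall_zero_iff.1 hx) hz0.le)
  have h4 := (norm_rpow_mem_Icc h1 h2 ha ha0).2
  have h5 : |a| ≤ 2 := by rw [abs_of_nonpos ha0]; linarith
  have h6 : ‖z‖⁻¹ ≤ 2 := by
    rw [inv_le_comm₀ hz0 (by norm_num)]; linarith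
  rw [e, abs_mul, abs_mul, abs_mul, abs_of_pos hlam, abs_of_nonneg (by positivity :
    0 ≤ ‖z‖ ^ a * (‖z‖ ^ 2)⁻¹)]
  calc lam * (|a| * (‖z‖ ^ a * (‖z‖ ^ 2)⁻¹ * |inner ℝ z x|))
      ≤ lam * (|a| * (‖z‖ ^ a * (‖z‖ ^ 2)⁻¹ * (‖z‖ * 100))) := by gcongr
    _ = lam * (|a| * (‖z‖ ^ a * (100 * ‖z‖⁻¹))) := by field_simp
    _ ≤ lam * (2 * (4 * (100 * 2))) := by gcongr
    _ = 1600 * lam := by ring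

theorem exists_maximal_point {M : EuclideanSpace ℝ (Fin N) → ℝ} {x₀ : EuclideanSpace ℝ (Fin N)}
    (hM : Continuous M) {B : ℝ} (hB : 0 < B) (hx : B < M x₀) :
    ∃ y ρ, dist y x₀ + ρ = 1 / 2 ∧ 0 < ρ ∧ B < M y * (2 * ρ) ∧
      ∀ z ∈ closedBall y (ρ / 2), M z ≤ 2 * M y := by
  obtain ⟨y, hy, hmax⟩ := (isCompact_closedBall x₀ (1 / 2)).exists_isMaxOn
    ⟨x₀, mem_closedBall_self (by norm_num)⟩
    (f := fun y => M y * (1 / 2 - dist y x₀)) (by fun_prop)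
  have h0 := hmax (mem_closedBall_self (by norm_num) : x₀ ∈ closedBall x₀ (1 / 2))
  simp only [dist_self, mem_ofPred_eq] at h0
  rw [mem_closedBall] at hy
  have hρ : 0 < 1 / 2 - dist y x₀ := by
    rcases (sub_nonneg.2 hy).eq_or_lt with h | h
    · rw [← h] at h0; linarith
    · exact h
  refine ⟨y, 1 / 2 - dist y x₀, by ring, hρ, by linarith, fun z hz => ?_⟩
  rw [mem_closedBall] at hz
  have htri := dist_triangle z y x₀
  have h1 := hmax (show z ∈ closedBall x₀ (1 / 2) by rw [mem_closedBall]; linarith)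
  simp only [mem_ofPred_eq] at h1
  set ρ := 1 / 2 - dist y x₀ with hρd
  rcases le_or_gt (M z) 0 with h | h
  · have : 0 < M y := by
      by_contra hcon
      have := mul_nonpos_of_nonpos_of_nonneg (not_lt.1 hcon) hρ.le
      linarith
    linarith
  · have h2 : M z * (ρ / 2) ≤ M y * ρ :=
      (mul_le_mul_of_nonneg_left (by linarith) h.le).trans h1
    nlinarith

theorem exists_bound_unit_sphere (hN : N = 3 ∨ N = 4) (hp : 0 < p) (hq : 0 < q)
    (hpq : 1 < p * q) (hsub : (N : ℝ) - 2 < N / (p + 1) + N / (q + 1))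
    (hα : α + 2 = β * p) (hβ : β + 2 = α * q) (hα0 : 0 < α) (hβ0 : 0 < β)
    (hκ : 0 < α + β + 2 - N) (ha : -2 < a) (ha0 : a ≤ 0) (hb : -2 < b) (hb0 : b ≤ 0) :
    ∃ B : ℝ, ∀ u v : EuclideanSpace ℝ (Fin N) → ℝ, IsHHSol a b p q univ u v → ∀ x, ‖x‖ = 1 →
      u x ≤ B ∧ v x ≤ B := by
  set A := max α β with hA
  have hA0 : 0 < A := lt_max_of_lt_left hα0
  have hαA : α ≤ A := le_max_left _ _
  have hβA : β ≤ A := le_max_right _ _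
  obtain ⟨S, hS1, HS⟩ := exists_no_local_solution hN hp hq hpq hsub hα hβ hα0 hβ0 hκ
    (K := 2 ^ A) (m := (1 / 2) ^ A) (Real.one_le_rpow (by norm_num) hA0.le) (by positivity)
  have hS0 : 0 < S := by linarith
  set ε := (N / (p + 1) + N / (q + 1) - ((N : ℝ) - 2)) / 16 with hε
  have hε0 : 0 < ε := by rw [hε]; linarith
  set B := max (400 * S) (1600 * S / ε) with hB
  have hB1 : 400 * S ≤ B := le_max_left _ _
  have hB2 : 1600 * S / ε ≤ B := le_max_right _ _
  have hB0 : 1 ≤ B := by linarith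
  suffices H : ∀ u v : EuclideanSpace ℝ (Fin N) → ℝ, IsHHSol a b p q univ u v → ∀ x, ‖x‖ = 1 →
      u x ^ α⁻¹ + v x ^ β⁻¹ ≤ B by
    refine ⟨B ^ A, fun u v h x hx => ?_⟩
    have h1 := H u v h x hx
    have hu := h.2.2.2.2.1 x trivial
    have hv := h.2.2.2.2.2.1 x trivial
    have key : ∀ t s : ℝ, 0 < t → 0 < s → s ≤ A → t ^ s⁻¹ ≤ B → t ≤ B ^ A := by
      intro t s ht hs hsA hts
      calc t = (t ^ s⁻¹) ^ s := by rw [← Real.rpow_mul ht.le, inv_mul_cancel₀ hs.ne', Real.rpow_one]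
        _ ≤ B ^ s := Real.rpow_le_rpow (by positivity) hts hs.le
        _ ≤ B ^ A := Real.rpow_le_rpow_of_exponent_le hB0 hsA
    exact ⟨key _ _ hu hα0 hαA (by linarith [Real.rpow_nonneg hv.le β⁻¹]),
      key _ _ hv hβ0 hβA (by linarith [Real.rpow_nonneg hu.le α⁻¹])⟩
  rintro u v ⟨cu, cv, du, dv, pu, pv, eu, ev⟩ x₀ hx₀
  by_contra! hlt
  set M := fun x => u x ^ α⁻¹ + v x ^ β⁻¹ with hM
  have hu0 : ∀ x, 0 < u x := fun x => pu x trivial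
  have hv0 : ∀ x, 0 < v x := fun x => pv x trivial
  have hMc : Continuous M :=
    ((continuousOn_univ.1 cu).rpow_const fun x => Or.inl (hu0 x).ne').add
      ((continuousOn_univ.1 cv).rpow_const fun x => Or.inl (hv0 x).ne')
  have hMp : ∀ x, 0 < M x := fun x =>
    add_pos (Real.rpow_pos_of_pos (hu0 x) _) (Real.rpow_pos_of_pos (hv0 x) _)
  obtain ⟨y, ρ, hyρ, hρ, hBy, hmax⟩ := exists_maximal_point hMc (by linarith) hlt
  have hMy := hMp y
  have hMyB : B ≤ M y := by nlinarith [dist_nonneg (x := y) (y := x₀)]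
  set lam := S / M y with hlam
  have hlam0 : 0 < lam := by positivity
  have hlamρ : 100 * lam ≤ ρ / 2 := by
    rw [hlam, ← mul_div_assoc, div_le_iff₀ hMy]; linarith
  have hlamε : 1600 * lam ≤ ε := by
    rw [hlam, ← mul_div_assoc, div_le_iff₀ hMy]
    rw [div_le_iff₀ hε0] at hB2
    nlinarith
  set Ω : Set (EuclideanSpace ℝ (Fin N)) := {x | y + lam • x ∈ ball x₀ (1 / 2)} with hΩ
  have hcd : ∀ n : WithTop ℕ∞, ContDiff ℝ n
      (fun x : EuclideanSpace ℝ (Fin N) => y + lam • x) := fun n => by fun_prop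
  have hnear : ∀ x ∈ closedBall (0 : EuclideanSpace ℝ (Fin N)) 100,
      y + lam • x ∈ closedBall y (ρ / 2) := fun x hx => by
    rw [mem_closedBall_zero_iff] at hx
    rw [mem_closedBall, dist_self_add_left, norm_smul, Real.norm_of_nonneg hlam0.le]
    nlinarith
  have hbΩ : closedBall 0 100 ⊆ Ω := fun x hx => by
    have h1 := hnear x hx
    rw [mem_closedBall] at h1
    change dist _ _ < _
    linarith [dist_triangle (y + lam • x) y x₀]
  have hno : ∀ x ∈ Ω, 1 / 2 ≤ ‖y + lam • x‖ ∧ ‖y + lam • x‖ ≤ 3 / 2 := fun x hx => by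
    have h1 : dist (y + lam • x) x₀ < 1 / 2 := hx
    rw [dist_eq_norm] at h1
    have h2 := norm_sub_norm_le (y + lam • x) x₀
    have h3 := norm_sub_norm_le x₀ (y + lam • x)
    rw [norm_sub_rev] at h3
    constructor <;> linarith
  have hne : ∀ x ∈ Ω, y + lam • x ∈ univ \ {(0 : EuclideanSpace ℝ (Fin N))} := fun x hx => by
    refine ⟨trivial, fun h0 => ?_⟩
    have := (hno x hx).1
    rw [mem_singleton_iff.1 h0, norm_zero] at this
    linarith
  have hop : IsOpen (univ \ {0} : Set (EuclideanSpace ℝ (Fin N))) := by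
    rw [← compl_eq_univ_sdiff]; exact isOpen_compl_singleton
  have key : ∀ (w f : EuclideanSpace ℝ (Fin N) → ℝ) (s t e k : ℝ), ContDiffOn ℝ 2 w (univ \ {0}) →
      (∀ x, 0 < f x) → s + 2 = t * k →
      (∀ x ∈ univ \ {0}, -lap w x = ‖x‖ ^ e * f x ^ k) → ∀ x ∈ Ω,
      -lap (fun x => lam ^ s * w (y + lam • x)) x =
        ‖y + lam • x‖ ^ e * (lam ^ t * f (y + lam • x)) ^ k := by
    intro w f s t e k hw hf hs hwf x hx
    have hw' := hw.contDiffAt (hop.mem_nhds (hne x hx))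
    have hw2 : ContDiffAt ℝ 2 (fun z => w (y + lam • z)) x :=
      ContDiffAt.comp (g := w) x hw' (hcd 2).contDiffAt
    have h1 := hwf _ (hne x hx)
    rw [lap_const_mul _ hw2, lap_affine lam y hw', Real.mul_rpow (by positivity) (hf _).le,
      ← Real.rpow_mul hlam0.le, ← hs, Real.rpow_add hlam0, Real.rpow_two]
    linear_combination lam ^ s * lam ^ 2 * h1
  have hcn : ∀ e : ℝ, ContDiffOn ℝ 1 (fun x => ‖y + lam • x‖ ^ e) Ω := fun e x hx =>
    (ContDiffAt.comp (g := fun z => ‖z‖ ^ e) x (contDiffAt_norm_rpow (hne x hx).2 e)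
      (hcd 1).contDiffAt).contDiffWithinAt
  have hsys : LocSys p q ε Ω (fun x => ‖y + lam • x‖ ^ a) (fun x => ‖y + lam • x‖ ^ b)
      (fun x => lam ^ α * u (y + lam • x)) (fun x => lam ^ β * v (y + lam • x)) :=
    ⟨isOpen_ball.preimage (hcd 0).continuous, hbΩ,
      contDiffOn_const.mul (du.comp (hcd 2).contDiffOn fun x hx => hne x hx),
      contDiffOn_const.mul (dv.comp (hcd 2).contDiffOn fun x hx => hne x hx), hcn a, hcn b,
      fun x _ => mul_pos (by positivity) (hu0 _), fun x _ => mul_pos (by positivity) (hv0 _),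
      fun x hx => norm_rpow_mem_Icc (hno x hx).1 (hno x hx).2 ha ha0,
      fun x hx => norm_rpow_mem_Icc (hno x hx).1 (hno x hx).2 hb hb0,
      fun x hx => (abs_sum_pd_affine_norm_rpow_le hlam0 ha ha0 hx (hno x (hbΩ hx)).1
        (hno x (hbΩ hx)).2).trans hlamε,
      fun x hx => (abs_sum_pd_affine_norm_rpow_le hlam0 hb hb0 hx (hno x (hbΩ hx)).1
        (hno x (hbΩ hx)).2).trans hlamε, key u v α β a p du hv0 hα eu, key v u β α b q dv hu0 hβ ev⟩
  have hpow : ∀ t s : ℝ, 0 < t → 0 < s → (t ^ s⁻¹) ^ s = t := fun t s ht hs => by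
    rw [← Real.rpow_mul ht.le, inv_mul_cancel₀ hs.ne', Real.rpow_one]
  have hup : ∀ t s : ℝ, 0 < t → 0 < s → s ≤ A → t ^ s⁻¹ ≤ 2 * M y →
      lam ^ s * t ≤ 2 ^ A * S ^ s := by
    intro t s ht hs hsA hts
    calc lam ^ s * t = (lam * t ^ s⁻¹) ^ s := by
          rw [Real.mul_rpow hlam0.le (by positivity), hpow t s ht hs]
      _ ≤ (2 * S) ^ s := by
          refine Real.rpow_le_rpow (by positivity) ?_ hs.le
          calc lam * t ^ s⁻¹ ≤ lam * (2 * M y) := mul_le_mul_of_nonneg_left hts hlam0.le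
            _ = 2 * S := by rw [hlam]; field_simp
      _ = 2 ^ s * S ^ s := Real.mul_rpow (by norm_num) hS0.le
      _ ≤ 2 ^ A * S ^ s := mul_le_mul_of_nonneg_right
          (Real.rpow_le_rpow_of_exponent_le (by norm_num) hsA) (by positivity)
  have hlo : ∀ t s : ℝ, 0 < t → 0 < s → s ≤ A → M y / 2 ≤ t ^ s⁻¹ →
      (1 / 2) ^ A * S ^ s ≤ lam ^ s * t := by
    intro t s ht hs hsA hts
    calc (1 / 2) ^ A * S ^ s ≤ (1 / 2) ^ s * S ^ s := mul_le_mul_of_nonneg_right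
          (Real.rpow_le_rpow_of_exponent_ge (by norm_num) (by norm_num) hsA) (by positivity)
      _ = (1 / 2 * S) ^ s := (Real.mul_rpow (by norm_num) hS0.le).symm
      _ ≤ (lam * t ^ s⁻¹) ^ s := by
          refine Real.rpow_le_rpow (by positivity) ?_ hs.le
          calc 1 / 2 * S = lam * (M y / 2) := by rw [hlam]; field_simp
            _ ≤ _ := mul_le_mul_of_nonneg_left hts hlam0.le
      _ = lam ^ s * t := by rw [Real.mul_rpow hlam0.le (by positivity), hpow t s ht hs]
  refine HS ε Ω _ _ _ _ hsys le_rfl (fun x hx => ?_) ?_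
  · have h1 : u (y + lam • x) ^ α⁻¹ + v (y + lam • x) ^ β⁻¹ ≤ 2 * M y := hmax _ (hnear x hx)
    have h2 := Real.rpow_nonneg (hu0 (y + lam • x)).le α⁻¹
    have h3 := Real.rpow_nonneg (hv0 (y + lam • x)).le β⁻¹
    exact ⟨hup _ _ (hu0 _) hα0 hαA (by linarith), hup _ _ (hv0 _) hβ0 hβA (by linarith)⟩
  · have h1 : u y ^ α⁻¹ + v y ^ β⁻¹ = M y := rfl
    simp only [smul_zero, add_zero]
    rcases le_total (v y ^ β⁻¹) (u y ^ α⁻¹) with h | h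
    · exact Or.inl (hlo _ _ (hu0 _) hα0 hαA (by linarith))
    · exact Or.inr (hlo _ _ (hv0 _) hβ0 hβA (by linarith))

/-- The decay estimate at the rate of the singular solution. -/
theorem exists_decay_bound {α' β' B : ℝ} (hα : α' + 2 + a = β' * p) (hβ : β' + 2 + b = α' * q)
    (hB : ∀ u v : EuclideanSpace ℝ (Fin N) → ℝ, IsHHSol a b p q univ u v → ∀ x, ‖x‖ = 1 →
      u x ≤ B ∧ v x ≤ B) (h : IsHHSol a b p q univ u v) {x : EuclideanSpace ℝ (Fin N)}
    (hx : x ≠ 0) : u x ≤ B * ‖x‖ ^ (-α') ∧ v x ≤ B * ‖x‖ ^ (-β') := by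
  have hx0 : 0 < ‖x‖ := norm_pos_iff.2 hx
  have h1 := hB _ _ (h.scale hx0 hα hβ) (‖x‖⁻¹ • x)
    (by rw [norm_smul, norm_inv, norm_norm, inv_mul_cancel₀ hx0.ne'])
  simp only [zero_add, smul_smul, mul_inv_cancel₀ hx0.ne', one_smul] at h1
  rw [Real.rpow_neg hx0.le, Real.rpow_neg hx0.le, ← div_eq_mul_inv, ← div_eq_mul_inv,
    le_div_iff₀ (by positivity), le_div_iff₀ (by positivity), mul_comm (u x), mul_comm (v x)]
  exact h1

end Decay

section GlobalPohozaev

variable {N : ℕ} {p q a b : ℝ} {u v : EuclideanSpace ℝ (Fin N) → ℝ}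

theorem isOpen_univ_sdiff_zero : IsOpen (univ \ {0} : Set (EuclideanSpace ℝ (Fin N))) := by
  rw [← compl_eq_univ_sdiff]; exact isOpen_compl_singleton

theorem exists_radial_cutoff : ∃ (χ : EuclideanSpace ℝ (Fin N) → ℝ) (C : ℝ), 0 < C ∧
    ContDiff ℝ 1 χ ∧ (∀ x, 0 ≤ χ x ∧ χ x ≤ 1) ∧ (∀ x, ‖x‖ ≤ 1 → χ x = 1) ∧
    (∀ x, 2 ≤ ‖x‖ → χ x = 0) ∧
    ∀ x i, |pd i χ x| ≤ C ∧ (pd i χ x ≠ 0 → 1 ≤ ‖x‖ ∧ ‖x‖ ≤ 2) := by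
  let f : ContDiffBump (0 : EuclideanSpace ℝ (Fin N)) := ⟨1, 2, by norm_num, by norm_num⟩
  have hf : ContDiff ℝ 1 f := f.contDiff
  have hb : ∀ i, ∃ C, ∀ x, ‖pd i f x‖ ≤ C := fun i =>
    (continuous_pd i hf).bounded_above_of_compact_support (hasCompactSupport_pd i f.hasCompactSupport)
  choose C hC using hb
  refine ⟨f, 1 + ∑ i, |C i|, by positivity, hf, fun x => ⟨f.nonneg, f.le_one⟩,
    fun x hx => f.one_of_mem_closedBall (mem_closedBall_zero_iff.2 hx),
    fun x hx => f.zero_of_le_dist (by simpa using hx), fun x i => ⟨?_, fun h0 => ?_⟩⟩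
  · have h1 : |C i| ≤ ∑ i, |C i| :=
      Finset.single_le_sum (f := fun i => |C i|) (fun j _ => abs_nonneg _) (Finset.mem_univ i)
    have h2 : |pd i f x| ≤ C i := hC i x
    linarith [le_abs_self (C i)]
  · by_contra hcon
    refine h0 ?_
    rw [not_and_or, not_le, not_le] at hcon
    rcases hcon with h | h
    · have : (f : EuclideanSpace ℝ (Fin N) → ℝ) =ᶠ[nhds x] fun _ => 1 := by
        filter_upwards [isOpen_ball.mem_nhds (mem_ball_zero_iff.2 h)] with y hy
        exact f.one_of_mem_closedBall (ball_subset_closedBall hy)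
      rw [pd_congr i this]; simp [pd]
    · have : (f : EuclideanSpace ℝ (Fin N) → ℝ) =ᶠ[nhds x] fun _ => 0 := by
        filter_upwards [(isOpen_lt continuous_const continuous_norm).mem_nhds h] with y hy
        exact f.zero_of_le_dist (by simpa using le_of_lt hy)
      rw [pd_congr i this]; simp [pd]

/-- The potential in the Pohozaev identity of the Hardy–Hénon system. -/
noncomputable def hhPot (a b p q : ℝ) (u v : EuclideanSpace ℝ (Fin N) → ℝ)
    (y : EuclideanSpace ℝ (Fin N)) : ℝ :=
  ‖y‖ ^ a * v y ^ (p + 1) / (p + 1) + ‖y‖ ^ b * u y ^ (q + 1) / (q + 1)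

theorem exists_abs_pohField_le (hN : 3 ≤ N) (hp : 0 < p) (hq : 0 < q) (θ₁ θ₂ : ℝ) {L : ℝ}
    (hL : 0 ≤ L) : ∃ C > 0, ∀ (a b : ℝ) (u v : EuclideanSpace ℝ (Fin N) → ℝ),
      IsHHSol a b p q univ u v → ∀ r A A' : ℝ, 0 < r → 0 < A → 0 < A' →
      (∀ y, r / 2 ≤ ‖y‖ → ‖y‖ ≤ 3 * r → u y ≤ A ∧ v y ≤ A' ∧
        r ^ 2 * (‖y‖ ^ a * v y ^ p) ≤ L * A ∧ r ^ 2 * (‖y‖ ^ b * u y ^ q) ≤ L * A') →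
      ∀ x, r ≤ ‖x‖ → ‖x‖ ≤ 2 * r → ∀ i,
        |pohField θ₁ θ₂ u v (hhPot a b p q u v) i x| ≤ C * (A * A' / r) := by
  obtain ⟨C, hC, hCs⟩ := exists_abs_pd_le hN
  set G := C * (2 + L / 2) with hG
  have hG0 : 0 < G := by positivity
  refine ⟨6 * (N * G) * (N * G) + 4 * L + |θ₁| * (N * G) + |θ₂| * (N * G) + 1, by positivity, ?_⟩
  rintro a b u v ⟨cu, cv, du, dv, pu, pv, eu, ev⟩ r A A' hr hA hA' hb x hx1 hx2 i
  have hy : ∀ y ∈ closedBall x (r / 2), r / 2 ≤ ‖y‖ ∧ ‖y‖ ≤ 3 * r := fun y hy => by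
    rw [mem_closedBall, dist_eq_norm] at hy
    have h1 := norm_sub_norm_le y x
    have h2 := norm_sub_norm_le x y
    rw [norm_sub_rev] at h2
    constructor <;> linarith
  have hΩ : closedBall x (r / 2) ⊆ univ \ {0} := fun y hy' => ⟨trivial, fun h0 => by
    have := (hy y hy').1
    rw [mem_singleton_iff.1 h0, norm_zero] at this
    linarith⟩
  have hx : x ∈ closedBall x (r / 2) := mem_closedBall_self (by positivity)
  have hr2 : 0 < r ^ 2 := by positivity
  have grad : ∀ (w : EuclideanSpace ℝ (Fin N) → ℝ) (f : EuclideanSpace ℝ (Fin N) → ℝ) (W : ℝ),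
      ContDiffOn ℝ 2 w (univ \ {0}) → (∀ y, 0 < w y) → (∀ y, 0 ≤ f y) →
      (∀ y ∈ univ \ {0}, -lap w y = f y) →
      (∀ y ∈ closedBall x (r / 2), w y ≤ W ∧ r ^ 2 * f y ≤ L * W) →
      ∑ j, |pd j w x| ≤ N * G * (W / r) := by
    intro w f W hw hw0 hf0 hwf hW
    have h1 : ∀ j, |pd j w x| ≤ G * (W / r) := fun j => by
      refine (hCs _ w x (r / 2) W (L * W / r ^ 2) isOpen_univ_sdiff_zero hw (by positivity) hΩ
        (fun y hy => ?_) (fun y hy => ?_) j).trans (le_of_eq ?_)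
      · rw [abs_of_pos (hw0 y)]; exact (hW y hy).1
      · rw [← abs_neg, hwf y (hΩ hy), abs_of_nonneg (hf0 y), le_div_iff₀ hr2, mul_comm]
        exact (hW y hy).2
      · rw [hG]; field_simp
    calc ∑ j, |pd j w x| ≤ ∑ _j : Fin N, G * (W / r) := Finset.sum_le_sum fun j _ => h1 j
      _ = N * G * (W / r) := by simp; ring
  have hu0 : ∀ y, 0 < u y := fun y => pu y trivial
  have hv0 : ∀ y, 0 < v y := fun y => pv y trivial
  have gu := grad u (fun y => ‖y‖ ^ a * v y ^ p) A du hu0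
    (fun y => mul_nonneg (by positivity) (Real.rpow_nonneg (hv0 y).le _)) eu
    fun y hy' => ⟨(hb y (hy y hy').1 (hy y hy').2).1, (hb y (hy y hy').1 (hy y hy').2).2.2.1⟩
  have gv := grad v (fun y => ‖y‖ ^ b * u y ^ q) A' dv hv0
    (fun y => mul_nonneg (by positivity) (Real.rpow_nonneg (hu0 y).le _)) ev
    fun y hy' => ⟨(hb y (hy y hy').1 (hy y hy').2).2.1, (hb y (hy y hy').1 (hy y hy').2).2.2.2⟩
  obtain ⟨b1, b2, b3, b4⟩ := hb x (hy x hx).1 (hy x hx).2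
  have su : 0 ≤ ∑ j, |pd j u x| := Finset.sum_nonneg fun _ _ => abs_nonneg _
  have sv : 0 ≤ ∑ j, |pd j v x| := Finset.sum_nonneg fun _ _ => abs_nonneg _
  have hΦ : |hhPot a b p q u v x| ≤ 2 * L * (A * A') / r ^ 2 := by
    have t : ∀ e k w f W W', 0 < k → 0 < w → w ≤ W → 0 ≤ f → 0 < W' → r ^ 2 * (f * w ^ k) ≤ L * W' →
        f * w ^ (k + 1) / (k + 1) ≤ L * (W' * W) / r ^ 2 ∧ 0 ≤ f * w ^ (k + 1) / (k + 1) + 0 * e := by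
      intro e k w f W W' hk hw hwW hf hW' h
      have hw1 : 0 ≤ w ^ (k + 1) := by positivity
      refine ⟨?_, by rw [zero_mul, add_zero]; positivity⟩
      have h1 : f * w ^ (k + 1) / (k + 1) ≤ f * w ^ (k + 1) :=
        div_le_self (by positivity) (by linarith)
      refine h1.trans ?_
      rw [le_div_iff₀ hr2, Real.rpow_add hw, Real.rpow_one]
      calc f * (w ^ k * w) * r ^ 2 = r ^ 2 * (f * w ^ k) * w := by ring
        _ ≤ L * W' * W := mul_le_mul h hwW hw.le (by positivity)
        _ = L * (W' * W) := by ring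
    have t1 := t 0 p (v x) (‖x‖ ^ a) A' A hp (hv0 x) b2 (by positivity) hA b3
    have t2 := t 0 q (u x) (‖x‖ ^ b) A A' hq (hu0 x) b1 (by positivity) hA' b4
    rw [zero_mul, add_zero] at t1 t2
    rw [hhPot, abs_of_nonneg (add_nonneg t1.2 t2.2)]
    have e : 2 * L * (A * A') / r ^ 2 = L * (A * A') / r ^ 2 + L * (A' * A) / r ^ 2 := by ring
    rw [e]
    exact add_le_add t1.1 t2.1
  refine (abs_pohField_le (mem_closedBall_zero_iff.2 hx2)).trans ?_
  rw [abs_of_pos (hu0 x), abs_of_pos (hv0 x)]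
  calc 3 * (2 * r) * ((∑ j, |pd j u x|) * ∑ j, |pd j v x|) + 2 * r * |hhPot a b p q u v x| +
        |θ₁| * (v x * ∑ j, |pd j u x|) + |θ₂| * (u x * ∑ j, |pd j v x|)
      ≤ 3 * (2 * r) * ((N * G * (A / r)) * (N * G * (A' / r))) + 2 * r * (2 * L * (A * A') / r ^ 2) +
        |θ₁| * (A' * (N * G * (A / r))) + |θ₂| * (A * (N * G * (A' / r))) := by
        have hv := (hv0 x).le
        have hu := (hu0 x).le
        gcongr
    _ = (6 * (N * G) * (N * G) + 4 * L + |θ₁| * (N * G) + |θ₂| * (N * G)) * (A * A' / r) := by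
        field_simp; ring
    _ ≤ _ := by
        have : 0 ≤ A * A' / r := by positivity
        nlinarith

theorem exists_integral_pohField_le (hN : 3 ≤ N) (hp : 0 < p) (hq : 0 < q) (θ₁ θ₂ : ℝ) {L : ℝ}
    (hL : 0 ≤ L) {χ : EuclideanSpace ℝ (Fin N) → ℝ} {C₀ : ℝ} (hC₀ : 0 < C₀) (hχ : ContDiff ℝ 1 χ)
    (hpd : ∀ x i, |pd i χ x| ≤ C₀ ∧ (pd i χ x ≠ 0 → 1 ≤ ‖x‖ ∧ ‖x‖ ≤ 2)) :
    ∃ C > 0, ∀ (a b : ℝ) (u v : EuclideanSpace ℝ (Fin N) → ℝ),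
      IsHHSol a b p q univ u v → ∀ r s A A' D D' : ℝ, 0 < r → 0 < s → 0 < A → 0 < A' → 0 < D →
      0 < D' → (∀ y, r / 2 ≤ ‖y‖ → ‖y‖ ≤ 3 * r → u y ≤ A ∧ v y ≤ A' ∧
        r ^ 2 * (‖y‖ ^ a * v y ^ p) ≤ L * A ∧ r ^ 2 * (‖y‖ ^ b * u y ^ q) ≤ L * A') →
      (∀ y, s / 2 ≤ ‖y‖ → ‖y‖ ≤ 3 * s → u y ≤ D ∧ v y ≤ D' ∧
        s ^ 2 * (‖y‖ ^ a * v y ^ p) ≤ L * D ∧ s ^ 2 * (‖y‖ ^ b * u y ^ q) ≤ L * D') →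
      |∫ x, ∑ i, pd i (fun x => χ (0 + r⁻¹ • x) - χ (0 + s⁻¹ • x)) x *
        pohField θ₁ θ₂ u v (hhPot a b p q u v) i x| ≤
        C * (A * A' / r ^ 2 * r ^ N + D * D' / s ^ 2 * s ^ N) := by
  obtain ⟨C, hC, hCs⟩ := exists_abs_pohField_le hN hp hq θ₁ θ₂ hL
  set vol := (volume (ball (0 : EuclideanSpace ℝ (Fin N)) 1)).toReal with hvol
  have hv0 : 0 < vol := ENNReal.toReal_pos (measure_ball_pos _ _ one_pos).ne'
    measure_ball_lt_top.ne
  have hN0 : (0 : ℝ) < N := by exact_mod_cast (show 0 < N by omega)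
  refine ⟨N * (C₀ * C) * (2 ^ N * vol), by positivity, ?_⟩
  intro a b u v h r s A A' D D' hr hs hA hA' hD hD' h1 h2
  have key : ∀ r A A' : ℝ, 0 < r → 0 < A → 0 < A' →
      (∀ y, r / 2 ≤ ‖y‖ → ‖y‖ ≤ 3 * r → u y ≤ A ∧ v y ≤ A' ∧
        r ^ 2 * (‖y‖ ^ a * v y ^ p) ≤ L * A ∧ r ^ 2 * (‖y‖ ^ b * u y ^ q) ≤ L * A') → ∀ i x,
      |pd i (fun x => χ (0 + r⁻¹ • x)) x * pohField θ₁ θ₂ u v (hhPot a b p q u v) i x| ≤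
        (closedBall 0 (2 * r)).indicator (fun _ => C₀ * C * (A * A' / r ^ 2)) x := by
    intro r A A' hr hA hA' h1 i x
    rw [pd_affine i r⁻¹ 0 (hχ.differentiable (by norm_num) _)]
    by_cases h0 : pd i χ (0 + r⁻¹ • x) = 0
    · rw [h0, mul_zero, zero_mul, abs_zero]
      exact indicator_nonneg (fun _ _ => by positivity) _
    · have hx := (hpd _ i).2 h0
      rw [zero_add, norm_smul, Real.norm_of_nonneg (by positivity : 0 ≤ r⁻¹), inv_mul_eq_div,
        le_div_iff₀ hr, div_le_iff₀ hr, one_mul] at hx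
      rw [indicator_of_mem (mem_closedBall_zero_iff.2 hx.2), abs_mul, abs_mul,
        abs_of_pos (by positivity : 0 < r⁻¹)]
      calc r⁻¹ * |pd i χ (0 + r⁻¹ • x)| * |pohField θ₁ θ₂ u v (hhPot a b p q u v) i x|
          ≤ r⁻¹ * C₀ * (C * (A * A' / r)) := by
            gcongr
            · exact (hpd _ i).1
            · exact hCs a b u v h r A A' hr hA hA' h1 x hx.1 hx.2 i
        _ = C₀ * C * (A * A' / r ^ 2) := by field_simp
  have hgint : ∀ r k : ℝ, IntegrableOn (fun _ => k) (closedBall (0 : EuclideanSpace ℝ (Fin N)) r) :=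
    fun r k => integrableOn_const (by exact measure_closedBall_lt_top.ne)
  have hval : ∀ r k : ℝ, 0 < r → ∫ x, (closedBall (0 : EuclideanSpace ℝ (Fin N)) (2 * r)).indicator
      (fun _ => k) x = (2 ^ N * vol) * (k * r ^ N) := by
    intro r k hr
    rw [integral_indicator measurableSet_closedBall, setIntegral_const, measureReal_def,
      Measure.addHaar_closedBall _ _ (by positivity), finrank_euclideanSpace_fin,
      ENNReal.toReal_mul, ENNReal.toReal_ofReal (by positivity), smul_eq_mul, mul_pow, hvol]
    ring
  rw [← Real.norm_eq_abs]
  refine (norm_integral_le_of_norm_le (g := fun x =>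
    (closedBall 0 (2 * r)).indicator (fun _ => N * (C₀ * C) * (A * A' / r ^ 2)) x +
    (closedBall 0 (2 * s)).indicator (fun _ => N * (C₀ * C) * (D * D' / s ^ 2)) x)
    (((hgint _ _).integrable_indicator measurableSet_closedBall).add
      ((hgint _ _).integrable_indicator measurableSet_closedBall))
    (Eventually.of_forall fun x => ?_)).trans (le_of_eq ?_)
  · have hc : ∀ r : ℝ, DifferentiableAt ℝ (fun x => χ (0 + r⁻¹ • x)) x := fun r =>
      DifferentiableAt.comp (g := χ) x (hχ.differentiable (by norm_num) _) (by fun_prop)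
    have hmulN : ∀ (S : Set (EuclideanSpace ℝ (Fin N))) (k : ℝ),
        S.indicator (fun _ => N * (C₀ * C) * k) x = ∑ _i : Fin N, S.indicator (fun _ => C₀ * C * k) x := by
      intro S k
      by_cases hx : x ∈ S <;> simp [hx]; ring
    rw [hmulN, hmulN, ← Finset.sum_add_distrib, Real.norm_eq_abs]
    refine (Finset.abs_sum_le_sum_abs _ _).trans (Finset.sum_le_sum fun i _ => ?_)
    rw [pd_sub i (hc r) (hc s), sub_mul]
    exact (abs_sub _ _).trans (add_le_add (key r A A' hr hA hA' h1 i x) (key s D D' hs hD hD' h2 i x))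
  · rw [integral_add ((hgint _ _).integrable_indicator measurableSet_closedBall)
      ((hgint _ _).integrable_indicator measurableSet_closedBall), hval r _ hr, hval s _ hs]
    ring

end GlobalPohozaev

section GlobalPohozaev

variable {N : ℕ} {p q a b : ℝ} {u v : EuclideanSpace ℝ (Fin N) → ℝ}

theorem contDiffOn_norm_rpow (a : ℝ) :
    ContDiffOn ℝ 1 (fun x : EuclideanSpace ℝ (Fin N) => ‖x‖ ^ a) (univ \ {0}) := fun _ hx =>
  ((contDiffAt_norm_rpow (fun h0 => hx.2 h0) a).of_le one_le_two).contDiffWithinAt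

set_option maxHeartbeats 1000000 in
theorem IsHHSol.false_of_decay (hN : 3 ≤ N) (hp : 0 < p) (hq : 0 < q) {α β θ₁ θ₂ B : ℝ}
    (hα : α + 2 + a = β * p) (hβ : β + 2 + b = α * q) (hα0 : 0 < α) (hβ0 : 0 < β)
    (hE : (N : ℝ) - 2 < α + β) (hθ₁ : θ₁ < (N + a) / (p + 1)) (hθ₂ : θ₂ < (N + b) / (q + 1))
    (hθ : θ₁ + θ₂ = N - 2) (ha : -2 < a) (hb : -2 < b)
    (h : IsHHSol a b p q univ u v)
    (hB : ∀ x, x ≠ 0 → u x ≤ B * ‖x‖ ^ (-α) ∧ v x ≤ B * ‖x‖ ^ (-β)) : False := by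
  have h' := h
  obtain ⟨cu, cv, du, dv, pu, pv, eu, ev⟩ := h'
  have hu0 : ∀ y, 0 < u y := fun y => pu y trivial
  have hv0 : ∀ y, 0 < v y := fun y => pv y trivial
  obtain ⟨Mu, hMu⟩ := (isCompact_closedBall (0 : EuclideanSpace ℝ (Fin N)) 1).exists_bound_of_continuousOn
    (cu.mono (subset_univ _))
  obtain ⟨Mv, hMv⟩ := (isCompact_closedBall (0 : EuclideanSpace ℝ (Fin N)) 1).exists_bound_of_continuousOn
    (cv.mono (subset_univ _))
  obtain ⟨M, hM1, hMB, hMu', hMv'⟩ : ∃ M : ℝ, 1 ≤ M ∧ B ≤ M ∧ Mu ≤ M ∧ Mv ≤ M :=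
    ⟨1 + |B| + |Mu| + |Mv|, by linarith [abs_nonneg B, abs_nonneg Mu, abs_nonneg Mv],
      by linarith [le_abs_self B, abs_nonneg Mu, abs_nonneg Mv],
      by linarith [abs_nonneg B, le_abs_self Mu, abs_nonneg Mv],
      by linarith [abs_nonneg B, abs_nonneg Mu, le_abs_self Mv]⟩
  have hM0 : 0 < M := by linarith
  obtain ⟨L, hL0, hLp, hLq⟩ : ∃ L : ℝ, 0 ≤ L ∧ 4 * M ^ p ≤ L ∧ 4 * M ^ q ≤ L :=
    ⟨4 * M ^ p + 4 * M ^ q, by positivity, by linarith [Real.rpow_nonneg hM0.le q],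
      by linarith [Real.rpow_nonneg hM0.le p]⟩
  have outer : ∀ r : ℝ, 0 < r → ∀ y : EuclideanSpace ℝ (Fin N), r / 2 ≤ ‖y‖ →
      u y ≤ M * (r / 2) ^ (-α) ∧ v y ≤ M * (r / 2) ^ (-β) ∧
        r ^ 2 * (‖y‖ ^ a * v y ^ p) ≤ L * (M * (r / 2) ^ (-α)) ∧
        r ^ 2 * (‖y‖ ^ b * u y ^ q) ≤ L * (M * (r / 2) ^ (-β)) := by
    intro r hr y hy
    have hy0 : 0 < ‖y‖ := by linarith
    obtain ⟨b1, b2⟩ := hB y (norm_pos_iff.1 hy0)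
    have mono : ∀ e : ℝ, 0 < e → ‖y‖ ^ (-e) ≤ (r / 2) ^ (-e) := fun e he =>
      Real.rpow_le_rpow_of_nonpos (by positivity) hy (by linarith)
    have c1 : u y ≤ M * ‖y‖ ^ (-α) := b1.trans (by gcongr)
    have c2 : v y ≤ M * ‖y‖ ^ (-β) := b2.trans (by gcongr)
    have main : ∀ e e' k c w : ℝ, 0 < e → 0 < k → 0 ≤ w → w ≤ M * ‖y‖ ^ (-e') →
        e + 2 + c = e' * k → 4 * M ^ k ≤ L →
        r ^ 2 * (‖y‖ ^ c * w ^ k) ≤ L * (M * (r / 2) ^ (-e)) := by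
      intro e e' k c w he hk hw0 hw hek hLk
      have h1 : w ^ k ≤ M ^ k * ‖y‖ ^ (-e' * k) := by
        refine (Real.rpow_le_rpow hw0 hw hk.le).trans (le_of_eq ?_)
        rw [Real.mul_rpow hM0.le (by positivity), ← Real.rpow_mul hy0.le]
      have h2 : r ^ 2 ≤ 4 * ‖y‖ ^ (2 : ℝ) := by
        rw [Real.rpow_two]; nlinarith
      calc r ^ 2 * (‖y‖ ^ c * w ^ k)
          ≤ 4 * ‖y‖ ^ (2 : ℝ) * (‖y‖ ^ c * (M ^ k * ‖y‖ ^ (-e' * k))) := by gcongr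
        _ = 4 * M ^ k * ‖y‖ ^ (2 + c + -e' * k) := by
            rw [Real.rpow_add hy0, Real.rpow_add hy0]; ring
        _ = 4 * M ^ k * (1 * ‖y‖ ^ (-e)) := by rw [one_mul]; congr 2; linarith
        _ ≤ L * (M * (r / 2) ^ (-e)) :=
            mul_le_mul hLk (mul_le_mul hM1 (mono e he) (by positivity) hM0.le) (by positivity) hL0
    exact ⟨c1.trans (mul_le_mul_of_nonneg_left (mono α hα0) hM0.le),
      c2.trans (mul_le_mul_of_nonneg_left (mono β hβ0) hM0.le),
      main α β p a _ hα0 hp (hv0 y).le c2 hα hLp, main β α q b _ hβ0 hq (hu0 y).le c1 hβ hLq⟩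
  have inner : ∀ s : ℝ, 0 < s → 3 * s ≤ 1 → ∀ y : EuclideanSpace ℝ (Fin N), s / 2 ≤ ‖y‖ →
      ‖y‖ ≤ 3 * s → u y ≤ M ∧ v y ≤ M ∧ s ^ 2 * (‖y‖ ^ a * v y ^ p) ≤ L * M ∧
        s ^ 2 * (‖y‖ ^ b * u y ^ q) ≤ L * M := by
    intro s hs hs1 y hy1 hy2
    have hy0 : 0 < ‖y‖ := by linarith
    have hyb : y ∈ closedBall (0 : EuclideanSpace ℝ (Fin N)) 1 :=
      mem_closedBall_zero_iff.2 (by linarith)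
    have b1 : u y ≤ M := ((le_abs_self _).trans (hMu y hyb)).trans hMu'
    have b2 : v y ≤ M := ((le_abs_self _).trans (hMv y hyb)).trans hMv'
    have main : ∀ k c w : ℝ, -2 < c → 0 < k → 0 ≤ w → w ≤ M → 4 * M ^ k ≤ L →
        s ^ 2 * (‖y‖ ^ c * w ^ k) ≤ L * M := by
      intro k c w hc hk hw0 hw hLk
      have h1 : ‖y‖ ^ c ≤ ‖y‖ ^ (-2 : ℝ) :=
        Real.rpow_le_rpow_of_exponent_ge hy0 (by linarith) hc.le
      have h2 : s ^ 2 ≤ 4 * ‖y‖ ^ 2 := by nlinarith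
      calc s ^ 2 * (‖y‖ ^ c * w ^ k) ≤ 4 * ‖y‖ ^ 2 * (‖y‖ ^ (-2 : ℝ) * M ^ k) := by gcongr
        _ = 4 * M ^ k * 1 := by
            rw [Real.rpow_neg hy0.le, Real.rpow_two]; field_simp
        _ ≤ L * M := by gcongr
    exact ⟨b1, b2, main p a _ ha hp (hv0 y).le b2 hLp, main q b _ hb hq (hu0 y).le b1 hLq⟩
  obtain ⟨χ, C₀, hC₀, hχ, hχ01, hχ1, hχ2, hpd⟩ := exists_radial_cutoff (N := N)
  obtain ⟨C, hC, hCs⟩ := exists_integral_pohField_le hN hp hq θ₁ θ₂ hL0 hC₀ hχ hpd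
  set W : EuclideanSpace ℝ (Fin N) → ℝ := fun x =>
    ((N + a) / (p + 1) - θ₁) * (‖x‖ ^ a * v x ^ (p + 1)) +
      ((N + b) / (q + 1) - θ₂) * (‖x‖ ^ b * u x ^ (q + 1)) with hW
  have hW0 : ∀ x, x ≠ 0 → 0 < W x := fun x hx => by
    have := norm_pos_iff.2 hx
    have h1 := sub_pos.2 hθ₁
    have h2 := sub_pos.2 hθ₂
    have := hu0 x
    have := hv0 x
    simp only [hW]; positivity
  have hWc : ContinuousOn W (univ \ {0}) := by
    have hc : ∀ (w : EuclideanSpace ℝ (Fin N) → ℝ) (k c : ℝ), ContinuousOn w univ → (∀ x, 0 < w x) →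
        ContinuousOn (fun x => ‖x‖ ^ c * w x ^ k) (univ \ {0}) := fun w k c hw hw0 =>
      (contDiffOn_norm_rpow c).continuousOn.mul
        ((hw.mono (subset_univ _)).rpow_const fun x _ => Or.inl (hw0 x).ne')
    exact (continuousOn_const.mul (hc v _ a cv hv0)).add (continuousOn_const.mul (hc u _ b cu hu0))
  let e : EuclideanSpace ℝ (Fin N) := EuclideanSpace.single ⟨0, by omega⟩ (3 / 2)
  have he : ‖e‖ = 3 / 2 := by simp [e]
  have hK1 : ∀ x ∈ closedBall e (1 / 4), 1 ≤ ‖x‖ ∧ ‖x‖ ≤ 2 := fun x hx => by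
    rw [mem_closedBall, dist_eq_norm] at hx
    have h1 := norm_sub_norm_le x e
    have h2 := norm_sub_norm_le e x
    rw [norm_sub_rev] at h2
    constructor <;> linarith
  have hK1' : closedBall e (1 / 4) ⊆ univ \ {0} := fun x hx => ⟨trivial, fun h0 => by
    have := (hK1 x hx).1
    rw [mem_singleton_iff.1 h0, norm_zero] at this
    linarith⟩
  obtain ⟨x₁, hx₁, hmin⟩ := (isCompact_closedBall e (1 / 4)).exists_isMinOn
    ⟨e, mem_closedBall_self (by norm_num)⟩ (hWc.mono hK1')
  have hω := hW0 x₁ (hK1' hx₁).2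
  set I := W x₁ * (volume (closedBall e (1 / 4))).toReal with hI
  have hI0 : 0 < I := mul_pos hω (ENNReal.toReal_pos (measure_closedBall_pos _ _ (by norm_num)).ne'
    measure_closedBall_lt_top.ne)
  have key : ∀ t : ℝ, 3 ≤ t → I ≤ C * (M ^ 2 * 2 ^ (α + β) * t ^ (-(α + β - (N - 2))) +
      M ^ 2 * t ^ (-((N : ℝ) - 2))) := by
    intro t ht
    have ht0 : 0 < t := by linarith
    set φ : EuclideanSpace ℝ (Fin N) → ℝ := fun x => χ (0 + t⁻¹ • x) - χ (0 + t⁻¹⁻¹ • x) with hφ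
    have hn1 : ∀ x : EuclideanSpace ℝ (Fin N), ‖0 + t⁻¹ • x‖ = ‖x‖ / t := fun x => by
      rw [zero_add, norm_smul, Real.norm_of_nonneg (by positivity), inv_mul_eq_div]
    have hn2 : ∀ x : EuclideanSpace ℝ (Fin N), ‖0 + t⁻¹⁻¹ • x‖ = t * ‖x‖ := fun x => by
      rw [zero_add, inv_inv, norm_smul, Real.norm_of_nonneg (by positivity)]
    have hφc : ContDiff ℝ 1 φ := by
      have : ∀ k : ℝ, ContDiff ℝ 1 fun x : EuclideanSpace ℝ (Fin N) => χ (0 + k • x) := fun k =>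
        hχ.comp (by fun_prop)
      exact (this _).sub (this _)
    have hφ0 : ∀ x, 0 ≤ φ x := fun x => by
      by_cases hx : ‖x‖ ≤ t
      · have h1 := hχ1 (0 + t⁻¹ • x) (by rw [hn1, div_le_one ht0]; exact hx)
        simp only [hφ, h1]
        linarith [(hχ01 (0 + t⁻¹⁻¹ • x)).2]
      · have h1 := hχ2 (0 + t⁻¹⁻¹ • x) (by rw [hn2]; nlinarith)
        simp only [hφ, h1]
        linarith [(hχ01 (0 + t⁻¹ • x)).1]
    have hφ1 : ∀ x ∈ closedBall e (1 / 4), φ x = 1 := fun x hx => by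
      obtain ⟨h1, h2⟩ := hK1 x hx
      simp only [hφ]
      rw [hχ1 (0 + t⁻¹ • x) (by rw [hn1, div_le_one ht0]; linarith),
        hχ2 (0 + t⁻¹⁻¹ • x) (by rw [hn2]; nlinarith), sub_zero]
    set K : Set (EuclideanSpace ℝ (Fin N)) := closedBall 0 (2 * t) \ ball 0 (1 / t) with hK
    have hKc : IsCompact K := (isCompact_closedBall _ _).diff isOpen_ball
    have hKΩ : K ⊆ univ \ {0} := fun x hx => ⟨trivial, fun h0 => hx.2 (by
      rw [mem_singleton_iff.1 h0]; exact mem_ball_self (by positivity))⟩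
    have hφK : ∀ x, x ∉ K → φ x = 0 := fun x hx => by
      rw [hK, Set.mem_sdiff, not_and_or, not_not, mem_closedBall_zero_iff, mem_ball_zero_iff, not_le] at hx
      simp only [hφ]
      rcases hx with hx | hx
      · rw [hχ2 (0 + t⁻¹ • x) (by rw [hn1, le_div_iff₀ ht0]; exact hx.le),
          hχ2 (0 + t⁻¹⁻¹ • x) (by rw [hn2]; nlinarith), sub_zero]
      · have h2 := (lt_div_iff₀ ht0).1 hx
        have h3 : ‖x‖ ≤ ‖x‖ * t := le_mul_of_one_le_right (norm_nonneg x) (by linarith)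
        rw [hχ1 (0 + t⁻¹ • x) (by rw [hn1, div_le_one ht0]; linarith),
          hχ1 (0 + t⁻¹⁻¹ • x) (by rw [hn2, mul_comm]; exact h2.le), sub_self]
    have poh := integral_pohozaev isOpen_univ_sdiff_zero hKc hKΩ hp hq hθ du dv
      (contDiffOn_norm_rpow a) (contDiffOn_norm_rpow b) (fun x _ => hu0 x) (fun x _ => hv0 x)
      eu ev hφc hφK
    have lhs : (fun x => φ x * (((N * ‖x‖ ^ a + ∑ j, x j * pd j (fun x => ‖x‖ ^ a) x) / (p + 1) -
        θ₁ * ‖x‖ ^ a) * v x ^ (p + 1) + ((N * ‖x‖ ^ b + ∑ j, x j * pd j (fun x => ‖x‖ ^ b) x) /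
        (q + 1) - θ₂ * ‖x‖ ^ b) * u x ^ (q + 1))) = fun x => φ x * W x := by
      funext x
      by_cases hx : x ∈ K
      · rw [sum_mul_pd_norm_rpow (hKΩ hx).2, sum_mul_pd_norm_rpow (hKΩ hx).2]
        simp only [hW]; ring
      · rw [hφK x hx, zero_mul, zero_mul]
    rw [lhs] at poh
    have hgint : Integrable (fun x => φ x * W x) := by
      have : (fun x => φ x * W x) = K.indicator fun x => φ x * W x := by
        funext x
        by_cases hx : x ∈ K
        · rw [indicator_of_mem hx]
        · rw [indicator_of_notMem hx, hφK x hx, zero_mul]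
      rw [this, integrable_indicator_iff hKc.measurableSet]
      exact (hφc.continuous.continuousOn.mul (hWc.mono hKΩ)).integrableOn_compact hKc
    have hφW : ∀ x, 0 ≤ φ x * W x := fun x => by
      by_cases hx : x ∈ K
      · exact mul_nonneg (hφ0 x) (hW0 x (hKΩ hx).2).le
      · rw [hφK x hx, zero_mul]
    have h1 : I ≤ ∫ x, φ x * W x := by
      refine le_trans ?_ (setIntegral_le_integral (s := closedBall e (1 / 4)) hgint
        (Eventually.of_forall hφW))
      have : I = ∫ _ in closedBall e (1 / 4), W x₁ := by
        rw [setIntegral_const, smul_eq_mul, measureReal_def, mul_comm]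
      rw [this]
      refine setIntegral_mono_on (integrableOn_const (by exact measure_closedBall_lt_top.ne))
        hgint.integrableOn measurableSet_closedBall fun x hx => ?_
      rw [hφ1 x hx, one_mul]
      exact hmin hx
    have h3 : 3 * t⁻¹ ≤ 1 := by rw [← div_eq_mul_inv, div_le_one ht0]; exact ht
    have h2 := hCs a b u v h t t⁻¹ (M * (t / 2) ^ (-α)) (M * (t / 2) ^ (-β)) M M ht0 (by positivity)
      (by positivity) (by positivity) hM0 hM0 (fun y hy _ => outer t ht0 y hy)
      (fun y hy1 hy2 => inner _ (by positivity) h3 y hy1 hy2)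
    refine (h1.trans (poh.le.trans ((neg_le_abs _).trans h2))).trans (le_of_eq ?_)
    have e1 : M * (t / 2) ^ (-α) * (M * (t / 2) ^ (-β)) / t ^ 2 * t ^ N =
        M ^ 2 * 2 ^ (α + β) * t ^ (-(α + β - (N - 2))) := by
      rw [show -(α + β - ((N : ℝ) - 2)) = -(α + β) + (N - 2) by ring, Real.rpow_add ht0,
        Real.rpow_sub ht0, Real.rpow_natCast, Real.rpow_two, Real.rpow_neg ht0.le,
        Real.rpow_neg (by positivity), Real.rpow_neg (by positivity),
        Real.div_rpow ht0.le (by norm_num), Real.div_rpow ht0.le (by norm_num), Real.rpow_add ht0,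
        Real.rpow_add two_pos]
      field_simp
    have e2 : M * M / t⁻¹ ^ 2 * t⁻¹ ^ N = M ^ 2 * t ^ (-((N : ℝ) - 2)) := by
      rw [show -((N : ℝ) - 2) = 2 - N by ring, Real.rpow_sub ht0, Real.rpow_natCast, Real.rpow_two, inv_pow, inv_pow]
      field_simp
    rw [e1, e2]
  have hN3 : (3 : ℝ) ≤ N := by exact_mod_cast hN
  have lim := ((((tendsto_rpow_neg_atTop (sub_pos.2 hE)).const_mul (M ^ 2 * 2 ^ (α + β))).add
    ((tendsto_rpow_neg_atTop (show (0 : ℝ) < N - 2 by linarith)).const_mul (M ^ 2))).const_mul C)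
  simp only [mul_zero, add_zero] at lim
  exact absurd (ge_of_tendsto lim ((eventually_ge_atTop 3).mono key)) (not_le.2 hI0)

end GlobalPohozaev

section Nonexistence

variable {N : ℕ} {p q a b : ℝ} {u v : EuclideanSpace ℝ (Fin N) → ℝ}

theorem lap_const (c : ℝ) (x : EuclideanSpace ℝ (Fin N)) :
    lap (fun _ : EuclideanSpace ℝ (Fin N) => c) x = 0 := by
  rw [lap_eq_sum_pd contDiffAt_const]
  have : ∀ i : Fin N, pd i (fun _ : EuclideanSpace ℝ (Fin N) => c) = fun _ => 0 := fun i => by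
    funext y; simp [pd]
  simp [this, pd]

theorem mul_volume_le_setIntegral {f : EuclideanSpace ℝ (Fin N) → ℝ}
    {x : EuclideanSpace ℝ (Fin N)} {k r : ℝ} (hf : ContinuousOn f (closedBall x r))
    (hk : ∀ y ∈ closedBall x r, k ≤ f y) :
    k * (volume (closedBall x r)).toReal ≤ ∫ y in closedBall x r, f y := by
  have : k * (volume (closedBall x r)).toReal = ∫ _ in closedBall x r, k := by
    rw [setIntegral_const, smul_eq_mul, measureReal_def, mul_comm]
  rw [this]
  exact setIntegral_mono_on (integrableOn_const (by exact measure_closedBall_lt_top.ne))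
    (hf.integrableOn_compact (isCompact_closedBall _ _)) measurableSet_closedBall hk

theorem false_of_isMinOn_of_lap_neg (hN : 3 ≤ N) {Ω : Set (EuclideanSpace ℝ (Fin N))}
    {w f : EuclideanSpace ℝ (Fin N) → ℝ} {x : EuclideanSpace ℝ (Fin N)} (hΩ : IsOpen Ω)
    (hw : ContDiffOn ℝ 2 w Ω) (hf : ContinuousOn f Ω) (hf0 : ∀ y ∈ Ω, 0 < f y)
    (hwf : ∀ y ∈ Ω, -lap w y = f y) (hx : x ∈ Ω) (hmin : ∀ y ∈ Ω, w x ≤ w y) : False := by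
  obtain ⟨c, hc, H⟩ := exists_superharmonic_ge hN
  obtain ⟨s, hs, hsΩ⟩ := nhds_basis_closedBall.mem_iff.1 (hΩ.mem_nhds hx)
  have hsub : closedBall x (s / 2) ⊆ Ω := (closedBall_subset_closedBall (by linarith)).trans hsΩ
  have hl : ∀ y ∈ Ω, -lap (fun z => w z + -w x) y = f y := fun y hy => by
    rw [lap_add (hw.contDiffAt (hΩ.mem_nhds hy)) contDiffAt_const, lap_const, add_zero, hwf y hy]
  have h := (H Ω (fun z => w z + -w x) x s hΩ (hw.add contDiffOn_const) hs hsΩ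
    (fun y hy => by linarith [hmin y (hsΩ hy)])
    (fun y hy => by rw [hl y (hsΩ hy)]; exact (hf0 y (hsΩ hy)).le)).2
  rw [setIntegral_congr_fun measurableSet_closedBall (fun y hy => hl y (hsub hy)), add_neg_cancel,
    mul_zero] at h
  obtain ⟨x₁, hx₁, h1⟩ := (isCompact_closedBall x (s / 2)).exists_isMinOn
    ⟨x, mem_closedBall_self (by positivity)⟩ (hf.mono hsub)
  have h2 := mul_volume_le_setIntegral (hf.mono hsub) h1
  have h3 : 0 < f x₁ * (volume (closedBall x (s / 2))).toReal :=
    mul_pos (hf0 _ (hsub hx₁)) (ENNReal.toReal_pos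
      (measure_closedBall_pos _ _ (by positivity)).ne' measure_closedBall_lt_top.ne)
  have : 0 < c * s ^ 2 * ∫ y in closedBall x (s / 2), f y :=
    mul_pos (by positivity) (h3.trans_le h2)
  linarith

theorem lap_norm_sq_rpow {z : EuclideanSpace ℝ (Fin N)} (hz : z ≠ 0) :
    lap (fun z : EuclideanSpace ℝ (Fin N) => (‖z‖ ^ 2) ^ (-(((N : ℝ) - 2) / 2))) z = 0 := by
  have hz0 : 0 < ‖z‖ := norm_pos_iff.2 hz
  have hd : ∀ (e t : ℝ), 0 < t → HasDerivAt (fun t : ℝ => t ^ e) (e * t ^ (e - 1)) t :=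
    fun e t ht => Real.hasDerivAt_rpow_const (Or.inl ht.ne')
  set e := -(((N : ℝ) - 2) / 2) with he
  have ht : 0 < ‖z‖ ^ 2 := by positivity
  rw [lap_comp_norm_sq (g := fun t => t ^ e) (g' := fun t => e * t ^ (e - 1))
    (g'' := fun t => e * ((e - 1) * t ^ (e - 1 - 1)))
    (Real.contDiffAt_rpow_const (Or.inl ht.ne'))
    (by filter_upwards [lt_mem_nhds ht] with t ht using hd e t ht) ((hd (e - 1) _ ht).const_mul e)]
  rw [Real.rpow_sub_one ht.ne' (e - 1)]
  field_simp
  rw [he]; ring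

theorem exists_norm_eq_le_origin (hN : 3 ≤ N) {f : EuclideanSpace ℝ (Fin N) → ℝ}
    (hu : Continuous u) (du : ContDiffOn ℝ 2 u (univ \ {0})) (hu0 : ∀ x, 0 < u x)
    (hf : ContinuousOn f (univ \ {0})) (hf0 : ∀ x ∈ univ \ {0}, 0 < f x)
    (huf : ∀ x ∈ univ \ {0}, -lap u x = f x) {R : ℝ} (hR : 0 < R) :
    ∃ x, ‖x‖ = R ∧ u x ≤ u 0 := by
  by_contra! hcon
  let e : EuclideanSpace ℝ (Fin N) := EuclideanSpace.single ⟨0, by omega⟩ 1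
  have he : ∀ t : ℝ, 0 < t → ‖t • e‖ = t := fun t ht => by
    simp [norm_smul, e, abs_of_pos ht]
  obtain ⟨x₁, hx₁, hmin⟩ := (isCompact_sphere (0 : EuclideanSpace ℝ (Fin N)) R).exists_isMinOn
    ⟨R • e, by rw [mem_sphere_zero_iff_norm, he R hR]⟩ hu.continuousOn
  have hd := hcon x₁ (mem_sphere_zero_iff_norm.1 hx₁)
  have hm : -(((N : ℝ) - 2) / 2) < 0 := by
    have : (3 : ℝ) ≤ N := by exact_mod_cast hN
    linarith
  set m := -(((N : ℝ) - 2) / 2) with hmdef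
  set Ψ : EuclideanSpace ℝ (Fin N) → ℝ := fun z => (‖z‖ ^ 2) ^ m with hΨ
  have dΨ : ContDiffOn ℝ 2 Ψ (univ \ {0}) :=
    (contDiff_norm_sq ℝ).contDiffOn.rpow_const_of_ne fun x hx => by
      have := norm_pos_iff.2 hx.2
      positivity
  have hle : ∀ ε : ℝ, 0 < ε → ∀ x, 0 < ‖x‖ → ‖x‖ < R → u x₁ ≤ u x + ε * Ψ x := by
    intro ε hε x hx0 hxR
    have hlim : Tendsto (fun t : ℝ => ε * t ^ m) (nhdsWithin 0 (Ioi 0)) atTop :=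
      (tendsto_rpow_neg_nhdsGT_zero hm).const_mul_atTop hε
    obtain ⟨ρ, hρ, hρ0, hρx⟩ : ∃ ρ : ℝ, u x₁ ≤ ε * (ρ ^ 2) ^ m ∧ 0 < ρ ∧ ρ < ‖x‖ := by
      obtain ⟨t, h1, h2⟩ := ((hlim.eventually_ge_atTop (u x₁)).and
        (Ioo_mem_nhdsGT (show (0 : ℝ) < ‖x‖ ^ 2 by positivity))).exists
      refine ⟨Real.sqrt t, by rwa [Real.sq_sqrt h2.1.le], Real.sqrt_pos.2 h2.1, ?_⟩
      exact (Real.sqrt_lt' hx0).2 h2.2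
    set w : EuclideanSpace ℝ (Fin N) → ℝ := fun z => u z + ε * Ψ z with hw
    have dw : ContDiffOn ℝ 2 w (univ \ {0}) := du.add (contDiffOn_const.mul dΨ)
    set K : Set (EuclideanSpace ℝ (Fin N)) := closedBall 0 R \ ball 0 ρ with hK
    have hKc : IsCompact K := (isCompact_closedBall _ _).diff isOpen_ball
    have hKm : ∀ y, y ∈ K ↔ ‖y‖ ≤ R ∧ ρ ≤ ‖y‖ := fun y => by
      rw [hK, Set.mem_sdiff, mem_closedBall_zero_iff, mem_ball_zero_iff, not_lt]
    have hKΩ : ∀ y : EuclideanSpace ℝ (Fin N), ρ ≤ ‖y‖ → y ∈ univ \ {0} := fun y hy => ⟨trivial, fun h0 => by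
      rw [mem_singleton_iff.1 h0, norm_zero] at hy
      linarith⟩
    have hxK : x ∈ K := (hKm x).2 ⟨hxR.le, hρx.le⟩
    obtain ⟨y, hy, hmin'⟩ := hKc.exists_isMinOn ⟨x, hxK⟩
      (dw.continuousOn.mono fun y hy => hKΩ y ((hKm y).1 hy).2)
    refine le_trans ?_ (show w y ≤ w x from hmin' hxK)
    obtain ⟨hy1, hy2⟩ := (hKm y).1 hy
    rcases hy1.eq_or_lt with h1 | h1
    · have h2 : u x₁ ≤ u y := hmin (mem_sphere_zero_iff_norm.2 h1)
      have h3 : 0 ≤ ε * Ψ y := by positivity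
      simp only [hw]; linarith
    rcases hy2.eq_or_lt with h2 | h2
    · simp only [hw, hΨ, ← h2]
      linarith [hu0 y]
    exfalso
    have hΩ : IsOpen {z : EuclideanSpace ℝ (Fin N) | ρ < ‖z‖ ∧ ‖z‖ < R} :=
      (isOpen_lt continuous_const continuous_norm).inter (isOpen_lt continuous_norm continuous_const)
    have hsub : {z : EuclideanSpace ℝ (Fin N) | ρ < ‖z‖ ∧ ‖z‖ < R} ⊆ univ \ {0} :=
      fun z hz => hKΩ z hz.1.le
    refine false_of_isMinOn_of_lap_neg hN hΩ (dw.mono hsub) (hf.mono hsub)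
      (fun z hz => hf0 z (hsub hz)) (fun z hz => ?_) (x := y) ⟨h2, h1⟩
      (fun z hz => hmin' ((hKm z).2 ⟨hz.2.le, hz.1.le⟩))
    have hz0 := isOpen_univ_sdiff_zero.mem_nhds (hsub hz)
    rw [lap_add (du.contDiffAt hz0) (contDiffAt_const.mul (dΨ.contDiffAt hz0)),
      lap_const_mul _ (dΨ.contDiffAt hz0), lap_norm_sq_rpow (hsub hz).2, mul_zero, add_zero,
      huf z (hsub hz)]
  have hle' : ∀ x, 0 < ‖x‖ → ‖x‖ < R → u x₁ ≤ u x := fun x h0 h1 => by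
    have : Tendsto (fun ε : ℝ => u x + ε * Ψ x) (nhdsWithin 0 (Ioi 0)) (nhds (u x + 0 * Ψ x)) :=
      Tendsto.mono_left (Continuous.tendsto (by fun_prop) _) nhdsWithin_le_nhds
    rw [zero_mul, add_zero] at this
    exact ge_of_tendsto this (eventually_mem_nhdsWithin.mono fun ε hε => hle ε hε x h0 h1)
  have hlim : Tendsto (fun t : ℝ => u (t • e)) (nhdsWithin 0 (Ioi 0)) (nhds (u ((0 : ℝ) • e))) :=
    Tendsto.mono_left (Continuous.tendsto (by fun_prop) _) nhdsWithin_le_nhds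
  rw [zero_smul] at hlim
  refine absurd (ge_of_tendsto hlim ?_) (not_le.2 hd)
  filter_upwards [Ioo_mem_nhdsGT hR] with t ht
  exact hle' _ (by rw [he t ht.1]; exact ht.1) (by rw [he t ht.1]; exact ht.2)

end Nonexistence

section Nonexistence

variable {N : ℕ} {p q a b : ℝ} {u v : EuclideanSpace ℝ (Fin N) → ℝ}

theorem exists_lower_bound_ball (hN : 3 ≤ N) : ∃ c > 0, ∀ (a p R k : ℝ)
    (w g : EuclideanSpace ℝ (Fin N) → ℝ) (z : EuclideanSpace ℝ (Fin N)), -2 < a → a ≤ 0 → 0 < p →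
    0 < R → 0 ≤ k → ContDiffOn ℝ 2 w (univ \ {0}) → (∀ x, 0 < w x) → Continuous g → (∀ x, 0 < g x) →
    (∀ x ∈ univ \ {0}, -lap w x = ‖x‖ ^ a * g x ^ p) → ‖z‖ = R →
    (∀ y ∈ closedBall z (R / 8), k ≤ g y) →
    ∀ x ∈ closedBall z (R / 8), c * R ^ (2 + a) * k ^ p ≤ w x := by
  obtain ⟨c, hc, H⟩ := exists_superharmonic_ge hN
  set vol := (volume (ball (0 : EuclideanSpace ℝ (Fin N)) 1)).toReal with hvol
  have hv0 : 0 < vol := ENNReal.toReal_pos (measure_ball_pos _ _ one_pos).ne'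
    measure_ball_lt_top.ne
  refine ⟨c / 16 * (vol / 4 ^ N), by positivity, ?_⟩
  intro a p R k w g z ha ha0 hp hR hk hw hw0 hg hg0 hwg hz hkg x hx
  have hxd := mem_closedBall.1 hx
  have hn : ∀ y, dist y x ≤ R / 2 → R / 4 ≤ ‖y‖ := fun y hy => by
    have h1 := dist_triangle z x y
    have h2 := norm_sub_norm_le z y
    rw [← dist_eq_norm] at h2
    rw [dist_comm z x, dist_comm x y] at h1
    linarith
  have hsub : closedBall x (R / 2) ⊆ univ \ {0} := fun y hy => ⟨trivial, fun h0 => by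
    have := hn y hy
    rw [mem_singleton_iff.1 h0, norm_zero] at this
    linarith⟩
  have hf0 : ∀ y, 0 ≤ ‖y‖ ^ a * g y ^ p := fun y =>
    mul_nonneg (by positivity) (Real.rpow_nonneg (hg0 y).le _)
  have hfc : ContinuousOn (fun y => ‖y‖ ^ a * g y ^ p) (univ \ {0}) :=
    (contDiffOn_norm_rpow a).continuousOn.mul
      (hg.rpow_const fun y => Or.inl (hg0 y).ne').continuousOn
  have h := (H _ w x (R / 2) isOpen_univ_sdiff_zero hw (by positivity) hsub (fun y _ => (hw0 y).le)
    (fun y hy => by rw [hwg y (hsub hy)]; exact hf0 y)).2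
  have hsub2 : closedBall x (R / 2 / 2) ⊆ closedBall x (R / 2) :=
    closedBall_subset_closedBall (by linarith)
  have hsub3 : closedBall z (R / 8) ⊆ closedBall x (R / 2 / 2) :=
    closedBall_subset_closedBall' (by rw [dist_comm]; linarith)
  rw [setIntegral_congr_fun measurableSet_closedBall fun y hy => hwg y (hsub (hsub2 hy))] at h
  have h1 := setIntegral_mono_set (μ := volume) ((hfc.mono (hsub2.trans hsub)).integrableOn_compact
    (isCompact_closedBall _ _)) (Eventually.of_forall hf0) (Eventually.of_forall hsub3)
  have h2 := mul_volume_le_setIntegral (k := R ^ a / 4 * k ^ p)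
    (hfc.mono ((hsub3.trans hsub2).trans hsub)) fun y hy => by
      have hy1 : ‖y‖ ≤ 2 * R := by
        have := norm_le_norm_add_norm_sub' y z
        rw [← dist_eq_norm, dist_comm, dist_comm] at this
        have := mem_closedBall.1 hy
        linarith
      have hy0 : 0 < ‖y‖ := norm_pos_iff.2 (hsub (hsub2 (hsub3 hy))).2
      have h3 : R ^ a / 4 ≤ ‖y‖ ^ a := calc
        R ^ a / 4 = 2 ^ (-2 : ℝ) * R ^ a := by
          rw [Real.rpow_neg two_pos.le, Real.rpow_two]; ring
        _ ≤ 2 ^ a * R ^ a := by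
          gcongr
          norm_num
        _ = (2 * R) ^ a := (Real.mul_rpow two_pos.le hR.le).symm
        _ ≤ ‖y‖ ^ a := Real.rpow_le_rpow_of_nonpos hy0 hy1 ha0
      exact mul_le_mul h3 (Real.rpow_le_rpow hk (hkg y hy) hp.le) (by positivity) (by positivity)
  rw [Measure.addHaar_closedBall _ _ (by positivity), finrank_euclideanSpace_fin,
    ENNReal.toReal_mul, ENNReal.toReal_ofReal (by positivity), ← hvol] at h2
  have h4 := (mul_le_mul_of_nonneg_left (h2.trans h1)
    (show 0 ≤ c * (R / 2) ^ 2 by positivity)).trans h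
  have h5 : c * (R / 2) ^ 2 * (R ^ a / 4 * k ^ p * ((R / 8) ^ N * vol)) =
      (R / 2) ^ N * (c / 16 * (vol / 4 ^ N) * R ^ (2 + a) * k ^ p) := by
    rw [show R / 8 = R / 2 / 4 by ring, div_pow (R / 2) 4 N, Real.rpow_add hR, Real.rpow_two]
    ring
  rw [h5] at h4
  exact le_of_mul_le_mul_left h4 (by positivity)

theorem IsHHSol.false_of_mul_le_one (hN : 3 ≤ N) (hp : 0 < p) (hq : 0 < q) (hpq : p * q ≤ 1)
    (ha : -2 < a) (ha0 : a ≤ 0) (hb : -2 < b) (hb0 : b ≤ 0)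
    (h : IsHHSol a b p q univ u v) : False := by
  obtain ⟨cu, cv, du, dv, pu, pv, eu, ev⟩ := h
  have hu0 : ∀ y, 0 < u y := fun y => pu y trivial
  have hv0 : ∀ y, 0 < v y := fun y => pv y trivial
  rw [continuousOn_univ] at cu cv
  obtain ⟨c, hc, H⟩ := exists_lower_bound_ball hN
  have hγ : 0 < 2 + a + (2 + b) * p := by
    have : 0 < (2 + b) * p := mul_pos (by linarith) hp
    linarith
  have key : ∀ R : ℝ, 0 < R → c ^ (1 + p) * R ^ (2 + a + (2 + b) * p) ≤ u 0 ^ (1 - p * q) := by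
    intro R hR
    obtain ⟨z, hz, hzu⟩ := exists_norm_eq_le_origin hN (f := fun y => ‖y‖ ^ a * v y ^ p) cu du hu0
      ((contDiffOn_norm_rpow a).continuousOn.mul
        (cv.rpow_const fun y => Or.inl (hv0 y).ne').continuousOn)
      (fun y hy => mul_pos (Real.rpow_pos_of_pos (norm_pos_iff.2 hy.2) _)
        (Real.rpow_pos_of_pos (hv0 y) _)) eu hR
    have hzB : z ∈ closedBall z (R / 8) := mem_closedBall_self (by positivity)
    obtain ⟨x, hx, hxm⟩ := (isCompact_closedBall z (R / 8)).exists_isMinOn ⟨z, hzB⟩ cu.continuousOn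
    obtain ⟨y, hy, hym⟩ := (isCompact_closedBall z (R / 8)).exists_isMinOn ⟨z, hzB⟩ cv.continuousOn
    have h1 := H a p R (v y) u v z ha ha0 hp hR (hv0 y).le du hu0 cv hv0 eu hz hym x hx
    have h2 := H b q R (u x) v u z hb hb0 hq hR (hu0 x).le dv hv0 cu hu0 ev hz hxm y hy
    have hux := hu0 x
    have h3 : c ^ (1 + p) * R ^ (2 + a + (2 + b) * p) * u x ^ (p * q) ≤ u x := by
      refine le_trans (le_of_eq ?_) ((mul_le_mul_of_nonneg_left
        (Real.rpow_le_rpow (by positivity) h2 hp.le) (by positivity)).trans h1)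
      rw [Real.mul_rpow (by positivity) (by positivity), Real.mul_rpow hc.le (by positivity),
        ← Real.rpow_mul hR.le, ← Real.rpow_mul hux.le, Real.rpow_add hc, Real.rpow_one,
        Real.rpow_add hR (2 + a), mul_comm q p]
      ring
    calc c ^ (1 + p) * R ^ (2 + a + (2 + b) * p) ≤ u x ^ (1 - p * q) := by
          rw [Real.rpow_sub hux, Real.rpow_one, le_div_iff₀ (by positivity)]; exact h3
      _ ≤ u 0 ^ (1 - p * q) :=
          Real.rpow_le_rpow hux.le ((hxm hzB).trans hzu) (by linarith)
  have lim := (tendsto_rpow_atTop hγ).const_mul_atTop (show 0 < c ^ (1 + p) by positivity)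
  obtain ⟨R, h1, h2⟩ := ((lim.eventually_gt_atTop (u 0 ^ (1 - p * q))).and
    (eventually_gt_atTop 0)).exists
  exact absurd (key R h2) (not_le.2 h1)

theorem IsHHSol.false_of_subcritical (hN : N = 3 ∨ N = 4) (hp : 0 < p) (hq : 0 < q)
    (ha : -2 < a) (ha0 : a ≤ 0) (hb : -2 < b) (hb0 : b ≤ 0)
    (hcond : (N : ℝ) - 2 < (N + a) / (p + 1) + (N + b) / (q + 1))
    (h : IsHHSol a b p q univ u v) : False := by
  have hN3 : 3 ≤ N := by omega
  rcases le_or_gt (p * q) 1 with hpq | hpq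
  · exact h.false_of_mul_le_one hN3 hp hq hpq ha ha0 hb hb0
  have hsub : (N : ℝ) - 2 < N / (p + 1) + N / (q + 1) := by
    refine hcond.trans_le (add_le_add ?_ ?_) <;> gcongr <;> linarith
  have hD : 0 < p * q - 1 := by linarith
  have hp1 : 0 < p + 1 := by linarith
  have hq1 : 0 < q + 1 := by linarith
  have e1 : ∀ A B : ℝ, A / (p + 1) + B / (q + 1) = (A * (q + 1) + B * (p + 1)) / ((p + 1) * (q + 1)) :=
    fun A B => by field_simp
  have hex : ∀ A B : ℝ, (N : ℝ) - 2 < (N + A) / (p + 1) + (N + B) / (q + 1) →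
      (N : ℝ) - 2 < (2 + A + (2 + B) * p) / (p * q - 1) + (2 + B + (2 + A) * q) / (p * q - 1) := by
    intro A B hAB
    rw [e1, lt_div_iff₀ (by positivity)] at hAB
    rw [← add_div, lt_div_iff₀ hD]
    linarith
  have pos : ∀ A B k : ℝ, -2 < A → -2 < B → 0 < k → 0 < (2 + A + (2 + B) * k) / (p * q - 1) :=
    fun A B k hA hB hk => div_pos (add_pos (by linarith) (mul_pos (by linarith) hk)) hD
  have scale : ∀ A B : ℝ, (2 + A + (2 + B) * p) / (p * q - 1) + 2 + A =
      (2 + B + (2 + A) * q) / (p * q - 1) * p := fun A B => by field_simp; ring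
  have scale' : ∀ A B : ℝ, (2 + B + (2 + A) * q) / (p * q - 1) + 2 + B =
      (2 + A + (2 + B) * p) / (p * q - 1) * q := fun A B => by
    have : q * p - 1 ≠ 0 := by rw [mul_comm]; exact hD.ne'
    field_simp; ring
  have h0 := hex 0 0 (by simpa using hsub)
  have s0 := scale 0 0
  have s0' := scale' 0 0
  rw [add_zero _] at s0 s0'
  obtain ⟨B, hB⟩ := exists_bound_unit_sphere hN hp hq hpq hsub s0 s0'
    (pos 0 0 p (by norm_num) (by norm_num) hp) (pos 0 0 q (by norm_num) (by norm_num) hq)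
    (by linarith) ha ha0 hb hb0
  set X := ((N : ℝ) + a) / (p + 1) with hX
  set Y := ((N : ℝ) + b) / (q + 1) with hY
  exact h.false_of_decay hN3 hp hq (scale a b) (scale' a b) (pos a b p ha hb hp)
    (pos b a q hb ha hq) (hex a b hcond) (θ₁ := X - (X + Y - (N - 2)) / 2)
    (θ₂ := Y - (X + Y - (N - 2)) / 2) (by linarith) (by linarith) (by ring) ha hb
    fun x hx => exists_decay_bound (scale a b) (scale' a b) hB h hx

end Nonexistence

section RadialODE

variable {m c : ℝ} {h u P h₂ u₂ P₂ : ℝ → ℝ}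

theorem sub_le_sub_of_hasDerivAt_le {f f' g g' : ℝ → ℝ} {s t : ℝ} (hst : s ≤ t)
    (cf : ContinuousOn f (Icc s t)) (cg : ContinuousOn g (Icc s t))
    (df : ∀ x ∈ Ioo s t, HasDerivAt f (f' x) x) (dg : ∀ x ∈ Ioo s t, HasDerivAt g (g' x) x)
    (hle : ∀ x ∈ Ioo s t, f' x ≤ g' x) : f t - f s ≤ g t - g s := by
  have : MonotoneOn (fun x => g x - f x) (Icc s t) := by
    refine monotoneOn_of_hasDerivWithinAt_nonneg (convex_Icc s t) (cg.sub cf)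
      (f' := fun x => g' x - f' x) (fun x hx => ?_) (fun x hx => ?_)
    · rw [interior_Icc] at hx ⊢
      exact ((dg x hx).sub (df x hx)).hasDerivWithinAt
    · rw [interior_Icc] at hx
      exact sub_nonneg.2 (hle x hx)
  have := this (left_mem_Icc.2 hst) (right_mem_Icc.2 hst) hst
  simp only at this
  linarith

/-- `u` solves `-4 t^{1-m} (t^m u')' = t^c h` on the half line, with flux `P = t^m u'` vanishing
at the origin: in the variable `t = |x|²` and with `m = N / 2` this is `-Δu = |x|^{2c} h`. -/
def IsRad (m c : ℝ) (h u P : ℝ → ℝ) : Prop :=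
  ContinuousOn u (Ici 0) ∧ ContinuousOn P (Ici 0) ∧ P 0 = 0 ∧
    ∀ t, 0 < t → HasDerivAt u (t ^ (-m) * P t) t ∧ HasDerivAt P (-(t ^ (m - 1 + c) * h t / 4)) t

theorem IsRad.sub (H : IsRad m c h u P) (H₂ : IsRad m c h₂ u₂ P₂) :
    IsRad m c (fun t => h t - h₂ t) (fun t => u t - u₂ t) (fun t => P t - P₂ t) := by
  obtain ⟨h1, h2, h3, h4⟩ := H
  obtain ⟨k1, k2, k3, k4⟩ := H₂
  refine ⟨h1.sub k1, h2.sub k2, by simp only [h3, k3, sub_zero], fun t ht => ⟨?_, ?_⟩⟩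
  · exact ((h4 t ht).1.sub (k4 t ht).1).congr_deriv (by ring)
  · exact ((h4 t ht).2.sub (k4 t ht).2).congr_deriv (by ring)

theorem IsRad.const_mul (H : IsRad m c h u P) (k : ℝ) :
    IsRad m c (fun t => k * h t) (fun t => k * u t) (fun t => k * P t) := by
  obtain ⟨h1, h2, h3, h4⟩ := H
  refine ⟨continuousOn_const.mul h1, continuousOn_const.mul h2, by simp only [h3, mul_zero],
    fun t ht => ⟨?_, ?_⟩⟩
  · exact ((h4 t ht).1.const_mul k).congr_deriv (by ring)
  · exact ((h4 t ht).2.const_mul k).congr_deriv (by ring)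

theorem continuousOn_rpow_Ici {e : ℝ} (he : 0 ≤ e) : ContinuousOn (fun t : ℝ => t ^ e) (Ici 0) :=
  (Real.continuous_rpow_const he).continuousOn

theorem isRad_rpow (hm : 3 / 2 ≤ m) (hc : -1 < c) : IsRad m c (fun _ => 1)
    (fun t => -(t ^ (c + 1) / (4 * (m + c) * (c + 1)))) (fun t => -(t ^ (m + c) / (4 * (m + c)))) := by
  have h1 : m + c ≠ 0 := by linarith
  have h2 : c + 1 ≠ 0 := by linarith
  refine ⟨((continuousOn_rpow_Ici (by linarith)).div_const _).neg,
    ((continuousOn_rpow_Ici (by linarith)).div_const _).neg,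
    by simp [Real.zero_rpow h1], fun t ht => ⟨?_, ?_⟩⟩
  · refine (((Real.hasDerivAt_rpow_const (p := c + 1) (Or.inl ht.ne')).div_const _).neg).congr_deriv ?_
    rw [add_sub_cancel_right, show t ^ c = t ^ (-m) * t ^ (m + c) by
      rw [← Real.rpow_add ht]; congr 1; ring]
    field_simp
  · refine (((Real.hasDerivAt_rpow_const (p := m + c) (Or.inl ht.ne')).div_const _).neg).congr_deriv ?_
    rw [show m + c - 1 = m - 1 + c by ring]
    field_simp

theorem IsRad.nonpos (H : IsRad m c h u P) {s t : ℝ} (h0 : ∀ x ∈ Ioo 0 t, 0 ≤ h x) (hs : 0 ≤ s)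
    (hst : s ≤ t) : P t ≤ P s ∧ P t ≤ 0 ∧ u t ≤ u s := by
  obtain ⟨h1, h2, h3, h4⟩ := H
  have key : ∀ s t', 0 ≤ s → s ≤ t' → t' ≤ t → P t' ≤ P s := fun s t' hs hst' ht' => by
    have hsub : Icc s t' ⊆ Ici 0 := fun x hx => hs.trans hx.1
    have := sub_le_sub_of_hasDerivAt_le hst' (h2.mono hsub) (continuousOn_const (c := (0 : ℝ)))
      (fun x hx => (h4 x (hs.trans_lt hx.1)).2) (fun x _ => hasDerivAt_const x (0 : ℝ)) fun x hx => by
        have h5 := h0 x ⟨hs.trans_lt hx.1, hx.2.trans_le ht'⟩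
        have h6 := (hs.trans_lt hx.1).le
        rw [Left.neg_nonpos_iff]; positivity
    linarith
  refine ⟨key s t hs hst le_rfl, h3 ▸ key 0 t le_rfl (hs.trans hst) le_rfl, ?_⟩
  have hsub : Icc s t ⊆ Ici 0 := fun x hx => hs.trans hx.1
  have := sub_le_sub_of_hasDerivAt_le hst (h1.mono hsub) (continuousOn_const (c := (0 : ℝ)))
    (fun x hx => (h4 x (hs.trans_lt hx.1)).1) (fun x _ => hasDerivAt_const x (0 : ℝ)) fun x hx => by
      have h5 := key 0 x le_rfl (hs.trans hx.1.le) hx.2.le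
      rw [h3] at h5
      exact mul_nonpos_of_nonneg_of_nonpos (Real.rpow_nonneg (hs.trans hx.1.le) _) h5
  linarith

theorem IsRad.le_of_le (hm : 3 / 2 ≤ m) (hc : -1 < c) (H : IsRad m c h u P) {s t l : ℝ}
    (h0 : ∀ x ∈ Ioo 0 t, l ≤ h x) (hs : 0 ≤ s) (hst : s ≤ t) :
    u t ≤ u s - l * ((t ^ (c + 1) - s ^ (c + 1)) / (4 * (m + c) * (c + 1))) ∧
      P t ≤ -(l * (t ^ (m + c) / (4 * (m + c)))) := by
  have := (H.sub ((isRad_rpow hm hc).const_mul l)).nonpos (s := s) (t := t)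
    (fun x hx => by simpa using h0 x hx) hs hst
  have e : l * ((t ^ (c + 1) - s ^ (c + 1)) / (4 * (m + c) * (c + 1))) =
    l * (t ^ (c + 1) / (4 * (m + c) * (c + 1))) - l * (s ^ (c + 1) / (4 * (m + c) * (c + 1))) := by ring
  constructor <;> linarith [this.2.1, this.2.2]

theorem IsRad.ge_of_le (hm : 3 / 2 ≤ m) (hc : -1 < c) (H : IsRad m c h u P) {s t l : ℝ}
    (h0 : ∀ x ∈ Ioo 0 t, h x ≤ l) (hs : 0 ≤ s) (hst : s ≤ t) :
    u s - l * ((t ^ (c + 1) - s ^ (c + 1)) / (4 * (m + c) * (c + 1))) ≤ u t ∧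
      -(l * (t ^ (m + c) / (4 * (m + c)))) ≤ P t := by
  have := (((isRad_rpow hm hc).const_mul l).sub H).nonpos (s := s) (t := t)
    (fun x hx => by simpa using h0 x hx) hs hst
  have e : l * ((t ^ (c + 1) - s ^ (c + 1)) / (4 * (m + c) * (c + 1))) =
    l * (t ^ (c + 1) / (4 * (m + c) * (c + 1))) - l * (s ^ (c + 1) / (4 * (m + c) * (c + 1))) := by ring
  constructor <;> linarith [this.2.1, this.2.2]

theorem hasDerivAt_integral_of_continuousOn {f : ℝ → ℝ} {t : ℝ} (hf : IntervalIntegrable f volume 0 t)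
    (hc : ContinuousOn f (Ioi 0)) (ht : 0 < t) :
    HasDerivAt (fun s => ∫ x in (0 : ℝ)..s, f x) (f t) t :=
  intervalIntegral.integral_hasDerivAt_right hf
    (hc.stronglyMeasurableAtFilter isOpen_Ioi t ht) (hc.continuousAt (Ioi_mem_nhds ht))

theorem continuousOn_integral_Ici {f : ℝ → ℝ} (hf : ∀ t, 0 ≤ t → IntervalIntegrable f volume 0 t) :
    ContinuousOn (fun s => ∫ x in (0 : ℝ)..s, f x) (Ici 0) := by
  intro t ht
  have ht' : (0 : ℝ) ≤ t := ht
  have h1 := intervalIntegral.continuousOn_primitive_interval' (hf (t + 1) (by linarith))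
    (left_mem_uIcc)
  rw [uIcc_of_le (by linarith)] at h1
  refine (h1 t ⟨ht', by linarith⟩).mono_of_mem_nhdsWithin ?_
  rw [← Ici_inter_Iic]
  exact inter_mem_nhdsWithin _ (Iic_mem_nhds (by linarith))

theorem exists_isRad (hm : 3 / 2 ≤ m) (hc : -1 < c) (hh : Continuous h) (θ : ℝ) :
    ∃ u P, IsRad m c h u P ∧ u 0 = θ := by
  have hI : ∀ t, 0 ≤ t → IntervalIntegrable (fun s => -(s ^ (m - 1 + c) * h s / 4)) volume 0 t :=
    fun t _ => ((((intervalIntegral.intervalIntegrable_rpow' (by linarith)).mul_continuousOn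
      hh.continuousOn)).div_const _).neg
  have hrp : ∀ e : ℝ, ContinuousOn (fun s : ℝ => s ^ e) (Ioi 0) := fun e =>
    continuousOn_id.rpow_const fun x hx => Or.inl (ne_of_gt hx)
  set P : ℝ → ℝ := fun t => ∫ s in (0 : ℝ)..t, -(s ^ (m - 1 + c) * h s / 4) with hP
  have cP : ContinuousOn P (Ici 0) := continuousOn_integral_Ici hI
  have dP : ∀ t, 0 < t → HasDerivAt P (-(t ^ (m - 1 + c) * h t / 4)) t := fun t ht =>
    hasDerivAt_integral_of_continuousOn (hI t ht.le)
      (((hrp _).mul hh.continuousOn).div_const _).neg ht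
  have P0 : P 0 = 0 := intervalIntegral.integral_same
  have cg : ContinuousOn (fun s : ℝ => s ^ (-m) * P s) (Ioi 0) :=
    (hrp _).mul (cP.mono Ioi_subset_Ici_self)
  have hI2 : ∀ t, 0 ≤ t → IntervalIntegrable (fun s => s ^ (-m) * P s) volume 0 t := by
    intro t ht
    obtain ⟨M, hM⟩ := (isCompact_Icc (a := (0 : ℝ)) (b := t)).exists_bound_of_continuousOn
      hh.continuousOn
    have hmc : 0 < m + c := by linarith
    have bP : ∀ s ∈ Icc 0 t, |P s| ≤ M / (4 * (m + c)) * s ^ (m + c) := by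
      intro s hs
      have cp : ∀ k : ℝ, ContinuousOn (fun s : ℝ => k * s ^ (m + c)) (Icc 0 s) := fun k =>
        continuousOn_const.mul ((continuousOn_rpow_Ici hmc.le).mono fun x hx => hx.1)
      have dp : ∀ k : ℝ, ∀ x ∈ Ioo 0 s, HasDerivAt (fun s : ℝ => k * s ^ (m + c))
          (k * (4 * (m + c)) * (x ^ (m - 1 + c) / 4)) x := fun k x hx =>
        ((Real.hasDerivAt_rpow_const (p := m + c) (Or.inl hx.1.ne')).const_mul k).congr_deriv (by
          rw [show m + c - 1 = m - 1 + c by ring]; ring)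
      have hsub : Icc 0 s ⊆ Ici 0 := fun x hx => hx.1
      have hb : ∀ x ∈ Ioo 0 s, |x ^ (m - 1 + c) * h x / 4| ≤ M * (x ^ (m - 1 + c) / 4) := fun x hx => by
        have h0 := Real.rpow_nonneg hx.1.le (m - 1 + c)
        rw [abs_div, abs_mul, abs_of_nonneg h0, abs_of_pos (by norm_num : (0 : ℝ) < 4)]
        have := mul_le_mul_of_nonneg_left (hM x ⟨hx.1.le, hx.2.le.trans hs.2⟩) h0
        rw [Real.norm_eq_abs] at this
        linarith
      have e : M / (4 * (m + c)) * (4 * (m + c)) = M := by field_simp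
      have h1 := sub_le_sub_of_hasDerivAt_le hs.1 (cP.mono hsub) (cp (M / (4 * (m + c))))
        (fun x hx => dP x hx.1) (dp _) (fun x hx => by
          rw [e]; exact (neg_le_abs _).trans (hb x hx))
      have h2 := sub_le_sub_of_hasDerivAt_le hs.1 (cp (-(M / (4 * (m + c))))) (cP.mono hsub)
        (dp _) (fun x hx => dP x hx.1) (fun x hx => by
          rw [neg_mul, e, neg_mul]; exact neg_le_neg ((le_abs_self _).trans (hb x hx)))
      simp only [P0, Real.zero_rpow hmc.ne', mul_zero, sub_zero] at h1 h2
      rw [abs_le]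
      constructor <;> linarith
    have hg := (intervalIntegral.intervalIntegrable_rpow' (a := 0) (b := t) hc).const_mul
      (M / (4 * (m + c)))
    refine hg.mono_fun ?_ ?_
    · rw [uIoc_of_le ht]
      exact (cg.mono fun x hx => hx.1).aestronglyMeasurable measurableSet_Ioc
    · rw [uIoc_of_le ht]
      refine (ae_restrict_iff' measurableSet_Ioc).2 (Eventually.of_forall fun x hx => ?_)
      have hx0 := hx.1
      beta_reduce
      rw [Real.norm_eq_abs, Real.norm_eq_abs, abs_mul, abs_of_pos (Real.rpow_pos_of_pos hx0 _)]
      refine le_trans ?_ (le_abs_self _)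
      calc x ^ (-m) * |P x| ≤ x ^ (-m) * (M / (4 * (m + c)) * x ^ (m + c)) := by
            gcongr; exact bP x ⟨hx0.le, hx.2⟩
        _ = M / (4 * (m + c)) * x ^ c := by
            rw [mul_left_comm, ← Real.rpow_add hx0, neg_add_cancel_left]
  refine ⟨fun t => θ + ∫ s in (0 : ℝ)..t, s ^ (-m) * P s, P,
    ⟨continuousOn_const.add (continuousOn_integral_Ici hI2), cP, P0, fun t ht => ⟨?_, dP t ht⟩⟩, by simp⟩
  exact (hasDerivAt_integral_of_continuousOn (hI2 t ht.le) cg ht).const_add θ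

end RadialODE

section RadialExistence

variable {m c d : ℝ} {h u P h₂ u₂ P₂ k v Q k₂ v₂ Q₂ : ℝ → ℝ}

theorem IsRad.congr (H : IsRad m c h u P) (e : ∀ t, 0 < t → h₂ t = h t) : IsRad m c h₂ u P :=
  ⟨H.1, H.2.1, H.2.2.1, fun t ht => by rw [e t ht]; exact H.2.2.2 t ht⟩

/-- The exponent of the weight used to solve the radial system. -/
noncomputable def radWeight (c d t : ℝ) : ℝ := t ^ (c + 1) / (c + 1) + t ^ (d + 1) / (d + 1)

theorem radWeight_comm (c d t : ℝ) : radWeight c d t = radWeight d c t := add_comm _ _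

theorem continuousOn_radWeight (hc : -1 < c) (hd : -1 < d) :
    ContinuousOn (radWeight c d) (Ici 0) :=
  ((continuousOn_rpow_Ici (by linarith)).div_const _).add
    ((continuousOn_rpow_Ici (by linarith)).div_const _)

theorem hasDerivAt_radWeight (hc : -1 < c) (hd : -1 < d) {t : ℝ} (ht : 0 < t) :
    HasDerivAt (radWeight c d) (t ^ c + t ^ d) t := by
  have h1 : c + 1 ≠ 0 := by linarith
  have h2 : d + 1 ≠ 0 := by linarith
  refine (((Real.hasDerivAt_rpow_const (p := c + 1) (Or.inl ht.ne')).div_const _).add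
    ((Real.hasDerivAt_rpow_const (p := d + 1) (Or.inl ht.ne')).div_const _)).congr_deriv ?_
  rw [add_sub_cancel_right, add_sub_cancel_right]
  field_simp

theorem radWeight_le_radWeight (hc : -1 < c) (hd : -1 < d) {s t : ℝ} (hs : 0 ≤ s) (hst : s ≤ t) :
    radWeight c d s ≤ radWeight c d t := by
  have h1 : 0 < c + 1 := by linarith
  have h2 : 0 < d + 1 := by linarith
  unfold radWeight
  gcongr

theorem radWeight_nonneg (hc : -1 < c) (hd : -1 < d) {t : ℝ} (ht : 0 ≤ t) : 0 ≤ radWeight c d t := by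
  have h1 : 0 < c + 1 := by linarith
  have h2 : 0 < d + 1 := by linarith
  unfold radWeight
  positivity

theorem IsRad.abs_sub_le (hm : 3 / 2 ≤ m) (hc : -1 < c) (hd : -1 < d) (H : IsRad m c h u P)
    {F L T : ℝ} (hF : 0 ≤ F) (hL : 0 < L)
    (hh : ∀ t ∈ Ioo 0 T, |h t| ≤ F * Real.exp (L * radWeight c d t)) {t : ℝ} (ht : t ∈ Icc 0 T) :
    |u t - u 0| ≤ F / (2 * L) * Real.exp (L * radWeight c d t) := by
  have hmc : 1 / 2 < m + c := by linarith
  have hsub : Icc 0 t ⊆ Ici 0 := fun x hx => hx.1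
  have bP : ∀ s ∈ Ioo 0 t, |s ^ (-m) * P s| ≤
      F / (2 * L) * (Real.exp (L * radWeight c d s) * (L * (s ^ c + s ^ d))) := by
    intro s hs
    have hs0 := hs.1
    have hb : ∀ x ∈ Ioo 0 s, |h x| ≤ F * Real.exp (L * radWeight c d s) := fun x hx => by
      refine (hh x ⟨hx.1, hx.2.trans (hs.2.trans_le ht.2)⟩).trans ?_
      have := radWeight_le_radWeight hc hd hx.1.le hx.2.le
      gcongr
    have h1 := (H.ge_of_le hm hc (fun x hx => (le_abs_self _).trans (hb x hx)) le_rfl hs0.le).2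
    have h2 := (H.le_of_le hm hc (fun x hx => (neg_le_of_abs_le (hb x hx))) le_rfl hs0.le).2
    set E := F * Real.exp (L * radWeight c d s) with hE
    have hE0 : 0 ≤ E := by positivity
    have h3 : |P s| ≤ E * (s ^ (m + c) / 2) := by
      have h4 : E * (s ^ (m + c) / (4 * (m + c))) ≤ E * (s ^ (m + c) / 2) := by
        gcongr; linarith
      rw [abs_le]
      constructor <;> linarith
    rw [abs_mul, abs_of_pos (Real.rpow_pos_of_pos hs0 _)]
    calc s ^ (-m) * |P s| ≤ s ^ (-m) * (E * (s ^ (m + c) / 2)) := by gcongr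
      _ = E / 2 * (s ^ (-m) * s ^ (m + c)) := by ring
      _ = E / 2 * s ^ c := by rw [← Real.rpow_add hs0, neg_add_cancel_left]
      _ ≤ E / 2 * (s ^ c + s ^ d) := by
        gcongr; exact le_add_of_nonneg_right (Real.rpow_nonneg hs0.le _)
      _ = _ := by rw [hE]; field_simp
  have cG : ContinuousOn (fun s => F / (2 * L) * Real.exp (L * radWeight c d s)) (Icc 0 t) :=
    continuousOn_const.mul ((continuousOn_const.mul
      ((continuousOn_radWeight hc hd).mono hsub)).rexp)
  have dG : ∀ s ∈ Ioo 0 t, HasDerivAt (fun s => F / (2 * L) * Real.exp (L * radWeight c d s))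
      (F / (2 * L) * (Real.exp (L * radWeight c d s) * (L * (s ^ c + s ^ d)))) s := fun s hs =>
    (((hasDerivAt_radWeight hc hd hs.1).const_mul L).exp).const_mul _
  have h1 := sub_le_sub_of_hasDerivAt_le ht.1 (H.1.mono hsub) cG (fun x hx => (H.2.2.2 x hx.1).1) dG
    fun x hx => (le_abs_self _).trans (bP x hx)
  have h2 := sub_le_sub_of_hasDerivAt_le ht.1 cG.neg (H.1.mono hsub) (fun x hx => (dG x hx).neg)
    (fun x hx => (H.2.2.2 x hx.1).1) fun x hx => neg_le_of_abs_le (bP x hx)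
  have h3 : 0 ≤ F / (2 * L) * Real.exp (L * radWeight c d 0) := by positivity
  simp only [Pi.neg_apply] at h2
  rw [abs_le]
  constructor <;> linarith

/-- Lipschitz dependence of the radial system on the initial values. -/
theorem IsRad.abs_sub_le_of_lipschitz (hm : 3 / 2 ≤ m) (hc : -1 < c) (hd : -1 < d)
    (Hu : IsRad m c h u P) (Hv : IsRad m d k v Q) (Hu₂ : IsRad m c h₂ u₂ P₂)
    (Hv₂ : IsRad m d k₂ v₂ Q₂) {L T D : ℝ} (hL : 0 < L)
    (hh : ∀ t ∈ Ioo 0 T, |h t - h₂ t| ≤ L * |v t - v₂ t|)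
    (hk : ∀ t ∈ Ioo 0 T, |k t - k₂ t| ≤ L * |u t - u₂ t|)
    (hu : |u 0 - u₂ 0| ≤ D) (hv : |v 0 - v₂ 0| ≤ D) {t : ℝ} (ht : t ∈ Icc 0 T) :
    |u t - u₂ t| ≤ 2 * D * Real.exp (L * radWeight c d t) ∧
      |v t - v₂ t| ≤ 2 * D * Real.exp (L * radWeight c d t) := by
  have hsub : Icc 0 T ⊆ Ici 0 := fun x hx => hx.1
  set W : ℝ → ℝ := fun t => max |u t - u₂ t| |v t - v₂ t| with hW
  have cW : ContinuousOn W (Icc 0 T) :=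
    ((Hu.1.mono hsub).sub (Hu₂.1.mono hsub)).abs.sup ((Hv.1.mono hsub).sub (Hv₂.1.mono hsub)).abs
  have cE : ContinuousOn (fun t => Real.exp (L * radWeight c d t)) (Icc 0 T) :=
    (continuousOn_const.mul ((continuousOn_radWeight hc hd).mono hsub)).rexp
  obtain ⟨s, hs, hmax⟩ := isCompact_Icc.exists_isMaxOn ⟨t, ht⟩
    (cW.div cE fun x _ => (Real.exp_pos _).ne')
  set M := W s / Real.exp (L * radWeight c d s) with hM
  have hWM : ∀ x ∈ Icc 0 T, W x ≤ M * Real.exp (L * radWeight c d x) := fun x hx =>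
    (div_le_iff₀ (Real.exp_pos _)).1 (hmax hx)
  have hM0 : 0 ≤ M := div_nonneg ((abs_nonneg _).trans (le_max_left _ _)) (Real.exp_pos _).le
  have hD : 0 ≤ D := (abs_nonneg _).trans hu
  have e1 : 1 ≤ Real.exp (L * radWeight c d s) :=
    Real.one_le_exp (mul_nonneg hL.le (radWeight_nonneg hc hd hs.1))
  have h1 := (Hu.sub Hu₂).abs_sub_le hm hc hd (F := L * M) (by positivity) hL (fun x hx => by
    refine (hh x hx).trans ?_
    rw [mul_assoc]
    exact mul_le_mul_of_nonneg_left ((le_max_right _ _).trans (hWM x (Ioo_subset_Icc_self hx))) hL.le)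
    hs
  have h2 := (Hv.sub Hv₂).abs_sub_le hm hd hc (F := L * M) (by positivity) hL (fun x hx => by
    refine (hk x hx).trans ?_
    rw [mul_assoc, radWeight_comm]
    exact mul_le_mul_of_nonneg_left ((le_max_left _ _).trans (hWM x (Ioo_subset_Icc_self hx))) hL.le)
    hs
  rw [radWeight_comm] at h2
  have e2 : L * M / (2 * L) = M / 2 := by field_simp
  rw [e2] at h1 h2
  have h3 : W s ≤ D + M / 2 * Real.exp (L * radWeight c d s) := by
    refine max_le ?_ ?_
    · have := abs_sub_abs_le_abs_sub (u s - u₂ s) (u 0 - u₂ 0)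
      linarith
    · have := abs_sub_abs_le_abs_sub (v s - v₂ s) (v 0 - v₂ 0)
      linarith
  have h4 : W s = M * Real.exp (L * radWeight c d s) := (div_mul_cancel₀ _ (Real.exp_pos _).ne').symm
  have h5 : M ≤ 2 * D := by
    have : M / 2 * 1 ≤ M / 2 * Real.exp (L * radWeight c d s) := by gcongr
    linarith
  have h6 := (hWM t ht).trans (mul_le_mul_of_nonneg_right h5 (Real.exp_pos _).le)
  exact ⟨(le_max_left _ _).trans h6, (le_max_right _ _).trans h6⟩

open BoundedContinuousFunction in
theorem exists_radial_system (hm : 3 / 2 ≤ m) (hc : -1 < c) (hd : -1 < d) {f g : ℝ → ℝ} {L B : ℝ}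
    (hL : 0 < L) (hf : ∀ x y, |f x - f y| ≤ L * |x - y|) (hg : ∀ x y, |g x - g y| ≤ L * |x - y|)
    (hfB : ∀ x, |f x| ≤ B) (hgB : ∀ x, |g x| ≤ B) (θ₁ θ₂ : ℝ) :
    ∃ u v P Q, IsRad m c (fun t => f (v t)) u P ∧ IsRad m d (fun t => g (u t)) v Q ∧
      u 0 = θ₁ ∧ v 0 = θ₂ := by
  set E : ℝ → ℝ := fun t => Real.exp (L * radWeight c d t) with hE
  have E1 : ∀ t, 0 ≤ t → 1 ≤ E t := fun t ht =>
    Real.one_le_exp (mul_nonneg hL.le (radWeight_nonneg hc hd ht))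
  have E0 : ∀ t, 0 < E t := fun t => Real.exp_pos _
  have cE : Continuous fun t => E |t| := by
    refine Real.continuous_exp.comp (continuous_const.mul ?_)
    exact (continuousOn_radWeight hc hd).comp_continuous continuous_abs fun x => abs_nonneg x
  have cf : Continuous f := (LipschitzWith.of_dist_le_mul (K := L.toNNReal) fun x y => by
    rw [Real.dist_eq, Real.dist_eq, Real.coe_toNNReal _ hL.le]; exact hf x y).continuous
  have cg : Continuous g := (LipschitzWith.of_dist_le_mul (K := L.toNNReal) fun x y => by
    rw [Real.dist_eq, Real.dist_eq, Real.coe_toNNReal _ hL.le]; exact hg x y).continuous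
  have hB : 0 ≤ B := (abs_nonneg _).trans (hfB 0)
  have step : ∀ w : ℝ →ᵇ ℝ × ℝ, ∃ w' : ℝ →ᵇ ℝ × ℝ, ∃ u v P Q,
      IsRad m c (fun t => f (E |t| * (w t).2)) u P ∧ IsRad m d (fun t => g (E |t| * (w t).1)) v Q ∧
      u 0 = θ₁ ∧ v 0 = θ₂ ∧ ∀ t, w' t = (u |t| / E |t|, v |t| / E |t|) := by
    intro w
    obtain ⟨u, P, hu, hu0⟩ := exists_isRad (h := fun t => f (E |t| * (w t).2)) hm hc
      (cf.comp (cE.mul w.continuous.snd)) θ₁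
    obtain ⟨v, Q, hv, hv0⟩ := exists_isRad (h := fun t => g (E |t| * (w t).1)) hm hd
      (cg.comp (cE.mul w.continuous.fst)) θ₂
    have bd : ∀ t, |u (|t|) / E (|t|)| ≤ |θ₁| + B / (2 * L) ∧ |v (|t|) / E (|t|)| ≤ |θ₂| + B / (2 * L) := by
      intro t
      have ht := abs_nonneg t
      have h1 := hu.abs_sub_le hm hc hd (F := B) (T := |t|) (L := L) hB hL (fun x hx => (hfB _).trans
        (le_mul_of_one_le_right hB (E1 x hx.1.le))) (right_mem_Icc.2 ht)
      have h2 := hv.abs_sub_le hm hd hc (F := B) (T := |t|) (L := L) hB hL (fun x hx => by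
        rw [radWeight_comm]
        exact (hgB _).trans (le_mul_of_one_le_right hB (E1 x hx.1.le))) (right_mem_Icc.2 ht)
      rw [radWeight_comm] at h2
      rw [hu0] at h1
      rw [hv0] at h2
      have h3 := abs_sub_abs_le_abs_sub (u |t|) θ₁
      have h4 := abs_sub_abs_le_abs_sub (v |t|) θ₂
      have h5 := le_mul_of_one_le_right (abs_nonneg θ₁) (E1 _ ht)
      have h6 := le_mul_of_one_le_right (abs_nonneg θ₂) (E1 _ ht)
      rw [abs_div, abs_div, abs_of_pos (E0 _), div_le_iff₀ (E0 _), div_le_iff₀ (E0 _), add_mul, add_mul]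
      constructor <;> simp only [hE] at * <;> linarith
    have cu : Continuous fun t => u |t| := hu.1.comp_continuous continuous_abs fun x => abs_nonneg x
    have cv : Continuous fun t => v |t| := hv.1.comp_continuous continuous_abs fun x => abs_nonneg x
    refine ⟨BoundedContinuousFunction.ofNormedAddCommGroup
      (fun t => (u |t| / E |t|, v |t| / E |t|))
      ((cu.div cE fun x => (E0 _).ne').prodMk (cv.div cE fun x => (E0 _).ne'))
      (max (|θ₁| + B / (2 * L)) (|θ₂| + B / (2 * L))) fun t => ?_, u, v, P, Q, hu, hv, hu0, hv0,
      fun t => rfl⟩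
    rw [Prod.norm_def]
    exact max_le_max (bd t).1 (bd t).2
  choose Φ hΦ using step
  have hcontr : ContractingWith (1 / 2) Φ := by
    refine ⟨by norm_num, LipschitzWith.of_dist_le_mul fun w₁ w₂ => ?_⟩
    obtain ⟨u₁, v₁, P₁, Q₁, hu₁, hv₁, hu₁0, hv₁0, e₁⟩ := hΦ w₁
    obtain ⟨u₂, v₂, P₂, Q₂, hu₂, hv₂, hu₂0, hv₂0, e₂⟩ := hΦ w₂
    set D := dist w₁ w₂ with hD
    have hD0 : 0 ≤ D := dist_nonneg
    have hw : ∀ t, |(w₁ t).1 - (w₂ t).1| ≤ D ∧ |(w₁ t).2 - (w₂ t).2| ≤ D := fun t => by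
      have := BoundedContinuousFunction.dist_coe_le_dist (f := w₁) (g := w₂) t
      rwa [Prod.dist_eq, max_le_iff] at this
    rw [BoundedContinuousFunction.dist_le (by positivity)]
    intro t
    have ht := abs_nonneg t
    have key : ∀ x y s : ℝ, 0 < s → |x - y| ≤ D →
        L * |E (|s|) * x - E (|s|) * y| ≤ L * D * E s := fun x y s hs hxy => by
      rw [← mul_sub, abs_mul, abs_of_pos (E0 _), abs_of_pos hs]
      have := (E0 s).le
      calc L * (E s * |x - y|) ≤ L * (E s * D) := by gcongr
        _ = _ := by ring
    have h1 := (hu₁.sub hu₂).abs_sub_le hm hc hd (F := L * D) (T := |t|) (L := L) (by positivity) hL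
      (fun x hx => (hf _ _).trans (key _ _ x hx.1 (hw x).2)) (right_mem_Icc.2 ht)
    have h2 := (hv₁.sub hv₂).abs_sub_le hm hd hc (F := L * D) (T := |t|) (L := L) (by positivity) hL
      (fun x hx => by
        rw [radWeight_comm]; exact (hg _ _).trans (key _ _ x hx.1 (hw x).1)) (right_mem_Icc.2 ht)
    rw [radWeight_comm] at h2
    have e2 : L * D / (2 * L) = 1 / 2 * D := by field_simp
    rw [hu₁0, hu₂0, e2, sub_self, sub_zero] at h1
    rw [hv₁0, hv₂0, e2, sub_self, sub_zero] at h2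
    rw [e₁, e₂, Prod.dist_eq, Real.dist_eq, Real.dist_eq, ← sub_div, ← sub_div, abs_div, abs_div,
      abs_of_pos (E0 _)]
    push_cast
    exact max_le ((div_le_iff₀ (E0 _)).2 h1) ((div_le_iff₀ (E0 _)).2 h2)
  obtain ⟨u, v, P, Q, hu, hv, hu0, hv0, e⟩ := hΦ (ContractingWith.fixedPoint Φ hcontr)
  rw [hcontr.fixedPoint_isFixedPt] at e
  refine ⟨u, v, P, Q, hu.congr fun t ht => ?_, hv.congr fun t ht => ?_, hu0, hv0⟩
  · rw [e]
    simp only [abs_of_pos ht]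
    rw [mul_div_cancel₀ _ (E0 t).ne']
  · rw [e]
    simp only [abs_of_pos ht]
    rw [mul_div_cancel₀ _ (E0 t).ne']

end RadialExistence

section Shooting

variable {m c d p q δ θ : ℝ} {u v u₂ v₂ : ℝ → ℝ}

/-- The power `s ^ e`, with its argument clamped to `[δ, 1]`. -/
noncomputable def clampPow (δ e s : ℝ) : ℝ := max δ (min s 1) ^ e

theorem clampPow_eq {e s : ℝ} (h1 : δ ≤ s) (h2 : s ≤ 1) : clampPow δ e s = s ^ e := by
  rw [clampPow, min_eq_left h2, max_eq_right h1]

theorem clampPow_nonneg {e s : ℝ} (hδ : 0 ≤ δ) : 0 ≤ clampPow δ e s :=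
  Real.rpow_nonneg (hδ.trans (le_max_left _ _)) _

theorem clampPow_le_one {e s : ℝ} (he : 0 ≤ e) (hδ : 0 ≤ δ) (h1 : δ ≤ 1) : clampPow δ e s ≤ 1 :=
  Real.rpow_le_one (hδ.trans (le_max_left _ _)) (max_le h1 (min_le_right _ _)) he

theorem le_clampPow {e s κ : ℝ} (he : 0 ≤ e) (h0 : 0 ≤ κ) (h1 : κ ≤ 1) (h2 : κ ≤ s) :
    κ ^ e ≤ clampPow δ e s :=
  Real.rpow_le_rpow h0 ((le_min h2 h1).trans (le_max_right _ _)) he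

theorem rpow_le_clampPow {e s : ℝ} (he : 0 ≤ e) (hδ : 0 ≤ δ) : δ ^ e ≤ clampPow δ e s :=
  Real.rpow_le_rpow hδ (le_max_left _ _) he

theorem exists_lipschitz_clampPow {e : ℝ} (hδ : 0 ≤ δ) (h1 : δ ≤ 1) (he0 : 0 < e)
    (he : 1 ≤ e ∨ 0 < δ) :
    ∃ L : ℝ, 0 < L ∧ ∀ x y, |clampPow δ e x - clampPow δ e y| ≤ L * |x - y| := by
  refine ⟨e * max 1 (δ ^ (e - 1)), by positivity, fun x y => ?_⟩
  have hd : ∀ z ∈ Icc δ 1, HasDerivWithinAt (fun z : ℝ => z ^ e) (e * z ^ (e - 1)) (Icc δ 1) z :=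
    fun z hz => (Real.hasDerivAt_rpow_const
      (he.symm.imp (fun h => (h.trans_le hz.1).ne') id)).hasDerivWithinAt
  have hb : ∀ z ∈ Icc δ 1, ‖e * z ^ (e - 1)‖ ≤ e * max 1 (δ ^ (e - 1)) := fun z hz => by
    have hz0 := hδ.trans hz.1
    rw [Real.norm_of_nonneg (by positivity)]
    refine mul_le_mul_of_nonneg_left ?_ he0.le
    rcases le_or_gt 1 e with h | h
    · exact (Real.rpow_le_one hz0 hz.2 (by linarith)).trans (le_max_left _ _)
    · have hδ0 : 0 < δ := he.resolve_left h.not_ge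
      exact (Real.rpow_le_rpow_of_nonpos hδ0 hz.1 (by linarith)).trans (le_max_right _ _)
  have hmem : ∀ x : ℝ, max δ (min x 1) ∈ Icc δ 1 := fun x =>
    ⟨le_max_left _ _, max_le h1 (min_le_right _ _)⟩
  have := (convex_Icc δ 1).norm_image_sub_le_of_norm_hasDerivWithin_le hd hb (hmem y) (hmem x)
  rw [Real.norm_eq_abs, Real.norm_eq_abs] at this
  refine this.trans (mul_le_mul_of_nonneg_left ?_ (by positivity))
  rw [max_comm δ, max_comm δ]
  refine (abs_max_sub_max_le_abs _ _ _).trans ?_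
  have := abs_min_sub_min_le_max x 1 y 1
  simpa using this

/-- The solutions of the regularised radial system, with initial values `θ` and `1 - θ`. -/
def IsShoot (m c d p q δ θ : ℝ) (u v : ℝ → ℝ) : Prop :=
  ∃ P Q, IsRad m c (fun t => clampPow 0 p (v t)) u P ∧
    IsRad m d (fun t => clampPow δ q (u t)) v Q ∧ u 0 = θ ∧ v 0 = 1 - θ

/-- The admissible parameters of the shooting problem. -/
structure ShootParam (m c d p q : ℝ) : Prop where
  hm : 3 / 2 ≤ m
  hc : -1 < c
  hd : -1 < d
  hp : 1 ≤ p
  hq : 0 < q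


theorem exists_isShoot (S : ShootParam m c d p q) (hδ : 0 < δ) (h1 : δ ≤ 1) (θ : ℝ) :
    ∃ u v, IsShoot m c d p q δ θ u v := by
  have hp0 : 0 < p := zero_lt_one.trans_le S.hp
  obtain ⟨L, hL, h2⟩ := exists_lipschitz_clampPow le_rfl zero_le_one hp0 (Or.inl S.hp)
  obtain ⟨L', hL', h3⟩ := exists_lipschitz_clampPow hδ.le h1 S.hq (Or.inr hδ)
  have ab : ∀ {δ e s : ℝ}, 0 ≤ e → 0 ≤ δ → δ ≤ 1 → |clampPow δ e s| ≤ 1 := fun he h0 h1 => by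
    rw [abs_of_nonneg (clampPow_nonneg h0)]; exact clampPow_le_one he h0 h1
  obtain ⟨u, v, P, Q, h⟩ := exists_radial_system S.hm S.hc S.hd (L := max L L') (B := 1)
    (f := clampPow 0 p) (g := clampPow δ q)
    (hL.trans_le (le_max_left _ _))
    (fun x y => (h2 x y).trans (mul_le_mul_of_nonneg_right (le_max_left _ _) (abs_nonneg _)))
    (fun x y => (h3 x y).trans (mul_le_mul_of_nonneg_right (le_max_right _ _) (abs_nonneg _)))
    (fun x => ab hp0.le le_rfl zero_le_one) (fun x => ab S.hq.le hδ.le h1) θ (1 - θ)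
  exact ⟨u, v, P, Q, h⟩

namespace IsShoot

theorem antitone (H : IsShoot m c d p q δ θ u v) (hδ : 0 < δ) {s t : ℝ} (hs : 0 ≤ s) (hst : s ≤ t) :
    u t ≤ u s ∧ v t ≤ v s := by
  obtain ⟨P, Q, hu, hv, -⟩ := H
  exact ⟨(hu.nonpos (fun x _ => clampPow_nonneg le_rfl) hs hst).2.2,
    (hv.nonpos (fun x _ => clampPow_nonneg hδ.le) hs hst).2.2⟩

theorem lt_of_lt (S : ShootParam m c d p q) (H : IsShoot m c d p q δ θ u v) (hδ : 0 < δ)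
    {s t : ℝ} (hs : 0 ≤ s) (hst : s < t) : v t < v s := by
  obtain ⟨P, Q, hu, hv, -⟩ := H
  have h1 := S.hm
  have h2 := S.hd
  have := (hv.le_of_le S.hm S.hd (fun x _ => rpow_le_clampPow S.hq.le hδ.le) hs hst.le).1
  have h3 : s ^ (d + 1) < t ^ (d + 1) := Real.rpow_lt_rpow hs hst (by linarith)
  have h4 : 0 < δ ^ q * ((t ^ (d + 1) - s ^ (d + 1)) / (4 * (m + d) * (d + 1))) :=
    mul_pos (Real.rpow_pos_of_pos hδ _) (div_pos (sub_pos.2 h3)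
      (mul_pos (by linarith) (by linarith)))
  linarith

/-- Stability of the shooting solutions in the initial value, and independence of the
regularisation as long as it is not active. -/
theorem exists_abs_sub_le (S : ShootParam m c d p q) {δ' : ℝ} (hδ : 0 < δ) (hδ' : δ ≤ δ')
    (h1 : δ' ≤ 1) (T : ℝ) : ∃ C : ℝ, 0 < C ∧ ∀ θ θ₂ u v u₂ v₂, IsShoot m c d p q δ θ u v →
      IsShoot m c d p q δ' θ₂ u₂ v₂ → (∀ t ∈ Ioo 0 T, clampPow δ' q (u₂ t) = clampPow δ q (u₂ t)) →
      ∀ t ∈ Icc 0 T, |u t - u₂ t| ≤ C * |θ - θ₂| ∧ |v t - v₂ t| ≤ C * |θ - θ₂| := by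
  have hp0 : 0 < p := zero_lt_one.trans_le S.hp
  obtain ⟨L, hL, h2⟩ := exists_lipschitz_clampPow le_rfl zero_le_one hp0 (Or.inl S.hp)
  obtain ⟨L', hL', h3⟩ := exists_lipschitz_clampPow hδ.le (hδ'.trans h1) S.hq (Or.inr hδ)
  have hL0 := hL.trans_le (le_max_left L L')
  refine ⟨2 * Real.exp (max L L' * radWeight c d T), by positivity, ?_⟩
  rintro θ θ₂ u v u₂ v₂ ⟨P, Q, hu, hv, hu0, hv0⟩ ⟨P₂, Q₂, hu₂, hv₂, hu₂0, hv₂0⟩ he t ht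
  have := hu.abs_sub_le_of_lipschitz S.hm S.hc S.hd hv hu₂ hv₂ (L := max L L') (T := T)
    (D := |θ - θ₂|) hL0
    (fun x _ => (h2 _ _).trans (mul_le_mul_of_nonneg_right (le_max_left _ _) (abs_nonneg _)))
    (fun x hx => by
      rw [he x hx]
      exact (h3 _ _).trans (mul_le_mul_of_nonneg_right (le_max_right _ _) (abs_nonneg _)))
    (by rw [hu0, hu₂0]) (by rw [hv0, hv₂0, sub_sub_sub_cancel_left, abs_sub_comm]) ht
  have h4 : 2 * |θ - θ₂| * Real.exp (max L L' * radWeight c d t) ≤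
      2 * Real.exp (max L L' * radWeight c d T) * |θ - θ₂| := by
    have := radWeight_le_radWeight S.hc S.hd ht.1 ht.2
    calc _ ≤ 2 * |θ - θ₂| * Real.exp (max L L' * radWeight c d T) := by gcongr
      _ = _ := by ring
  exact ⟨this.1.trans h4, this.2.trans h4⟩

theorem eq_of_le (S : ShootParam m c d p q) {δ' : ℝ} (H : IsShoot m c d p q δ θ u v)
    (H₂ : IsShoot m c d p q δ' θ u₂ v₂)
    (hδ : 0 < δ) (hδ' : δ ≤ δ') (h1 : δ' ≤ 1) (hθ : θ ≤ 1) {t : ℝ} (ht : 0 ≤ t) (hut : δ' ≤ u₂ t) :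
    u t = u₂ t ∧ v t = v₂ t := by
  obtain ⟨C, -, h⟩ := exists_abs_sub_le S hδ hδ' h1 t
  have := h _ _ _ _ _ _ H H₂ (fun x hx => by
    have h2 := hut.trans (H₂.antitone (hδ.trans_le hδ') hx.1.le hx.2.le).1
    have h3 := (H₂.antitone (hδ.trans_le hδ') le_rfl hx.1.le).1
    have h4 : u₂ 0 = θ := by obtain ⟨_, _, _, _, h, _⟩ := H₂; exact h
    have h5 : u₂ x ≤ 1 := by linarith
    rw [clampPow_eq h2 h5, clampPow_eq (hδ'.trans h2) h5]) t (right_mem_Icc.2 ht)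
  rw [sub_self, abs_zero, mul_zero] at this
  exact ⟨sub_eq_zero.1 (abs_nonpos_iff.1 this.1), sub_eq_zero.1 (abs_nonpos_iff.1 this.2)⟩

end IsShoot

/-- Initial values for which `u` is forced to vanish while `v` stays positive. -/
def lowSet (m c d p q : ℝ) : Set ℝ :=
  {θ | ∃ δ u v t τ κ, 0 < δ ∧ δ ≤ 1 ∧ IsShoot m c d p q δ θ u v ∧ 0 ≤ t ∧ t ≤ τ ∧ 0 < κ ∧ κ ≤ 1 ∧
    δ < u t ∧ u t < κ ^ p * ((τ ^ (c + 1) - t ^ (c + 1)) / (4 * (m + c) * (c + 1))) ∧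
    κ + (τ ^ (d + 1) - t ^ (d + 1)) / (4 * (m + d) * (d + 1)) < v t}

/-- Initial values for which `v` becomes negative while `u` is positive. -/
def highSet (m c d p q : ℝ) : Set ℝ :=
  {θ | ∃ δ u v t, 0 < δ ∧ δ ≤ 1 ∧ IsShoot m c d p q δ θ u v ∧ 0 ≤ t ∧ δ < u t ∧ v t < 0}

theorem isOpen_of_forall_lt {A : Set ℝ} (h : ∀ θ ∈ A, ∃ r : ℝ, 0 < r ∧ ∀ θ', |θ' - θ| < r → θ' ∈ A) :
    IsOpen A :=
  Metric.isOpen_iff.2 fun θ hθ => (h θ hθ).imp fun _ hr => ⟨hr.1, fun θ' hθ' => hr.2 θ' hθ'⟩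

theorem IsShoot.exists_near (S : ShootParam m c d p q) (H : IsShoot m c d p q δ θ u v)
    (hδ : 0 < δ) (h1 : δ ≤ 1) {t : ℝ} (ht : 0 ≤ t) {η : ℝ} (hη : 0 < η) : ∃ r : ℝ, 0 < r ∧ ∀ θ', |θ' - θ| < r →
      ∃ u' v', IsShoot m c d p q δ θ' u' v' ∧ |u' t - u t| < η ∧ |v' t - v t| < η := by
  obtain ⟨C, hC, h⟩ := IsShoot.exists_abs_sub_le S hδ le_rfl h1 t
  refine ⟨η / C, by positivity, fun θ' hθ' => ?_⟩
  obtain ⟨u', v', H'⟩ := exists_isShoot S hδ h1 θ'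
  have h2 := h _ _ _ _ _ _ H' H (fun _ _ => rfl) t (right_mem_Icc.2 ht)
  rw [lt_div_iff₀ hC, mul_comm] at hθ'
  exact ⟨u', v', H', h2.1.trans_lt hθ', h2.2.trans_lt hθ'⟩

theorem isOpen_lowSet (S : ShootParam m c d p q) : IsOpen (lowSet m c d p q) := by
  refine isOpen_of_forall_lt ?_
  rintro θ ⟨δ, u, v, t, τ, κ, hδ, hδ1, H, ht, htτ, hκ, hκ1, h1, h2, h3⟩
  obtain ⟨r, hr, h⟩ := H.exists_near S hδ hδ1 ht
    (lt_min (sub_pos.2 h1) (lt_min (sub_pos.2 h2) (sub_pos.2 h3)))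
  refine ⟨r, hr, fun θ' hθ' => ?_⟩
  obtain ⟨u', v', H', h4, h5⟩ := h θ' hθ'
  rw [lt_min_iff, lt_min_iff, abs_lt, abs_lt, abs_lt] at h4 h5
  exact ⟨δ, u', v', t, τ, κ, hδ, hδ1, H', ht, htτ, hκ, hκ1, by linarith, by linarith, by linarith⟩

theorem isOpen_highSet (S : ShootParam m c d p q) : IsOpen (highSet m c d p q) := by
  refine isOpen_of_forall_lt ?_
  rintro θ ⟨δ, u, v, t, hδ, hδ1, H, ht, h1, h2⟩
  obtain ⟨r, hr, h⟩ := H.exists_near S hδ hδ1 ht (lt_min (sub_pos.2 h1) (neg_pos.2 h2))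
  refine ⟨r, hr, fun θ' hθ' => ?_⟩
  obtain ⟨u', v', H', h4, h5⟩ := h θ' hθ'
  rw [lt_min_iff, abs_lt, abs_lt] at h4 h5
  exact ⟨δ, u', v', t, hδ, hδ1, H', ht, by linarith, by linarith⟩

theorem not_mem_highSet_of_mem_lowSet (S : ShootParam m c d p q) (hθ : θ ≤ 1) (h : θ ∈ lowSet m c d p q) :
    θ ∉ highSet m c d p q := by
  obtain ⟨δ₁, u₁, v₁, t, τ, κ, hδ₁, hδ₁1, H₁, ht, htτ, hκ, hκ1, h1, h2, h3⟩ := h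
  rintro ⟨δ₂, u₂, v₂, s, hδ₂, hδ₂1, H₂, hs, h4, h5⟩
  have hδ := lt_min hδ₁ hδ₂
  obtain ⟨u, v, H⟩ := exists_isShoot S hδ ((min_le_left _ _).trans hδ₁1) θ
  have e₁ := H.eq_of_le S H₁ hδ (min_le_left _ _) hδ₁1 hθ ht h1.le
  have e₂ := H.eq_of_le S H₂ hδ (min_le_right _ _) hδ₂1 hθ hs h4.le
  rw [← e₁.1] at h1 h2
  rw [← e₁.2] at h3
  rw [← e₂.1] at h4
  rw [← e₂.2] at h5
  obtain ⟨P, Q, hu, hv, -⟩ := id H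
  have hvτ := (hv.ge_of_le S.hm S.hd (fun x _ => clampPow_le_one S.hq.le hδ.le
    ((min_le_left _ _).trans hδ₁1)) ht htτ).1
  have hvτ' : κ < v τ := by linarith
  have huτ := (hu.le_of_le S.hm S.hc (l := κ ^ p) (fun x hx => le_clampPow
    (zero_le_one.trans S.hp) hκ.le hκ1
    (hvτ'.le.trans (H.antitone hδ hx.1.le hx.2.le).2)) ht htτ).1
  rcases le_total s τ with h6 | h6
  · have := (H.antitone hδ hs h6).2
    linarith
  · have := (H.antitone hδ (ht.trans htτ) h6).1
    linarith

theorem one_mem_highSet (S : ShootParam m c d p q) : 1 ∈ highSet m c d p q := by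
  obtain ⟨u, v, H⟩ := exists_isShoot S (δ := 1 / 2) (by norm_num) (by norm_num) 1
  obtain ⟨P, Q, hu, hv, hu0, hv0⟩ := id H
  have h1 : ∀ᶠ t in nhdsWithin 0 (Ioi 0), 1 / 2 < u t :=
    ((hu.1 0 self_mem_Ici).mono_left (nhdsWithin_mono 0 Ioi_subset_Ici_self)).eventually
      (lt_mem_nhds (by rw [hu0]; norm_num))
  obtain ⟨t, h2, h3⟩ := (h1.and self_mem_nhdsWithin).exists
  have h4 := H.lt_of_lt S (by norm_num) le_rfl h3
  rw [hv0, sub_self] at h4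
  exact ⟨1 / 2, u, v, t, by norm_num, by norm_num, H, le_of_lt h3, h2, h4⟩

theorem exists_mem_lowSet (S : ShootParam m c d p q) : ∃ ε : ℝ, 0 < ε ∧ ε ≤ 1 ∧ ε ∈ lowSet m c d p q := by
  have h1 := S.hm
  have h2 := S.hc
  have h3 := S.hd
  have kc : 0 < 4 * (m + c) * (c + 1) := mul_pos (by linarith) (by linarith)
  have kd : 0 < 4 * (m + d) * (d + 1) := mul_pos (by linarith) (by linarith)
  set τ : ℝ := (4 * (m + d) * (d + 1) / 8) ^ (d + 1)⁻¹ with hτ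
  have hτ0 : 0 < τ := by positivity
  have eτ : τ ^ (d + 1) = 4 * (m + d) * (d + 1) / 8 :=
    Real.rpow_inv_rpow (by positivity) (by linarith)
  set e := (1 / 2 : ℝ) ^ p * (τ ^ (c + 1) / (4 * (m + c) * (c + 1))) with he
  have he0 : 0 < e := by positivity
  set ε := min (1 / 4) (e / 2) with hε
  have hε0 : 0 < ε := by positivity
  have hε1 : ε ≤ 1 / 4 := min_le_left _ _
  have hε2 : ε ≤ e / 2 := min_le_right _ _
  obtain ⟨u, v, H⟩ := exists_isShoot S (δ := ε / 2) (by positivity) (by linarith) ε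
  obtain ⟨P, Q, hu, hv, hu0, hv0⟩ := id H
  refine ⟨ε, hε0, by linarith, ε / 2, u, v, 0, τ, 1 / 2, by positivity, by linarith, H, le_rfl,
    hτ0.le, by norm_num, by norm_num, ?_, ?_, ?_⟩
  · rw [hu0]; linarith
  · rw [hu0, Real.zero_rpow (by linarith), sub_zero]
    linarith
  · rw [hv0, eτ, Real.zero_rpow (by linarith), sub_zero, div_div_cancel_left' kd.ne']
    linarith

theorem exists_threshold (S : ShootParam m c d p q) :
    ∃ θ : ℝ, 0 < θ ∧ θ < 1 ∧ θ ∉ lowSet m c d p q ∧ θ ∉ highSet m c d p q := by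
  obtain ⟨ε, hε, hε1, hεA⟩ := exists_mem_lowSet S
  by_contra! hcon
  have h1 := one_mem_highSet S
  have h2 : Icc ε 1 ⊆ lowSet m c d p q ∪ highSet m c d p q := fun θ hθ => by
    rcases hθ.2.eq_or_lt with h | h
    · exact h ▸ Or.inr h1
    · exact or_iff_not_imp_left.2 (hcon θ (hε.trans_le hθ.1) h)
  obtain ⟨θ, hθ, hA, hB⟩ := isPreconnected_Icc _ _ (isOpen_lowSet S) (isOpen_highSet S) h2
    ⟨ε, left_mem_Icc.2 hε1, hεA⟩ ⟨1, right_mem_Icc.2 hε1, h1⟩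
  exact not_mem_highSet_of_mem_lowSet S hθ.2 hA hB

end Shooting

section RadialSolution

variable {N : ℕ} {m c d p q θ a b : ℝ} {h u P : ℝ → ℝ}

theorem IsRad.contDiffOn (H : IsRad m c h u P) (hh : ContinuousOn h (Ici 0)) :
    ContDiffOn ℝ 2 u (Ioi 0) := by
  have h1 : ∀ e : ℝ, ContDiffOn ℝ 1 (fun t : ℝ => t ^ e) (Ioi 0) := fun e t ht =>
    (Real.contDiffAt_rpow_const_of_ne (ne_of_gt ht)).contDiffWithinAt
  have h2 : ContDiffOn ℝ 1 P (Ioi 0) := by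
    rw [← zero_add (1 : WithTop ℕ∞), contDiffOn_succ_iff_deriv_of_isOpen isOpen_Ioi]
    refine ⟨fun t ht => (H.2.2.2 t ht).2.differentiableAt.differentiableWithinAt, by simp,
      contDiffOn_zero.2 ?_⟩
    refine ContinuousOn.congr (f := fun t => -(t ^ (m - 1 + c) * h t / 4)) ?_ fun t ht =>
      (H.2.2.2 t ht).2.deriv
    exact (((h1 _).continuousOn.mul (hh.mono Ioi_subset_Ici_self)).div_const _).neg
  rw [← one_add_one_eq_two, contDiffOn_succ_iff_deriv_of_isOpen isOpen_Ioi]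
  exact ⟨fun t ht => (H.2.2.2 t ht).1.differentiableAt.differentiableWithinAt, by simp,
    ((h1 (-m)).mul h2).congr fun t ht => (H.2.2.2 t ht).1.deriv⟩

theorem IsRad.contDiffAt_comp_norm_sq (H : IsRad m c h u P) (hh : ContinuousOn h (Ici 0))
    {x : EuclideanSpace ℝ (Fin N)} (hx : x ≠ 0) :
    ContDiffAt ℝ 2 (fun z : EuclideanSpace ℝ (Fin N) => u (‖z‖ ^ 2)) x := by
  have hx0 : 0 < ‖x‖ ^ 2 := by positivity
  exact ((H.contDiffOn hh).contDiffAt (Ioi_mem_nhds hx0)).comp x (contDiff_norm_sq ℝ).contDiffAt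

theorem IsRad.neg_lap_comp_norm_sq (H : IsRad (N / 2) (a / 2) h u P) (hh : ContinuousOn h (Ici 0))
    {x : EuclideanSpace ℝ (Fin N)} (hx : x ≠ 0) :
    -lap (fun z : EuclideanSpace ℝ (Fin N) => u (‖z‖ ^ 2)) x = ‖x‖ ^ a * h (‖x‖ ^ 2) := by
  have hx0 : 0 < ‖x‖ := norm_pos_iff.2 hx
  have ht : 0 < ‖x‖ ^ 2 := by positivity
  set m : ℝ := N / 2 with hm
  have hN : (N : ℝ) = 2 * m := by rw [hm]; ring
  rw [lap_comp_norm_sq (g' := fun t => t ^ (-m) * P t)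
    (g'' := fun t => -m * t ^ (-m - 1) * P t + t ^ (-m) * -(t ^ (m - 1 + a / 2) * h t / 4))
    ((H.contDiffOn hh).contDiffAt (Ioi_mem_nhds ht))
    ((lt_mem_nhds ht).mono fun t ht => (H.2.2.2 t ht).1)
    ((Real.hasDerivAt_rpow_const (p := -m) (Or.inl ht.ne')).mul (H.2.2.2 _ ht).2)]
  have e1 : ‖x‖ ^ a = (‖x‖ ^ 2) ^ (-m) * (‖x‖ ^ 2) ^ (m - 1 + a / 2) * ‖x‖ ^ 2 := by
    rw [← Real.rpow_add ht, ← Real.rpow_add_one ht.ne', ← Real.rpow_natCast, ← Real.rpow_mul hx0.le]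
    congr 1
    push_cast
    ring
  have e2 : (‖x‖ ^ 2) ^ (-m) = (‖x‖ ^ 2) ^ (-m - 1) * ‖x‖ ^ 2 := by
    rw [← Real.rpow_add_one ht.ne', sub_add_cancel]
  rw [e1, hN]
  linear_combination (-4 * m * P (‖x‖ ^ 2)) * e2

theorem IsShoot.eq_of_le_of_le (S : ShootParam m c d p q) {δ δ' : ℝ} {u v u₂ v₂ : ℝ → ℝ}
    (H : IsShoot m c d p q δ θ u v) (H₂ : IsShoot m c d p q δ' θ u₂ v₂) (hδ : 0 < δ) (hδ' : 0 < δ')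
    (h1 : δ ≤ 1) (h1' : δ' ≤ 1) (hθ : θ ≤ 1) {t : ℝ} (ht : 0 ≤ t) (hu : δ ≤ u t) (hu₂ : δ' ≤ u₂ t) :
    u t = u₂ t ∧ v t = v₂ t := by
  have h0 := lt_min hδ hδ'
  obtain ⟨u₃, v₃, H₃⟩ := exists_isShoot S h0 ((min_le_left _ _).trans h1) θ
  have e := H₃.eq_of_le S H h0 (min_le_left _ _) h1 hθ ht hu
  have e₂ := H₃.eq_of_le S H₂ h0 (min_le_right _ _) h1' hθ ht hu₂
  exact ⟨e.1.symm.trans e₂.1, e.2.symm.trans e₂.2⟩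

theorem continuous_clampPow {δ e : ℝ} (he : 0 ≤ e) : Continuous (clampPow δ e) :=
  (Real.continuous_rpow_const he).comp (continuous_const.max (continuous_id.min continuous_const))

theorem exists_isHHSol_of_forall_pos (S : ShootParam (N / 2) (a / 2) (b / 2) p q) (hθ1 : θ < 1)
    (hB : θ ∉ highSet (N / 2) (a / 2) (b / 2) p q)
    (hT : ∀ T : ℝ, 0 ≤ T → ∃ δ u v, 0 < δ ∧ δ ≤ 1 ∧
      IsShoot (N / 2) (a / 2) (b / 2) p q δ θ u v ∧ δ < u T) :
    ∃ u v : EuclideanSpace ℝ (Fin N) → ℝ, IsHHSol a b p q univ u v := by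
  have hp0 : 0 ≤ p := zero_le_one.trans S.hp
  choose! δ u v hδ hδ1 H hu using hT
  have hu' : ∀ s T, 0 ≤ s → s ≤ T → δ T < u T s := fun s T hs hsT =>
    (hu T (hs.trans hsT)).trans_le ((H T (hs.trans hsT)).antitone (hδ T (hs.trans hsT)) hs hsT).1
  have h1 : ∀ s : ℝ, 0 ≤ s → s ≤ s + 1 := fun s _ => by linarith
  have agree : ∀ s T, 0 ≤ s → s ≤ T → u (s + 1) s = u T s ∧ v (s + 1) s = v T s :=
    fun s T hs hsT => by
      have hs1 : 0 ≤ s + 1 := by linarith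
      have hT := hs.trans hsT
      exact (H _ hs1).eq_of_le_of_le S (H T hT) (hδ _ hs1) (hδ T hT) (hδ1 _ hs1) (hδ1 T hT) hθ1.le hs
        (hu' s _ hs (h1 s hs)).le (hu' s T hs hsT).le
  have vpos : ∀ s, 0 ≤ s → 0 < v (s + 1) s := fun s hs => by
    have hs1 : 0 ≤ s + 1 := by linarith
    have h2 : 0 ≤ v (s + 1) (s + 1) := by
      by_contra! hneg
      exact hB ⟨_, _, _, _, hδ _ hs1, hδ1 _ hs1, H _ hs1, hs1, hu _ hs1, hneg⟩
    exact h2.trans_lt ((H _ hs1).lt_of_lt S (hδ _ hs1) hs (by linarith))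
  have upos : ∀ s, 0 ≤ s → 0 < u (s + 1) s := fun s hs =>
    (hδ _ (by linarith)).trans (hu' s _ hs (h1 s hs))
  have near : ∀ x : EuclideanSpace ℝ (Fin N), ∀ᶠ z : EuclideanSpace ℝ (Fin N) in nhds x,
      ‖z‖ ^ 2 ≤ ‖x‖ ^ 2 + 1 := fun x => by
    have hc : Continuous fun z : EuclideanSpace ℝ (Fin N) => ‖z‖ ^ 2 := continuous_norm.pow 2
    exact (hc.tendsto x).eventually (Iic_mem_nhds (by linarith))
  have ueq : ∀ x : EuclideanSpace ℝ (Fin N),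
      (fun z : EuclideanSpace ℝ (Fin N) => u (‖z‖ ^ 2 + 1) (‖z‖ ^ 2)) =ᶠ[nhds x]
        fun z => u (‖x‖ ^ 2 + 1) (‖z‖ ^ 2) := fun x =>
    (near x).mono fun z hz => (agree _ _ (sq_nonneg _) hz).1
  have veq : ∀ x : EuclideanSpace ℝ (Fin N),
      (fun z : EuclideanSpace ℝ (Fin N) => v (‖z‖ ^ 2 + 1) (‖z‖ ^ 2)) =ᶠ[nhds x]
        fun z => v (‖x‖ ^ 2 + 1) (‖z‖ ^ 2) := fun x =>
    (near x).mono fun z hz => (agree _ _ (sq_nonneg _) hz).2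
  have cont : ∀ w : ℝ → ℝ, ContinuousOn w (Ici 0) →
      Continuous fun z : EuclideanSpace ℝ (Fin N) => w (‖z‖ ^ 2) := fun w hw =>
    hw.comp_continuous (continuous_norm.pow 2) fun z => Set.mem_Ici.2 (sq_nonneg ‖z‖)
  have hpos : ∀ x : EuclideanSpace ℝ (Fin N), 0 ≤ ‖x‖ ^ 2 + 1 := fun x => by positivity
  have le_one : ∀ s, 0 ≤ s → u (s + 1) s ≤ 1 ∧ v (s + 1) s ≤ 1 := fun s hs => by
    have hs1 : 0 ≤ s + 1 := by linarith
    have h2 := (H _ hs1).antitone (hδ _ hs1) le_rfl hs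
    obtain ⟨_, _, _, _, e1, e2⟩ := H _ hs1
    have h3 := (upos 0 le_rfl).trans_eq (agree 0 _ le_rfl hs1).1
    constructor <;> linarith
  refine ⟨fun x => u (‖x‖ ^ 2 + 1) (‖x‖ ^ 2), fun x => v (‖x‖ ^ 2 + 1) (‖x‖ ^ 2),
    fun x _ => ?_, fun x _ => ?_, fun x hx => ?_, fun x hx => ?_, fun x _ => upos _ (sq_nonneg _),
    fun x _ => vpos _ (sq_nonneg _), fun x hx => ?_, fun x hx => ?_⟩
  all_goals
    obtain ⟨P, Q, ru, rv, -⟩ := H _ (hpos x)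
    have ch := (continuous_clampPow (δ := 0) hp0).comp_continuousOn rv.1
    have ck := (continuous_clampPow (δ := δ (‖x‖ ^ 2 + 1)) S.hq.le).comp_continuousOn ru.1
  · exact ((cont _ ru.1).continuousAt.congr (ueq x).symm).continuousWithinAt
  · exact ((cont _ rv.1).continuousAt.congr (veq x).symm).continuousWithinAt
  · exact ((ru.contDiffAt_comp_norm_sq ch hx.2).congr_of_eventuallyEq (ueq x)).contDiffWithinAt
  · exact ((rv.contDiffAt_comp_norm_sq ck hx.2).congr_of_eventuallyEq (veq x)).contDiffWithinAt
  · rw [lap_congr (ueq x), ru.neg_lap_comp_norm_sq ch hx.2,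
      clampPow_eq (vpos _ (sq_nonneg _)).le (le_one _ (sq_nonneg _)).2]
  · rw [lap_congr (veq x), rv.neg_lap_comp_norm_sq ck hx.2,
      clampPow_eq (hu' _ _ (sq_nonneg _) (by linarith)).le (le_one _ (sq_nonneg _)).1]

end RadialSolution

section RadialPohozaev

variable {m c d p q δ θ l₁ l₂ : ℝ} {h k u v P Q : ℝ → ℝ}

theorem IsRad.abs_flux_le (hm : 3 / 2 ≤ m) (hc : -1 < c) (H : IsRad m c h u P) {t : ℝ}
    (hh : ∀ x ∈ Ioo 0 t, |h x| ≤ 1) (ht : 0 ≤ t) : |P t| ≤ t ^ (m + c) := by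
  have h1 := (H.ge_of_le hm hc (fun x hx => (abs_le.1 (hh x hx)).2) le_rfl ht).2
  have h2 := (H.le_of_le hm hc (fun x hx => (abs_le.1 (hh x hx)).1) le_rfl ht).2
  have h3 : t ^ (m + c) / (4 * (m + c)) ≤ t ^ (m + c) :=
    div_le_self (Real.rpow_nonneg ht _) (by linarith)
  rw [abs_le]
  constructor <;> linarith

theorem IsRad.continuousOn_rpow_mul_mul (hm : 3 / 2 ≤ m) (hc : -1 < c) (hd : -1 < d)
    (Hu : IsRad m c h u P) (Hv : IsRad m d k v Q) {s : ℝ} (hh : ∀ x ∈ Ioo 0 s, |h x| ≤ 1)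
    (hk : ∀ x ∈ Ioo 0 s, |k x| ≤ 1) :
    ContinuousOn (fun t => t ^ (1 - m) * P t * Q t) (Icc 0 s) := by
  have hsub : Icc 0 s ⊆ Ici 0 := fun x hx => hx.1
  intro t ht
  rcases ht.1.eq_or_lt with h0 | h0
  · subst h0
    have e0 : 1 + m + c + d ≠ 0 := by linarith
    have h1 : Tendsto (fun t : ℝ => t ^ (1 + m + c + d)) (nhdsWithin 0 (Icc 0 s)) (nhds 0) := by
      have := ((Real.continuous_rpow_const (q := 1 + m + c + d) (by linarith)).tendsto 0).mono_left
        (nhdsWithin_le_nhds (s := Icc 0 s))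
      rwa [Real.zero_rpow e0] at this
    rw [ContinuousWithinAt, Hu.2.2.1, mul_zero, zero_mul]
    refine squeeze_zero_norm' ?_ h1
    filter_upwards [self_mem_nhdsWithin] with t ht
    rcases ht.1.eq_or_lt with h0 | h0
    · rw [← h0, Hu.2.2.1, Real.zero_rpow e0]; simp
    · have h2 := Hu.abs_flux_le hm hc (fun x hx => hh x ⟨hx.1, hx.2.trans_le ht.2⟩) h0.le
      have h3 := Hv.abs_flux_le hm hd (fun x hx => hk x ⟨hx.1, hx.2.trans_le ht.2⟩) h0.le
      rw [Real.norm_eq_abs, abs_mul, abs_mul, abs_of_pos (Real.rpow_pos_of_pos h0 _)]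
      calc t ^ (1 - m) * |P t| * |Q t| ≤ t ^ (1 - m) * t ^ (m + c) * t ^ (m + d) := by gcongr
        _ = t ^ (1 + m + c + d) := by
          rw [← Real.rpow_add h0, ← Real.rpow_add h0]; congr 1; ring
  · exact (((continuousAt_id.rpow_const (Or.inl h0.ne')).continuousWithinAt.mul
      (Hu.2.1.mono hsub t ht)).mul (Hv.2.1.mono hsub t ht))

/-- The Pohozaev inequality for radial solutions. -/
theorem IsRad.pohozaev (hm : 3 / 2 ≤ m) (hc : -1 < c) (hd : -1 < d) (hp : 0 < p) (hq : 0 < q)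
    (Hu : IsRad m c h u P) (Hv : IsRad m d k v Q) {s : ℝ} (hs : 0 ≤ s)
    (hh : ∀ x ∈ Ioo 0 s, |h x| ≤ 1) (hk : ∀ x ∈ Ioo 0 s, |k x| ≤ 1)
    (eh : ∀ x ∈ Ioo 0 s, h x = v x ^ p) (ek : ∀ x ∈ Ioo 0 s, k x = u x ^ q)
    (hu : ∀ x ∈ Ioo 0 s, 0 < u x) (hv : ∀ x ∈ Ioo 0 s, 0 < v x) (hus : 0 ≤ u s) (hvs : 0 ≤ v s)
    (hl₁ : (m + c) / (p + 1) ≤ l₁) (hl₂ : (m + d) / (q + 1) ≤ l₂) (hl : l₁ + l₂ = m - 1) :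
    s ^ (1 - m) * P s * Q s + l₁ * (v s * P s) + l₂ * (u s * Q s) ≤ 0 := by
  have hsub : Icc 0 s ⊆ Ici 0 := fun x hx => hx.1
  set G : ℝ → ℝ := fun t => t ^ (1 - m) * P t * Q t + l₁ * (v t * P t) + l₂ * (u t * Q t) +
    (t ^ (m + c) * v t ^ (p + 1) / (4 * (p + 1)) + t ^ (m + d) * u t ^ (q + 1) / (4 * (q + 1)))
    with hG
  have cpow : ∀ e : ℝ, 0 ≤ e → ContinuousOn (fun t : ℝ => t ^ e) (Icc 0 s) := fun e he =>
    (continuousOn_rpow_Ici he).mono hsub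
  have cu := Hu.1.mono hsub
  have cv := Hv.1.mono hsub
  have cG : ContinuousOn G (Icc 0 s) :=
    (((Hu.continuousOn_rpow_mul_mul hm hc hd Hv hh hk).add
      (continuousOn_const.mul (cv.mul (Hu.2.1.mono hsub)))).add
      (continuousOn_const.mul (cu.mul (Hv.2.1.mono hsub)))).add
      ((((cpow _ (by linarith)).mul (cv.rpow_const fun _ _ => Or.inr (by linarith))).div_const _).add
      (((cpow _ (by linarith)).mul (cu.rpow_const fun _ _ => Or.inr (by linarith))).div_const _))
  have key := sub_le_sub_of_hasDerivAt_le hs cG (continuousOn_const (c := (0 : ℝ)))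
    (f' := fun t => t ^ (m + c - 1) * v t ^ (p + 1) / 4 * ((m + c) / (p + 1) - l₁) +
      t ^ (m + d - 1) * u t ^ (q + 1) / 4 * ((m + d) / (q + 1) - l₂))
    (fun t ht => ?_) (fun t _ => hasDerivAt_const t (0 : ℝ)) (fun t ht => ?_)
  · have h1 : m + c ≠ 0 := by linarith
    have h2 : m + d ≠ 0 := by linarith
    have e0 : G 0 = 0 := by
      simp only [hG, Hu.2.2.1, Hv.2.2.1, Real.zero_rpow h1, Real.zero_rpow h2]
      simp
    have h3 : 0 ≤ s ^ (m + c) * v s ^ (p + 1) / (4 * (p + 1)) := by positivity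
    have h4 : 0 ≤ s ^ (m + d) * u s ^ (q + 1) / (4 * (q + 1)) := by positivity
    have h5 : G s ≤ 0 := by linarith
    simp only [hG] at h5
    linarith
  · have ht0 := ht.1
    obtain ⟨du, dP⟩ := Hu.2.2.2 t ht0
    obtain ⟨dv, dQ⟩ := Hv.2.2.2 t ht0
    rw [eh t ht] at dP
    rw [ek t ht] at dQ
    have dpow : ∀ e : ℝ, HasDerivAt (fun t : ℝ => t ^ e) (e * t ^ (e - 1)) t := fun e =>
      Real.hasDerivAt_rpow_const (Or.inl ht0.ne')
    have D := (((((dpow (1 - m)).mul dP).mul dQ).add ((dv.mul dP).const_mul l₁)).add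
      ((du.mul dQ).const_mul l₂)).add
      ((((dpow (m + c)).mul (dv.rpow_const (p := p + 1) (Or.inl (hv t ht).ne'))).div_const
        (4 * (p + 1))).add (((dpow (m + d)).mul (du.rpow_const (p := q + 1)
          (Or.inl (hu t ht).ne'))).div_const (4 * (q + 1))))
    refine D.congr_deriv ?_
    have x1 : t ^ (1 - m) = t ^ (-m) * t := by rw [← Real.rpow_add_one ht0.ne']; congr 1; ring
    have x2 : t ^ (1 - m - 1) = t ^ (-m) := by congr 1; ring
    have x3 : ∀ e : ℝ, t ^ (m - 1 + e) = t ^ (m + e - 1) := fun e => by congr 1; ring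
    have x4 : ∀ e : ℝ, t ^ (m + e) = t ^ (m + e - 1) * t := fun e => by
      rw [← Real.rpow_add_one ht0.ne', sub_add_cancel]
    have y1 : v t ^ (p + 1) = v t ^ p * v t := Real.rpow_add_one (hv t ht).ne' _
    have y2 : u t ^ (q + 1) = u t ^ q * u t := Real.rpow_add_one (hu t ht).ne' _
    have z1 : p + 1 ≠ 0 := by linarith
    have z2 : q + 1 ≠ 0 := by linarith
    have z3 : l₂ = m - 1 - l₁ := by linarith
    simp only [Pi.mul_apply, x1, x2, x3, x4, y1, y2, z3, add_sub_cancel_right]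
    field_simp
    ring
  · have h1 : 0 ≤ t ^ (m + c - 1) * v t ^ (p + 1) / 4 := by
      have := (hv t ht).le; have := ht.1.le; positivity
    have h2 : 0 ≤ t ^ (m + d - 1) * u t ^ (q + 1) / 4 := by
      have := (hu t ht).le; have := ht.1.le; positivity
    exact add_nonpos (mul_nonpos_of_nonneg_of_nonpos h1 (by linarith))
      (mul_nonpos_of_nonneg_of_nonpos h2 (by linarith))

end RadialPohozaev

section Existence

variable {m c d p q δ θ l₁ l₂ : ℝ} {u v : ℝ → ℝ}

theorem IsShoot.pos_of_not_mem_highSet (S : ShootParam m c d p q) (H : IsShoot m c d p q δ θ u v)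
    (hδ : 0 < δ) (h1 : δ ≤ 1) (hB : θ ∉ highSet m c d p q) {t s : ℝ} (ht : 0 ≤ t) (hts : t < s)
    (hs : ∀ x, 0 ≤ x → x < s → δ < u x) : 0 < v t := by
  have h2 : 0 ≤ v ((t + s) / 2) := by
    by_contra! hneg
    exact hB ⟨δ, u, v, _, hδ, h1, H, by linarith, hs _ (by linarith) (by linarith), hneg⟩
  exact h2.trans_lt (H.lt_of_lt S hδ ht (by linarith))

theorem IsShoot.le_of_not_mem_lowSet (H : IsShoot m c d p q δ θ u v)
    (hδ : 0 < δ) (h1 : δ ≤ 1) (hA : θ ∉ lowSet m c d p q) {s τ κ : ℝ} (hs0 : 0 < s) (hsτ : s ≤ τ)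
    (hs : ∀ x, 0 ≤ x → x < s → δ < u x) (hκ : 0 < κ) (hκ1 : κ ≤ 1)
    (hus : u s < κ ^ p * ((τ ^ (c + 1) - s ^ (c + 1)) / (4 * (m + c) * (c + 1)))) :
    v s ≤ κ + (τ ^ (d + 1) - s ^ (d + 1)) / (4 * (m + d) * (d + 1)) := by
  by_contra! hvs
  obtain ⟨P, Q, hu, hv, -⟩ := id H
  have cu := hu.1.continuousAt (Ici_mem_nhds hs0)
  have cv := hv.1.continuousAt (Ici_mem_nhds hs0)
  have cpow : ∀ e : ℝ, ContinuousAt (fun t : ℝ => t ^ e) s := fun e =>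
    continuousAt_id.rpow_const (Or.inl hs0.ne')
  have h2 : ∀ᶠ t in nhds s,
      u t < κ ^ p * ((τ ^ (c + 1) - t ^ (c + 1)) / (4 * (m + c) * (c + 1))) :=
    cu.eventually_lt (continuousAt_const.mul ((continuousAt_const.sub (cpow _)).div_const _)) hus
  have h3 : ∀ᶠ t in nhds s, κ + (τ ^ (d + 1) - t ^ (d + 1)) / (4 * (m + d) * (d + 1)) < v t :=
    (continuousAt_const.add ((continuousAt_const.sub (cpow _)).div_const _)).eventually_lt cv hvs
  obtain ⟨t, ⟨⟨h2, h3⟩, h4⟩, h5⟩ := ((((h2.and h3).and (lt_mem_nhds hs0)).filter_mono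
    (nhdsWithin_le_nhds (s := Iio s))).and self_mem_nhdsWithin).exists
  exact hA ⟨δ, u, v, t, τ, κ, hδ, h1, H, h4.le, (le_of_lt h5).trans hsτ, hκ, hκ1,
    hs t h4.le h5, h2, h3⟩

theorem IsShoot.exists_first (H : IsShoot m c d p q δ θ u v) (hδθ : δ < θ) {T : ℝ} (hT : 0 ≤ T)
    (huT : u T ≤ δ) : ∃ s, 0 < s ∧ s ≤ T ∧ u s = δ ∧ ∀ x, 0 ≤ x → x < s → δ < u x := by
  obtain ⟨P, Q, hu, hv, hu0, -⟩ := id H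
  have cu : ContinuousOn u (Icc 0 T) := hu.1.mono fun x hx => hx.1
  have hcl : IsClosed (Icc 0 T ∩ u ⁻¹' Iic δ) := cu.preimage_isClosed_of_isClosed isClosed_Icc isClosed_Iic
  obtain ⟨s, ⟨hs, hsu⟩, hmin⟩ := (isCompact_Icc.of_isClosed_subset hcl inter_subset_left).exists_isLeast
    ⟨T, ⟨right_mem_Icc.2 hT, huT⟩⟩
  have hlt : ∀ x, 0 ≤ x → x < s → δ < u x := fun x hx hxs => by
    by_contra! hneg
    exact hxs.not_ge (hmin ⟨⟨hx, hxs.le.trans hs.2⟩, hneg⟩)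
  have hs0 : 0 < s := hs.1.lt_of_ne fun h => by
    have : u s ≤ δ := hsu
    rw [← h, hu0] at this
    linarith
  refine ⟨s, hs0, hs.2, le_antisymm hsu ?_, hlt⟩
  have cs : Tendsto u (nhdsWithin s (Iio s)) (nhds (u s)) :=
    (hu.1.continuousAt (Ici_mem_nhds hs0)).mono_left nhdsWithin_le_nhds
  refine ge_of_tendsto cs ?_
  filter_upwards [self_mem_nhdsWithin, nhdsWithin_le_nhds (lt_mem_nhds hs0)] with x hx hx0
  exact (hlt x hx0.le hx).le

theorem false_of_forall_le (S : ShootParam m c d p q) (hθ : 0 < θ) (hθ1 : θ < 1)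
    (hA : θ ∉ lowSet m c d p q) (hB : θ ∉ highSet m c d p q)
    (hl₁ : (m + c) / (p + 1) ≤ l₁) (hl₂ : (m + d) / (q + 1) ≤ l₂) (hl : l₁ + l₂ = m - 1)
    {T : ℝ} (hT : 0 ≤ T)
    (hu : ∀ δ u v, 0 < δ → δ ≤ 1 → IsShoot m c d p q δ θ u v → u T ≤ δ) : False := by
  obtain ⟨hm, hc, hd, hp, hq⟩ := id S
  have hp0 : 0 < p := by linarith
  have hmc : 0 < m + c := by linarith
  have hmd : 0 < m + d := by linarith
  have hc1 : 0 < c + 1 := by linarith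
  have hd1 : 0 < d + 1 := by linarith
  have hl₁0 : 0 < l₁ := lt_of_lt_of_le (by positivity) hl₁
  have hl₂0 : 0 < l₂ := lt_of_lt_of_le (by positivity) hl₂
  set δ₀ := θ / 2 with hδ₀
  have hδ₀0 : 0 < δ₀ := by positivity
  have hδ₀1 : δ₀ ≤ 1 := by linarith
  obtain ⟨u₀, v₀, H₀⟩ := exists_isShoot S hδ₀0 hδ₀1 θ
  obtain ⟨s₀, hs₀, hs₀T, -, hlt₀⟩ := H₀.exists_first (by linarith) hT (hu _ _ _ hδ₀0 hδ₀1 H₀)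
  set t₀ := s₀ / 2 with ht₀
  have ht₀0 : 0 < t₀ := by positivity
  have hT0 : 0 < T := hs₀.trans_le hs₀T
  have hu₀ : δ₀ < u₀ t₀ := hlt₀ _ ht₀0.le (by linarith)
  have hv₀ : 0 < v₀ t₀ := H₀.pos_of_not_mem_highSet S hδ₀0 hδ₀1 hB ht₀0.le (by linarith) hlt₀
  set A := min (v₀ t₀) 1 ^ p * (t₀ ^ (m + c) / (4 * (m + c))) with hAdef
  set B := δ₀ ^ q * (t₀ ^ (m + d) / (4 * (m + d))) with hBdef
  have hmin0 : 0 < min (v₀ t₀) 1 := lt_min hv₀ one_pos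
  have hA0 : 0 < A := by positivity
  have hB0 : 0 < B := by positivity
  set E := T ^ (1 - m) with hE
  have hE0 : 0 < E := by positivity
  set κ := min 1 (E * B / (6 * l₁)) with hκ
  have hκ0 : 0 < κ := by positivity
  set D := 4 * (m + d) * (d + 1) with hD
  have hD0 : 0 < D := by positivity
  set κ' := κ * D / T ^ (d + 1) with hκ'
  have hκ'0 : 0 < κ' := by positivity
  set r := (1 + κ') ^ (d + 1)⁻¹ with hr
  have hr1 : 1 < r := Real.one_lt_rpow (by linarith) (by positivity)
  have hrd : r ^ (d + 1) = 1 + κ' := Real.rpow_inv_rpow (by positivity) hd1.ne'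
  have hrc : 0 < r ^ (c + 1) - 1 := sub_pos.2 (Real.one_lt_rpow hr1 hc1)
  set ρ := κ ^ p * (t₀ ^ (c + 1) * (r ^ (c + 1) - 1) / (4 * (m + c) * (c + 1))) with hρ
  have hρ0 : 0 < ρ := by positivity
  set δ := min (δ₀ / 2) (min (ρ / 2) (E * A / (3 * l₂))) with hδ
  have hδ0 : 0 < δ := by positivity
  have hδδ₀ : δ ≤ δ₀ / 2 := min_le_left _ _
  have hδρ : δ ≤ ρ / 2 := (min_le_right _ _).trans (min_le_left _ _)
  have hδA : δ ≤ E * A / (3 * l₂) := (min_le_right _ _).trans (min_le_right _ _)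
  have hδ1 : δ ≤ 1 := by linarith
  obtain ⟨u, v, H⟩ := exists_isShoot S hδ0 hδ1 θ
  obtain ⟨s, hs0, hsT, hus, hlt⟩ := H.exists_first (by linarith) hT (hu _ _ _ hδ0 hδ1 H)
  obtain ⟨eu, ev⟩ := H.eq_of_le S H₀ hδ0 (by linarith) hδ₀1 hθ1.le ht₀0.le hu₀.le
  have hts : t₀ < s := by
    by_contra! h
    have := (H.antitone hδ0 hs0.le h).1
    linarith
  have hvpos : ∀ x, 0 ≤ x → x < s → 0 < v x := fun x hx hxs =>
    H.pos_of_not_mem_highSet S hδ0 hδ1 hB hx hxs hlt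
  obtain ⟨P, Q, ru, rv, hu0, hv0⟩ := id H
  have hvs : 0 ≤ v s := by
    have cs : Tendsto v (nhdsWithin s (Iio s)) (nhds (v s)) :=
      (rv.1.continuousAt (Ici_mem_nhds hs0)).mono_left nhdsWithin_le_nhds
    refine ge_of_tendsto cs ?_
    filter_upwards [self_mem_nhdsWithin, nhdsWithin_le_nhds (lt_mem_nhds hs0)] with x hx hx0
    exact (hvpos x hx0.le hx).le
  have hPA : P s ≤ -A := by
    refine (ru.nonpos (fun x _ => clampPow_nonneg le_rfl) ht₀0.le hts.le).1.trans ?_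
    refine (ru.le_of_le hm hc (fun x hx => le_clampPow hp0.le hmin0.le (min_le_right _ _) ?_)
      le_rfl ht₀0.le).2
    have := (H.antitone hδ0 hx.1.le hx.2.le).2
    exact (min_le_left _ _).trans (by linarith)
  have hQB : Q s ≤ -B := by
    refine (rv.nonpos (fun x _ => clampPow_nonneg hδ0.le) ht₀0.le hts.le).1.trans ?_
    refine (rv.le_of_le hm hd (fun x hx => le_clampPow hq.le hδ₀0.le hδ₀1 ?_) le_rfl ht₀0.le).2
    have := (H.antitone hδ0 hx.1.le hx.2.le).1
    linarith
  have hvκ : v s ≤ κ + (((s * r) ^ (d + 1)) - s ^ (d + 1)) / D := by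
    refine H.le_of_not_mem_lowSet hδ0 hδ1 hA hs0 (le_mul_of_one_le_right hs0.le hr1.le) hlt hκ0 (min_le_left _ _) ?_
    rw [hus, Real.mul_rpow hs0.le (by linarith)]
    refine lt_of_lt_of_le (b := ρ) (by linarith) ?_
    have := Real.rpow_le_rpow ht₀0.le hts.le hc1.le
    rw [hρ, ← mul_sub_one]
    gcongr
  have hvκ2 : v s ≤ 2 * κ := by
    rw [Real.mul_rpow hs0.le (by linarith), ← mul_sub_one, hrd, add_sub_cancel_left] at hvκ
    have h1 : s ^ (d + 1) * κ' / D ≤ T ^ (d + 1) * κ' / D := by gcongr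
    have h2 : T ^ (d + 1) * κ' / D = κ := by rw [hκ']; field_simp
    linarith
  have hle1 : ∀ x, 0 ≤ x → u x ≤ 1 ∧ v x ≤ 1 := fun x hx => by
    have := H.antitone hδ0 le_rfl hx
    constructor <;> linarith
  have ab : ∀ {δ e s : ℝ}, 0 ≤ e → 0 ≤ δ → δ ≤ 1 → |clampPow δ e s| ≤ 1 := fun he h0 h1 => by
    rw [abs_of_nonneg (clampPow_nonneg h0)]; exact clampPow_le_one he h0 h1
  have poh := ru.pohozaev hm hc hd hp0 hq rv hs0.le (fun x _ => ab hp0.le le_rfl zero_le_one)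
    (fun x _ => ab hq.le hδ0.le hδ1)
    (fun x hx => clampPow_eq (hvpos x hx.1.le hx.2).le (hle1 x hx.1.le).2)
    (fun x hx => clampPow_eq (hlt x hx.1.le hx.2).le (hle1 x hx.1.le).1)
    (fun x hx => hδ0.trans (hlt x hx.1.le hx.2)) (fun x hx => hvpos x hx.1.le hx.2)
    (hus ▸ hδ0.le) hvs hl₁ hl₂ hl
  have hEs : E ≤ s ^ (1 - m) := Real.rpow_le_rpow_of_nonpos hs0 hsT (by linarith)
  rw [hus] at poh
  set X := -P s with hX
  set Y := -Q s with hY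
  have hXA : A ≤ X := by linarith
  have hYB : B ≤ Y := by linarith
  have hX0 : 0 < X := hA0.trans_le hXA
  have hY0 : 0 < Y := hB0.trans_le hYB
  have h1 : l₁ * v s ≤ E * B / 3 := by
    have : κ ≤ E * B / (6 * l₁) := min_le_right _ _
    calc l₁ * v s ≤ l₁ * (2 * (E * B / (6 * l₁))) := by
          gcongr; linarith
      _ = _ := by field_simp; norm_num
  have h2 : l₂ * δ ≤ E * A / 3 := by
    calc l₂ * δ ≤ l₂ * (E * A / (3 * l₂)) := by gcongr
      _ = _ := by field_simp
  have h3 : l₁ * v s * X ≤ E * Y / 3 * X :=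
    mul_le_mul_of_nonneg_right (h1.trans (by gcongr)) hX0.le
  have h4 : l₂ * δ * Y ≤ E * X / 3 * Y :=
    mul_le_mul_of_nonneg_right (h2.trans (by gcongr)) hY0.le
  have h5 : E * (X * Y) ≤ s ^ (1 - m) * (X * Y) := by gcongr
  have h6 : 0 < E * (X * Y) := by positivity
  have h7 : s ^ (1 - m) * P s * Q s = s ^ (1 - m) * (X * Y) := by rw [hX, hY]; ring
  have h8 : l₁ * (v s * P s) = -(l₁ * v s * X) := by rw [hX]; ring
  have h9 : l₂ * (δ * Q s) = -(l₂ * δ * Y) := by rw [hY]; ring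
  rw [h7, h8, h9] at poh
  have e1 : E * Y / 3 * X = E * (X * Y) / 3 := by ring
  have e2 : E * X / 3 * Y = E * (X * Y) / 3 := by ring
  linarith

variable {N : ℕ} {a b : ℝ}

theorem exists_isHHSol_of_one_le (hN : N = 3 ∨ N = 4) (ha : -2 < a) (hb : -2 < b) (hp : 1 ≤ p)
    (hq : 0 < q) (hcond : ((N : ℝ) + a) / (p + 1) + ((N : ℝ) + b) / (q + 1) ≤ (N : ℝ) - 2) :
    ∃ u v : EuclideanSpace ℝ (Fin N) → ℝ, IsHHSol a b p q univ u v := by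
  have hN3 : (3 : ℝ) ≤ N := by rcases hN with h | h <;> rw [h] <;> norm_num
  have S : ShootParam (N / 2) (a / 2) (b / 2) p q :=
    ⟨by linarith, by linarith, by linarith, hp, hq⟩
  obtain ⟨θ, hθ, hθ1, hA, hB⟩ := exists_threshold S
  by_cases hT : ∀ T : ℝ, 0 ≤ T → ∃ δ u v, 0 < δ ∧ δ ≤ 1 ∧
      IsShoot (N / 2) (a / 2) (b / 2) p q δ θ u v ∧ δ < u T
  · exact exists_isHHSol_of_forall_pos S hθ1 hB hT
  · push Not at hT
    obtain ⟨T, hT, h⟩ := hT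
    have e1 : ((N : ℝ) / 2 + a / 2) / (p + 1) = ((N : ℝ) + a) / (p + 1) / 2 := by ring
    have e2 : ((N : ℝ) / 2 + b / 2) / (q + 1) = ((N : ℝ) + b) / (q + 1) / 2 := by ring
    exact (false_of_forall_le S hθ hθ1 hA hB le_rfl
      (l₂ := (N : ℝ) / 2 - 1 - ((N : ℝ) / 2 + a / 2) / (p + 1)) (by linarith) (by ring) hT h).elim

theorem exists_isHHSol (hN : N = 3 ∨ N = 4) (ha : -2 < a) (hb : -2 < b) (hp : 0 < p)
    (hq : 0 < q) (hcond : ((N : ℝ) + a) / (p + 1) + ((N : ℝ) + b) / (q + 1) ≤ (N : ℝ) - 2) :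
    ∃ u v : EuclideanSpace ℝ (Fin N) → ℝ, IsHHSol a b p q univ u v := by
  have hN3 : (3 : ℝ) ≤ N := by rcases hN with h | h <;> rw [h] <;> norm_num
  rcases le_or_gt 1 p with h | h
  · exact exists_isHHSol_of_one_le hN ha hb h hq hcond
  have hq1 : 1 ≤ q := by
    by_contra! hq1
    have h1 : ((N : ℝ) - 2) / 2 < ((N : ℝ) + a) / (p + 1) := by
      rw [div_lt_div_iff₀ two_pos (by linarith)]
      nlinarith
    have h2 : ((N : ℝ) - 2) / 2 < ((N : ℝ) + b) / (q + 1) := by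
      rw [div_lt_div_iff₀ two_pos (by linarith)]
      nlinarith
    linarith
  obtain ⟨v, u, h1, h2, h3, h4, h5, h6, h7, h8⟩ :=
    exists_isHHSol_of_one_le hN hb ha hq1 hp (by linarith)
  exact ⟨u, v, h2, h1, h4, h3, h6, h5, h8, h7⟩

end Existence

/-- Conjecture C holds in dimensions 3 and 4 when `a, b ≤ 0`: the Hardy–Hénon system has
no positive solution on `ℝ^N` if and only if `(N+a)/(p+1) + (N+b)/(q+1) > N-2`. -/
theorem no_positive_solution_dim34_iff
    (N : ℕ) (hN : N = 3 ∨ N = 4) (a b p q : ℝ)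
    (ha : -2 < a) (ha0 : a ≤ 0) (hb : -2 < b) (hb0 : b ≤ 0) (hp : 0 < p) (hq : 0 < q) :
    (¬ ∃ u v : EuclideanSpace ℝ (Fin N) → ℝ,
        IsHHSol a b p q (univ : Set (EuclideanSpace ℝ (Fin N))) u v) ↔
      ((N : ℝ) + a) / (p + 1) + ((N : ℝ) + b) / (q + 1) > (N : ℝ) - 2 := by
  refine ⟨fun h => ?_, fun h ⟨u, v, huv⟩ => huv.false_of_subcritical hN hp hq ha ha0 hb hb0 h⟩
  by_contra hcond
  exact h (exists_isHHSol hN ha hb hp hq (not_lt.1 hcond))
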